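/- Let F_n denote the set of simple graphs with vertex set {1,…,n} that are C_6-free, and let G_n ⊆ F_n be the set of those graphs G whose vertex set can be partitioned into two sets S and T such that S is a stable set of G and the complement of the induced subgraph G[T] has girth at least 5. Then |G_n|/|F_n| tends to 1 as n tends to infinity. -/

import Mathlib

open SimpleGraph Filter

/-- `G` contains no induced copy of `H` (graph embeddings are induced-subgraph copies). -/
def IndFree {W V : Type*} (H : SimpleGraph W) (G : SimpleGraph V) : Prop :=
  ¬ Nonempty (H ↪g G)

/-- `G` has girth at least 5: it contains no cycle of length 3 or 4. -/
def GirthAtLeastFive {V : Type*} (G : SimpleGraph V) : Prop :=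
  ∀ (v : V) (w : G.Walk v v), w.IsCycle → w.length ≠ 3 ∧ w.length ≠ 4

section Part1
open SimpleGraph Filter
open scoped Classical
namespace C6P
open Finset

/-- adjacency of the 6-cycle -/
def c6 (i j : Fin 6) : Bool := (i + 1 == j) || (j + 1 == i)

def C6F {V : Type*} (G : SimpleGraph V) : Prop :=
  ∀ φ : Fin 6 → V, ¬ ∀ i j, G.Adj (φ i) (φ j) ↔ c6 i j = true

def Stab {V : Type*} (G : SimpleGraph V) (S : Finset V) : Prop :=
  ∀ a ∈ S, ∀ b ∈ S, ¬ G.Adj a b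

def CoG5 {V : Type*} (G : SimpleGraph V) (T : Finset V) : Prop :=
  (∀ a ∈ T, ∀ b ∈ T, ∀ c ∈ T, a ≠ b → a ≠ c → b ≠ c → G.Adj a b ∨ G.Adj a c ∨ G.Adj b c) ∧
  (∀ a ∈ T, ∀ b ∈ T, ∀ c ∈ T, ∀ d ∈ T, G.Adj a b → G.Adj c d →
    G.Adj a c ∨ G.Adj a d ∨ G.Adj b c ∨ G.Adj b d)

def Good {V : Type*} (G : SimpleGraph V) : Prop :=
  ∃ S T : Finset V, (∀ v, v ∈ S ∨ v ∈ T) ∧ Disjoint S T ∧ Stab G S ∧ CoG5 G T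

lemma c6_twin : ∀ i j : Fin 6, i ≠ j → ∃ k, c6 i k ≠ c6 j k := by decide

lemma emb_inj {V : Type*} {G : SimpleGraph V} {φ : Fin 6 → V}
    (h : ∀ i j, G.Adj (φ i) (φ j) ↔ c6 i j = true) : Function.Injective φ := by
  intro i j hij
  by_contra hne
  obtain ⟨k, hk⟩ := c6_twin i j hne
  apply hk
  have h1 := h i k
  have h2 := h j k
  rw [hij] at h1
  rw [Bool.eq_iff_iff, ← h1, ← h2]

set_option maxRecDepth 100000 in
lemma c6_split : ∀ I : Fin 6 → Bool, (∃ i j, I i = true ∧ I j = true ∧ c6 i j = true) ∨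
    (∃ i j k, I i = false ∧ I j = false ∧ I k = false ∧ i ≠ j ∧ i ≠ k ∧ j ≠ k ∧
      c6 i j = false ∧ c6 i k = false ∧ c6 j k = false) ∨
    (∃ i, I i = false ∧ I (i+1) = false ∧ I (i+3) = false ∧ I (i+4) = false) := by
  decide

lemma c6_aux : ∀ i : Fin 6, c6 i (i+1) = true ∧ c6 (i+3) (i+4) = true ∧ c6 i (i+3) = false ∧
   c6 i (i+4) = false ∧ c6 (i+1) (i+3) = false ∧ c6 (i+1) (i+4) = false := by decide

lemma Good.c6f {V : Type*} {G : SimpleGraph V} (hG : Good G) : C6F G := by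
  obtain ⟨S, T, hST, -, hS, hT1, hT2⟩ := hG
  intro φ hφ
  have hinj := emb_inj hφ
  have hf : ∀ i j, c6 i j = false → ¬ G.Adj (φ i) (φ j) := by
    intro i j h; rw [hφ, h]; simp
  have hT : ∀ i, decide (φ i ∈ S) = false → φ i ∈ T := by
    intro i hi
    have : φ i ∉ S := by simpa using hi
    exact (hST _).resolve_left this
  rcases c6_split (fun i => decide (φ i ∈ S)) with ⟨i, j, hi, hj, h⟩ |
    ⟨i, j, k, hi, hj, hk, hij, hik, hjk, h1, h2, h3⟩ | ⟨i, h1, h2, h3, h4⟩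
  · exact hS _ (by simpa using hi) _ (by simpa using hj) ((hφ i j).2 h)
  · rcases hT1 _ (hT i hi) _ (hT j hj) _ (hT k hk) (hinj.ne hij) (hinj.ne hik) (hinj.ne hjk)
      with h | h | h
    · exact hf _ _ h1 h
    · exact hf _ _ h2 h
    · exact hf _ _ h3 h
  · obtain ⟨a1, a2, a3, a4, a5, a6⟩ := c6_aux i
    rcases hT2 _ (hT _ h1) _ (hT _ h2) _ (hT _ h3) _ (hT _ h4) ((hφ _ _).2 a1) ((hφ _ _).2 a2)
      with h | h | h | h
    · exact hf _ _ a3 h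
    · exact hf _ _ a4 h
    · exact hf _ _ a5 h
    · exact hf _ _ a6 h

lemma C6F.comap {V W : Type*} {G : SimpleGraph V} (h : C6F G) (e : W → V) :
    C6F (G.comap e) := by
  intro φ hφ
  exact h (e ∘ φ) (fun i j => by simpa using hφ i j)

/-- number of good graphs on `V` -/
noncomputable def gT (V : Type*) [Fintype V] : ℕ :=
  Nat.card {G : SimpleGraph V // Good G}

noncomputable def Fs (n : ℕ) : Finset (SimpleGraph (Fin n)) := univ.filter C6F
noncomputable def Gs (n : ℕ) : Finset (SimpleGraph (Fin n)) := univ.filter Good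
noncomputable def f (n : ℕ) : ℕ := (Fs n).card
noncomputable def g (n : ℕ) : ℕ := (Gs n).card

lemma mem_Fs {n : ℕ} {G : SimpleGraph (Fin n)} : G ∈ Fs n ↔ C6F G := by simp [Fs]
lemma mem_Gs {n : ℕ} {G : SimpleGraph (Fin n)} : G ∈ Gs n ↔ Good G := by simp [Gs]

lemma g_eq (n : ℕ) : g n = gT (Fin n) := by
  unfold g gT Gs
  rw [Nat.card_eq_fintype_card, Fintype.card_subtype]

lemma Good.comap {V W : Type*} {G : SimpleGraph V} (h : Good G) (e : W ↪ V) : Good (G.comap e) := by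
  obtain ⟨S, T, hST, hd, hS, hT1, hT2⟩ := h
  refine ⟨S.preimage e e.injective.injOn, T.preimage e e.injective.injOn, ?_, ?_, ?_, ?_, ?_⟩
  · intro v; simpa using hST (e v)
  · rw [Finset.disjoint_left] at hd ⊢
    intro v hv hv'
    exact hd (by simpa using hv) (by simpa using hv')
  · intro a ha b hb hab
    exact hS _ (by simpa using ha) _ (by simpa using hb) hab
  · intro a ha b hb c hc hab hac hbc
    exact hT1 _ (by simpa using ha) _ (by simpa using hb) _ (by simpa using hc)
      (e.injective.ne hab) (e.injective.ne hac) (e.injective.ne hbc)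
  · intro a ha b hb c hc d hd
    exact hT2 _ (by simpa using ha) _ (by simpa using hb) _ (by simpa using hc) _ (by simpa using hd)

lemma gT_congr {V W : Type*} [Fintype V] [Fintype W] (e : V ≃ W) : gT V = gT W := by
  unfold gT
  refine Nat.card_congr
    { toFun := fun G => ⟨G.1.comap e.symm, G.2.comap e.symm.toEmbedding⟩
      invFun := fun G => ⟨G.1.comap e, G.2.comap e.toEmbedding⟩
      left_inv := ?_
      right_inv := ?_ }
  · intro G; apply Subtype.ext; ext a b; simp
  · intro G; apply Subtype.ext; ext a b; simp

lemma gT_eq_g {V : Type*} [Fintype V] {n : ℕ} (h : Fintype.card V = n) : gT V = g n := by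
  rw [g_eq]; exact gT_congr (Fintype.equivFinOfCardEq h)

lemma g_pos (n : ℕ) : 1 ≤ g n := by
  have : (⊥ : SimpleGraph (Fin n)) ∈ Gs n := by
    rw [mem_Gs]
    exact ⟨univ, ∅, by simp, by simp, by simp [Stab], by simp [CoG5], by simp⟩
  exact Finset.card_pos.2 ⟨_, this⟩

end C6P
end Part1

section Part2
open SimpleGraph Filter
open scoped Classical
namespace C6P
open Finset

def Thin {V : Type*} (K : SimpleGraph V) : Prop :=
  (∀ a b c, K.Adj a b → K.Adj b c → ¬ K.Adj a c) ∧
  (∀ a b c d, a ≠ b → c ≠ d → K.Adj a c → K.Adj c b → K.Adj b d → ¬ K.Adj d a)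

/-- the extension graph -/
def extG {m a b : ℕ} (H : SimpleGraph (Fin m)) (T : Finset (Fin m))
    (Z1 : Finset (Fin a × Fin m)) (Z2 : Finset (Fin b × Fin m)) (Z3 : Finset (Fin a × Fin b))
    (Z4 : Finset (Sym2 (Fin b))) : SimpleGraph (Fin m ⊕ (Fin a ⊕ Fin b)) where
  Adj x y := match x, y with
    | .inl u, .inl v => H.Adj u v
    | .inl u, .inr (.inl i) => (i, u) ∈ Z1
    | .inr (.inl i), .inl u => (i, u) ∈ Z1
    | .inl u, .inr (.inr j) => u ∈ T ∨ (j, u) ∈ Z2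
    | .inr (.inr j), .inl u => u ∈ T ∨ (j, u) ∈ Z2
    | .inr (.inl _), .inr (.inl _) => False
    | .inr (.inl i), .inr (.inr j) => (i, j) ∈ Z3
    | .inr (.inr j), .inr (.inl i) => (i, j) ∈ Z3
    | .inr (.inr j), .inr (.inr j') => j ≠ j' ∧ s(j, j') ∉ Z4
  symm := ⟨by
    rintro (u | i | j) (v | i' | j') h
    · exact h.symm
    · exact h
    · exact h
    · exact h
    · exact h
    · exact h
    · exact h
    · exact h
    · exact ⟨h.1.symm, by rw [Sym2.eq_swap]; exact h.2⟩⟩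
  loopless := ⟨by
    rintro (u | i | j) h
    · exact H.loopless.irrefl _ h
    · exact h
    · exact h.1 rfl⟩

lemma extG_good {m a b : ℕ} {H : SimpleGraph (Fin m)} {S T : Finset (Fin m)}
    (hST : ∀ v, v ∈ S ∨ v ∈ T) (hd : Disjoint S T) (hS : Stab H S) (hT : CoG5 H T)
    {K : SimpleGraph (Fin b)} (hK : Thin K)
    {Z1 : Finset (Fin a × Fin m)} {Z2 : Finset (Fin b × Fin m)} {Z3 : Finset (Fin a × Fin b)}
    {Z4 : Finset (Sym2 (Fin b))} (h1 : ∀ p ∈ Z1, p.2 ∈ T) (h4 : ∀ e ∈ Z4, e ∈ K.edgeSet) :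
    Good (extG H T Z1 Z2 Z3 Z4) := by
  have key : ∀ x y : Fin m ⊕ (Fin a ⊕ Fin b),
      x ∈ T.map Function.Embedding.inl ∪ univ.map (Function.Embedding.inr.trans Function.Embedding.inr) →
      y ∈ T.map Function.Embedding.inl ∪ univ.map (Function.Embedding.inr.trans Function.Embedding.inr) →
      ¬ (extG H T Z1 Z2 Z3 Z4).Adj x y → x ≠ y →
      (∃ u ∈ T, ∃ v ∈ T, x = .inl u ∧ y = .inl v ∧ ¬ H.Adj u v) ∨
      (∃ j j', x = .inr (.inr j) ∧ y = .inr (.inr j') ∧ K.Adj j j') := by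
    rintro (u | i | j) (v | i' | j') hx hy hn hne
    · left
      refine ⟨u, by simpa using hx, v, by simpa using hy, rfl, rfl, hn⟩
    · simp at hy
    · exact absurd (Or.inl (by simpa using hx)) hn
    · simp at hx
    · simp at hx
    · simp at hx
    · exact absurd (Or.inl (by simpa using hy)) hn
    · simp at hy
    · right
      refine ⟨j, j', rfl, rfl, ?_⟩
      have : s(j, j') ∈ Z4 := by
        by_contra h
        exact hn ⟨fun h' => hne (by rw [h']), h⟩
      exact h4 _ this
  refine ⟨S.map Function.Embedding.inl ∪ univ.map (Function.Embedding.inl.trans Function.Embedding.inr),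
    T.map Function.Embedding.inl ∪ univ.map (Function.Embedding.inr.trans Function.Embedding.inr),
    ?_, ?_, ?_, ?_, ?_⟩
  · rintro (u | i | j)
    · simpa using hST u
    · simp
    · simp
  · rw [Finset.disjoint_left]
    rintro (u | i | j) h h'
    · simp at h h'
      exact (Finset.disjoint_left.1 hd) h h'
    · simp at h'
    · simp at h
  · rintro (u | i | j) hx (v | i' | j') hy h
    · exact hS u (by simpa using hx) v (by simpa using hy) h
    · exact Finset.disjoint_left.1 hd (by simpa using hx) (h1 _ h)
    · simp at hy
    · exact Finset.disjoint_left.1 hd (by simpa using hy) (h1 _ h)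
    · exact h
    · simp at hy
    · simp at hx
    · simp at hx
    · simp at hx
  · intro x hx y hy z hz hxy hxz hyz
    by_contra hcon
    push Not at hcon
    obtain ⟨n1, n2, n3⟩ := hcon
    rcases key x y hx hy n1 hxy with ⟨u, hu, v, hv, rfl, rfl, huv⟩ | ⟨j, j', rfl, rfl, hj⟩
    · rcases key _ z hx hz n2 hxz with ⟨u', hu', w, hw, e, rfl, huw⟩ | ⟨k, k', e, _, _⟩
      · rcases hT.1 u hu v hv w hw (by simpa using hxy) (by simpa using hxz) (by simpa using hyz)
          with h | h | h
        · exact n1 h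
        · exact n2 h
        · exact n3 h
      · simp at e
    · rcases key _ z hx hz n2 hxz with ⟨u', hu', w, hw, e, rfl, huw⟩ | ⟨k, k', e, rfl, hk⟩
      · simp at e
      · rcases key _ _ hy hz n3 hyz with ⟨u', hu', w, hw, e', _, huw⟩ | ⟨l, l', e', e'', hl⟩
        · simp at e'
        · simp at e e' e''
          subst e e' e''
          exact hK.1 _ _ _ hj hl hk
  · intro x hx y hy z hz w hw hxy hzw
    by_contra hcon
    push Not at hcon
    obtain ⟨n1, n2, n3, n4⟩ := hcon
    have e1 : x ≠ z := by rintro rfl; exact n2 hzw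
    have e2 : x ≠ w := by rintro rfl; exact n1 hzw.symm
    have e3 : y ≠ z := by rintro rfl; exact n4 hzw
    have e4 : y ≠ w := by rintro rfl; exact n3 hzw.symm
    rcases key x z hx hz n1 e1 with ⟨u, hu, v, hv, rfl, rfl, huv⟩ | ⟨j, j', rfl, rfl, hj⟩
    · rcases key _ w hx hw n2 e2 with ⟨u', hu', w', hw', e, rfl, huw⟩ | ⟨k, k', e, _, _⟩
      · rcases key y _ hy hz n3 e3 with ⟨y', hy', z', hz', rfl, e, huw⟩ | ⟨k, k', e, e', _⟩
        · rcases hT.2 u hu y' hy' v hv w' hw' hxy hzw with h | h | h | h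
          · exact n1 h
          · exact n2 h
          · exact n3 h
          · exact n4 h
        · simp at e'
      · simp at e
    · rcases key _ w hx hw n2 e2 with ⟨u', hu', w', hw', e, rfl, huw⟩ | ⟨k, k', e, rfl, hk⟩
      · simp at e
      · rcases key y _ hy hz n3 e3 with ⟨y', hy', z', hz', rfl, e, huw⟩ | ⟨l, l', rfl, e', hl⟩
        · simp at e
        · rcases key _ _ hy hw n4 e4 with ⟨y', hy', z', hz', e', _, huw⟩ | ⟨i, i', e2', e3', hi⟩
          · simp at e'
          · simp at e e' e2' e3'
            subst e e' e2' e3'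
            exact hK.2 j l j' k' (fun h => hxy.ne (by rw [h])) (fun h => hzw.ne (by rw [h]))
              hj hl.symm hi hk.symm

lemma ext_fiber {m a b : ℕ} {H : SimpleGraph (Fin m)} {S T : Finset (Fin m)}
    (hST : ∀ v, v ∈ S ∨ v ∈ T) (hd : Disjoint S T) (hS : Stab H S) (hT : CoG5 H T)
    {K : SimpleGraph (Fin b)} (hK : Thin K) :
    2 ^ (a * T.card + b * S.card + a * b + K.edgeFinset.card) ≤
      ((Gs (m + (a + b))).filter (fun G => G.comap (Fin.castAdd (a + b)) = H)).card := by
  set e : Fin m ⊕ (Fin a ⊕ Fin b) ≃ Fin (m + (a + b)) :=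
    (Equiv.sumCongr (Equiv.refl _) finSumFinEquiv).trans finSumFinEquiv with he
  let D := ((univ : Finset (Fin a)) ×ˢ T).powerset ×ˢ (((univ : Finset (Fin b)) ×ˢ S).powerset ×ˢ
    ((univ : Finset (Finset (Fin a × Fin b))) ×ˢ K.edgeFinset.powerset))
  have hD : D.card = 2 ^ (a * T.card + b * S.card + a * b + K.edgeFinset.card) := by
    simp only [D, card_product, card_powerset, card_univ, Fintype.card_fin, Fintype.card_finset,
      Fintype.card_prod, pow_add]
    ring
  rw [← hD]
  refine Finset.card_le_card_of_injOn
    (fun Z => (extG H T Z.1 Z.2.1 Z.2.2.1 Z.2.2.2).comap e.symm) ?_ ?_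
  · rintro ⟨Z1, Z2, Z3, Z4⟩ hZ
    simp only [D, coe_product, Set.mem_prod, mem_coe, mem_powerset] at hZ
    obtain ⟨hZ1, hZ2, -, hZ4⟩ := hZ
    simp only [coe_filter, Set.mem_ofPred_eq, mem_Gs]
    constructor
    · refine Good.comap (extG_good hST hd hS hT hK ?_ ?_) e.symm.toEmbedding
      · intro p hp; have := hZ1 hp; simp at this; exact this
      · intro p hp; have := hZ4 hp; simpa using this
    · ext u v
      have : ∀ u, e.symm (Fin.castAdd (a+b) u) = Sum.inl u := by
        intro u; rw [Equiv.symm_apply_eq]; simp [he]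
      simp only [comap_adj, this]
      rfl
  · rintro ⟨Z1, Z2, Z3, Z4⟩ hZ ⟨Y1, Y2, Y3, Y4⟩ hY h
    simp only [D, coe_product, Set.mem_prod, mem_coe, mem_powerset] at hZ hY
    obtain ⟨hZ1, hZ2, -, hZ4⟩ := hZ
    obtain ⟨hY1, hY2, -, hY4⟩ := hY
    have hadj : ∀ x y, (extG H T Z1 Z2 Z3 Z4).Adj x y ↔ (extG H T Y1 Y2 Y3 Y4).Adj x y := by
      intro x y
      have := congrArg (fun G : SimpleGraph _ => G.Adj (e x) (e y)) h
      simpa using this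
    have a1 : Z1 = Y1 := by
      ext ⟨i, u⟩; exact hadj (.inl u) (.inr (.inl i))
    have a2 : Z2 = Y2 := by
      ext ⟨j, u⟩
      have := hadj (.inl u) (.inr (.inr j))
      change (u ∈ T ∨ (j, u) ∈ Z2) ↔ (u ∈ T ∨ (j, u) ∈ Y2) at this
      constructor
      · intro h
        have h' := hZ2 h
        simp only [mem_product, mem_univ, true_and] at h'
        exact (this.1 (Or.inr h)).resolve_left (Finset.disjoint_left.1 hd h')
      · intro h
        have h' := hY2 h
        simp only [mem_product, mem_univ, true_and] at h'
        exact (this.2 (Or.inr h)).resolve_left (Finset.disjoint_left.1 hd h')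
    have a3 : Z3 = Y3 := by
      ext ⟨i, j⟩; exact hadj (.inr (.inl i)) (.inr (.inr j))
    have a4 : Z4 = Y4 := by
      have : ∀ j j', K.Adj j j' → (s(j,j') ∈ Z4 ↔ s(j,j') ∈ Y4) := by
        intro j j' hj
        have := hadj (.inr (.inr j)) (.inr (.inr j'))
        change (j ≠ j' ∧ s(j, j') ∉ Z4) ↔ (j ≠ j' ∧ s(j, j') ∉ Y4) at this
        have hne := hj.ne
        tauto
      ext p
      induction p using Sym2.ind with
      | _ j j' =>
        constructor
        · intro h; have h' := hZ4 h; simp at h'; exact (this j j' h').1 h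
        · intro h; have h' := hY4 h; simp at h'; exact (this j j' h').2 h
    rw [a1, a2, a3, a4]

lemma g_fiber_sum (m c N : ℕ)
    (h : ∀ H ∈ Gs m, N ≤ ((Gs (m + c)).filter (fun G => G.comap (Fin.castAdd c) = H)).card) :
    g m * N ≤ g (m + c) := by
  unfold g
  rw [Finset.card_eq_sum_card_fiberwise (s := Gs (m+c)) (f := fun G => G.comap (Fin.castAdd c))
    (t := Gs m)]
  · rw [← smul_eq_mul]
    exact Finset.card_nsmul_le_sum _ _ _ h
  · intro G hG
    simp only [mem_coe, mem_Gs] at hG ⊢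
    exact hG.comap (Fin.castAddEmb c)

lemma card_parts {m : ℕ} {S T : Finset (Fin m)} (hST : ∀ v, v ∈ S ∨ v ∈ T) (hd : Disjoint S T) :
    S.card + T.card = m := by
  rw [← card_union_of_disjoint hd]
  have : S ∪ T = univ := by ext v; simpa using hST v
  rw [this]; simp

lemma g_step (m : ℕ) : g m * 2 ^ ((m + 1) / 2) ≤ g (m + 1) := by
  apply g_fiber_sum
  intro H hH
  rw [mem_Gs] at hH
  obtain ⟨S, T, hST, hd, hS, hT⟩ := hH
  have hc := card_parts hST hd
  by_cases h : (m + 1) / 2 ≤ T.card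
  · have := ext_fiber (a := 1) (b := 0) hST hd hS hT (K := ⊥) (by constructor <;> simp)
    refine le_trans (Nat.pow_le_pow_right (by norm_num) ?_) this
    omega
  · have := ext_fiber (a := 0) (b := 1) hST hd hS hT (K := ⊥) (by constructor <;> simp)
    refine le_trans (Nat.pow_le_pow_right (by norm_num) ?_) this
    omega

lemma g_two (m k : ℕ) (K : SimpleGraph (Fin k)) (hK : Thin K) :
    g m * 2 ^ (k * m + k * k + K.edgeFinset.card) ≤ g (m + (k + k)) := by
  apply g_fiber_sum
  intro H hH
  rw [mem_Gs] at hH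
  obtain ⟨S, T, hST, hd, hS, hT⟩ := hH
  have hc := card_parts hST hd
  have := ext_fiber (a := k) (b := k) hST hd hS hT hK
  refine le_trans (le_of_eq ?_) this
  congr 1
  have : k * m = k * S.card + k * T.card := by rw [← mul_add, hc]
  rw [this]; ring

lemma g_steps (m k : ℕ) : g m * 2 ^ ((m + k) ^ 2 / 4 - m ^ 2 / 4) ≤ g (m + k) := by
  induction k with
  | zero => simp
  | succ k ih =>
    have h1 := g_step (m + k)
    have e : (m + (k + 1)) ^ 2 / 4 - m ^ 2 / 4 =
        ((m + k) ^ 2 / 4 - m ^ 2 / 4) + (m + k + 1) / 2 := by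
      have h2 : m ^ 2 / 4 ≤ (m + k) ^ 2 / 4 := by
        apply Nat.div_le_div_right; apply Nat.pow_le_pow_left; omega
      have h3 : (m + (k + 1)) ^ 2 / 4 = (m + k) ^ 2 / 4 + (m + k + 1) / 2 := by
        rcases Nat.even_or_odd' (m + k) with ⟨c, hc | hc⟩
        · rw [show m + (k + 1) = m + k + 1 by ring, hc]
          ring_nf
          omega
        · rw [show m + (k + 1) = m + k + 1 by ring, hc]
          ring_nf
          omega
      omega
    rw [e, pow_add, ← mul_assoc]
    exact le_trans (Nat.mul_le_mul_right _ ih) h1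

lemma exists_thin (b : ℕ) (hb : 8 ≤ b) : ∃ K : SimpleGraph (Fin b), Thin K ∧
    ∃ p : ℕ, b < 8 * p ^ 2 ∧ p ^ 3 ≤ K.edgeFinset.card := by
  set q := Nat.sqrt (b / 8) with hq
  have hq1 : q ^ 2 ≤ b / 8 := by rw [hq]; exact Nat.sqrt_le' _
  have hq2 : b / 8 < (q + 1) ^ 2 := by rw [hq]; exact Nat.lt_succ_sqrt' _
  have hq0 : q ≠ 0 := by
    intro h; rw [h] at hq2; omega
  obtain ⟨p, hp, hp1, hp2⟩ := Nat.exists_prime_lt_and_le_two_mul q hq0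
  have : Fact p.Prime := ⟨hp⟩
  have hp3 : 2 * p ^ 2 ≤ b := by
    have : p ^ 2 ≤ (2 * q) ^ 2 := Nat.pow_le_pow_left hp2 2
    have h8 : 8 * (b / 8) ≤ b := Nat.mul_div_le b 8
    nlinarith
  have hp4 : b < 8 * p ^ 2 := by
    have : (q + 1) ^ 2 ≤ p ^ 2 := Nat.pow_le_pow_left hp1 2
    omega
  let I : SimpleGraph ((ZMod p × ZMod p) ⊕ (ZMod p × ZMod p)) :=
    { Adj := fun x y => match x, y with
        | .inl u, .inr v => u.2 = v.1 * u.1 + v.2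
        | .inr v, .inl u => u.2 = v.1 * u.1 + v.2
        | _, _ => False
      symm := ⟨by rintro (u | u) (v | v) h <;> exact h⟩
      loopless := ⟨by rintro (u | u) h <;> exact h⟩ }
  have hl : ∀ (x y a b c d : ZMod p), y = a * x + b → d = a * c + b →
      ∀ a' b', y = a' * x + b' → d = a' * c + b' → x ≠ c → a = a' ∧ b = b' := by
    intro x y a b c d h1 h2 a' b' h3 h4 hne
    have : (a - a') * (x - c) = 0 := by linear_combination (-h1 + h2 + h3 - h4)
    rcases mul_eq_zero.1 this with h | h
    · have ha := sub_eq_zero.1 h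
      refine ⟨ha, ?_⟩
      rw [ha] at h1
      linear_combination h3 - h1
    · exact absurd (sub_eq_zero.1 h) hne
  have hI : Thin I := by
    constructor
    · rintro (u | u) (v | v) (w | w) h1 h2 h3 <;> first | exact h1 | exact h2 | exact h3
    · have gen : ∀ (u v w z : ZMod p × ZMod p), u ≠ v → w ≠ z → u.2 = w.1 * u.1 + w.2 →
          v.2 = w.1 * v.1 + w.2 → v.2 = z.1 * v.1 + z.2 → u.2 = z.1 * u.1 + z.2 → False := by
        intro u v w z huv hwz h1 h2 h3 h4
        by_cases hx : u.1 = v.1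
        · apply huv
          ext
          · exact hx
          · rw [h1, h2, hx]
        · obtain ⟨e1, e2⟩ := hl _ _ _ _ _ _ h1 h2 _ _ h4 h3 hx
          exact hwz (Prod.ext e1 e2)
      rintro (u | u) (v | v) (w | w) (z | z) h1 h2 h3 h4 h5 h6
      all_goals first
        | exact h3
        | exact h4
        | exact h5
        | exact h6
        | exact gen u v w z (fun h => h1 (by rw [h])) (fun h => h2 (by rw [h])) h3 h4 h5 h6
        | exact gen w z u v (fun h => h2 (by rw [h])) (fun h => h1 (by rw [h])) h3 h6 h5 h4
  have hcard : Fintype.card ((ZMod p × ZMod p) ⊕ (ZMod p × ZMod p)) ≤ Fintype.card (Fin b) := by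
    simp only [Fintype.card_sum, Fintype.card_prod, ZMod.card, Fintype.card_fin]
    nlinarith
  obtain ⟨e⟩ := Function.Embedding.nonempty_of_card_le hcard
  refine ⟨I.map e, ?_, p, hp4, ?_⟩
  · constructor
    · rintro x y z ⟨-, a, b, hab, rfl, rfl⟩ ⟨-, b', c, hbc, e1, rfl⟩ ⟨-, a', c', hac, e2, e3⟩
      have e1 := e.injective e1; have e2 := e.injective e2; have e3 := e.injective e3
      subst e1 e2 e3
      exact hI.1 _ _ _ hab hbc hac
    · rintro x y z w hxy hzw ⟨-, a, c, h1, rfl, rfl⟩ ⟨-, c', b, h2, e1, rfl⟩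
        ⟨-, b', d, h3, e2, rfl⟩ ⟨-, d', a', h4, e3, e4⟩
      have e1 := e.injective e1; have e2 := e.injective e2; have e3 := e.injective e3
      have e4 := e.injective e4
      subst e1 e2 e3 e4
      exact hI.2 _ _ _ _ (fun h => hxy (by rw [h])) (fun h => hzw (by rw [h])) h1 h2 h3 h4
  · have : Fintype.card (ZMod p × ZMod p × ZMod p) = p ^ 3 := by
      simp only [Fintype.card_prod, ZMod.card]; ring
    rw [← this, ← Finset.card_univ]
    refine Finset.card_le_card_of_injOn
      (fun t => s(e (.inl (t.1, t.2.1 * t.1 + t.2.2)), e (.inr (t.2.1, t.2.2)))) ?_ ?_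
    · rintro ⟨x, a, b⟩ -
      simp only [coe_edgeFinset, mem_edgeSet]
      exact ⟨by simp, _, _, rfl, rfl, rfl⟩
    · rintro ⟨x, a, b⟩ - ⟨x', a', b'⟩ - h
      simp only [Sym2.eq_iff, EmbeddingLike.apply_eq_iff_eq, Sum.inl.injEq, Sum.inr.injEq,
        Prod.mk.injEq, reduceCtorEq, false_and, or_false] at h
      obtain ⟨⟨h1, -⟩, h2, h3⟩ := h
      rw [h1, h2, h3]

end C6P
end Part2

section Part3
open SimpleGraph Filter
open scoped Classical
namespace C6P
open Finset

section Bd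
set_option linter.unusedSectionVars false
variable {V : Type*} [DecidableEq V]

noncomputable def tr (E : Finset (V × V)) (G : SimpleGraph V) : Finset (V × V) :=
  E.filter (fun p => G.Adj p.1 p.2)

def Bd (𝒢 : Set (SimpleGraph V)) (E : Finset (V × V)) (x : ℝ) : Prop :=
  ((tr E '' 𝒢).ncard : ℝ) ≤ 2 ^ x

lemma tr_sub (E : Finset (V × V)) (G : SimpleGraph V) : tr E G ⊆ E := filter_subset _ _

lemma mem_tr {E : Finset (V × V)} {G : SimpleGraph V} {p : V × V} :
    p ∈ tr E G ↔ p ∈ E ∧ G.Adj p.1 p.2 := by simp [tr]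

lemma tr_fin (𝒢 : Set (SimpleGraph V)) (E : Finset (V × V)) : (tr E '' 𝒢).Finite := by
  apply Set.Finite.subset (E.powerset.finite_toSet)
  rintro _ ⟨G, -, rfl⟩
  simpa using tr_sub E G

lemma Bd.code {𝒢 : Set (SimpleGraph V)} {E : Finset (V × V)} {x : ℝ}
    (𝒵 : Finset (Finset (V × V))) (h : ∀ G ∈ 𝒢, tr E G ∈ 𝒵) (hc : (𝒵.card : ℝ) ≤ 2 ^ x) :
    Bd 𝒢 E x := by
  unfold Bd
  refine le_trans ?_ hc
  rw [← Set.ncard_coe_finset 𝒵, Nat.cast_le]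
  apply Set.ncard_le_ncard _ 𝒵.finite_toSet
  rintro _ ⟨G, hG, rfl⟩
  exact h G hG

lemma Bd.mono {𝒢 : Set (SimpleGraph V)} {E : Finset (V × V)} {x y : ℝ} (h : Bd 𝒢 E x)
    (hxy : x ≤ y) : Bd 𝒢 E y :=
  le_trans h (Real.rpow_le_rpow_of_exponent_le (by norm_num) hxy)

lemma Bd.mono_set {𝒢 𝒢' : Set (SimpleGraph V)} {E : Finset (V × V)} {x : ℝ} (h : Bd 𝒢' E x)
    (hs : 𝒢 ⊆ 𝒢') : Bd 𝒢 E x := by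
  refine le_trans ?_ h
  norm_cast
  exact Set.ncard_le_ncard (Set.image_mono hs) (tr_fin _ _)

lemma Bd.mono_E {𝒢 : Set (SimpleGraph V)} {E E' : Finset (V × V)} {x : ℝ} (h : Bd 𝒢 E' x)
    (hs : E ⊆ E') : Bd 𝒢 E x := by
  refine le_trans ?_ h
  norm_cast
  have : tr E '' 𝒢 = (fun Z => E ∩ Z) '' ((tr E') '' 𝒢) := by
    rw [Set.image_image]
    apply Set.image_congr
    intro G _
    ext p
    simp only [mem_tr, mem_inter]
    have := @hs p
    tauto
  rw [this]
  exact Set.ncard_image_le (tr_fin _ _)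

lemma Bd.union {𝒢 : Set (SimpleGraph V)} {E E' : Finset (V × V)} {x y : ℝ} (h : Bd 𝒢 E x)
    (h' : Bd 𝒢 E' y) : Bd 𝒢 (E ∪ E') (x + y) := by
  unfold Bd at *
  rw [Real.rpow_add (by norm_num)]
  refine le_trans ?_ (mul_le_mul h h' (by positivity) (by positivity))
  norm_cast
  rw [← Set.ncard_prod]
  refine Set.ncard_le_ncard_of_injOn (fun Z => (E ∩ Z, E' ∩ Z)) ?_ ?_ ((tr_fin _ _).prod (tr_fin _ _))
  · rintro _ ⟨G, hG, rfl⟩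
    refine ⟨⟨G, hG, ?_⟩, ⟨G, hG, ?_⟩⟩
    · ext p; simp only [mem_tr, mem_inter, mem_union]; tauto
    · ext p; simp only [mem_tr, mem_inter, mem_union]; tauto
  · rintro _ ⟨G, hG, rfl⟩ _ ⟨G', hG', rfl⟩ h
    simp only [Prod.mk.injEq] at h
    ext p
    have h1 := congrArg (p ∈ ·) h.1
    have h2 := congrArg (p ∈ ·) h.2
    simp only [mem_tr, mem_inter, mem_union, eq_iff_iff] at h1 h2 ⊢
    tauto

lemma Bd.triv (𝒢 : Set (SimpleGraph V)) (E : Finset (V × V)) : Bd 𝒢 E E.card := by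
  apply Bd.code E.powerset
  · intro G _; simpa using tr_sub E G
  · simp

lemma Bd.biUnion {𝒢 : Set (SimpleGraph V)} {I : Type*} (s : Finset I)
    (E : I → Finset (V × V)) (x : I → ℝ) (h : ∀ i ∈ s, Bd 𝒢 (E i) (x i)) :
    Bd 𝒢 (s.biUnion E) (∑ i ∈ s, x i) := by
  induction s using Finset.induction_on with
  | empty => simpa using Bd.triv 𝒢 ∅
  | insert a s ha ih =>
    rw [Finset.biUnion_insert, Finset.sum_insert ha]
    exact (h a (by simp)).union (ih fun i hi => h i (by simp [hi]))

lemma Bd.biUnion_const {𝒢 : Set (SimpleGraph V)} {I : Type*} (s : Finset I)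
    (E : I → Finset (V × V)) (x : ℝ) (h : ∀ i ∈ s, Bd 𝒢 (E i) x) :
    Bd 𝒢 (s.biUnion E) (s.card * x) := by
  have := Bd.biUnion s E (fun _ => x) h
  simpa using this

lemma Bd.avoid {𝒢 : Set (SimpleGraph V)} {E Z : Finset (V × V)} {c : ℕ} (hE : E.card ≤ c)
    (hZ : Z ⊆ E) (h : ∀ G ∈ 𝒢, tr E G ≠ Z) : Bd 𝒢 E (E.card - 1 / 2 ^ c) := by
  apply Bd.code (E.powerset.erase Z)
  · intro G hG; simp [tr_sub, h G hG]
  · rw [Finset.card_erase_of_mem (by simpa using hZ), Finset.card_powerset,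
      Nat.cast_sub Nat.one_le_two_pow, Real.rpow_sub (by norm_num), Real.rpow_natCast]
    push_cast
    rw [le_div_iff₀ (by positivity)]
    set u : ℝ := 1 / 2 ^ c with hu
    have hu0 : 0 ≤ u := by positivity
    have hu1 : u ≤ 1 := by rw [hu]; exact div_le_one_of_le₀ (one_le_pow₀ (by norm_num)) (by positivity)
    -- 2^u ≤ 1 + u
    have h1 : (2:ℝ) ^ u ≤ 1 + u := by
      have h2 := rpow_one_add_le_one_add_mul_self (s := (1:ℝ)) (by norm_num) hu0 hu1
      have e : (1:ℝ) + 1 = 2 := by norm_num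
      rw [e] at h2; linarith
    have h3 : (1:ℝ) ≤ 2 ^ E.card := one_le_pow₀ (by norm_num)
    have h4 : (2:ℝ) ^ E.card * u ≤ 1 := by
      rw [hu, mul_one_div]
      exact div_le_one_of_le₀ (pow_le_pow_right₀ (by norm_num) hE) (by positivity)
    calc ((2:ℝ) ^ E.card - 1) * 2 ^ u ≤ (2 ^ E.card - 1) * (1 + u) :=
          mul_le_mul_of_nonneg_left h1 (by linarith)
      _ ≤ _ := by nlinarith

lemma Bd.lab {L : Type*} [Fintype L] {𝒢 : Set (SimpleGraph V)} {E : Finset (V × V)} {x y : ℝ}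
    (𝒢' : L → Set (SimpleGraph V)) (h : ∀ G ∈ 𝒢, ∃ l, G ∈ 𝒢' l)
    (hx : ∀ l, Bd (𝒢' l) E x) (hL : (Fintype.card L : ℝ) ≤ 2 ^ y) : Bd 𝒢 E (x + y) := by
  unfold Bd at *
  have h1 : tr E '' 𝒢 ⊆ ⋃ l ∈ (univ : Finset L), tr E '' 𝒢' l := by
    rintro _ ⟨G, hG, rfl⟩
    obtain ⟨l, hl⟩ := h G hG
    simp only [mem_univ, Set.iUnion_true, Set.mem_iUnion]
    exact ⟨l, G, hl, rfl⟩
  have h2 : (tr E '' 𝒢).ncard ≤ ∑ l : L, (tr E '' 𝒢' l).ncard := by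
    refine le_trans (Set.ncard_le_ncard h1 ?_) (Finset.set_ncard_biUnion_le _ _)
    exact Set.Finite.biUnion (Set.toFinite _) (fun l _ => tr_fin _ _)
  have h3 : ((tr E '' 𝒢).ncard : ℝ) ≤ ∑ l : L, (2:ℝ) ^ x := by
    refine le_trans (Nat.cast_le.2 h2) ?_
    push_cast
    exact Finset.sum_le_sum fun l _ => hx l
  rw [Real.rpow_add (by norm_num), mul_comm]
  refine le_trans h3 ?_
  simp only [sum_const, card_univ, nsmul_eq_mul]
  exact mul_le_mul_of_nonneg_right hL (by positivity)

/-- label by a subset of V -/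
lemma Bd.labS [Fintype V] {𝒢 : Set (SimpleGraph V)} {E : Finset (V × V)} {x : ℝ}
    (𝒢' : Finset V → Set (SimpleGraph V)) (h : ∀ G ∈ 𝒢, ∃ l, G ∈ 𝒢' l)
    (hx : ∀ l, Bd (𝒢' l) E x) : Bd 𝒢 E (x + Fintype.card V) :=
  Bd.lab 𝒢' h hx (by simp)

/-- label by a tuple of subsets -/
lemma Bd.labSs [Fintype V] (M : ℕ) {𝒢 : Set (SimpleGraph V)} {E : Finset (V × V)} {x : ℝ}
    (𝒢' : (Fin M → Finset V) → Set (SimpleGraph V)) (h : ∀ G ∈ 𝒢, ∃ l, G ∈ 𝒢' l)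
    (hx : ∀ l, Bd (𝒢' l) E x) : Bd 𝒢 E (x + M * Fintype.card V) :=
  Bd.lab 𝒢' h hx (by simp [mul_comm (M:ℝ), Real.rpow_mul])

/-- label by a constant size type -/
lemma Bd.labC {L : Type*} [Fintype L] {𝒢 : Set (SimpleGraph V)} {E : Finset (V × V)} {x : ℝ}
    (𝒢' : L → Set (SimpleGraph V)) (h : ∀ G ∈ 𝒢, ∃ l, G ∈ 𝒢' l)
    (hx : ∀ l, Bd (𝒢' l) E x) : Bd 𝒢 E (x + Fintype.card L) :=
  Bd.lab 𝒢' h hx (by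
    rw [Real.rpow_natCast]
    exact_mod_cast Nat.lt_two_pow_self.le)

noncomputable def ball {α : Type*} (E : Finset α) (d : ℝ) : Finset (Finset α) :=
  E.powerset.filter (fun D => (D.card : ℝ) ≤ d)

lemma Bd.ball {𝒢 : Set (SimpleGraph V)} {E : Finset (V × V)} {d x y : ℝ}
    (ℛ : Finset (Finset (V × V))) (h : ∀ G ∈ 𝒢, ∃ R ∈ ℛ, ((symmDiff (tr E G) R).card : ℝ) ≤ d)
    (hb : ((ball E d).card : ℝ) ≤ 2 ^ x) (hR : (ℛ.card : ℝ) ≤ 2 ^ y) : Bd 𝒢 E (x + y) := by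
  apply Bd.code (Finset.image₂ (fun D R => symmDiff D (E ∩ R)) (C6P.ball E d) ℛ)
  · intro G hG
    obtain ⟨R, hR, hd⟩ := h G hG
    rw [Finset.mem_image₂]
    refine ⟨E ∩ symmDiff (tr E G) R, ?_, R, hR, ?_⟩
    · simp only [C6P.ball, mem_filter, mem_powerset, inter_subset_left, true_and]
      refine le_trans ?_ hd
      exact_mod_cast card_le_card inter_subset_right
    · ext p
      simp only [mem_symmDiff, mem_inter, mem_tr]
      tauto
  · rw [Real.rpow_add (by norm_num)]
    refine le_trans ?_ (mul_le_mul hb hR (by positivity) (by positivity))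
    exact_mod_cast Finset.card_image₂_le _ _ _

lemma ball_bound (h : ℝ) (hh : 0 < h) : ∃ δ : ℝ, 0 < δ ∧ δ ≤ 1 ∧
    ∀ {α : Type} (E : Finset α) (N d : ℝ),
    (E.card : ℝ) ≤ N → d ≤ δ * N → ((ball E d).card : ℝ) ≤ 2 ^ (h * N) := by
  -- choose z
  set z : ℝ := 2 ^ (h / 2) - 1 with hz
  have hz0 : 0 < z := by
    have : (1:ℝ) < 2 ^ (h/2) := Real.one_lt_rpow (by norm_num) (by positivity)
    linarith
  set z' := min z (1/2) with hz'
  have hz'0 : 0 < z' := by rw [hz']; exact lt_min hz0 (by norm_num)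
  have hz'1 : z' ≤ 1/2 := min_le_right _ _
  have h1z : 1 + z' ≤ 2 ^ (h/2) := by
    have : z' ≤ z := min_le_left _ _
    linarith
  -- z'^(-δ) ≤ 2^(h/2)
  set lz := Real.logb 2 (1 / z') with hlz
  have hlz1 : 0 < lz := Real.logb_pos (by norm_num) (by rw [lt_div_iff₀ hz'0]; linarith [hz'1])
  have hlz2 : z' = 2 ^ (-lz) := by
    rw [Real.rpow_neg (by norm_num), hlz,
      Real.rpow_logb (by norm_num) (by norm_num) (one_div_pos.2 hz'0), one_div, inv_inv]
  set δ := min 1 (h / (2 * lz)) with hδ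
  refine ⟨δ, lt_min one_pos (div_pos hh (by linarith)), min_le_left _ _, ?_⟩
  intro α E N d hN hd
  have hN0 : 0 ≤ N := le_trans (Nat.cast_nonneg _) hN
  have key : ((ball E d).card : ℝ) * z' ^ d ≤ (1 + z') ^ E.card := by
    rw [← nsmul_eq_mul]
    have e : (1 + z') ^ E.card = ∑ D ∈ E.powerset, z' ^ D.card := by
      have := Finset.sum_pow_mul_eq_add_pow z' 1 E
      simp only [one_pow, mul_one] at this
      rw [this, add_comm]
    rw [e]
    refine le_trans ?_ (Finset.sum_le_sum_of_subset_of_nonneg (filter_subset _ _)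
      (fun D _ _ => by positivity) : ∑ D ∈ ball E d, z' ^ D.card ≤ _)
    apply Finset.card_nsmul_le_sum
    intro D hD
    simp only [ball, mem_filter] at hD
    rw [← Real.rpow_natCast]
    exact Real.rpow_le_rpow_of_exponent_ge hz'0 (by linarith) hD.2
  have hzd : 0 < z' ^ d := by positivity
  rw [← le_div_iff₀ hzd] at key
  refine le_trans key ?_
  rw [div_le_iff₀ hzd]
  have hA : (1 + z') ^ E.card ≤ (2:ℝ) ^ (h / 2 * N) := by
    rw [← Real.rpow_natCast, Real.rpow_mul (by norm_num)]
    calc (1 + z') ^ (E.card : ℝ) ≤ (1 + z') ^ N :=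
          Real.rpow_le_rpow_of_exponent_le (by linarith) hN
      _ ≤ _ := Real.rpow_le_rpow (by linarith) h1z hN0
  refine le_trans hA ?_
  rw [hlz2, ← Real.rpow_mul (by norm_num), ← Real.rpow_add (by norm_num)]
  apply Real.rpow_le_rpow_of_exponent_le (by norm_num)
  have hd2 : d ≤ h / (2 * lz) * N :=
    le_trans hd (mul_le_mul_of_nonneg_right (min_le_right _ _) hN0)
  have : lz * d ≤ h / 2 * N := by
    have := mul_le_mul_of_nonneg_left hd2 hlz1.le
    refine le_trans this (le_of_eq ?_)
    field_simp
  linarith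

end Bd

end C6P
end Part3

section Part4
open SimpleGraph Filter
open scoped Classical
namespace C6P
open Finset

section DP
set_option linter.unusedVariables false

def out {V : Type*} (X : Finset V) (G : SimpleGraph V) : SimpleGraph V where
  Adj a b := G.Adj a b ∧ a ∉ X ∧ b ∉ X
  symm := ⟨fun a b h => ⟨h.1.symm, h.2.2, h.2.1⟩⟩
  loopless := ⟨fun a h => G.loopless.irrefl a h.1⟩

lemma out_adj {V : Type*} {X : Finset V} {G H : SimpleGraph V} (h : out X G = H) {a b : V}
    (ha : a ∉ X) (hb : b ∉ X) : G.Adj a b ↔ H.Adj a b := by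
  rw [← h]; simp [out, ha, hb]

lemma fiber_card {V : Type*} [Fintype V] {X : Finset V} {H : SimpleGraph V}
    {𝒢 : Set (SimpleGraph V)} {x : ℝ} (h : ∀ G ∈ 𝒢, out X G = H)
    (hB : Bd 𝒢 (X ×ˢ univ) x) : (𝒢.ncard : ℝ) ≤ 2 ^ x := by
  refine le_trans (le_of_eq ?_) hB
  norm_cast
  symm
  apply Set.InjOn.ncard_image
  intro G hG G' hG' he
  have key : ∀ a b, a ∈ X → (G.Adj a b ↔ G'.Adj a b) := by
    intro a b ha
    have := congrArg ((a, b) ∈ ·) he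
    simpa [mem_tr, ha] using this
  ext a b
  by_cases ha : a ∈ X
  · exact key a b ha
  · by_cases hb : b ∈ X
    · rw [G.adj_comm, G'.adj_comm]; exact key b a hb
    · rw [out_adj (h G hG) ha hb, out_adj (h G' hG') ha hb]

lemma out_count {n k : ℕ} {X : Finset (Fin n)} (hX : X.card = k) :
    ((Fs n).image (out X)).card ≤ f (n - k) := by
  have hc : Fintype.card {v // v ∉ X} = n - k := by
    rw [Fintype.card_subtype_compl]; simp [hX]
  let e : Fin (n - k) ≃ {v // v ∉ X} := (Fintype.equivFinOfCardEq hc).symm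
  unfold f
  refine Finset.card_le_card_of_injOn (fun H => H.comap (fun i => (e i : Fin n))) ?_ ?_
  · rintro H hH
    simp only [coe_image, Set.mem_image, mem_coe, mem_Fs] at hH
    obtain ⟨G, hG, rfl⟩ := hH
    simp only [mem_coe, mem_Fs]
    have : (out X G).comap (fun i => (e i : Fin n)) = G.comap (fun i => (e i : Fin n)) := by
      ext a b
      simp only [comap_adj, out]
      have h1 := (e a).2
      have h2 := (e b).2
      tauto
    rw [this]
    exact hG.comap _
  · rintro _ hH _ hH' he
    simp only [coe_image, Set.mem_image, mem_coe, mem_Fs] at hH hH'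
    obtain ⟨G, hG, rfl⟩ := hH
    obtain ⟨G', hG', rfl⟩ := hH'
    ext a b
    by_cases ha : a ∈ X
    · simp [out, ha]
    by_cases hb : b ∈ X
    · simp [out, hb]
    have := congrArg (fun H : SimpleGraph _ => H.Adj (e.symm ⟨a, ha⟩) (e.symm ⟨b, hb⟩)) he
    simpa using this

lemma dp_count {n k : ℕ} (P : SimpleGraph (Fin n) → Prop)
    (R : Finset (Fin n) → SimpleGraph (Fin n) → Prop) (x : ℝ)
    (hbad : ∀ G, C6F G → ¬ P G → ∃ X, X.card = k ∧ R X G)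
    (hfib : ∀ X, X.card = k → ∀ H,
      Bd {G | C6F G ∧ R X G ∧ out X G = H} (X ×ˢ univ) x) :
    (((Fs n).filter (fun G => ¬ P G)).card : ℝ) ≤ (n:ℝ) ^ k * f (n - k) * 2 ^ x := by
  set 𝒳 := (univ : Finset (Fin n)).powersetCard k with h𝒳
  have h1 : (Fs n).filter (fun G => ¬ P G) ⊆ 𝒳.biUnion (fun X => ((Fs n).image (out X)).biUnion
      (fun H => (Fs n).filter (fun G => R X G ∧ out X G = H))) := by
    intro G hG
    simp only [mem_filter, mem_Fs] at hG
    obtain ⟨X, hX, hR⟩ := hbad G hG.1 hG.2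
    simp only [mem_biUnion, mem_filter, mem_image, mem_Fs]
    exact ⟨X, by simp [h𝒳, mem_powersetCard, hX], out X G, ⟨G, hG.1, rfl⟩, hG.1, hR, rfl⟩
  have h2 : (((Fs n).filter (fun G => ¬ P G)).card : ℝ) ≤
      ∑ X ∈ 𝒳, ∑ H ∈ (Fs n).image (out X), (2:ℝ) ^ x := by
    calc (((Fs n).filter (fun G => ¬ P G)).card : ℝ) ≤ _ := Nat.cast_le.2 (card_le_card h1)
      _ ≤ ∑ X ∈ 𝒳, (((((Fs n).image (out X)).biUnion
          (fun H => (Fs n).filter (fun G => R X G ∧ out X G = H))).card : ℕ) : ℝ) := by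
          exact_mod_cast card_biUnion_le
      _ ≤ _ := by
          apply Finset.sum_le_sum
          intro X hX
          simp only [h𝒳, mem_powersetCard] at hX
          refine le_trans (Nat.cast_le.2 card_biUnion_le) ?_
          push_cast
          apply Finset.sum_le_sum
          intro H _
          have := fiber_card (fun G hG => hG.2.2) (hfib X hX.2 H)
          refine le_trans (le_of_eq ?_) this
          norm_cast
          rw [← Set.ncard_coe_finset]
          congr 1
          ext G
          simp [mem_Fs]
  refine le_trans h2 ?_
  have h3 : ∀ X ∈ 𝒳, ∑ H ∈ (Fs n).image (out X), (2:ℝ) ^ x ≤ f (n - k) * 2 ^ x := by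
    intro X hX
    simp only [h𝒳, mem_powersetCard] at hX
    rw [sum_const, nsmul_eq_mul]
    exact mul_le_mul_of_nonneg_right (Nat.cast_le.2 (out_count hX.2)) (by positivity)
  refine le_trans (Finset.sum_le_sum h3) ?_
  rw [sum_const, nsmul_eq_mul, mul_assoc]
  refine mul_le_mul_of_nonneg_right ?_ (by positivity)
  rw [h𝒳, card_powersetCard]
  simp only [card_univ, Fintype.card_fin]
  exact_mod_cast Nat.choose_le_pow n k

def IH (C : ℝ) (n : ℕ) : Prop := ∀ m < n, (f m : ℝ) ≤ C * g m

def AA (P : ∀ n, SimpleGraph (Fin n) → Prop) : Prop :=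
  ∀ ε : ℝ, 0 < ε → ∃ n0, ∀ n ≥ n0, ∀ C : ℝ, 1 ≤ C → IH C n →
    (((Fs n).filter (fun G => ¬ P n G)).card : ℝ) ≤ ε * C * g n

lemma AA.mono {P Q : ∀ n, SimpleGraph (Fin n) → Prop} (hP : AA P)
    (h : ∃ n0, ∀ n ≥ n0, ∀ G, C6F G → P n G → Q n G) : AA Q := by
  intro ε hε
  obtain ⟨n0, h0⟩ := hP ε hε
  obtain ⟨n1, h1⟩ := h
  refine ⟨max n0 n1, fun n hn C hC hI => le_trans ?_ (h0 n (le_trans (le_max_left _ _) hn) C hC hI)⟩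
  norm_cast
  apply card_le_card
  intro G hG
  simp only [mem_filter, mem_Fs] at hG ⊢
  exact ⟨hG.1, fun hp => hG.2 (h1 n (le_trans (le_max_right _ _) hn) G hG.1 hp)⟩

lemma AA.and {P Q : ∀ n, SimpleGraph (Fin n) → Prop} (hP : AA P) (hQ : AA Q) :
    AA (fun n G => P n G ∧ Q n G) := by
  intro ε hε
  obtain ⟨n0, h0⟩ := hP (ε / 2) (by linarith)
  obtain ⟨n1, h1⟩ := hQ (ε / 2) (by linarith)
  refine ⟨max n0 n1, fun n hn C hC hI => ?_⟩
  have a := h0 n (le_trans (le_max_left _ _) hn) C hC hI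
  have b := h1 n (le_trans (le_max_right _ _) hn) C hC hI
  have c : (((Fs n).filter (fun G => ¬ (P n G ∧ Q n G))).card : ℝ) ≤
      ((Fs n).filter (fun G => ¬ P n G)).card + ((Fs n).filter (fun G => ¬ Q n G)).card := by
    norm_cast
    refine le_trans (card_le_card ?_) (card_union_le _ _)
    intro G hG
    simp only [mem_filter, mem_union] at hG ⊢
    tauto
  have : ε * C * g n = ε / 2 * C * g n + ε / 2 * C * g n := by ring
  rw [this]
  refine le_trans (le_of_eq ?_) (le_trans c (add_le_add a b))
  congr

lemma AA.mp {P Q : ∀ n, SimpleGraph (Fin n) → Prop} (hP : AA P)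
    (hQ : AA (fun n G => P n G → Q n G)) : AA Q :=
  (hP.and hQ).mono ⟨0, fun _ _ _ _ h => h.2 h.1⟩

lemma AA.triv {P : ∀ n, SimpleGraph (Fin n) → Prop}
    (h : ∃ n0, ∀ n ≥ n0, ∀ G, C6F G → P n G) : AA P := by
  intro ε hε
  obtain ⟨n0, h0⟩ := h
  refine ⟨n0, fun n hn C hC _ => ?_⟩
  have : (Fs n).filter (fun G => ¬ P n G) = ∅ := by
    ext G
    simp only [mem_filter, mem_Fs, notMem_empty, iff_false, not_and, not_not]
    exact h0 n hn G
  rw [this]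
  simp only [card_empty, Nat.cast_zero]
  positivity

/-- an absolute count bound gives AA -/
lemma AA.of_count {P : ∀ n, SimpleGraph (Fin n) → Prop}
    (h : ∀ ε : ℝ, 0 < ε → ∃ n0, ∀ n ≥ n0,
      (((Fs n).filter (fun G => ¬ P n G)).card : ℝ) ≤ ε * g n) : AA P := by
  intro ε hε
  obtain ⟨n0, h0⟩ := h ε hε
  refine ⟨n0, fun n hn C hC _ => le_trans (h0 n hn) ?_⟩
  have : 0 ≤ ε * (g n : ℝ) := by positivity
  nlinarith

lemma g_ratio {n k : ℕ} (hk : k ≤ n) :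
    (g (n - k) : ℝ) * 2 ^ ((k:ℝ) * n / 2 - (k:ℝ) ^ 2 / 4 - 1 / 4) ≤ g n := by
  have h := g_steps (n - k) k
  rw [Nat.sub_add_cancel hk] at h
  have h' : (g (n-k) : ℝ) * 2 ^ (((n ^ 2 / 4 - (n - k) ^ 2 / 4 : ℕ)) : ℝ) ≤ g n := by
    rw [Real.rpow_natCast]; exact_mod_cast h
  refine le_trans (mul_le_mul_of_nonneg_left ?_ (by positivity)) h'
  apply Real.rpow_le_rpow_of_exponent_le (by norm_num)
  have h1 : (n - k) ^ 2 / 4 ≤ n ^ 2 / 4 := by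
    apply Nat.div_le_div_right; apply Nat.pow_le_pow_left; omega
  rw [Nat.cast_sub h1]
  have h2 : (((n - k) ^ 2 / 4 : ℕ) : ℝ) ≤ ((n:ℝ) - k) ^ 2 / 4 := by
    refine le_trans Nat.cast_div_le ?_
    push_cast [Nat.cast_sub hk]
    exact le_refl _
  have h3 : ((n:ℝ) ^ 2 - 1) / 4 ≤ ((n ^ 2 / 4 : ℕ) : ℝ) := by
    have : n ^ 2 ≤ 4 * (n ^ 2 / 4) + 1 := by
      rcases Nat.even_or_odd' n with ⟨c, hc | hc⟩
      · rw [hc]; ring_nf; omega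
      · rw [hc]; ring_nf; omega
    have : (n:ℝ) ^ 2 ≤ 4 * ((n ^ 2 / 4 : ℕ) : ℝ) + 1 := by exact_mod_cast this
    linarith
  nlinarith

lemma AA.of_dp {P : ∀ n, SimpleGraph (Fin n) → Prop}
    (h : ∃ n0 : ℕ, ∀ n ≥ n0, ∃ (k : ℕ) (R : Finset (Fin n) → SimpleGraph (Fin n) → Prop) (x : ℝ),
      1 ≤ k ∧ k ≤ n ∧ x + (k:ℝ) ^ 2 / 4 + 1 / 4 + (k + 1) * Real.logb 2 n ≤ k * n / 2 ∧
      (∀ G, C6F G → ¬ P n G → ∃ X, X.card = k ∧ R X G) ∧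
      (∀ X, X.card = k → ∀ H, Bd {G | C6F G ∧ R X G ∧ out X G = H} (X ×ˢ univ) x)) : AA P := by
  intro ε hε
  obtain ⟨n0, h0⟩ := h
  obtain ⟨n1, hn1⟩ := exists_nat_gt (1 / ε)
  refine ⟨max n0 (max n1 1), fun n hn C hC hI => ?_⟩
  have hna : n0 ≤ n := le_trans (le_max_left _ _) hn
  have hnb : n1 ≤ n := le_trans (le_trans (le_max_left _ _) (le_max_right _ _)) hn
  have hnc : 1 ≤ n := le_trans (le_trans (le_max_right _ _) (le_max_right _ _)) hn
  have hn0 : (0:ℝ) < n := by exact_mod_cast hnc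
  obtain ⟨k, R, x, hk1, hkn, hx, hbad, hfib⟩ := h0 n hna
  have h1 := dp_count (P n) R x hbad hfib
  have h2 := hI (n - k) (by omega)
  have h3 := g_ratio hkn
  have hpow : (n:ℝ) ^ k * 2 ^ x ≤ 1 / n * 2 ^ ((k:ℝ) * n / 2 - (k:ℝ) ^ 2 / 4 - 1 / 4) := by
    have e : (n:ℝ) = 2 ^ (Real.logb 2 n) := by
      rw [Real.rpow_logb (by norm_num) (by norm_num) hn0]
    have e1 : (n:ℝ) ^ k = 2 ^ (k * Real.logb 2 n) := by
      rw [mul_comm, Real.rpow_mul (by norm_num), ← e, Real.rpow_natCast]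
    have e2 : 1 / (n:ℝ) = 2 ^ (- Real.logb 2 n) := by
      rw [Real.rpow_neg (by norm_num), ← e, one_div]
    rw [e1, e2, ← Real.rpow_add (by norm_num), ← Real.rpow_add (by norm_num)]
    apply Real.rpow_le_rpow_of_exponent_le (by norm_num)
    linarith
  calc (((Fs n).filter (fun G => ¬ P n G)).card : ℝ) ≤ (n:ℝ) ^ k * f (n - k) * 2 ^ x := h1
    _ = f (n - k) * ((n:ℝ) ^ k * 2 ^ x) := by ring
    _ ≤ (C * g (n - k)) * (1 / n * 2 ^ ((k:ℝ) * n / 2 - (k:ℝ) ^ 2 / 4 - 1 / 4)) :=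
        mul_le_mul h2 hpow (by positivity) (by positivity)
    _ = (1 / n) * C * (g (n - k) * 2 ^ ((k:ℝ) * n / 2 - (k:ℝ) ^ 2 / 4 - 1 / 4)) := by ring
    _ ≤ (1 / n) * C * g n := mul_le_mul_of_nonneg_left h3 (by positivity)
    _ ≤ ε * C * g n := by
        have : 1 / (n:ℝ) ≤ ε := by
          rw [div_le_iff₀ hn0]
          have h5 : (n1:ℝ) ≤ n := by exact_mod_cast hnb
          have h6 : 1 / ε < n := lt_of_lt_of_le hn1 h5
          rw [div_lt_iff₀ hε] at h6
          linarith
        have hc : 0 ≤ C * (g n : ℝ) := by positivity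
        nlinarith

lemma log_small (a : ℝ) (ha : 0 < a) (b : ℝ) : ∃ n0 : ℕ, ∀ n : ℕ, n ≥ n0 →
    b + b * Real.logb 2 n ≤ a * n := by
  have h1 : Tendsto (fun n : ℕ => Real.logb 2 n / n) atTop (nhds 0) := by
    have : Tendsto (fun x : ℝ => Real.log x / x) atTop (nhds 0) := by
      have := Real.isLittleO_log_id_atTop.tendsto_div_nhds_zero
      simpa using this
    have := (this.comp tendsto_natCast_atTop_atTop).div_const (Real.log 2)
    simp only [zero_div] at this
    refine this.congr fun n => ?_
    simp only [Function.comp, Real.logb]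
    ring
  have h2 : Tendsto (fun n : ℕ => b / (n:ℝ) + b * (Real.logb 2 n / n)) atTop (nhds 0) := by
    have := (tendsto_const_div_atTop_nhds_zero_nat b).add (h1.const_mul b)
    simpa using this
  have h3 := (h2.eventually (gt_mem_nhds ha)).and (eventually_ge_atTop 1)
  obtain ⟨n0, h0⟩ := eventually_atTop.1 h3
  refine ⟨n0, fun n hn => ?_⟩
  obtain ⟨h4, h5⟩ := h0 n hn
  have hn0 : (0:ℝ) < n := by exact_mod_cast h5
  have : b / (n:ℝ) + b * (Real.logb 2 n / n) = (b + b * Real.logb 2 n) / n := by ring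
  rw [this, div_lt_iff₀ hn0] at h4
  exact h4.le

/-- constant size version -/
lemma AA.of_dp_const {P : ∀ n, SimpleGraph (Fin n) → Prop} (k : ℕ) (hk : 1 ≤ k) (ε : ℝ) (hε : 0 < ε)
    (R : ∀ n, Finset (Fin n) → SimpleGraph (Fin n) → Prop)
    (h : ∃ n0 : ℕ, ∀ n ≥ n0,
      (∀ G, C6F G → ¬ P n G → ∃ X, X.card = k ∧ R n X G) ∧
      (∀ X, X.card = k → ∀ H, Bd {G | C6F G ∧ R n X G ∧ out X G = H} (X ×ˢ univ)
        ((k/2 - ε) * n))) : AA P := by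
  obtain ⟨n0, h0⟩ := h
  obtain ⟨n1, h1⟩ := log_small ε hε ((k:ℝ)^2 + k + 1)
  apply AA.of_dp
  refine ⟨max n0 (max n1 (k+1)), fun n hn => ?_⟩
  have hna : n0 ≤ n := le_trans (le_max_left _ _) hn
  have hnb : n1 ≤ n := le_trans (le_trans (le_max_left _ _) (le_max_right _ _)) hn
  have hnc : k + 1 ≤ n := le_trans (le_trans (le_max_right _ _) (le_max_right _ _)) hn
  obtain ⟨a, b⟩ := h0 n hna
  refine ⟨k, R n, _, hk, by omega, ?_, a, b⟩
  have h2 := h1 n hnb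
  have h3 : 0 ≤ Real.logb 2 n := by
    apply Real.logb_nonneg (by norm_num)
    have : 1 ≤ n := by omega
    exact_mod_cast this
  have h4 : 0 ≤ (k:ℝ)^2 * Real.logb 2 n := by positivity
  have h5 : (1:ℝ) ≤ k := by exact_mod_cast hk
  nlinarith

lemma AA_final (h : AA (fun _ G => Good G)) :
    Tendsto (fun n : ℕ => (g n : ℝ) / f n) atTop (nhds 1) := by
  have hgp : ∀ n, (1:ℝ) ≤ g n := fun n => by exact_mod_cast g_pos n
  have hsub : ∀ n, Gs n ⊆ Fs n := by
    intro n G hG; rw [mem_Gs] at hG; rw [mem_Fs]; exact hG.c6f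
  have hfg : ∀ n, (g n : ℝ) ≤ f n := fun n => by
    exact_mod_cast card_le_card (hsub n)
  have hbad : ∀ n, (((Fs n).filter (fun G => ¬ Good G)).card : ℝ) = f n - g n := by
    intro n
    have h1 := Finset.card_filter_add_card_filter_not (s := Fs n) (fun G => Good G)
    have h2 : (Fs n).filter (fun G => Good G) = Gs n := by
      ext G
      simp only [mem_filter, mem_Gs, mem_Fs]
      exact ⟨fun h => h.2, fun h => ⟨h.c6f, h⟩⟩
    rw [h2] at h1
    have h3 : (g n : ℝ) + ((Fs n).filter (fun G => ¬ Good G)).card = f n := by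
      unfold g f; exact_mod_cast h1
    linarith
  obtain ⟨C, hC1, hC⟩ : ∃ C : ℝ, 1 ≤ C ∧ ∀ n, (f n : ℝ) ≤ C * g n := by
    obtain ⟨n0, h0⟩ := h (1/2) (by norm_num)
    refine ⟨2 + ∑ m ∈ range n0, (f m : ℝ), ?_, ?_⟩
    · have : (0:ℝ) ≤ ∑ m ∈ range n0, (f m : ℝ) := by positivity
      linarith
    set C := 2 + ∑ m ∈ range n0, (f m : ℝ) with hCdef
    have hC2 : 2 ≤ C := by
      have : (0:ℝ) ≤ ∑ m ∈ range n0, (f m : ℝ) := by positivity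
      linarith
    intro n
    induction n using Nat.strong_induction_on with
    | _ n ih =>
      by_cases hn : n < n0
      · have : (f n : ℝ) ≤ ∑ m ∈ range n0, (f m : ℝ) :=
          Finset.single_le_sum (f := fun m => (f m : ℝ)) (fun _ _ => by positivity) (mem_range.2 hn)
        have := hgp n
        nlinarith
      · have h1 := h0 n (by omega) C (by linarith) ih
        rw [hbad] at h1
        have := hgp n
        nlinarith
  rw [Metric.tendsto_atTop]
  intro ε hε
  obtain ⟨n0, h0⟩ := h (ε / (2 * C)) (by positivity)
  refine ⟨n0, fun n hn => ?_⟩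
  have h1 := h0 n hn C hC1 (fun m _ => hC m)
  rw [hbad] at h1
  have e : ε / (2 * C) * C * (g n:ℝ) = ε / 2 * g n := by field_simp
  rw [e] at h1
  have h2 := hfg n
  have h3 := hgp n
  have h4 : (0:ℝ) < f n := by linarith
  rw [Real.dist_eq, abs_sub_lt_iff]
  constructor
  · have : (g n : ℝ) / f n ≤ 1 := div_le_one_of_le₀ h2 h4.le
    linarith
  · have : 1 - ε < (g n : ℝ) / f n := by
      rw [lt_div_iff₀ h4]
      nlinarith
    linarith

end DP
end C6P
end Part4

section Part5
open SimpleGraph Filter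
open scoped Classical
namespace C6P
open Finset

section PL

lemma ramsey_aux (a b : ℕ) : ∃ N : ℕ, ∀ {V : Type} (G : SimpleGraph V) (D : Finset V), N ≤ D.card →
    (∃ A ⊆ D, A.card = a ∧ ∀ x ∈ A, ∀ y ∈ A, x ≠ y → G.Adj x y) ∨
    (∃ A ⊆ D, A.card = b ∧ ∀ x ∈ A, ∀ y ∈ A, x ≠ y → ¬ G.Adj x y) := by
  induction a generalizing b with
  | zero => exact ⟨0, fun G D _ => Or.inl ⟨∅, by simp, by simp, by simp⟩⟩
  | succ a iha =>
    induction b with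
    | zero => exact ⟨0, fun G D _ => Or.inr ⟨∅, by simp, by simp, by simp⟩⟩
    | succ b ihb =>
      obtain ⟨N1, h1⟩ := iha (b+1)
      obtain ⟨N2, h2⟩ := ihb
      refine ⟨N1 + N2 + 1, ?_⟩
      intro V G D hD
      obtain ⟨v, hv⟩ : D.Nonempty := Finset.card_pos.1 (by omega)
      have hc := Finset.card_filter_add_card_filter_not (s := D.erase v) (fun u => G.Adj v u)
      rw [Finset.card_erase_of_mem hv] at hc
      by_cases hN : N1 ≤ ((D.erase v).filter (fun u => G.Adj v u)).card
      · rcases h1 G _ hN with ⟨A, hA, hAc, hAa⟩ | ⟨A, hA, hAc, hAa⟩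
        · left
          have hvA : v ∉ A := fun h => by have := hA h; simp at this
          refine ⟨insert v A, ?_, by rw [card_insert_of_notMem hvA, hAc], ?_⟩
          · intro x hx
            rcases mem_insert.1 hx with rfl | hx
            · exact hv
            · have := hA hx; simp at this; exact this.1.2
          · intro x hx y hy hxy
            rcases mem_insert.1 hx with hxv | hxA
            · subst hxv
              rcases mem_insert.1 hy with hyv | hyA
              · exact absurd hyv.symm hxy
              · have := hA hyA; simp at this; exact this.2
            · rcases mem_insert.1 hy with hyv | hyA
              · subst hyv
                have := hA hxA; simp at this; exact this.2.symm
              · exact hAa x hxA y hyA hxy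
        · right
          exact ⟨A, fun x hx => by have := hA hx; simp at this; exact this.1.2, hAc, hAa⟩
      · have hN2 : N2 ≤ ((D.erase v).filter (fun u => ¬ G.Adj v u)).card := by omega
        rcases h2 G _ hN2 with ⟨A, hA, hAc, hAa⟩ | ⟨A, hA, hAc, hAa⟩
        · left
          exact ⟨A, fun x hx => by have := hA hx; simp at this; exact this.1.2, hAc, hAa⟩
        · right
          have hvA : v ∉ A := fun h => by have := hA h; simp at this
          refine ⟨insert v A, ?_, by rw [card_insert_of_notMem hvA, hAc], ?_⟩
          · intro x hx
            rcases mem_insert.1 hx with rfl | hx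
            · exact hv
            · have := hA hx; simp at this; exact this.1.2
          · intro x hx y hy hxy
            rcases mem_insert.1 hx with hxv | hxA
            · subst hxv
              rcases mem_insert.1 hy with hyv | hyA
              · exact absurd hyv.symm hxy
              · have := hA hyA; simp at this; exact this.2
            · rcases mem_insert.1 hy with hyv | hyA
              · subst hyv
                have := hA hxA; simp at this; exact fun h => this.2 h.symm
              · exact hAa x hxA y hyA hxy

lemma ramsey (a : ℕ) : ∃ N : ℕ, ∀ {V : Type} (G : SimpleGraph V) (D : Finset V), N ≤ D.card →
    ∃ A ⊆ D, A.card = a ∧ ∃ c : Bool, ∀ x ∈ A, ∀ y ∈ A, x ≠ y → (G.Adj x y ↔ c = true) := by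
  obtain ⟨N, h⟩ := ramsey_aux a a
  refine ⟨N, ?_⟩
  intro V G D hD
  rcases h G D hD with ⟨A, h1, h2, h3⟩ | ⟨A, h1, h2, h3⟩
  · exact ⟨A, h1, h2, true, fun x hx y hy hxy => by simp [h3 x hx y hy hxy]⟩
  · exact ⟨A, h1, h2, false, fun x hx y hy hxy => by simp [h3 x hx y hy hxy]⟩

lemma greedy {α β : Type} (sep : α → β → Prop) (P : Finset α) (U : Finset β) (hU : U.Nonempty)
    (c : ℝ) (hc : 0 ≤ c) (hc1 : c ≤ 1)
    (h : ∀ p ∈ P, c * U.card ≤ (U.filter (fun u => sep p u)).card) (N : ℕ) :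
    ∃ W ⊆ U, W.card ≤ N ∧ ((P.filter (fun p => ∀ w ∈ W, ¬ sep p w)).card : ℝ) ≤ (1 - c) ^ N * P.card := by
  induction N with
  | zero => exact ⟨∅, by simp, by simp, by simp⟩
  | succ N ih =>
    obtain ⟨W, hW, hWc, hWp⟩ := ih
    set P' := P.filter (fun p => ∀ w ∈ W, ¬ sep p w) with hP'
    have hsum : c * P'.card * U.card ≤ ∑ u ∈ U, ((P'.filter (fun p => sep p u)).card : ℝ) := by
      have : (∑ u ∈ U, ((P'.filter (fun p => sep p u)).card : ℝ)) =
          ∑ p ∈ P', ((U.filter (fun u => sep p u)).card : ℝ) := by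
        simp only [card_filter, Nat.cast_sum]
        exact Finset.sum_comm
      rw [this]
      have : ∑ p ∈ P', c * (U.card : ℝ) ≤ ∑ p ∈ P', ((U.filter (fun u => sep p u)).card : ℝ) :=
        Finset.sum_le_sum fun p hp => h p (mem_filter.1 hp).1
      rw [sum_const, nsmul_eq_mul] at this
      linarith
    obtain ⟨u, hu, hu2⟩ : ∃ u ∈ U, c * P'.card ≤ ((P'.filter (fun p => sep p u)).card : ℝ) := by
      by_contra hcon
      push Not at hcon
      have := Finset.sum_lt_sum_of_nonempty hU hcon
      rw [sum_const, nsmul_eq_mul] at this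
      linarith
    refine ⟨insert u W, ?_, le_trans (card_insert_le _ _) (by omega), ?_⟩
    · intro x hx
      rcases mem_insert.1 hx with rfl | hx
      · exact hu
      · exact hW hx
    · have h1 := Finset.card_filter_add_card_filter_not (s := P') (fun p => sep p u)
      have h2 : P.filter (fun p => ∀ w ∈ insert u W, ¬ sep p w) = P'.filter (fun p => ¬ sep p u) := by
        ext p
        simp only [hP', mem_filter, mem_insert, forall_eq_or_imp]
        tauto
      rw [h2]
      have h3 : ((P'.filter (fun p => sep p u)).card : ℝ) + (P'.filter (fun p => ¬ sep p u)).card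
          = P'.card := by exact_mod_cast h1
      rw [pow_succ]
      have : ((P'.filter (fun p => ¬ sep p u)).card : ℝ) ≤ (1 - c) * P'.card := by linarith
      refine le_trans this ?_
      have := mul_le_mul_of_nonneg_left hWp (sub_nonneg.2 hc1)
      linarith

lemma few_small {α : Type} (W : Finset α) (d : ℕ) :
    (W.powerset.filter (fun s => s.card < d)).card ≤ (W.card + 1) ^ d := by
  have h1 : W.powerset.filter (fun s => s.card < d) = (range d).biUnion (fun i => W.powersetCard i) := by
    ext s
    simp only [mem_filter, mem_powerset, mem_biUnion, mem_range, mem_powersetCard]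
    constructor
    · rintro ⟨a, b⟩; exact ⟨_, b, a, rfl⟩
    · rintro ⟨i, hi, a, rfl⟩; exact ⟨a, hi⟩
  rw [h1]
  refine le_trans card_biUnion_le ?_
  simp only [card_powersetCard]
  rw [add_pow]
  rw [Finset.sum_range_succ]
  refine le_trans (Finset.sum_le_sum fun i hi => ?_) (Nat.le_add_right _ _)
  have h2 : W.card.choose i ≤ W.card ^ i := Nat.choose_le_pow _ _
  have h3 : 1 ≤ d.choose i := Nat.choose_pos (mem_range.1 hi).le
  simp only [one_pow, mul_one]
  nlinarith [Nat.zero_le (W.card ^ i)]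

/-- Sauer: a big family on a set W shatters a d-set -/
lemma sauer {β : Type} (𝒜 : Finset (Finset β)) (W : Finset β) (h𝒜 : ∀ A ∈ 𝒜, A ⊆ W) (d : ℕ)
    (h : (W.card + 1) ^ d < 𝒜.card) : ∃ s ⊆ W, s.card = d ∧ 𝒜.Shatters s := by
  by_contra hcon
  push Not at hcon
  have h1 : 𝒜.shatterer ⊆ W.powerset.filter (fun s => s.card < d) := by
    intro s hs
    rw [mem_shatterer] at hs
    simp only [mem_filter, mem_powerset]
    have hsW : s ⊆ W := by
      obtain ⟨u, hu, hsu⟩ := hs (Subset.refl s)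
      exact fun x hx => h𝒜 u hu (by rw [← hsu] at hx; exact (mem_inter.1 hx).2)
    refine ⟨hsW, ?_⟩
    by_contra hd
    push Not at hd
    obtain ⟨t, ht, htc⟩ := Finset.exists_subset_card_eq hd
    exact hcon t (ht.trans hsW) htc (hs.mono_right ht)
  have h2 := card_le_card_shatterer 𝒜
  have h3 := card_le_card h1
  have h4 := few_small W d
  omega

lemma PL (r : ℕ) (δ : ℝ) (hδ : 0 < δ) (hδ1 : δ ≤ 1) : ∃ (M : ℕ) (γ : ℝ), 0 < γ ∧ γ ≤ 1 ∧
    ∀ {α β : Type} (rel : α → β → Prop) (Q : Finset α) (U : Finset β), U.Nonempty → M ≤ Q.card →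
    (∀ q ∈ Q, ∀ q' ∈ Q, q ≠ q' →
      δ * U.card ≤ (U.filter (fun u => ¬ (rel q u ↔ rel q' u))).card) →
    ∃ Q' ⊆ Q, Q'.card = r ∧ ∀ Z ⊆ Q',
      γ * U.card ≤ (U.filter (fun u => ∀ q ∈ Q', rel q u ↔ q ∈ Z)).card := by
  set d := 2 ^ r with hd
  obtain ⟨N, hN⟩ : ∃ N : ℕ, (((N + 1) ^ d + 1 : ℕ) : ℝ) ^ 2 * (1 - δ / 2) ^ N < 1 := by
    have h1 := tendsto_pow_const_mul_const_pow_of_abs_lt_one (2 * d) (r := 1 - δ / 2)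
      (by rw [abs_lt]; constructor <;> linarith)
    have h2 := h1.eventually (gt_mem_nhds (show (0:ℝ) < (1 - δ/2) / 4 by linarith))
    obtain ⟨n0, h0⟩ := eventually_atTop.1 h2
    refine ⟨n0, ?_⟩
    have h3 := h0 (n0 + 1) (by omega)
    have h4 : (1:ℝ) ≤ ((n0:ℝ) + 1) ^ d := one_le_pow₀ (by linarith [Nat.cast_nonneg (α := ℝ) n0])
    have h5 : ((((n0 + 1) ^ d + 1 : ℕ)) : ℝ) ^ 2 ≤ 4 * ((n0:ℝ) + 1) ^ (2 * d) := by
      push_cast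
      rw [mul_comm 2 d, pow_mul]
      nlinarith
    have h6 : 0 < (1 - δ / 2) := by linarith
    have h7 : 0 < (1 - δ / 2) ^ n0 := by positivity
    push_cast at h3
    rw [pow_succ (1 - δ/2)] at h3
    have h8 : ((n0:ℝ) + 1) ^ (2 * d) * (1 - δ / 2) ^ n0 * 4 < 1 := by
      have : (((n0:ℝ) + 1) ^ (2 * d) * (1 - δ / 2) ^ n0 * 4) * (1 - δ/2) < 1 * (1 - δ/2) := by
        linarith
      exact lt_of_mul_lt_mul_right this h6.le
    nlinarith
  set M := (N + 1) ^ d + 1 with hM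
  have hM2 : 2 ≤ M := by
    have : 1 ≤ (N + 1) ^ d := Nat.one_le_pow _ _ (by omega)
    omega
  refine ⟨M, δ / 2 / 2 ^ M, by positivity, ?_, ?_⟩
  · rw [div_le_iff₀ (by positivity)]
    have : (1:ℝ) ≤ 2 ^ M := one_le_pow₀ (by norm_num)
    linarith
  intro α β rel Q0 U hU hQ0 hsep0
  obtain ⟨Q, hQQ0, hQc⟩ := Finset.exists_subset_card_eq hQ0
  have hsep : ∀ q ∈ Q, ∀ q' ∈ Q, q ≠ q' →
      δ * U.card ≤ (U.filter (fun u => ¬ (rel q u ↔ rel q' u))).card :=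
    fun q hq q' hq' hne => hsep0 q (hQQ0 hq) q' (hQQ0 hq') hne
  set γ := δ / 2 / 2 ^ M with hγ
  set cl : Finset α → Finset β := fun Z => U.filter (fun u => Q.filter (fun q => rel q u) = Z) with hcl
  set U' := U.filter (fun u => γ * U.card ≤ (cl (Q.filter (fun q => rel q u))).card) with hU'
  have hbadc : ((U.filter (fun u => ¬ γ * U.card ≤ (cl (Q.filter (fun q => rel q u))).card)).card : ℝ)
      ≤ δ / 2 * U.card := by
    have h1 : U.filter (fun u => ¬ γ * U.card ≤ (cl (Q.filter (fun q => rel q u))).card) ⊆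
        (Q.powerset.filter (fun Z => ¬ γ * U.card ≤ (cl Z).card)).biUnion cl := by
      intro u hu
      rw [mem_filter] at hu
      rw [mem_biUnion]
      refine ⟨Q.filter (fun q => rel q u), ?_, ?_⟩
      · rw [mem_filter, mem_powerset]; exact ⟨filter_subset _ _, hu.2⟩
      · rw [hcl, mem_filter]; exact ⟨hu.1, rfl⟩
    refine le_trans (Nat.cast_le.2 ((card_le_card h1).trans card_biUnion_le)) ?_
    push_cast
    have h2 : ∑ Z ∈ Q.powerset.filter (fun Z => ¬ γ * U.card ≤ (cl Z).card), ((cl Z).card : ℝ) ≤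
        ∑ Z ∈ Q.powerset, γ * U.card := by
      refine le_trans (Finset.sum_le_sum (fun Z hZ => ?_))
        (Finset.sum_le_sum_of_subset_of_nonneg (filter_subset _ _) (fun _ _ _ => by positivity))
      rw [mem_filter] at hZ
      exact (not_le.1 hZ.2).le
    refine le_trans h2 ?_
    rw [sum_const, nsmul_eq_mul, card_powerset, hQc, hγ]
    push_cast
    apply le_of_eq
    field_simp
  have hsep' : ∀ q ∈ Q, ∀ q' ∈ Q, q ≠ q' →
      δ / 2 * U.card ≤ (U'.filter (fun u => ¬ (rel q u ↔ rel q' u))).card := by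
    intro q hq q' hq' hne
    have h1 := hsep q hq q' hq' hne
    have h2 : U.filter (fun u => ¬ (rel q u ↔ rel q' u)) ⊆
        U'.filter (fun u => ¬ (rel q u ↔ rel q' u)) ∪
        (U.filter (fun u => ¬ γ * U.card ≤ (cl (Q.filter (fun q => rel q u))).card)) := by
      intro u hu
      simp only [mem_filter, mem_union, hU'] at hu ⊢
      tauto
    have h3 : ((U.filter (fun u => ¬ (rel q u ↔ rel q' u))).card : ℝ) ≤ _ :=
      Nat.cast_le.2 ((card_le_card h2).trans (card_union_le _ _))
    push_cast at h3
    linarith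
  have hUc : (0:ℝ) < U.card := by exact_mod_cast hU.card_pos
  have hU'U : (U'.card : ℝ) ≤ U.card := by exact_mod_cast card_le_card (filter_subset _ _)
  have hU'n : U'.Nonempty := by
    obtain ⟨q, hq, q', hq', hne⟩ := Finset.one_lt_card.1 (show 1 < Q.card by omega)
    have h1 := hsep' q hq q' hq' hne
    have h2 : (0:ℝ) < (U'.filter (fun u => ¬ (rel q u ↔ rel q' u))).card :=
      lt_of_lt_of_le (by positivity) h1
    have h3 : 0 < (U'.filter (fun u => ¬ (rel q u ↔ rel q' u))).card := by exact_mod_cast h2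
    obtain ⟨u, hu⟩ := Finset.card_pos.1 h3
    exact ⟨u, (mem_filter.1 hu).1⟩
  obtain ⟨W, hWU, hWc, hWp⟩ := greedy (fun (p : α × α) u => ¬ (rel p.1 u ↔ rel p.2 u)) Q.offDiag U' hU'n
    (δ/2) (by positivity) (by linarith) (by
      intro p hp
      rw [mem_offDiag] at hp
      have h0 := hsep' p.1 hp.1 p.2 hp.2.1 hp.2.2
      refine le_trans ?_ (le_trans h0 (le_of_eq (by congr)))
      exact mul_le_mul_of_nonneg_left hU'U (by positivity)) N
  have hall : ∀ q ∈ Q, ∀ q' ∈ Q, q ≠ q' → ∃ w ∈ W, ¬ (rel q w ↔ rel q' w) := by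
    intro q hq q' hq' hne
    by_contra hcon
    push Not at hcon
    have hmem : (q, q') ∈ Q.offDiag.filter (fun p => ∀ w ∈ W, ¬ ¬ (rel p.1 w ↔ rel p.2 w)) := by
      simp only [mem_filter, mem_offDiag, not_not]
      exact ⟨⟨hq, hq', hne⟩, hcon⟩
    have h1 : 1 ≤ (Q.offDiag.filter (fun p => ∀ w ∈ W, ¬ ¬ (rel p.1 w ↔ rel p.2 w))).card :=
      Finset.card_pos.2 ⟨_, hmem⟩
    have h2 : (1:ℝ) ≤ (Q.offDiag.filter (fun p => ∀ w ∈ W, ¬ ¬ (rel p.1 w ↔ rel p.2 w))).card := by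
      exact_mod_cast h1
    have h3 : (Q.offDiag.card : ℝ) ≤ (M:ℝ) ^ 2 := by
      rw [offDiag_card, hQc]
      have : M * M - M ≤ M ^ 2 := by rw [sq]; omega
      exact_mod_cast this
    have h2' := h2.trans (le_trans (le_of_eq (by congr)) hWp)
    have h4 : (1 - δ / 2) ^ N * (Q.offDiag.card : ℝ) ≤ (1 - δ / 2) ^ N * (M:ℝ) ^ 2 :=
      mul_le_mul_of_nonneg_left h3 (pow_nonneg (by linarith) _)
    linarith
  set 𝒜 := Q.image (fun q => W.filter (fun w => rel q w)) with h𝒜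
  have h𝒜c : 𝒜.card = M := by
    rw [h𝒜, Finset.card_image_of_injOn, hQc]
    intro q hq q' hq' he
    by_contra hne
    obtain ⟨w, hw, hw2⟩ := hall q hq q' hq' hne
    apply hw2
    have := congrArg (w ∈ ·) he
    simpa [hw] using this
  obtain ⟨s, hsW, hsc, hs⟩ := sauer 𝒜 W (by
    intro A hA
    rw [h𝒜, mem_image] at hA
    obtain ⟨q, _, rfl⟩ := hA
    exact filter_subset _ _) d (by
    rw [h𝒜c, hM]
    have : (W.card + 1) ^ d ≤ (N + 1) ^ d := Nat.pow_le_pow_left (by omega) _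
    omega)
  have e : s ≃ (Fin r → Bool) := Fintype.equivOfCardEq (by simp [hsc, hd])
  have hq : ∀ i : Fin r, ∃ q ∈ Q, ∀ w : s, rel q w ↔ e w i = true := by
    intro i
    obtain ⟨u, hu, hsu⟩ := hs (t := (univ.filter (fun w : s => e w i = true)).map
      (Function.Embedding.subtype _)) (by
        intro x hx
        simp only [Finset.mem_map, mem_filter, mem_univ, true_and, Function.Embedding.subtype_apply] at hx
        obtain ⟨w, _, rfl⟩ := hx
        exact w.2)
    rw [h𝒜, mem_image] at hu
    obtain ⟨q, hq, rfl⟩ := hu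
    refine ⟨q, hq, fun w => ?_⟩
    have := congrArg ((w : β) ∈ ·) hsu
    simpa [hsW w.2] using this
  choose q hqQ hqr using hq
  have hqinj : Function.Injective q := by
    intro i j hij
    by_contra hne
    have h1 := hqr i (e.symm (fun k => decide (k = i)))
    have h2 := hqr j (e.symm (fun k => decide (k = i)))
    rw [hij] at h1
    rw [h1] at h2
    simp only [Equiv.apply_symm_apply, decide_true, true_iff, decide_eq_true_eq] at h2
    exact hne h2.symm
  refine ⟨univ.image q, ?_, ?_, ?_⟩
  · intro x hx
    simp only [mem_image, mem_univ, true_and] at hx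
    obtain ⟨i, rfl⟩ := hx
    exact hQQ0 (hqQ i)
  · rw [card_image_of_injective _ hqinj]; simp
  · intro Z _
    set w := e.symm (fun i => decide (q i ∈ Z)) with hw
    have hwU' : (w : β) ∈ U' := hWU (hsW w.2)
    rw [hU', mem_filter] at hwU'
    refine le_trans hwU'.2 ?_
    norm_cast
    apply card_le_card
    intro u hu
    simp only [hcl, mem_filter] at hu
    simp only [mem_filter, mem_image, mem_univ, true_and, forall_exists_index,
      forall_apply_eq_imp_iff]
    refine ⟨hu.1, fun i => ?_⟩
    have h1 := congrArg ((q i) ∈ ·) hu.2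
    simp only [mem_filter, hqQ i, true_and, eq_iff_iff] at h1
    rw [h1, hqr i w, hw]
    simp

end PL
end C6P
end Part5

section Part6
open SimpleGraph Filter
open scoped Classical
namespace C6P
open Finset

section TL

/-- number of vertices of `U` on which `x`, `y` disagree -/
noncomputable def dis {V : Type} (G : SimpleGraph V) (U : Finset V) (x y : V) : ℕ :=
  (U.filter (fun u => ¬ (G.Adj x u ↔ G.Adj y u))).card

def Gen {V : Type} (G : SimpleGraph V) (S T : Finset V) (γ : ℝ) : Prop :=
  ∀ S1 ⊆ S, ∀ S2 ⊆ S, Disjoint S1 S2 → ∀ T1 ⊆ T, ∀ T2 ⊆ T, Disjoint T1 T2 →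
    γ * S.card ≤ S1.card → γ * S.card ≤ S2.card → γ * T.card ≤ T1.card → γ * T.card ≤ T2.card →
    ∀ pat : Bool → Bool → Fin 2 → Fin 2 → Bool, ∃ s t : Fin 2 → V,
      s 0 ∈ S1 ∧ s 1 ∈ S2 ∧ t 0 ∈ T1 ∧ t 1 ∈ T2 ∧
      ∀ i j, G.Adj (s i) (t j) ↔ pat (decide (G.Adj (s 0) (s 1))) (decide (G.Adj (t 0) (t 1))) i j = true

lemma Gen.mono {V : Type} {G : SimpleGraph V} {S T : Finset V} {γ γ' : ℝ} (h : Gen G S T γ)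
    (hγ : γ ≤ γ') : Gen G S T γ' := by
  intro S1 h1 S2 h2 h3 T1 h4 T2 h5 h6 h7 h8 h9 h10 pat
  have e1 := mul_le_mul_of_nonneg_right hγ (Nat.cast_nonneg (α := ℝ) S.card)
  have e2 := mul_le_mul_of_nonneg_right hγ (Nat.cast_nonneg (α := ℝ) T.card)
  exact h S1 h1 S2 h2 h3 T1 h4 T2 h5 h6 (by linarith) (by linarith) (by linarith) (by linarith) pat

def tlσ (a b c : Bool) : Fin 6 → Fin 6 :=
  match a, b, c with
  | true, true, true => ![0,1,2,3,4,5]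
  | false, true, true => ![0,3,1,2,4,5]
  | true, false, true => ![1,2,0,3,4,5]
  | true, true, false => ![1,2,4,5,0,3]
  | true, false, false => ![0,1,2,4,3,5]
  | false, true, false => ![2,4,0,1,3,5]
  | false, false, true => ![2,4,3,5,0,1]
  | false, false, false => ![0,3,1,5,2,4]

lemma tlσ_spec : ∀ a b c : Bool, (∀ k, ∃ i, tlσ a b c i = k) ∧
    c6 (tlσ a b c 0) (tlσ a b c 1) = a ∧ c6 (tlσ a b c 2) (tlσ a b c 3) = b ∧
    c6 (tlσ a b c 4) (tlσ a b c 5) = c ∧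
    ∃ i : Fin 4, c6 (tlσ a b c 4) (tlσ a b c (i.castLE (by omega))) ≠
      c6 (tlσ a b c 5) (tlσ a b c (i.castLE (by omega))) := by
  decide

lemma c6_symm : ∀ i j, c6 i j = c6 j i := by decide
lemma c6_irr : ∀ i, c6 i i = false := by decide

/-- an arrangement `ψ` of the 6-cycle through surjection `σ` -/
lemma emb6 {V : Type*} {G : SimpleGraph V} (hG : C6F G) (σ : Fin 6 → Fin 6) (hσ : ∀ k, ∃ i, σ i = k)
    (ψ : Fin 6 → V) (h : ∀ i j, i < j → (G.Adj (ψ i) (ψ j) ↔ c6 (σ i) (σ j) = true)) : False := by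
  choose τ hτ using hσ
  apply hG (ψ ∘ τ)
  intro i j
  have key : ∀ a b, G.Adj (ψ a) (ψ b) ↔ c6 (σ a) (σ b) = true := by
    intro a b
    rcases lt_trichotomy a b with hab | rfl | hab
    · exact h a b hab
    · simp [c6_irr]
    · rw [G.adj_comm, h b a hab, c6_symm]
  simp only [Function.comp]
  rw [key, hτ, hτ]

lemma TL (δ : ℝ) (hδ : 0 < δ) (hδ1 : δ ≤ 1) : ∃ (M : ℕ) (γ : ℝ), 0 < γ ∧ γ ≤ 1 ∧
    ∀ {V : Type} (G : SimpleGraph V) (S T : Finset V), C6F G → S.Nonempty → T.Nonempty →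
    Gen G S T γ → ∀ Q : Finset V,
      (∀ q ∈ Q, ∀ q' ∈ Q, q ≠ q' → δ * S.card ≤ dis G S q q' ∧ δ * T.card ≤ dis G T q q') →
      Q.card < M := by
  obtain ⟨N, hN⟩ := ramsey 16
  obtain ⟨M2, γ2, hγ2, hγ2', h2⟩ := PL N δ hδ hδ1
  obtain ⟨M1, γ1, hγ1, hγ1', h1⟩ := PL M2 δ hδ hδ1
  refine ⟨M1, min γ1 γ2, lt_min hγ1 hγ2, (min_le_left _ _).trans hγ1', ?_⟩
  intro V G S T hG hS hT hgen Q hQ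
  by_contra hcon
  push Not at hcon
  obtain ⟨Q1, hQ1Q, hQ1c, hQ1⟩ := h1 (fun q u => G.Adj q u) Q S hS hcon
    (fun q hq q' hq' hne => le_trans (hQ q hq q' hq' hne).1 (le_of_eq (by unfold dis; congr)))
  obtain ⟨Q2, hQ21, hQ2c, hQ2⟩ := h2 (fun q u => G.Adj q u) Q1 T hT hQ1c.ge
    (fun q hq q' hq' hne => le_trans (hQ q (hQ1Q hq) q' (hQ1Q hq') hne).2
      (le_of_eq (by unfold dis; congr)))
  obtain ⟨Q3, hQ32, hQ3c, c, hc⟩ := hN G Q2 hQ2c.ge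
  have e : Q3 ≃ (Fin 4 → Bool) := Fintype.equivOfCardEq (by simp [hQ3c])
  set Z : Fin 4 → Finset V := fun i => (univ.filter (fun q : Q3 => e q i = true)).map
    (Function.Embedding.subtype _) with hZ
  have hZm : ∀ i (q : Q3), (q : V) ∈ Z i ↔ e q i = true := by
    intro i q
    simp [hZ]
  have hZs : ∀ i, Z i ⊆ Q3 := by
    intro i x hx
    simp only [hZ, Finset.mem_map, Function.Embedding.subtype_apply] at hx
    obtain ⟨w, _, rfl⟩ := hx
    exact w.2
  set cl : Finset V → Fin 4 → Finset V := fun U i =>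
    U.filter (fun u => ∀ q ∈ Q3, G.Adj q u ↔ q ∈ Z i) with hcl
  have hclS : ∀ i, γ1 * S.card ≤ (cl S i).card := by
    intro i
    refine (hQ1 (Z i) ((hZs i).trans (hQ32.trans hQ21))).trans ?_
    norm_cast
    apply card_le_card
    intro u hu
    simp only [hcl, mem_filter] at hu ⊢
    exact ⟨hu.1, fun q hq => hu.2 q (hQ21 (hQ32 hq))⟩
  have hclT : ∀ i, γ2 * T.card ≤ (cl T i).card := by
    intro i
    refine (hQ2 (Z i) ((hZs i).trans hQ32)).trans ?_
    norm_cast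
    apply card_le_card
    intro u hu
    simp only [hcl, mem_filter] at hu ⊢
    exact ⟨hu.1, fun q hq => hu.2 q (hQ32 hq)⟩
  have hdis : ∀ U i j, i ≠ j → Disjoint (cl U i) (cl U j) := by
    intro U i j hij
    rw [Finset.disjoint_left]
    intro u hu hu'
    simp only [hcl, mem_filter] at hu hu'
    have a1 := hu.2 (e.symm (fun k => decide (k = i))) (Subtype.coe_prop _)
    have a2 := hu'.2 (e.symm (fun k => decide (k = i))) (Subtype.coe_prop _)
    rw [a1, hZm, hZm] at a2
    simp at a2
    exact hij a2.symm
  have m1 := mul_le_mul_of_nonneg_right (min_le_left γ1 γ2) (Nat.cast_nonneg (α := ℝ) S.card)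
  have m2 := mul_le_mul_of_nonneg_right (min_le_right γ1 γ2) (Nat.cast_nonneg (α := ℝ) T.card)
  obtain ⟨s, t, hs0, hs1, ht0, ht1, hst⟩ := hgen (cl S 0) (filter_subset _ _) (cl S 1) (filter_subset _ _)
    (hdis S 0 1 (by decide)) (cl T 2) (filter_subset _ _) (cl T 3) (filter_subset _ _)
    (hdis T 2 3 (by decide)) (m1.trans (hclS 0)) (m1.trans (hclS 1)) (m2.trans (hclT 2))
    (m2.trans (hclT 3)) (fun a b i j => c6 (tlσ a b c (i.castLE (by omega)))
      (tlσ a b c (j.natAdd 2 |>.castLE (by omega))))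
  set a := decide (G.Adj (s 0) (s 1)) with ha
  set b := decide (G.Adj (t 0) (t 1)) with hb
  obtain ⟨k1, k2, k3, k4, i, hi⟩ := tlσ_spec a b c
  set y := e.symm (fun i => c6 (tlσ a b c 4) (tlσ a b c (i.castLE (by omega)))) with hy
  set y' := e.symm (fun i => c6 (tlσ a b c 5) (tlσ a b c (i.castLE (by omega)))) with hy'
  have hyy : (y : V) ≠ y' := by
    intro h
    have h' := Subtype.ext h
    rw [hy, hy', e.symm.injective.eq_iff] at h'
    exact hi (congrFun h' i)
  have adjS : ∀ (q : Q3) i U u, u ∈ cl U i → (G.Adj u q ↔ e q i = true) := by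
    intro q i U u hu
    simp only [hcl, mem_filter] at hu
    rw [G.adj_comm, hu.2 q q.2, hZm]
  have ya : ∀ i, e y i = c6 (tlσ a b c 4) (tlσ a b c (i.castLE (by omega))) := by
    intro i; rw [hy, Equiv.apply_symm_apply]
  have ya' : ∀ i, e y' i = c6 (tlσ a b c 5) (tlσ a b c (i.castLE (by omega))) := by
    intro i; rw [hy', Equiv.apply_symm_apply]
  refine emb6 hG (tlσ a b c) k1 ![s 0, s 1, t 0, t 1, y, y'] ?_
  have A0 := adjS y 0 _ _ hs0
  have A1 := adjS y 1 _ _ hs1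
  have A2 := adjS y 2 _ _ ht0
  have A3 := adjS y 3 _ _ ht1
  have B0 := adjS y' 0 _ _ hs0
  have B1 := adjS y' 1 _ _ hs1
  have B2 := adjS y' 2 _ _ ht0
  have B3 := adjS y' 3 _ _ ht1
  rw [ya, c6_symm] at A0 A1 A2 A3
  rw [ya', c6_symm] at B0 B1 B2 B3
  have C := hc y y.2 y' y'.2 hyy
  have D : G.Adj (s 0) (s 1) ↔ a = true := by simp [ha]
  have E : G.Adj (t 0) (t 1) ↔ b = true := by simp [hb]
  have F00 := hst 0 0
  have F01 := hst 0 1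
  have F10 := hst 1 0
  have F11 := hst 1 1
  rw [← k2] at D
  rw [← k3] at E
  rw [← k4] at C
  intro i j hij
  fin_cases i <;> fin_cases j <;> first
    | exact absurd hij (by decide)
    | assumption

end TL
end C6P
end Part6

section Part7
open SimpleGraph Filter
open scoped Classical
namespace C6P
open Finset

section infra

variable {V : Type}

lemma Bd.empty (E : Finset (V × V)) (x : ℝ) : Bd (∅ : Set (SimpleGraph V)) E x := by
  unfold Bd
  simp only [Set.image_empty, Set.ncard_empty, Nat.cast_zero]
  positivity

/-- label by trace on another cell set -/
lemma Bd.labT {𝒢 : Set (SimpleGraph V)} {E E0 : Finset (V × V)} {x : ℝ}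
    (h : ∀ H ∈ 𝒢, Bd {G | G ∈ 𝒢 ∧ tr E0 G = tr E0 H} E x) : Bd 𝒢 E (x + E0.card) := by
  refine Bd.lab (L := E0.powerset) (fun Z => {G | G ∈ 𝒢 ∧ tr E0 G = Z.1}) ?_ ?_ ?_
  · intro G hG
    exact ⟨⟨tr E0 G, mem_powerset.2 (tr_sub _ _)⟩, hG, rfl⟩
  · intro Z
    by_cases hne : ∃ H, H ∈ 𝒢 ∧ tr E0 H = Z.1
    · obtain ⟨H, hH, hHZ⟩ := hne
      have := h H hH
      rwa [hHZ] at this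
    · have : {G | G ∈ 𝒢 ∧ tr E0 G = Z.1} = ∅ := by
        ext G
        simp only [Set.mem_ofPred_eq, Set.mem_empty_iff_false, iff_false]
        exact fun hG => hne ⟨G, hG⟩
      rw [this]; exact Bd.empty _ _
  · rw [Fintype.card_coe, card_powerset, Real.rpow_natCast]
    push_cast; rfl

def Agr (X : Finset V) (G H : SimpleGraph V) : Prop :=
  ∀ a b, (a ∈ X ↔ b ∈ X) → (G.Adj a b ↔ H.Adj a b)

lemma AA.of_dpg {P : ∀ n, SimpleGraph (Fin n) → Prop}
    (h : ∃ n0 : ℕ, ∀ n ≥ n0, ∃ (k : ℕ) (L : Type) (_ : Fintype L)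
      (R : (Fin k → Fin n) → L → SimpleGraph (Fin n) → Prop) (x y : ℝ),
      1 ≤ k ∧ k ≤ n ∧ (Fintype.card L : ℝ) ≤ 2 ^ y ∧
      x + y + 3 * (k:ℝ) ^ 2 + 1 + (2 * k + 1) * Real.logb 2 n ≤ k * n / 2 ∧
      (∀ G, C6F G → ¬ P n G → ∃ u, Function.Injective u ∧ ∃ l, R u l G) ∧
      (∀ u, Function.Injective u → ∀ l H, Bd {G | C6F G ∧ R u l G ∧ Agr (univ.image u) G H}
        (univ.image u ×ˢ (univ.image u)ᶜ) x)) : AA P := by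
  obtain ⟨n0, h⟩ := h
  apply AA.of_dp
  refine ⟨n0 + 1, fun n hn => ?_⟩
  obtain ⟨k, L, _, R, x, y, hk, hkn, hL, hx, hbad, hfib⟩ := h n (by omega)
  refine ⟨k, fun X G => ∃ u, (Function.Injective u ∧ univ.image u = X) ∧ ∃ l, R u l G,
    ((x + (k * k : ℕ)) + (k*k:ℕ)) + y + k * Real.logb 2 n, hk, hkn, ?_, ?_, ?_⟩
  · push_cast
    nlinarith
  · intro G hG hP
    obtain ⟨u, hu, l, hl⟩ := hbad G hG hP
    refine ⟨univ.image u, by rw [card_image_of_injective _ hu]; simp, u, ⟨hu, rfl⟩, l, hl⟩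
  · intro X hX H0
    have hn1 : (0:ℝ) < n := by exact_mod_cast (by omega : 0 < n)
    refine Bd.lab (L := Fin k → Fin n) (fun u => {G | C6F G ∧ (Function.Injective u ∧ univ.image u = X) ∧
      (∃ l, R u l G) ∧ out X G = H0}) ?_ ?_ ?_
    · rintro G ⟨h1, ⟨u, h2, h3⟩, h4⟩
      exact ⟨u, h1, h2, h3, h4⟩
    rotate_left
    · rw [mul_comm, Real.rpow_mul (by norm_num), Real.rpow_logb (by norm_num) (by norm_num) hn1]
      simp
    intro u
    refine Bd.lab (L := L) (fun l => {G | C6F G ∧ (Function.Injective u ∧ univ.image u = X) ∧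
      (R u l G) ∧ out X G = H0}) ?_ ?_ hL
    · rintro G ⟨h1, h2, ⟨l, h3⟩, h4⟩
      exact ⟨l, h1, h2, h3, h4⟩
    intro l
    have hXX : (X ×ˢ X).card = k * k := by rw [card_product, hX]
    rw [← hXX]
    apply Bd.labT
    rintro H ⟨hH1, ⟨hH2, hH3⟩, hH4, hH5⟩
    have hE : X ×ˢ (univ : Finset (Fin n)) = (X ×ˢ Xᶜ) ∪ (X ×ˢ X) := by
      rw [← Finset.product_union, Finset.union_comm, Finset.union_compl]
    rw [hE]
    refine Bd.union ?_ (Bd.triv _ _)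
    have := hfib u hH2 l H
    rw [hH3] at this
    refine this.mono_set ?_
    rintro G ⟨⟨hG1, -, hG3, hG4⟩, hG5⟩
    refine ⟨hG1, hG3, ?_⟩
    intro a b hab
    by_cases ha : a ∈ X
    · have hb := hab.1 ha
      have := congrArg ((a, b) ∈ ·) hG5
      simpa [mem_tr, ha, hb] using this
    · have hb : b ∉ X := fun hb => ha (hab.2 hb)
      rw [out_adj hG4 ha hb, out_adj hH5 ha hb]

/-- constant size version -/
lemma AA.of_dpc {P : ∀ n, SimpleGraph (Fin n) → Prop} (k b : ℕ) (L : Type) [Fintype L]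
    (hk : 1 ≤ k) (ε : ℝ) (hε : 0 < ε)
    (R : ∀ n, (Fin k → Fin n) → (Fin b → Finset (Fin n)) → L → SimpleGraph (Fin n) → Prop)
    (h : ∃ n0 : ℕ, ∀ n ≥ n0,
      (∀ G, C6F G → ¬ P n G → ∃ u, Function.Injective u ∧ ∃ s l, R n u s l G) ∧
      (∀ u, Function.Injective u → ∀ s l H, Bd {G | C6F G ∧ R n u s l G ∧ Agr (univ.image u) G H}
        (univ.image u ×ˢ (univ.image u)ᶜ) ((k / 2 - b - ε) * n))) : AA P := by
  obtain ⟨n0, h⟩ := h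
  obtain ⟨n1, h1⟩ := log_small ε hε (Fintype.card L + 3 * (k:ℝ) ^ 2 + 1 + (2 * k + 1))
  apply AA.of_dpg
  refine ⟨n0 + n1 + k + 1, fun n hn => ?_⟩
  obtain ⟨hb, hf⟩ := h n (by omega)
  refine ⟨k, (Fin b → Finset (Fin n)) × L, inferInstance, fun u l G => R n u l.1 l.2 G,
    (k / 2 - b - ε) * n, b * n + Fintype.card L, hk, by omega, ?_, ?_, ?_, ?_⟩
  · rw [Fintype.card_prod, Nat.cast_mul, Real.rpow_add (by norm_num)]
    refine mul_le_mul (le_of_eq ?_) ?_ (Nat.cast_nonneg _) (by positivity)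
    · rw [Fintype.card_fun, Fintype.card_finset]
      simp only [Fintype.card_fin]
      push_cast
      rw [← pow_mul, mul_comm n b, ← Real.rpow_natCast]; push_cast; rfl
    · rw [Real.rpow_natCast]
      exact_mod_cast Nat.lt_two_pow_self.le
  · have h2 := h1 n (by omega)
    have h3 : 0 ≤ Real.logb 2 n := Real.logb_nonneg (by norm_num) (by exact_mod_cast (by omega : 1 ≤ n))
    have h4 : 0 ≤ (Fintype.card L : ℝ) * Real.logb 2 n := by positivity
    have h5 : 0 ≤ (k:ℝ)^2 * Real.logb 2 n := by positivity
    nlinarith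
  · intro G hG hP
    obtain ⟨u, hu, s, l, hR⟩ := hb G hG hP
    exact ⟨u, hu, (s, l), hR⟩
  · intro u hu l H
    exact hf u hu l.1 l.2 H

lemma Bd.avoids {𝒢 : Set (SimpleGraph V)} {E : Finset (V × V)} {K : Type*} (s : Finset K)
    (B : K → Finset (V × V)) (c : ℕ) (hB : ∀ k ∈ s, B k ⊆ E) (hc : ∀ k ∈ s, (B k).card ≤ c)
    (hd : ∀ k ∈ s, ∀ k' ∈ s, k ≠ k' → Disjoint (B k) (B k'))
    (h : ∀ k ∈ s, ∃ Z ⊆ B k, ∀ G ∈ 𝒢, tr (B k) G ≠ Z) : Bd 𝒢 E (E.card - s.card * (1 / 2 ^ c)) := by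
  have h1 : Bd 𝒢 (s.biUnion B) (∑ k ∈ s, (((B k).card : ℝ) - 1 / 2 ^ c)) := by
    apply Bd.biUnion
    intro k hk
    obtain ⟨Z, hZ, h2⟩ := h k hk
    exact Bd.avoid (hc k hk) hZ h2
  have hsub : s.biUnion B ⊆ E := by
    intro x hx
    rw [mem_biUnion] at hx
    obtain ⟨k, hk, hx⟩ := hx
    exact hB k hk hx
  have h2 := h1.union (Bd.triv 𝒢 (E \ s.biUnion B))
  rw [Finset.union_sdiff_of_subset hsub] at h2
  refine h2.mono (le_of_eq ?_)
  rw [Finset.sum_sub_distrib, sum_const, nsmul_eq_mul]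
  have h3 : (s.biUnion B).card = ∑ k ∈ s, (B k).card := Finset.card_biUnion hd
  have h4 := Finset.card_sdiff_add_card_eq_card hsub
  have h5 : ((E \ s.biUnion B).card : ℝ) + (s.biUnion B).card = E.card := by exact_mod_cast h4
  rw [h3] at h5
  push_cast at h5
  linarith

/-- product blocks -/
lemma Bd.blocks {𝒢 : Set (SimpleGraph V)} {X Y : Finset V} {N m : ℕ} (p : Fin N → Finset V)
    (q : Fin m → Finset V) (c : ℕ)
    (hp : ∀ i, p i ⊆ X) (hq : ∀ j, q j ⊆ Y)
    (hpd : ∀ i i', i ≠ i' → Disjoint (p i) (p i')) (hqd : ∀ i i', i ≠ i' → Disjoint (q i) (q i'))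
    (hc : ∀ i j, (p i).card * (q j).card ≤ c)
    (h : ∀ i j, ∃ Z ⊆ p i ×ˢ q j, ∀ G ∈ 𝒢, tr (p i ×ˢ q j) G ≠ Z) :
    Bd 𝒢 (X ×ˢ Y) (X.card * Y.card - N * m * (1 / 2 ^ c)) := by
  have := Bd.avoids (𝒢 := 𝒢) (E := X ×ˢ Y) (univ : Finset (Fin N × Fin m))
    (fun k => p k.1 ×ˢ q k.2) c (fun k _ => Finset.product_subset_product (hp _) (hq _))
    (fun k _ => by rw [card_product]; exact hc _ _)
    (by
      rintro ⟨i, j⟩ - ⟨i', j'⟩ - hne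
      rw [Finset.disjoint_product]
      by_cases hi : i = i'
      · right
        apply hqd
        rintro rfl; exact hne (by rw [hi])
      · left; exact hpd _ _ hi)
    (fun k _ => h k.1 k.2)
  simpa [card_product] using this

lemma two_inj {A B : Finset V} {m : ℕ} (hA : m ≤ A.card) (hB : m ≤ B.card) :
    ∃ a b : Fin m → V, Function.Injective a ∧ Function.Injective b ∧ (∀ i, a i ∈ A) ∧ (∀ i, b i ∈ B) := by
  have key : ∀ A : Finset V, m ≤ A.card → ∃ a : Fin m → V, Function.Injective a ∧ ∀ i, a i ∈ A := by
    intro A hA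
    obtain ⟨A', hA', hc⟩ := Finset.exists_subset_card_eq hA
    refine ⟨fun i => (A'.equivFinOfCardEq hc).symm i, ?_, fun i => hA' (Subtype.coe_prop _)⟩
    intro i j hij
    exact (A'.equivFinOfCardEq hc).symm.injective (Subtype.ext hij)
  obtain ⟨a, h1, h2⟩ := key A hA
  obtain ⟨b, h3, h4⟩ := key B hB
  exact ⟨a, b, h1, h3, h2, h4⟩

lemma genBlock {𝒢 : Set (SimpleGraph V)} (H : SimpleGraph V) {X Y X1 X2 Y1 Y2 : Finset V} {m1 m2 : ℕ}
    (hX1 : X1 ⊆ X) (hX2 : X2 ⊆ X) (hXd : Disjoint X1 X2) (hY1 : Y1 ⊆ Y) (hY2 : Y2 ⊆ Y)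
    (hYd : Disjoint Y1 Y2) (hx1 : m1 ≤ X1.card) (hx2 : m1 ≤ X2.card) (hy1 : m2 ≤ Y1.card)
    (hy2 : m2 ≤ Y2.card) (pat : Bool → Bool → Fin 2 → Fin 2 → Bool)
    (h : ∀ G ∈ 𝒢, ∀ s t : Fin 2 → V, s 0 ∈ X1 → s 1 ∈ X2 → t 0 ∈ Y1 → t 1 ∈ Y2 →
      ¬ ∀ i j, G.Adj (s i) (t j) ↔
        pat (decide (H.Adj (s 0) (s 1))) (decide (H.Adj (t 0) (t 1))) i j = true) :
    Bd 𝒢 (X ×ˢ Y) (X.card * Y.card - m1 * m2 * (1 / 2 ^ 4)) := by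
  obtain ⟨a, b, ha, hb, haX, hbX⟩ := two_inj hx1 hx2
  obtain ⟨c, d, hc, hd, hcY, hdY⟩ := two_inj hy1 hy2
  rw [Finset.disjoint_left] at hXd hYd
  have hab : ∀ i j, a i ≠ b j := fun i j he => hXd (haX i) (he ▸ hbX j)
  have hcd : ∀ i j, c i ≠ d j := fun i j he => hYd (hcY i) (he ▸ hdY j)
  refine Bd.blocks (fun i => {a i, b i}) (fun j => {c j, d j}) 4 ?_ ?_ ?_ ?_ ?_ ?_
  · intro i x hx
    simp only [mem_insert, mem_singleton] at hx
    rcases hx with rfl | rfl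
    · exact hX1 (haX i)
    · exact hX2 (hbX i)
  · intro i x hx
    simp only [mem_insert, mem_singleton] at hx
    rcases hx with rfl | rfl
    · exact hY1 (hcY i)
    · exact hY2 (hdY i)
  · intro i j hij
    simp [ha.eq_iff, hb.eq_iff, hab, hij.symm, fun i j => (hab i j).symm]
  · intro i j hij
    simp [hc.eq_iff, hd.eq_iff, hcd, hij.symm, fun i j => (hcd i j).symm]
  · intro i j
    have h1 : ({a i, b i} : Finset V).card ≤ 2 := card_le_two
    have h2 : ({c j, d j} : Finset V).card ≤ 2 := card_le_two
    calc _ ≤ 2 * 2 := Nat.mul_le_mul h1 h2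
      _ = 4 := rfl
  · intro i j
    set p := pat (decide (H.Adj (a i) (b i))) (decide (H.Adj (c j) (d j))) with hp
    refine ⟨(({a i, b i} : Finset V) ×ˢ ({c j, d j} : Finset V)).filter (fun z =>
      p (if z.1 = a i then 0 else 1) (if z.2 = c j then 0 else 1) = true), filter_subset _ _, ?_⟩
    intro G hG htr
    apply h G hG ![a i, b i] ![c j, d j] (haX i) (hbX i) (hcY j) (hdY j)
    intro i' j'
    have hz : (![a i, b i] i', ![c j, d j] j') ∈ ({a i, b i} : Finset V) ×ˢ ({c j, d j} : Finset V) := by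
      fin_cases i' <;> fin_cases j' <;> simp
    have h3 := congrArg ((![a i, b i] i', ![c j, d j] j') ∈ ·) htr
    simp only [mem_tr, mem_filter, hz, true_and, eq_iff_iff] at h3
    rw [h3]
    have e1 : (if ![a i, b i] i' = a i then (0:Fin 2) else 1) = i' := by
      fin_cases i' <;> simp [(hab i i).symm]
    have e2 : (if ![c j, d j] j' = c j then (0:Fin 2) else 1) = j' := by
      fin_cases j' <;> simp [(hcd j j).symm]
    rw [e1, e2, hp]
    simp

lemma Gen.symm {G : SimpleGraph V} {S T : Finset V} {γ : ℝ} (h : Gen G S T γ) : Gen G T S γ := by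
  intro T1 h1 T2 h2 h3 S1 h4 S2 h5 h6 h7 h8 h9 h10 pat
  obtain ⟨s, t, a1, a2, a3, a4, a5⟩ := h S1 h4 S2 h5 h6 T1 h1 T2 h2 h3 h9 h10 h7 h8
    (fun a b i j => pat b a j i)
  exact ⟨t, s, a3, a4, a1, a2, fun i j => by rw [G.adj_comm]; exact a5 j i⟩

end infra
end C6P
end Part7

section Part8
open SimpleGraph Filter
open scoped Classical
namespace C6P
open Finset

section steps

def BallB (h δ : ℝ) : Prop := ∀ {α : Type} (E : Finset α) (N d : ℝ),
    (E.card : ℝ) ≤ N → d ≤ δ * N → ((ball E d).card : ℝ) ≤ 2 ^ (h * N)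

variable {V : Type}

lemma Bd.near1 {𝒢 : Set (SimpleGraph V)} {E : Finset (V × V)} {h δ N : ℝ} (hb : BallB h δ)
    (pr : V × V → V) {M : ℕ} (hM : 1 ≤ M) (R : Fin M → Finset V) (hE : (E.card : ℝ) ≤ N)
    (hn : ∀ G ∈ 𝒢, ∃ i, ((E.filter (fun z => ¬ (G.Adj z.1 z.2 ↔ pr z ∈ R i))).card : ℝ) ≤ δ * N) :
    Bd 𝒢 E (h * N + Real.logb 2 M) := by
  refine Bd.ball (d := δ * N) (univ.image (fun i => E.filter (fun z => pr z ∈ R i))) ?_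
    (hb E N _ hE le_rfl) ?_
  · intro G hG
    obtain ⟨i, hi⟩ := hn G hG
    refine ⟨_, mem_image_of_mem _ (mem_univ i), le_trans (Nat.cast_le.2 (card_le_card ?_)) hi⟩
    intro z hz
    simp only [mem_symmDiff, mem_tr, mem_filter] at hz ⊢
    tauto
  · rw [Real.rpow_logb (by norm_num) (by norm_num) (by exact_mod_cast hM)]
    have : (univ.image (fun i => E.filter (fun z => pr z ∈ R i))).card ≤ M := by
      refine card_image_le.trans (by simp)
    exact_mod_cast this

lemma Bd.nearcol {𝒢 : Set (SimpleGraph V)} {X U : Finset V} {h δ N : ℝ} (hb : BallB h δ)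
    {M : ℕ} (hM : 1 ≤ M) (R : Fin M → Finset V) (hX : (X.card : ℝ) ≤ N)
    (hn : ∀ G ∈ 𝒢, ∀ u ∈ U, ∃ i, ((X.filter (fun x => ¬ (G.Adj x u ↔ x ∈ R i))).card : ℝ) ≤ δ * N) :
    Bd 𝒢 (X ×ˢ U) (U.card * (h * N + Real.logb 2 M)) := by
  have hE : X ×ˢ U = U.biUnion (fun u => X ×ˢ {u}) := by
    ext ⟨a, b⟩; simp [and_comm]
  rw [hE]
  apply Bd.biUnion_const
  intro u hu
  refine Bd.near1 hb (fun z => z.1) hM R (by simpa using hX) ?_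
  intro G hG
  obtain ⟨i, hi⟩ := hn G hG u hu
  refine ⟨i, le_trans (Nat.cast_le.2 ?_) hi⟩
  apply Finset.card_le_card_of_injOn (fun z => z.1)
  · rintro ⟨a, b⟩ hz
    simp only [coe_filter, mem_product, mem_singleton, Set.mem_ofPred_eq] at hz ⊢
    obtain ⟨⟨h1, rfl⟩, h2⟩ := hz
    exact ⟨h1, h2⟩
  · rintro ⟨a, b⟩ hz ⟨a', b'⟩ hz' he
    simp only [coe_filter, mem_product, mem_singleton, Set.mem_ofPred_eq] at hz hz' he
    rw [he, hz.1.2, hz'.1.2]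

lemma Bd.nearrow {𝒢 : Set (SimpleGraph V)} {X U : Finset V} {h δ N : ℝ} (hb : BallB h δ)
    {M : ℕ} (hM : 1 ≤ M) (R : Fin M → Finset V) (hU : (U.card : ℝ) ≤ N)
    (hn : ∀ G ∈ 𝒢, ∀ x ∈ X, ∃ i, ((U.filter (fun u => ¬ (G.Adj x u ↔ u ∈ R i))).card : ℝ) ≤ δ * N) :
    Bd 𝒢 (X ×ˢ U) (X.card * (h * N + Real.logb 2 M)) := by
  have hE : X ×ˢ U = X.biUnion (fun x => {x} ×ˢ U) := by
    ext ⟨a, b⟩; simp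
  rw [hE]
  apply Bd.biUnion_const
  intro x hx
  refine Bd.near1 hb (fun z => z.2) hM R (by simpa using hU) ?_
  intro G hG
  obtain ⟨i, hi⟩ := hn G hG x hx
  refine ⟨i, le_trans (Nat.cast_le.2 ?_) hi⟩
  apply Finset.card_le_card_of_injOn (fun z => z.2)
  · rintro ⟨a, b⟩ hz
    simp only [coe_filter, mem_product, mem_singleton, Set.mem_ofPred_eq] at hz ⊢
    obtain ⟨⟨rfl, h1⟩, h2⟩ := hz
    exact ⟨h1, h2⟩
  · rintro ⟨a, b⟩ hz ⟨a', b'⟩ hz' he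
    simp only [coe_filter, mem_product, mem_singleton, Set.mem_ofPred_eq] at hz hz' he
    rw [he, hz.1.1, hz'.1.1]

lemma ball_bound' (h : ℝ) (hh : 0 < h) : ∃ δ : ℝ, 0 < δ ∧ δ ≤ 1 ∧ BallB h δ := ball_bound h hh

lemma dis_self (G : SimpleGraph V) (U : Finset V) (x : V) : dis G U x x = 0 := by
  simp [dis]

lemma dis_comm (G : SimpleGraph V) (U : Finset V) (x y : V) : dis G U x y = dis G U y x := by
  unfold dis; congr 1; ext u; simp only [mem_filter]; tauto

lemma dis_tri (G : SimpleGraph V) (U : Finset V) (x y z : V) :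
    dis G U x z ≤ dis G U x y + dis G U y z := by
  unfold dis
  refine (card_le_card ?_).trans (card_union_le _ _)
  intro u; simp only [mem_filter, mem_union]; tauto

lemma dis_mono (G : SimpleGraph V) {U U' : Finset V} (h : U ⊆ U') (x y : V) :
    dis G U x y ≤ dis G U' x y := by
  unfold dis
  exact card_le_card (filter_subset_filter _ h)

lemma dis_union (G : SimpleGraph V) (U U' : Finset V) (x y : V) :
    dis G (U ∪ U') x y ≤ dis G U x y + dis G U' x y := by
  unfold dis
  rw [filter_union]; exact card_union_le _ _

lemma dis_le (G : SimpleGraph V) (U : Finset V) (x y : V) : dis G U x y ≤ U.card :=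
  card_filter_le _ _

lemma exists_maxfin (U : Finset V) (Pr : Finset V → Prop) (h0 : Pr ∅) :
    ∃ Q ⊆ U, Pr Q ∧ ∀ Q' ⊆ U, Pr Q' → Q'.card ≤ Q.card := by
  obtain ⟨Q, hQ, hmax⟩ := Finset.exists_max_image (U.powerset.filter Pr) Finset.card ⟨∅, by simp [h0]⟩
  rw [mem_filter, mem_powerset] at hQ
  exact ⟨Q, hQ.1, hQ.2, fun Q' h1 h2 => hmax Q' (by rw [mem_filter, mem_powerset]; exact ⟨h1, h2⟩)⟩

lemma TLmax (δ : ℝ) (hδ : 0 < δ) (hδ1 : δ ≤ 1) : ∃ (M : ℕ) (γ : ℝ), 0 < γ ∧ γ ≤ 1 ∧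
    ∀ {V : Type} (G : SimpleGraph V) (S T : Finset V), C6F G → S.Nonempty → T.Nonempty →
    Gen G S T γ → ∀ U : Finset V, ∃ Q ⊆ U, Q.card < M ∧
      ∀ v ∈ U, ∃ q ∈ Q, (dis G S v q : ℝ) < δ * S.card ∨ (dis G T v q : ℝ) < δ * T.card := by
  obtain ⟨M, γ, h1, h2, h3⟩ := TL δ hδ hδ1
  refine ⟨M, γ, h1, h2, ?_⟩
  intro V G S T hG hS hT hgen U
  obtain ⟨Q, hQ1, hQ2, hmax⟩ := exists_maxfin U (fun Q => ∀ q ∈ Q, ∀ q' ∈ Q, q ≠ q' →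
    δ * S.card ≤ dis G S q q' ∧ δ * T.card ≤ dis G T q q') (by simp)
  refine ⟨Q, hQ1, h3 G S T hG hS hT hgen Q hQ2, ?_⟩
  intro v hv
  by_contra hcon
  push Not at hcon
  have hvQ : v ∉ Q := by
    intro hvQ
    have := (hcon v hvQ).1
    rw [dis_self] at this
    have h5 : (0:ℝ) < S.card := by exact_mod_cast hS.card_pos
    have : 0 < δ * S.card := by positivity
    push_cast at *
    linarith
  have h4 := hmax (insert v Q) (insert_subset hv hQ1) (by
    intro q hq q' hq' hne
    rcases mem_insert.1 hq with e1 | e1 <;> rcases mem_insert.1 hq' with e2 | e2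
    · exact absurd (e1.trans e2.symm) hne
    · subst e1; exact hcon q' e2
    · subst e2; rw [dis_comm G S, dis_comm G T]; exact hcon q e1
    · exact hQ2 q e1 q' e2 hne)
  rw [card_insert_of_notMem hvQ] at h4
  omega

/-- step 1: some m-set is shattered -/
lemma AA1 (m : ℕ) : AA (fun n G => ∃ D : Finset (Fin n), D.card = m ∧ ∀ Z ⊆ D, ∃ v,
    ∀ d ∈ D, G.Adj v d ↔ d ∈ Z) := by
  obtain ⟨b, hb1, hb⟩ : ∃ b : ℕ, 1 ≤ b ∧ m * Real.logb 2 (b + 1) ≤ b / 4 := by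
    obtain ⟨n0, h⟩ := log_small (1/8) (by norm_num) m
    refine ⟨n0 + 1, by omega, ?_⟩
    have h1 := h (n0 + 1 + 1) (by omega)
    push_cast at h1 ⊢
    have : (0:ℝ) ≤ m := Nat.cast_nonneg _
    have : (0:ℝ) ≤ n0 := Nat.cast_nonneg _
    linarith
  refine AA.of_dpc b 0 (Finset (Finset (Fin b))) hb1 (1/4 * b) (by positivity)
    (fun n u _ l G => l.card ≤ (b+1)^m ∧ ∀ v, univ.filter (fun i => G.Adj (u i) v) ∈ l) ?_
  refine ⟨b, fun n hn => ⟨?_, ?_⟩⟩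
  · intro G hG hP
    refine ⟨Fin.castLE hn, Fin.castLE_injective hn, fun _ => ∅, 
      univ.image (fun v => univ.filter (fun i => G.Adj (Fin.castLE hn i) v)), ?_, ?_⟩
    · by_contra hcon
      push Not at hcon
      apply hP
      obtain ⟨s, -, hsc, hs⟩ := sauer _ (univ : Finset (Fin b)) (by simp) m (by simpa using hcon)
      refine ⟨s.map (Fin.castLEEmb hn), by simp [hsc], ?_⟩
      intro Z hZ
      obtain ⟨t, ht, hst⟩ := hs (t := s.filter (fun i => Fin.castLE hn i ∈ Z)) (filter_subset _ _)
      rw [mem_image] at ht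
      obtain ⟨v, -, rfl⟩ := ht
      refine ⟨v, ?_⟩
      intro d hd
      rw [Finset.mem_map] at hd
      obtain ⟨i, hi, rfl⟩ := hd
      have := congrArg (i ∈ ·) hst
      simp only [mem_inter, mem_filter, hi, mem_univ, true_and, eq_iff_iff] at this
      rw [G.adj_comm]
      exact this
    · intro v; exact mem_image_of_mem _ (mem_univ v)
  · intro u hu s l H
    set X := univ.image u with hX
    by_cases hl : l.card ≤ (b+1)^m
    swap
    · have : {G | C6F G ∧ (l.card ≤ (b+1)^m ∧ ∀ v, univ.filter (fun i => G.Adj (u i) v) ∈ l) ∧ Agr X G H} = ∅ := by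
        ext G; simp [hl]
      rw [this]; exact Bd.empty _ _
    have h1 : ∀ v ∈ Xᶜ, Bd {G | C6F G ∧ (l.card ≤ (b+1)^m ∧ ∀ v, univ.filter (fun i => G.Adj (u i) v) ∈ l) ∧ Agr X G H}
        (X ×ˢ {v}) (m * Real.logb 2 (b+1)) := by
      intro v _
      refine Bd.code (l.image (fun A => A.image (fun i => (u i, v)))) ?_ ?_
      · rintro G ⟨-, ⟨-, h⟩, -⟩
        rw [mem_image]
        refine ⟨_, h v, ?_⟩
        ext ⟨a, c⟩
        simp only [mem_image, mem_filter, mem_univ, true_and, mem_tr, mem_product, mem_singleton, hX,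
          Prod.mk.injEq]
        constructor
        · rintro ⟨i, hi, rfl, rfl⟩; exact ⟨⟨⟨i, rfl⟩, rfl⟩, hi⟩
        · rintro ⟨⟨⟨i, rfl⟩, rfl⟩, hi⟩; exact ⟨i, hi, rfl, rfl⟩
      · rw [mul_comm, Real.rpow_mul (by norm_num), Real.rpow_logb (by norm_num) (by norm_num) (by positivity)]
        rw [Real.rpow_natCast]
        have h9 : (l.image (fun A => A.image (fun i => (u i, v)))).card ≤ (b+1)^m :=
          card_image_le.trans hl
        exact_mod_cast h9
    have hE : X ×ˢ Xᶜ = Xᶜ.biUnion (fun v => X ×ˢ {v}) := by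
      ext ⟨a, c⟩; simp only [mem_biUnion, mem_product, mem_singleton]
      constructor
      · rintro ⟨h1, h2⟩; exact ⟨c, h2, h1, rfl⟩
      · rintro ⟨v, h2, h1, rfl⟩; exact ⟨h1, h2⟩
    rw [hE]
    have h2 := Bd.biUnion_const (𝒢 := {G | C6F G ∧ (l.card ≤ (b+1)^m ∧
      ∀ v, univ.filter (fun i => G.Adj (u i) v) ∈ l) ∧ Agr X G H}) Xᶜ (fun v => X ×ˢ ({v} : Finset (Fin n)))
      (m * Real.logb 2 (b+1)) h1
    refine h2.mono ?_
    have h3 : (Xᶜ.card : ℝ) ≤ n := by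
      have := card_le_univ Xᶜ
      simp only [Fintype.card_fin] at this
      exact_mod_cast this
    have h4 : 0 ≤ Real.logb 2 ((b:ℝ)+1) :=
      Real.logb_nonneg (by norm_num) (by linarith [Nat.cast_nonneg (α := ℝ) b])
    have h5 : 0 ≤ (m:ℝ) * Real.logb 2 ((b:ℝ)+1) := mul_nonneg (Nat.cast_nonneg _) h4
    have h6 := mul_le_mul_of_nonneg_right h3 h5
    have h7 := mul_le_mul_of_nonneg_left hb (Nat.cast_nonneg (α := ℝ) n)
    refine h6.trans (h7.trans (le_of_eq ?_))
    push_cast; ring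

/-- step 2: an arbitrary matrix between homogeneous sets -/
lemma AA2 (t : ℕ) (P : Fin t → Fin t → Bool) : AA (fun n G => ∃ A B : Fin t → Fin n,
    Function.Injective A ∧ Function.Injective B ∧ (∀ i j, G.Adj (A i) (B j) ↔ P i j = true) ∧
    (∃ c : Bool, ∀ i j, i ≠ j → (G.Adj (A i) (A j) ↔ c = true)) ∧
    (∃ c : Bool, ∀ i j, i ≠ j → (G.Adj (B i) (B j) ↔ c = true))) := by
  obtain ⟨N, hN⟩ := ramsey (t + t)
  obtain ⟨m, hm⟩ := ramsey (2 ^ N)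
  refine (AA1 m).mono ⟨0, fun n _ G hG => ?_⟩
  rintro ⟨D, hDc, hD⟩
  obtain ⟨D', hD'D, hD'c, cB, hcB⟩ := hm G D hDc.ge
  have e : D' ≃ (Fin N → Bool) := Fintype.equivOfCardEq (by simp [hD'c])
  have hv : ∀ i : Fin N, ∃ v, ∀ d : D', G.Adj v d ↔ e d i = true := by
    intro i
    obtain ⟨v, hv⟩ := hD ((univ.filter (fun d : D' => e d i = true)).map (Function.Embedding.subtype _)) (by
      intro x hx
      simp only [Finset.mem_map, Function.Embedding.subtype_apply] at hx
      obtain ⟨w, _, rfl⟩ := hx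
      exact hD'D w.2)
    refine ⟨v, fun d => ?_⟩
    rw [hv d (hD'D d.2)]
    simp
  choose v hv using hv
  have hvi : Function.Injective v := by
    intro i j hij
    by_contra hne
    have h1 := hv i (e.symm (fun k => decide (k = i)))
    have h2 := hv j (e.symm (fun k => decide (k = i)))
    rw [hij] at h1
    rw [h1] at h2
    simp only [Equiv.apply_symm_apply, decide_true, true_iff, decide_eq_true_eq] at h2
    exact hne h2.symm
  obtain ⟨A', hA', hA'c, cA, hcA⟩ := hN G (univ.image v) (by rw [card_image_of_injective _ hvi]; simp)
  have ea : A' ≃ Fin t ⊕ Fin t := Fintype.equivOfCardEq (by simp [hA'c])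
  have hι : ∀ x : Fin t ⊕ Fin t, ∃ i, v i = ea.symm x := by
    intro x
    have := hA' (ea.symm x).2
    simpa using this
  choose ι hι using hι
  have hιi : Function.Injective ι := by
    intro x y hxy
    have h1 := hι x
    rw [hxy, hι y] at h1
    exact (ea.symm.injective (Subtype.ext h1)).symm
  have hB : ∀ j : Fin t, ∃ d : D', (∀ i, e d (ι (.inl i)) = P i j) ∧ (∀ i, e d (ι (.inr i)) = decide (i = j)) := by
    intro j
    refine ⟨e.symm (fun k => if h : ∃ x, ι x = k then
      (match h.choose with | .inl i => P i j | .inr i => decide (i = j)) else false), ?_, ?_⟩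
    · intro i
      have h : ∃ x, ι x = ι (.inl i) := ⟨_, rfl⟩
      have h' : h.choose = .inl i := hιi h.choose_spec
      rw [Equiv.apply_symm_apply, dif_pos h, h']
    · intro i
      have h : ∃ x, ι x = ι (.inr i) := ⟨_, rfl⟩
      have h' : h.choose = .inr i := hιi h.choose_spec
      rw [Equiv.apply_symm_apply, dif_pos h, h']
  choose B hB1 hB2 using hB
  have hBi : Function.Injective B := by
    intro i j hij
    have h1 := hB2 i i
    rw [hij, hB2 j i] at h1
    simpa using h1
  refine ⟨fun i => v (ι (.inl i)), fun j => B j, ?_, ?_, ?_, ⟨cA, ?_⟩, ⟨cB, ?_⟩⟩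
  · intro i j hij
    exact Sum.inl.inj (hιi (hvi hij))
  · intro i j hij
    exact hBi (Subtype.ext hij)
  · intro i j
    rw [hv, hB1]
  · intro i j hij
    have h1 : v (ι (.inl i)) ≠ v (ι (.inl j)) := fun h => hij (Sum.inl.inj (hιi (hvi h)))
    refine hcA _ ?_ _ ?_ h1
    · simp only [hι]; exact Subtype.coe_prop _
    · simp only [hι]; exact Subtype.coe_prop _
  · intro i j hij
    exact hcB _ (B i).2 _ (B j).2 (fun h => hij (hBi (Subtype.ext h)))

end steps
end C6P
end Part8

section Part9
open SimpleGraph Filter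
open scoped Classical
namespace C6P
open Finset

section matrix

def GoodP (γ : ℝ) (t : ℕ) (P : Fin t → Fin t → Bool) : Prop :=
  ∀ S1 S2 T1 T2 : Finset (Fin t), Disjoint S1 S2 → Disjoint T1 T2 → γ * t ≤ S1.card → γ * t ≤ S2.card →
    γ * t ≤ T1.card → γ * t ≤ T2.card → ∀ p : Fin 2 → Fin 2 → Bool, ∃ s u : Fin 2 → Fin t,
      s 0 ∈ S1 ∧ s 1 ∈ S2 ∧ u 0 ∈ T1 ∧ u 1 ∈ T2 ∧ ∀ i j, P (s i) (u j) = p i j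

lemma exists_P (γ : ℝ) (hγ : 0 < γ) : ∃ t0 : ℕ, ∀ t ≥ t0, ∃ P, GoodP γ t P := by
  obtain ⟨t0, ht0⟩ := exists_nat_gt (256 / γ ^ 2)
  refine ⟨t0 + 1, fun t ht => ?_⟩
  by_contra hcon
  push Not at hcon
  have htr : (1:ℝ) ≤ t := by exact_mod_cast (by omega : 1 ≤ t)
  have ht0' : (t0:ℝ) ≤ t := by exact_mod_cast (by omega : t0 ≤ t)
  set V := Fin t ⊕ Fin t
  set X : Finset V := univ.map Function.Embedding.inl with hX
  set Y : Finset V := univ.map Function.Embedding.inr with hY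
  have hXc : X.card = t := by simp [hX]
  have hYc : Y.card = t := by simp [hY]
  set m := ⌈γ * t⌉₊ with hm
  have hmle : γ * t ≤ m := Nat.le_ceil _
  let L := (Finset (Fin t) × Finset (Fin t)) × (Finset (Fin t) × Finset (Fin t)) × (Fin 2 → Fin 2 → Bool)
  have hB : Bd (Set.univ : Set (SimpleGraph V)) (X ×ˢ Y) ((t * t - m * m * (1/2^4)) + (4 * t + 4)) := by
    refine Bd.lab (L := L) (fun l => {G | (Disjoint l.1.1 l.1.2 ∧ Disjoint l.2.1.1 l.2.1.2 ∧
      γ * t ≤ l.1.1.card ∧ γ * t ≤ l.1.2.card ∧ γ * t ≤ l.2.1.1.card ∧ γ * t ≤ l.2.1.2.card) ∧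
      ¬ ∃ s u : Fin 2 → Fin t, s 0 ∈ l.1.1 ∧ s 1 ∈ l.1.2 ∧ u 0 ∈ l.2.1.1 ∧ u 1 ∈ l.2.1.2 ∧
        ∀ i j, decide (G.Adj (Sum.inl (s i)) (Sum.inr (u j))) = l.2.2 i j}) ?_ ?_ ?_
    · intro G _
      have := hcon (fun i j => decide (G.Adj (Sum.inl i) (Sum.inr j)))
      unfold GoodP at this
      push Not at this
      obtain ⟨S1, S2, T1, T2, h1, h2, h3, h4, h5, h6, p, h7⟩ := this
      refine ⟨((S1, S2), (T1, T2), p), ⟨h1, h2, h3, h4, h5, h6⟩, ?_⟩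
      rintro ⟨s, u, a1, a2, a3, a4, a5⟩
      obtain ⟨i, j, h8⟩ := h7 s u a1 a2 a3 a4
      exact h8 (a5 i j)
    · rintro ⟨⟨S1, S2⟩, ⟨T1, T2⟩, p⟩
      by_cases hh : Disjoint S1 S2 ∧ Disjoint T1 T2 ∧
        γ * t ≤ S1.card ∧ γ * t ≤ S2.card ∧ γ * t ≤ T1.card ∧ γ * t ≤ T2.card
      swap
      · convert Bd.empty _ _
        ext G
        simp only [Set.mem_ofPred_eq, Set.mem_empty_iff_false, iff_false]
        exact fun h => hh h.1
      obtain ⟨h1, h2, h3, h4, h5, h6⟩ := hh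
      have := genBlock (𝒢 := {G : SimpleGraph V | (Disjoint S1 S2 ∧ Disjoint T1 T2 ∧
        γ * t ≤ S1.card ∧ γ * t ≤ S2.card ∧ γ * t ≤ T1.card ∧ γ * t ≤ T2.card) ∧
        ¬ ∃ s u : Fin 2 → Fin t, s 0 ∈ S1 ∧ s 1 ∈ S2 ∧ u 0 ∈ T1 ∧ u 1 ∈ T2 ∧
        ∀ i j, decide (G.Adj (Sum.inl (s i)) (Sum.inr (u j))) = p i j}) (⊥ : SimpleGraph V)
        (X := X) (Y := Y) (X1 := S1.map Function.Embedding.inl) (X2 := S2.map Function.Embedding.inl)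
        (Y1 := T1.map Function.Embedding.inr) (Y2 := T2.map Function.Embedding.inr) (m1 := m) (m2 := m)
        (map_subset_map.2 (subset_univ _)) (map_subset_map.2 (subset_univ _)) ((Finset.disjoint_map _).2 h1)
        (map_subset_map.2 (subset_univ _)) (map_subset_map.2 (subset_univ _)) ((Finset.disjoint_map _).2 h2)
        (by rw [card_map]; exact Nat.ceil_le.2 h3) (by rw [card_map]; exact Nat.ceil_le.2 h4)
        (by rw [card_map]; exact Nat.ceil_le.2 h5) (by rw [card_map]; exact Nat.ceil_le.2 h6)
        (fun _ _ => p) (by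
          rintro G ⟨-, hG⟩ s u hs0 hs1 hu0 hu1 hadj
          apply hG
          simp only [Finset.mem_map, Function.Embedding.inl_apply, Function.Embedding.inr_apply] at hs0 hs1 hu0 hu1
          obtain ⟨a0, ha0, ea0⟩ := hs0
          obtain ⟨a1, ha1, ea1⟩ := hs1
          obtain ⟨b0, hb0, eb0⟩ := hu0
          obtain ⟨b1, hb1, eb1⟩ := hu1
          refine ⟨![a0, a1], ![b0, b1], ha0, ha1, hb0, hb1, ?_⟩
          intro i j
          have hsi : Sum.inl (![a0, a1] i) = s i := by fin_cases i <;> assumption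
          have huj : Sum.inr (![b0, b1] j) = u j := by fin_cases j <;> assumption
          rw [hsi, huj, Bool.eq_iff_iff, decide_eq_true_eq]
          exact hadj i j)
      rw [hXc, hYc] at this
      exact this
    · have : Fintype.card L = 2 ^ (4 * t + 4) := by
        simp only [L, Fintype.card_prod, Fintype.card_finset, Fintype.card_fin, Fintype.card_fun,
          Fintype.card_bool]
        ring
      rw [this]
      push_cast
      rw [← Real.rpow_natCast]
      push_cast
      exact le_rfl
  have hcount : (2:ℝ) ^ ((t:ℝ) * t) ≤ ((tr (X ×ˢ Y) '' (Set.univ : Set (SimpleGraph V))).ncard : ℝ) := by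
    have h1 : ((X ×ˢ Y).powerset : Set (Finset (V × V))) ⊆ tr (X ×ˢ Y) '' (Set.univ : Set (SimpleGraph V)) := by
      intro Z hZ
      simp only [coe_powerset, Set.mem_preimage, Set.mem_powerset_iff, coe_subset] at hZ
      have hZm : ∀ a b, (a, b) ∈ Z → a ∈ X ∧ b ∈ Y := fun a b h => mem_product.1 (hZ h)
      have hXY : ∀ a, a ∈ X → a ∈ Y → False := by
        intro a h1 h2
        simp only [hX, hY, Finset.mem_map] at h1 h2
        obtain ⟨x, _, rfl⟩ := h1
        obtain ⟨y, _, h⟩ := h2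
        exact Sum.inr_ne_inl h
      refine ⟨⟨fun a b => (a, b) ∈ Z ∨ (b, a) ∈ Z, ⟨fun a b h => h.symm⟩, ⟨fun a h => ?_⟩⟩, Set.mem_univ _, ?_⟩
      · have h2 : (a, a) ∈ Z := by tauto
        exact hXY a (hZm _ _ h2).1 (hZm _ _ h2).2
      · ext ⟨a, b⟩
        simp only [mem_tr]
        constructor
        · rintro ⟨h2, h3 | h3⟩
          · exact h3
          · exact (hXY a (mem_product.1 h2).1 (hZm _ _ h3).2).elim
        · intro h; exact ⟨hZ h, Or.inl h⟩
    have h2 := Set.ncard_le_ncard h1 (tr_fin _ _)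
    rw [Set.ncard_coe_finset, card_powerset, card_product, hXc, hYc] at h2
    rw [show (t:ℝ) * t = ((t * t : ℕ) : ℝ) by push_cast; ring, Real.rpow_natCast]
    exact_mod_cast h2
  have h3 := hcount.trans hB
  rw [Real.rpow_le_rpow_left_iff (by norm_num)] at h3
  have h4 : (γ * t) * (γ * t) ≤ (m:ℝ) * m := mul_self_le_mul_self (by positivity) hmle
  have h5 : 256 < γ ^ 2 * t := by
    rw [div_lt_iff₀ (by positivity)] at ht0
    nlinarith [sq_nonneg γ]
  nlinarith

lemma gen_of_P {V : Type} {G : SimpleGraph V} {γ : ℝ} {t : ℕ} {P : Fin t → Fin t → Bool}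
    (hP : GoodP γ t P) (A B : Fin t → V) (hA : Function.Injective A) (hB : Function.Injective B)
    (hAB : ∀ i j, G.Adj (A i) (B j) ↔ P i j = true)
    (hAc : ∃ c : Bool, ∀ i j, i ≠ j → (G.Adj (A i) (A j) ↔ c = true))
    (hBc : ∃ c : Bool, ∀ i j, i ≠ j → (G.Adj (B i) (B j) ↔ c = true)) :
    Gen G (univ.image A) (univ.image B) γ := by
  obtain ⟨cA, hcA⟩ := hAc
  obtain ⟨cB, hcB⟩ := hBc
  intro S1 h1 S2 h2 hS T1 h3 T2 h4 hT c1 c2 c3 c4 pat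
  have cA' : (univ.image A).card = t := by rw [card_image_of_injective _ hA]; simp
  have cB' : (univ.image B).card = t := by rw [card_image_of_injective _ hB]; simp
  rw [cA'] at c1 c2
  rw [cB'] at c3 c4
  have key : ∀ (F : Fin t → V), Function.Injective F → ∀ U ⊆ univ.image F,
      (univ.filter (fun i => F i ∈ U)).card = U.card := by
    intro F hF U hU
    rw [← card_image_of_injective _ hF]
    congr 1
    ext x
    simp only [mem_image, mem_filter, mem_univ, true_and]
    constructor
    · rintro ⟨i, h, rfl⟩; exact h
    · intro hx
      obtain ⟨i, -, rfl⟩ := mem_image.1 (hU hx)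
      exact ⟨i, hx, rfl⟩
  have dkey : ∀ (F : Fin t → V) (U U' : Finset V), Disjoint U U' →
      Disjoint (univ.filter (fun i => F i ∈ U)) (univ.filter (fun i => F i ∈ U')) := by
    intro F U U' h
    rw [Finset.disjoint_left] at h ⊢
    intro i hi hi'
    simp only [mem_filter, mem_univ, true_and] at hi hi'
    exact h hi hi'
  obtain ⟨s, u, a1, a2, a3, a4, a5⟩ := hP (univ.filter (fun i => A i ∈ S1)) (univ.filter (fun i => A i ∈ S2))
    (univ.filter (fun i => B i ∈ T1)) (univ.filter (fun i => B i ∈ T2)) (dkey _ _ _ hS) (dkey _ _ _ hT)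
    (by rwa [key A hA _ h1]) (by rwa [key A hA _ h2]) (by rwa [key B hB _ h3]) (by rwa [key B hB _ h4])
    (pat cA cB)
  simp only [mem_filter, mem_univ, true_and] at a1 a2 a3 a4
  have n1 : s 0 ≠ s 1 := by
    intro h; rw [h] at a1; exact Finset.disjoint_left.1 hS a1 a2
  have n2 : u 0 ≠ u 1 := by
    intro h; rw [h] at a3; exact Finset.disjoint_left.1 hT a3 a4
  refine ⟨A ∘ s, B ∘ u, a1, a2, a3, a4, ?_⟩
  intro i j
  simp only [Function.comp]
  have e1 : decide (G.Adj (A (s 0)) (A (s 1))) = cA := by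
    rw [Bool.eq_iff_iff, decide_eq_true_eq]; exact hcA _ _ n1
  have e2 : decide (G.Adj (B (u 0)) (B (u 1))) = cB := by
    rw [Bool.eq_iff_iff, decide_eq_true_eq]; exact hcB _ _ n2
  rw [hAB, a5, e1, e2]

lemma AA2' (γ : ℝ) (hγ : 0 < γ) : ∃ t0 : ℕ, ∀ t ≥ t0, AA (fun n G => ∃ A B : Finset (Fin n),
    A.card = t ∧ B.card = t ∧ Gen G A B γ) := by
  obtain ⟨t0, h⟩ := exists_P γ hγ
  refine ⟨t0, fun t ht => ?_⟩
  obtain ⟨P, hP⟩ := h t ht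
  refine (AA2 t P).mono ⟨0, fun n _ G _ => ?_⟩
  rintro ⟨A, B, hA, hB, h1, h2, h3⟩
  exact ⟨univ.image A, univ.image B, by rw [card_image_of_injective _ hA]; simp,
    by rw [card_image_of_injective _ hB]; simp, by have := gen_of_P hP A B hA hB h1 h2 h3; convert this⟩

end matrix
end C6P
end Part9

section Part10
open SimpleGraph Filter
open scoped Classical
namespace C6P
open Finset

section st34

/-- columns outside `S0` are near one of the label columns -/
def NearS {n t : ℕ} (M : ℕ) (δ : ℝ) (u : Fin t → Fin n) (S0 : Finset (Fin n)) (l : Fin M → Finset (Fin t))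
    (G : SimpleGraph (Fin n)) : Prop :=
  ∀ v, v ∉ S0 → ∃ i, ((univ.filter (fun j => ¬ (G.Adj (u j) v ↔ j ∈ l i))).card : ℝ) ≤ δ * t

lemma filter_image_card {n t : ℕ} (u : Fin t → Fin n) (hu : Function.Injective u) (p : Fin n → Prop) :
    ((univ.image u).filter p).card = (univ.filter (fun j => p (u j))).card := by
  rw [filter_image, card_image_of_injective _ hu]

lemma dis_image {n t : ℕ} (G : SimpleGraph (Fin n)) (u : Fin t → Fin n) (hu : Function.Injective u) (x y : Fin n) :
    dis G (univ.image u) x y = (univ.filter (fun j => ¬ (G.Adj (u j) x ↔ G.Adj (u j) y))).card := by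
  unfold dis
  have h1 : (univ.image u).filter (fun w => ¬ (G.Adj x w ↔ G.Adj y w)) =
    (univ.image u).filter (fun w => ¬ (G.Adj w x ↔ G.Adj w y)) := by
    ext w; simp only [mem_filter, G.adj_comm]
  have h2 := filter_image_card u hu (fun w => ¬ (G.Adj w x ↔ G.Adj w y))
  refine Eq.trans ?_ (h2.trans ?_)
  · convert congrArg card h1
  · congr

lemma nearS_bd {n t M : ℕ} {δ h : ℝ} (hb : BallB h δ) (hh : 0 ≤ h) (hM : 1 ≤ M) {u : Fin t → Fin n}
    (hu : Function.Injective u) {S0 : Finset (Fin n)} {l : Fin M → Finset (Fin t)}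
    {𝒢 : Set (SimpleGraph (Fin n))} (h1 : ∀ G ∈ 𝒢, NearS M δ u S0 l G) (U : Finset (Fin n)) (hU : ∀ v ∈ U, v ∉ S0) :
    Bd 𝒢 (univ.image u ×ˢ U) (U.card * (h * t + Real.logb 2 M)) := by
  refine Bd.nearcol hb hM (fun i => (l i).image u) ?_ ?_
  · rw [card_image_of_injective _ hu]; simp
  · intro G hG v hv
    obtain ⟨i, hi⟩ := h1 G hG v (hU v hv)
    refine ⟨i, le_trans (le_of_eq ?_) hi⟩
    have := filter_image_card u hu (fun x => ¬ (G.Adj x v ↔ x ∈ (l i).image u))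
    rw [Nat.cast_inj]
    refine Eq.trans ?_ (this.trans ?_)
    · congr
    · congr 1; ext j; simp only [mem_filter, mem_univ, true_and, mem_image]
      have : (∃ a ∈ l i, u a = u j) ↔ j ∈ l i :=
        ⟨fun ⟨a, ha, e⟩ => hu e ▸ ha, fun h => ⟨j, h, rfl⟩⟩
      rw [this]

lemma exists_inj_image {n t : ℕ} (B : Finset (Fin n)) (hB : B.card = t) :
    ∃ u : Fin t → Fin n, Function.Injective u ∧ univ.image u = B := by
  refine ⟨fun i => B.orderEmbOfFin hB i, (B.orderEmbOfFin hB).injective, ?_⟩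
  simp

lemma exists_enum {V : Type*} [Nonempty V] (Q : Finset V) {M : ℕ} (hQ : Q.card ≤ M) :
    ∃ q : Fin M → V, ∀ x ∈ Q, ∃ i, q i = x := by
  obtain ⟨e⟩ : Nonempty (Q ↪ Fin M) := Function.Embedding.nonempty_of_card_le (by simpa using hQ)
  refine ⟨fun i => if h : ∃ x : Q, e x = i then (h.choose : V) else Classical.arbitrary V, ?_⟩
  intro x hx
  have h : ∃ y : Q, e y = e ⟨x, hx⟩ := ⟨_, rfl⟩
  refine ⟨e ⟨x, hx⟩, ?_⟩
  simp only [dif_pos h]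
  exact congrArg Subtype.val (e.injective h.choose_spec)

lemma exists_nearS {n t M : ℕ} {δ : ℝ} (hn : 1 ≤ n) (G : SimpleGraph (Fin n)) (u : Fin t → Fin n)
    (hu : Function.Injective u) (Q S0 : Finset (Fin n)) (hQ : Q.card ≤ M)
    (h : ∀ v, v ∉ S0 → ∃ q ∈ Q, (dis G (univ.image u) v q : ℝ) ≤ δ * t) :
    ∃ l, NearS M δ u S0 l G := by
  have : Nonempty (Fin n) := ⟨⟨0, hn⟩⟩
  obtain ⟨q, hq⟩ := exists_enum Q hQ
  refine ⟨fun i => univ.filter (fun j => G.Adj (u j) (q i)), ?_⟩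
  intro v hv
  obtain ⟨x, hx, hd⟩ := h v hv
  obtain ⟨i, rfl⟩ := hq x hx
  refine ⟨i, ?_⟩
  rw [dis_image G u hu] at hd
  simpa using hd

def FarC {n : ℕ} (G : SimpleGraph (Fin n)) (B Q S0 : Finset (Fin n)) (d : ℝ) : Prop :=
  ∀ v, v ∉ S0 → ∃ q ∈ Q, (dis G B v q : ℝ) ≤ d

lemma card_fin_le {n : ℕ} (S : Finset (Fin n)) : (S.card : ℝ) ≤ n := by
  have := card_le_univ S
  simp only [Fintype.card_fin] at this
  exact_mod_cast this

lemma ST3i (ε δ : ℝ) (hε : 0 < ε) (hb : BallB (ε/2) δ) (M : ℕ) (hM : 1 ≤ M) :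
    ∃ t0 : ℕ, ∀ t ≥ t0, AA (fun n G => ∀ B Q S0 : Finset (Fin n), B.card = t → Q.card ≤ M →
      FarC G B Q S0 (δ * t) → (1/2 - ε) * n ≤ S0.card) := by
  obtain ⟨t0, ht0⟩ := exists_nat_ge ((Real.logb 2 M + 2) / (ε / 2))
  refine ⟨t0 + 1, fun t ht => ?_⟩
  refine AA.of_dpc t 1 (Fin M → Finset (Fin t)) (by omega) 1 (by norm_num)
    (fun n u s l G => (s 0).card < (1/2 - ε) * n ∧ NearS M δ u (s 0) l G) ?_
  refine ⟨1, fun n hn => ⟨?_, ?_⟩⟩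
  · intro G hG hP
    push Not at hP
    obtain ⟨B, Q, S0, hB, hQ, hf, hlt⟩ := hP
    obtain ⟨u, hu, rfl⟩ := exists_inj_image B hB
    obtain ⟨l, hl⟩ := exists_nearS hn G u hu Q S0 hQ hf
    exact ⟨u, hu, fun _ => S0, l, hlt, hl⟩
  · intro u hu s l H
    set 𝒢 := {G | C6F G ∧ (((s 0).card : ℝ) < (1/2 - ε) * n ∧ NearS M δ u (s 0) l G) ∧ Agr (univ.image u) G H}
    by_cases hs : ((s 0).card : ℝ) < (1/2 - ε) * n
    swap
    · refine (Bd.empty _ _).mono_set ?_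
      rintro G ⟨-, h, -⟩
      exact hs h.1
    have h1 : Bd 𝒢 (univ.image u ×ˢ (s 0)ᶜ) _ :=
      nearS_bd hb (by positivity) hM hu (S0 := s 0) (l := l) (fun G hG => hG.2.1.2) (s 0)ᶜ
        (fun v hv => by simpa using hv)
    have h2 := h1.union (Bd.triv 𝒢 (univ.image u ×ˢ s 0))
    refine (h2.mono_E ?_).mono ?_
    · rintro ⟨a, b⟩ h
      simp only [mem_product, mem_union, mem_compl] at h ⊢
      tauto
    · rw [card_product, card_image_of_injective _ hu, card_univ, Fintype.card_fin]
      have h3 := card_fin_le (s 0)ᶜ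
      have hlog : 0 ≤ Real.logb 2 (M:ℝ) := Real.logb_nonneg (by norm_num) (by exact_mod_cast hM)
      have h4 : (Real.logb 2 M + 2) ≤ ε / 2 * t := by
        rw [div_le_iff₀ (by positivity)] at ht0
        have : (t0:ℝ) ≤ t := by exact_mod_cast (by omega : t0 ≤ t)
        nlinarith
      have h5 : 0 ≤ ε / 2 * t + Real.logb 2 M := by positivity
      have h6 := mul_le_mul_of_nonneg_right h3 h5
      have h7 := mul_le_mul_of_nonneg_left hs.le (Nat.cast_nonneg (α := ℝ) t)
      have h8 := mul_le_mul_of_nonneg_left h4 (Nat.cast_nonneg (α := ℝ) n)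
      push_cast
      nlinarith

lemma ST3ii (ε δ γ : ℝ) (hε : 0 < ε) (hε1 : ε ≤ 1/4) (hγ : 0 < γ) (hεγ : ε ≤ γ^2/256)
    (hb : BallB (ε/2) δ) (M : ℕ) (hM : 1 ≤ M) :
    ∃ t0 : ℕ, ∀ t ≥ t0, AA (fun n G => ∀ B Q S0 : Finset (Fin n), B.card = t → Q.card ≤ M →
      FarC G B Q S0 (δ * t) → (1/2 - ε) * n ≤ S0.card → S0.card ≤ (1/2 + ε) * n → Gen G B S0 γ) := by
  obtain ⟨t0, ht0⟩ := exists_nat_ge ((Real.logb 2 M + 5) / (γ^2/128))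
  refine ⟨t0 + 1, fun t ht => ?_⟩
  obtain ⟨n0, hn0⟩ := exists_nat_ge (γ * t^2 / 16)
  refine AA.of_dpc t 3 ((Fin M → Finset (Fin t)) × Finset (Fin t) × Finset (Fin t) ×
    (Bool → Bool → Fin 2 → Fin 2 → Bool)) (by omega) 1 (by norm_num)
    (fun n u s l G => (1/2 - ε) * n ≤ (s 0).card ∧ (s 0).card ≤ (1/2 + ε) * n ∧
      s 1 ⊆ s 0 ∧ s 2 ⊆ s 0 ∧ Disjoint (s 1) (s 2) ∧ γ * (s 0).card ≤ (s 1).card ∧ γ * (s 0).card ≤ (s 2).card ∧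
      Disjoint l.2.1 l.2.2.1 ∧ γ * t ≤ l.2.1.card ∧ γ * t ≤ l.2.2.1.card ∧
      NearS M δ u (s 0) l.1 G ∧
      ∀ a b : Fin 2 → Fin n, a 0 ∈ l.2.1.image u → a 1 ∈ l.2.2.1.image u → b 0 ∈ s 1 → b 1 ∈ s 2 →
      ¬ ∀ i j, G.Adj (a i) (b j) ↔ l.2.2.2 (decide (G.Adj (a 0) (a 1))) (decide (G.Adj (b 0) (b 1))) i j = true) ?_
  refine ⟨n0 + 1, fun n hn => ⟨?_, ?_⟩⟩
  · intro G hG hP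
    push Not at hP
    obtain ⟨B, Q, S0, hB, hQ, hf, hlt, hle, hng⟩ := hP
    obtain ⟨u, hu, rfl⟩ := exists_inj_image B hB
    obtain ⟨l, hl⟩ := exists_nearS (by omega) G u hu Q S0 hQ hf
    unfold Gen at hng
    push Not at hng
    obtain ⟨B1, h1, B2, h2, h3, S1, h4, S2, h5, h6, h7, h8, h9, h10, pat, hpat⟩ := hng
    have key : ∀ U ⊆ univ.image u, (univ.filter (fun i => u i ∈ U)).image u = U := by
      intro U hU
      ext x
      simp only [mem_image, mem_filter, mem_univ, true_and]
      constructor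
      · rintro ⟨i, hi, rfl⟩; exact hi
      · intro hx
        obtain ⟨i, -, rfl⟩ := mem_image.1 (hU hx)
        exact ⟨i, hx, rfl⟩
    have keyc : ∀ U ⊆ univ.image u, (univ.filter (fun i => u i ∈ U)).card = U.card := by
      intro U hU
      conv_rhs => rw [← key U hU]
      rw [card_image_of_injective _ hu]
    refine ⟨u, hu, ![S0, S1, S2], (l, univ.filter (fun i => u i ∈ B1), univ.filter (fun i => u i ∈ B2), pat), ?_⟩
    refine ⟨hlt, hle, h4, h5, h6, h9, h10, ?_, ?_, ?_, hl, ?_⟩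
    · rw [Finset.disjoint_left] at h3 ⊢
      intro i hi hi'
      simp only [mem_filter, mem_univ, true_and] at hi hi'
      exact h3 hi hi'
    · rw [keyc B1 h1]; rw [hB] at h7; exact h7
    · rw [keyc B2 h2]; rw [hB] at h8; exact h8
    · intro a b ha1 ha2 hb1 hb2 hcon
      simp only at ha1 ha2 hcon
      rw [key B1 h1] at ha1
      rw [key B2 h2] at ha2
      obtain ⟨i, j, hij⟩ := hpat a b ha1 ha2 hb1 hb2
      have := hcon i j
      rcases hij with h | h
      · exact h.2 (this.1 h.1)
      · exact h.1 (this.2 h.2)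
  · intro u hu s l H
    set X := univ.image u with hX
    have hXc : X.card = t := by rw [hX, card_image_of_injective _ hu, card_univ, Fintype.card_fin]
    set S0 := s 0
    by_cases hs : (1/2 - ε) * n ≤ S0.card ∧ S0.card ≤ (1/2 + ε) * n ∧
      s 1 ⊆ S0 ∧ s 2 ⊆ S0 ∧ Disjoint (s 1) (s 2) ∧ γ * S0.card ≤ (s 1).card ∧ γ * S0.card ≤ (s 2).card ∧
      Disjoint l.2.1 l.2.2.1 ∧ γ * t ≤ l.2.1.card ∧ γ * t ≤ l.2.2.1.card
    swap
    · refine (Bd.empty _ _).mono_set ?_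
      rintro G ⟨-, h, -⟩
      exact hs ⟨h.1, h.2.1, h.2.2.1, h.2.2.2.1, h.2.2.2.2.1, h.2.2.2.2.2.1, h.2.2.2.2.2.2.1,
        h.2.2.2.2.2.2.2.1, h.2.2.2.2.2.2.2.2.1, h.2.2.2.2.2.2.2.2.2.1⟩
    obtain ⟨c1, c2, c3, c4, c5, c6, c7, c8, c9, c10⟩ := hs
    set 𝒢 : Set (SimpleGraph (Fin n)) := {G | NearS M δ u S0 l.1 G ∧ Agr X G H ∧
      ∀ a b : Fin 2 → Fin n, a 0 ∈ l.2.1.image u → a 1 ∈ l.2.2.1.image u → b 0 ∈ s 1 → b 1 ∈ s 2 →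
      ¬ ∀ i j, G.Adj (a i) (b j) ↔ l.2.2.2 (decide (G.Adj (a 0) (a 1))) (decide (G.Adj (b 0) (b 1))) i j = true}
      with h𝒢
    have h0 : Bd 𝒢 (X ×ˢ Xᶜ) ((t / 2 - (3:ℕ) - 1) * n) := by
      have h1 : Bd 𝒢 (X ×ˢ S0ᶜ) _ :=
        nearS_bd hb (by positivity) hM hu (S0 := S0) (l := l.1) (fun G hG => hG.1) S0ᶜ
          (fun v hv => by simpa using hv)
      have hsd : ∀ Z : Finset (Fin n), (Z.card : ℝ) - t ≤ (Z \ X).card := by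
        intro Z
        have := card_le_card_sdiff_add_card (s := Z) (t := X)
        rw [hXc] at this
        have : (Z.card : ℝ) ≤ (Z \ X).card + t := by exact_mod_cast this
        linarith
      have h2 : Bd 𝒢 (X ×ˢ (S0 \ X)) _ := genBlock (𝒢 := 𝒢) H (X := X) (Y := S0 \ X)
        (X1 := l.2.1.image u) (X2 := l.2.2.1.image u) (Y1 := s 1 \ X) (Y2 := s 2 \ X)
        (m1 := ⌈γ * t⌉₊) (m2 := ⌈γ * S0.card - t⌉₊)
        (image_subset_image (subset_univ _)) (image_subset_image (subset_univ _))
        ((disjoint_image hu).2 c8) (sdiff_subset_sdiff c3 le_rfl) (sdiff_subset_sdiff c4 le_rfl)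
        (c5.mono sdiff_subset sdiff_subset)
        (by rw [card_image_of_injective _ hu]; exact Nat.ceil_le.2 c9)
        (by rw [card_image_of_injective _ hu]; exact Nat.ceil_le.2 c10)
        (Nat.ceil_le.2 (by linarith [hsd (s 1)])) (Nat.ceil_le.2 (by linarith [hsd (s 2)])) l.2.2.2
        (by
          rintro G ⟨-, hA, hG⟩ a b ha0 ha1 hb0 hb1 hcon
          rw [Finset.mem_sdiff] at hb0 hb1
          apply hG a b ha0 ha1 hb0.1 hb1.1
          have a0 : a 0 ∈ X := image_subset_image (subset_univ _) ha0
          have a1 : a 1 ∈ X := image_subset_image (subset_univ _) ha1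
          have e1 : G.Adj (a 0) (a 1) ↔ H.Adj (a 0) (a 1) := hA _ _ (by simp [a0, a1])
          have e2 : G.Adj (b 0) (b 1) ↔ H.Adj (b 0) (b 1) := hA _ _ (by simp [hb0.2, hb1.2])
          intro i j
          rw [hcon i j]
          simp only [e1, e2])
      refine ((h1.union h2).mono_E ?_).mono ?_
      · rintro ⟨a, b⟩ h
        simp only [mem_product, mem_union, mem_compl, Finset.mem_sdiff] at h ⊢
        tauto
      · rw [hXc]
        have h3 := card_fin_le S0ᶜ
        have h31 : ((S0 \ X).card : ℝ) ≤ S0.card := by exact_mod_cast card_le_card sdiff_subset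
        have hlog : 0 ≤ Real.logb 2 (M:ℝ) := Real.logb_nonneg (by norm_num) (by exact_mod_cast hM)
        have h4 : (Real.logb 2 M + 5) ≤ γ^2/128 * t := by
          rw [div_le_iff₀ (by positivity)] at ht0
          have : (t0:ℝ) ≤ t := by exact_mod_cast (by omega : t0 ≤ t)
          nlinarith [sq_nonneg γ]
        have h5 : 0 ≤ ε / 2 * t + Real.logb 2 M := by positivity
        have h6 := mul_le_mul_of_nonneg_right h3 h5
        have h7 := mul_le_mul_of_nonneg_left (h31.trans c2) (Nat.cast_nonneg (α := ℝ) t)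
        have h8 := mul_le_mul_of_nonneg_left h4 (Nat.cast_nonneg (α := ℝ) n)
        have h9 : γ * t * (γ * S0.card - t) ≤ (⌈γ * t⌉₊:ℝ) * (⌈γ * S0.card - t⌉₊:ℝ) := by
          have q1 := Nat.le_ceil (γ * t)
          have q2 := Nat.le_ceil (γ * S0.card - t)
          calc γ * t * (γ * S0.card - t) ≤ γ * t * (⌈γ * S0.card - t⌉₊:ℝ) :=
                mul_le_mul_of_nonneg_left q2 (by positivity)
            _ ≤ _ := mul_le_mul_of_nonneg_right q1 (Nat.cast_nonneg _)
        have h10 : γ^2 * t * (n/4) ≤ γ^2 * t * S0.card := by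
          apply mul_le_mul_of_nonneg_left _ (by positivity)
          have : (0:ℝ) ≤ n := Nat.cast_nonneg _
          nlinarith
        have h11 : γ * t^2 / 16 ≤ n := hn0.trans (by exact_mod_cast (by omega : n0 ≤ n))
        have h12 := mul_le_mul_of_nonneg_right hεγ (by positivity : (0:ℝ) ≤ t * n)
        push_cast
        nlinarith
    refine h0.mono_set ?_
    rintro G ⟨hG1, h, hG3⟩
    exact ⟨h.2.2.2.2.2.2.2.2.2.2.1, hG3, h.2.2.2.2.2.2.2.2.2.2.2⟩

lemma ST3iii (ε δ δ2 κ : ℝ) (hε : 0 < ε) (hκ : 0 < κ) (hεκ : ε ≤ κ/8)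
    (hb : BallB (ε/2) δ) (hb2 : BallB (1/2) δ2) (M : ℕ) (hM : 1 ≤ M) :
    ∃ t0 : ℕ, ∀ t ≥ t0, AA (fun n G => ∀ B Q S0 : Finset (Fin n), B.card = t → Q.card ≤ M →
      FarC G B Q S0 (δ * t) → S0.card ≤ (1/2 + ε) * n → ∀ v, ∀ W ⊆ S0,
        (∀ w ∈ W, (dis G B w v : ℝ) ≤ δ2 * t) → W.card ≤ κ * n) := by
  obtain ⟨t0, ht0⟩ := exists_nat_ge ((Real.logb 2 M + 3) / (κ/8))
  refine ⟨t0 + 1, fun t ht => ?_⟩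
  refine AA.of_dpc t 2 ((Fin M → Finset (Fin t)) × Finset (Fin t)) (by omega) 1 (by norm_num)
    (fun n u s l G => s 1 ⊆ s 0 ∧ (s 0).card ≤ (1/2 + ε) * n ∧ κ * n < (s 1).card ∧ NearS M δ u (s 0) l.1 G ∧
      NearS 1 δ2 u (s 1)ᶜ (fun _ => l.2) G) ?_
  refine ⟨1, fun n hn => ⟨?_, ?_⟩⟩
  · intro G hG hP
    push Not at hP
    obtain ⟨B, Q, S0, hB, hQ, hf, hlt, v, W, hW, hWv, hWc⟩ := hP
    obtain ⟨u, hu, rfl⟩ := exists_inj_image B hB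
    obtain ⟨l, hl⟩ := exists_nearS hn G u hu Q S0 hQ hf
    obtain ⟨l', hl'⟩ := exists_nearS (M := 1) (δ := δ2) hn G u hu {v} Wᶜ (by simp) (by
      intro w hw
      exact ⟨v, by simp, hWv w (by simpa using hw)⟩)
    refine ⟨u, hu, ![S0, W], (l, l' 0), hW, hlt, hWc, hl, ?_⟩
    have : (fun _ => l' 0) = l' := by ext i; rw [Subsingleton.elim i 0]
    simp only [this]
    exact hl'
  · intro u hu s l H
    set X := univ.image u with hX
    have hXc : X.card = t := by rw [hX, card_image_of_injective _ hu, card_univ, Fintype.card_fin]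
    by_cases hs : s 1 ⊆ s 0 ∧ (s 0).card ≤ (1/2 + ε) * n ∧ κ * n < (s 1).card
    swap
    · refine (Bd.empty _ _).mono_set ?_
      rintro G ⟨-, h, -⟩
      exact hs ⟨h.1, h.2.1, h.2.2.1⟩
    obtain ⟨c1, c2, c3⟩ := hs
    set 𝒢 : Set (SimpleGraph (Fin n)) := {G | NearS M δ u (s 0) l.1 G ∧ NearS 1 δ2 u (s 1)ᶜ (fun _ => l.2) G}
    have h0 : Bd 𝒢 (X ×ˢ Xᶜ) ((t / 2 - (2:ℕ) - 1) * n) := by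
      have h1 : Bd 𝒢 (X ×ˢ (s 0)ᶜ) _ :=
        nearS_bd hb (by positivity) hM hu (S0 := s 0) (l := l.1) (fun G hG => hG.1) (s 0)ᶜ
          (fun v hv => by simpa using hv)
      have h2 : Bd 𝒢 (X ×ˢ (s 1)) _ :=
        nearS_bd hb2 (by positivity) le_rfl hu (S0 := (s 1)ᶜ) (l := fun _ => l.2) (fun G hG => hG.2) (s 1)
          (fun v hv => by simpa using hv)
      refine (((h1.union h2).union (Bd.triv 𝒢 (X ×ˢ (s 0 \ s 1)))).mono_E ?_).mono ?_
      · rintro ⟨a, b⟩ h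
        simp only [mem_product, mem_union, mem_compl, Finset.mem_sdiff] at h ⊢
        tauto
      · rw [card_product, hXc]
        have h3 := card_fin_le (s 0)ᶜ
        have h31 : ((s 0 \ s 1).card : ℝ) + (s 1).card = (s 0).card := by
          exact_mod_cast card_sdiff_add_card_eq_card c1
        have hlog : 0 ≤ Real.logb 2 (M:ℝ) := Real.logb_nonneg (by norm_num) (by exact_mod_cast hM)
        have h4 : (Real.logb 2 M + 3) ≤ κ/8 * t := by
          rw [div_le_iff₀ (by positivity)] at ht0
          have : (t0:ℝ) ≤ t := by exact_mod_cast (by omega : t0 ≤ t)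
          nlinarith
        have h5 : 0 ≤ ε / 2 * t + Real.logb 2 M := by positivity
        have h6 := mul_le_mul_of_nonneg_right h3 h5
        have h7 := mul_le_mul_of_nonneg_left c2 (Nat.cast_nonneg (α := ℝ) t)
        have h8 := mul_le_mul_of_nonneg_left h4 (Nat.cast_nonneg (α := ℝ) n)
        have h9 := mul_le_mul_of_nonneg_left c3.le (Nat.cast_nonneg (α := ℝ) t)
        have h12 := mul_le_mul_of_nonneg_right hεκ (by positivity : (0:ℝ) ≤ t * n)
        have h13 : ((s 0 \ s 1).card : ℝ) = (s 0).card - (s 1).card := by linarith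
        push_cast
        rw [h13, Real.logb_one]
        nlinarith
    refine h0.mono_set ?_
    rintro G ⟨hG1, h, hG3⟩
    exact ⟨h.2.2.2.1, h.2.2.2.2⟩

end st34
end C6P
end Part10

section Part11
open SimpleGraph Filter
open scoped Classical
namespace C6P
open Finset

section rs

lemma BallB.mono {h δ δ' : ℝ} (hb : BallB h δ) (hd : δ' ≤ δ) : BallB h δ' := by
  intro α E N d h1 h2
  have h0 : (0:ℝ) ≤ N := le_trans (Nat.cast_nonneg _) h1
  exact hb E N d h1 (h2.trans (mul_le_mul_of_nonneg_right hd h0))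

def LP {n : ℕ} (G : SimpleGraph (Fin n)) (S0 : Finset (Fin n)) (γ : ℝ) (N : ℕ) (δ : ℝ) : Prop :=
  ∀ S1 ⊆ S0, γ * n ≤ S1.card → ∃ Sg ⊆ S1, Sg.card = N ∧ ∀ x ∈ Sg, ∀ y ∈ Sg, (dis G S0 x y : ℝ) ≤ δ * n

lemma LP_of {δ γ : ℝ} (hδ : 0 ≤ δ) (hγ : 0 < γ) {M N : ℕ} (hM : 1 ≤ M) {n : ℕ} (hn : N ≤ γ / (2 * M) * n) (hn1 : 1 ≤ n)
    (G : SimpleGraph (Fin n)) (S0 B : Finset (Fin n))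
    (hT : ∀ U : Finset (Fin n), ∃ Q ⊆ U, Q.card < M ∧
      ∀ v ∈ U, ∃ q ∈ Q, (dis G S0 v q : ℝ) < δ * S0.card ∨ (dis G B v q : ℝ) < δ * B.card)
    (hW : ∀ v, ∀ W ⊆ S0, (∀ w ∈ W, (dis G B w v : ℝ) ≤ δ * B.card) → W.card ≤ γ / (2 * M) * n) :
    LP G S0 γ N (2 * δ) := by
  intro S1 hS1 hc
  obtain ⟨Q, hQ1, hQ2, hQ⟩ := hT S1
  have hM' : (0:ℝ) < M := by exact_mod_cast hM
  have hn' : (0:ℝ) < n := by exact_mod_cast hn1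
  obtain ⟨q, hq, hcq⟩ : ∃ q ∈ Q, γ / (2 * M) * n ≤ (S1.filter (fun v => (dis G S0 v q : ℝ) < δ * S0.card)).card := by
    by_contra hcon
    push Not at hcon
    have h1 : S1 ⊆ Q.biUnion (fun q => S1.filter (fun v => (dis G S0 v q : ℝ) < δ * S0.card)) ∪
        Q.biUnion (fun q => S1.filter (fun v => (dis G B v q : ℝ) < δ * B.card)) := by
      intro v hv
      obtain ⟨q, hq, h | h⟩ := hQ v hv
      · exact mem_union_left _ (mem_biUnion.2 ⟨q, hq, mem_filter.2 ⟨hv, h⟩⟩)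
      · exact mem_union_right _ (mem_biUnion.2 ⟨q, hq, mem_filter.2 ⟨hv, h⟩⟩)
    have h2 : (S1.card : ℝ) ≤ ∑ q ∈ Q, ((S1.filter (fun v => (dis G S0 v q : ℝ) < δ * S0.card)).card : ℝ) +
        ∑ q ∈ Q, ((S1.filter (fun v => (dis G B v q : ℝ) < δ * B.card)).card : ℝ) := by
      have := (card_le_card h1).trans ((card_union_le _ _).trans (Nat.add_le_add card_biUnion_le card_biUnion_le))
      exact_mod_cast this
    have h3 : ∑ q ∈ Q, ((S1.filter (fun v => (dis G S0 v q : ℝ) < δ * S0.card)).card : ℝ) ≤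
        Q.card * (γ / (2 * M) * n) := by
      rw [← nsmul_eq_mul]; exact sum_le_card_nsmul _ _ _ (fun q hq => (hcon q hq).le)
    have h4 : ∑ q ∈ Q, ((S1.filter (fun v => (dis G B v q : ℝ) < δ * B.card)).card : ℝ) ≤
        Q.card * (γ / (2 * M) * n) := by
      rw [← nsmul_eq_mul]
      refine sum_le_card_nsmul _ _ _ (fun q hq => hW q _ ((filter_subset _ _).trans hS1) ?_)
      intro w hw
      exact (mem_filter.1 hw).2.le
    have h5 : (Q.card : ℝ) < M := by exact_mod_cast hQ2
    have h6 : 0 < γ / (2 * M) * n := by positivity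
    have h7 : M * (γ / (2 * M) * n) = γ * n / 2 := by field_simp
    nlinarith
  have : N ≤ (S1.filter (fun v => (dis G S0 v q : ℝ) < δ * S0.card)).card := by
    exact_mod_cast hn.trans hcq
  obtain ⟨Sg, h1, h2⟩ := exists_subset_card_eq this
  refine ⟨Sg, h1.trans (filter_subset _ _), h2, ?_⟩
  intro x hx y hy
  have h3 := (mem_filter.1 (h1 hx)).2
  have h4 := (mem_filter.1 (h1 hy)).2
  have h5 : (dis G S0 x y : ℝ) ≤ dis G S0 x q + dis G S0 y q := by
    have := dis_tri G S0 x q y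
    rw [dis_comm G S0 q y] at this
    exact_mod_cast this
  have h6 := mul_le_mul_of_nonneg_left (card_fin_le S0) hδ
  linarith

lemma RS3 (γ δ ε : ℝ) (N : ℕ) (hγ : 0 < γ) (hδ : 0 < δ) (hε : 0 < ε) :
    AA (fun n G => ∃ S0 T0 : Finset (Fin n), Disjoint S0 T0 ∧ (1/2 - ε) * n ≤ S0.card ∧ (1/2 - ε) * n ≤ T0.card ∧
      S0.card ≤ (1/2 + ε) * n ∧ T0.card ≤ (1/2 + ε) * n ∧ LP G S0 γ N δ ∧ LP G T0 γ N δ) := by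
  obtain ⟨δb, hb0, hb1, hbb⟩ := ball_bound' (1/2) (by norm_num)
  set δ2 := min δb (δ/2) with hδ2
  have hδ20 : 0 < δ2 := by positivity
  have hdelb : BallB (1/2) δ2 := hbb.mono (min_le_left _ _)
  have hdeld : 2 * δ2 ≤ δ := by linarith [min_le_right δb (δ/2)]
  obtain ⟨M2', γ2, hγ2, hγ21, hTL2'⟩ := TLmax δ2 hδ20 ((min_le_left _ _).trans hb1)
  set M2 := M2' + 1 with hM2
  have hTL2 : ∀ {n : ℕ} (G : SimpleGraph (Fin n)) (S T : Finset (Fin n)), C6F G → S.Nonempty → T.Nonempty →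
    Gen G S T γ2 → ∀ U : Finset (Fin n), ∃ Q ⊆ U, Q.card < M2 ∧
      ∀ v ∈ U, ∃ q ∈ Q, (dis G S v q : ℝ) < δ2 * S.card ∨ (dis G T v q : ℝ) < δ2 * T.card := by
    intro n G S T a1 a2 a3 a4 U
    obtain ⟨Q, q1, q2, q3⟩ := hTL2' G S T a1 a2 a3 a4 U
    exact ⟨Q, q1, by omega, q3⟩
  set κ := γ / (2 * M2) with hκ
  have hκ0 : 0 < κ := by positivity
  set ε1 := min (min ε (1/4)) (min (γ2^2/256) (κ/8)) with hε1
  have e0 : 0 < ε1 := by positivity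
  have e1 : ε1 ≤ ε := (min_le_left _ _).trans (min_le_left _ _)
  have e2 : ε1 ≤ 1/4 := (min_le_left _ _).trans (min_le_right _ _)
  have e3 : ε1 ≤ γ2^2/256 := (min_le_right _ _).trans (min_le_left _ _)
  have e4 : ε1 ≤ κ/8 := (min_le_right _ _).trans (min_le_right _ _)
  obtain ⟨δ1, d0, d1, hδ1⟩ := ball_bound' (ε1/2) (by positivity)
  obtain ⟨M1, γ1, hγ1, hγ11, hTL1⟩ := TLmax δ1 d0 d1
  obtain ⟨ta, hta⟩ := ST3i ε1 δ1 e0 hδ1 (M1+1) (by omega)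
  obtain ⟨tb, htb⟩ := ST3ii ε1 δ1 γ2 e0 e2 hγ2 e3 hδ1 (M1+1) (by omega)
  obtain ⟨tc, htc⟩ := ST3iii ε1 δ1 δ2 κ e0 hκ0 e4 hδ1 hdelb (M1+1) (by omega)
  obtain ⟨td, htd⟩ := AA2' γ1 hγ1
  set t := ta + tb + tc + td + 1 with ht
  obtain ⟨n0, hn0⟩ := exists_nat_ge (N / κ)
  refine ((((hta t (by omega)).and (htb t (by omega))).and (htc t (by omega))).and (htd t (by omega))).mono
    ⟨n0 + 1, fun n hn G hG => ?_⟩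
  rintro ⟨⟨⟨h1, h2⟩, h3⟩, A, B, hA, hB, hAB⟩
  have hAn : A.Nonempty := by rw [← card_pos]; omega
  have hBn : B.Nonempty := by rw [← card_pos]; omega
  obtain ⟨Q, -, hQ1, hQ2⟩ := hTL1 G A B hG hAn hBn hAB univ
  set S0 : Finset (Fin n) := univ.filter (fun v => ¬ ∃ q ∈ Q, (dis G B v q : ℝ) ≤ δ1 * t) with hS0
  set T0 : Finset (Fin n) := univ.filter (fun v => ¬ ∃ q ∈ Q, (dis G A v q : ℝ) ≤ δ1 * t) with hT0
  have fS : FarC G B Q S0 (δ1 * t) := by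
    intro v hv
    rw [hS0, mem_filter] at hv
    push Not at hv
    exact hv (mem_univ _)
  have fT : FarC G A Q T0 (δ1 * t) := by
    intro v hv
    rw [hT0, mem_filter] at hv
    push Not at hv
    exact hv (mem_univ _)
  have hdis : Disjoint S0 T0 := by
    rw [Finset.disjoint_left]
    intro v hv hv'
    rw [hS0, mem_filter] at hv
    rw [hT0, mem_filter] at hv'
    obtain ⟨q, hq, h | h⟩ := hQ2 v (mem_univ _)
    · exact hv'.2 ⟨q, hq, by rw [hA] at h; exact h.le⟩
    · exact hv.2 ⟨q, hq, by rw [hB] at h; exact h.le⟩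
  have lS := h1 B Q S0 hB (by omega) fS
  have lT := h1 A Q T0 hA (by omega) fT
  have hsum : (S0.card : ℝ) + T0.card ≤ n := by
    have := card_fin_le (S0 ∪ T0)
    rw [card_union_of_disjoint hdis] at this
    exact_mod_cast this
  have uS : (S0.card : ℝ) ≤ (1/2 + ε1) * n := by linarith
  have uT : (T0.card : ℝ) ≤ (1/2 + ε1) * n := by linarith
  have hnpos : (0:ℝ) < n := by exact_mod_cast (by omega : 0 < n)
  have hNn : (N:ℝ) ≤ κ * n := by
    rw [div_le_iff₀ hκ0] at hn0
    have : (n0:ℝ) ≤ n := by exact_mod_cast (by omega : n0 ≤ n)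
    nlinarith
  have hen : ε1 * n ≤ ε * n := mul_le_mul_of_nonneg_right e1 hnpos.le
  have nS : S0.Nonempty := by
    rw [← card_pos]
    have : (0:ℝ) < S0.card := by nlinarith
    exact_mod_cast this
  have nT : T0.Nonempty := by
    rw [← card_pos]
    have : (0:ℝ) < T0.card := by nlinarith
    exact_mod_cast this
  have key : ∀ S0 B : Finset (Fin n), B.card = t → FarC G B Q S0 (δ1 * t) → (1/2 - ε1) * n ≤ S0.card →
      S0.card ≤ (1/2 + ε1) * n → S0.Nonempty → B.Nonempty → LP G S0 γ N δ := by
    intro S0 B hB fS lS uS nS nB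
    have hL := LP_of (N := N) hδ20.le hγ (by omega : 1 ≤ M2) (by rw [← hκ]; exact hNn) (by omega) G S0 B
      (hTL2 G S0 B hG nS nB (h2 B Q S0 hB (by omega) fS lS uS).symm) (by
        intro v W hW hw
        rw [hB] at hw
        exact h3 B Q S0 hB (by omega) fS uS v W hW hw)
    intro S1 a1 a2
    obtain ⟨Sg, b1, b2, b3⟩ := hL S1 a1 a2
    exact ⟨Sg, b1, b2, fun x hx y hy => (b3 x hx y hy).trans (mul_le_mul_of_nonneg_right hdeld hnpos.le)⟩
  refine ⟨S0, T0, hdis, by linarith, by linarith, by linarith, by linarith, ?_, ?_⟩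
  · exact key S0 B hB fS lS uS nS hBn
  · exact key T0 A hA fT lT uT nT hAn

lemma step5 (γ3 δ ε : ℝ) (N : ℕ) (h3 : 0 < γ3) (hε : 0 < ε) (hε1 : ε ≤ 1/4) (hε3 : ε ≤ γ3/2048)
    (hb : BallB (γ3/1024) δ) (hN : 1024 ≤ N * γ3) (γ : ℝ) (hγ : γ ≤ γ3/8) :
    AA (fun n G => ∀ S0 T0 : Finset (Fin n), Disjoint S0 T0 → (1/2 - ε) * n ≤ S0.card → (1/2 - ε) * n ≤ T0.card →
      S0.card ≤ (1/2 + ε) * n → T0.card ≤ (1/2 + ε) * n → LP G S0 γ N δ → Gen G S0 T0 γ3) := by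
  have hN1 : 1 ≤ N := by
    rcases Nat.eq_zero_or_pos N with h | h
    · rw [h] at hN; norm_num at hN
    · exact h
  refine AA.of_dpc (N + N) 6 (Finset (Fin (N+N)) × Finset (Fin (N+N)) ×
    (Bool → Bool → Fin 2 → Fin 2 → Bool)) (by omega) 1 (by norm_num)
    (fun n u s l G => Disjoint (s 0) (s 1) ∧ (1/2 - ε) * n ≤ (s 0).card ∧ (1/2 - ε) * n ≤ (s 1).card ∧
      (s 1).card ≤ (1/2 + ε) * n ∧
      s 2 ⊆ s 1 ∧ s 3 ⊆ s 1 ∧ Disjoint (s 2) (s 3) ∧ γ3 * (s 1).card ≤ (s 2).card ∧ γ3 * (s 1).card ≤ (s 3).card ∧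
      Disjoint l.1 l.2.1 ∧ l.1.card = N ∧ l.2.1.card = N ∧
      (∀ x ∈ univ.image u, ∃ i, (((s 0).filter (fun v => ¬ (G.Adj x v ↔ v ∈ ![s 4, s 5] i))).card : ℝ) ≤ δ * n) ∧
      ∀ a b : Fin 2 → Fin n, a 0 ∈ l.1.image u → a 1 ∈ l.2.1.image u → b 0 ∈ s 2 → b 1 ∈ s 3 →
      ¬ ∀ i j, G.Adj (a i) (b j) ↔ l.2.2 (decide (G.Adj (a 0) (a 1))) (decide (G.Adj (b 0) (b 1))) i j = true) ?_
  refine ⟨2 * N + N^2 + 1, fun n hn => ⟨?_, ?_⟩⟩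
  · intro G hG hP
    push Not at hP
    obtain ⟨S0, T0, hd, lS, lT, uS, uT, hLP, hng⟩ := hP
    unfold Gen at hng
    push Not at hng
    obtain ⟨S1, h1, S2, h2, h12, T1, h4, T2, h5, h6, h7, h8, h9, h10, pat, hpat⟩ := hng
    have hn' : (0:ℝ) ≤ n := Nat.cast_nonneg _
    have hbig : γ * n ≤ γ3 * S0.card := by
      have : (1/4:ℝ) * n ≤ S0.card := by nlinarith
      nlinarith
    obtain ⟨Sg1, a1, a2, a3⟩ := hLP S1 h1 (hbig.trans h7)
    obtain ⟨Sg2, b1, b2, b3⟩ := hLP S2 h2 (hbig.trans h8)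
    have hdSg : Disjoint Sg1 Sg2 := h12.mono a1 b1
    obtain ⟨u, hu, huB⟩ := exists_inj_image (Sg1 ∪ Sg2) (t := N + N) (by rw [card_union_of_disjoint hdSg, a2, b2])
    have key : ∀ U ⊆ univ.image u, (univ.filter (fun i => u i ∈ U)).image u = U := by
      intro U hU
      ext x
      simp only [mem_image, mem_filter, mem_univ, true_and]
      constructor
      · rintro ⟨i, hi, rfl⟩; exact hi
      · intro hx
        obtain ⟨i, -, rfl⟩ := mem_image.1 (hU hx)
        exact ⟨i, hx, rfl⟩
    have keyc : ∀ U ⊆ univ.image u, (univ.filter (fun i => u i ∈ U)).card = U.card := by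
      intro U hU
      conv_rhs => rw [← key U hU]
      rw [card_image_of_injective _ hu]
    have k1 : Sg1 ⊆ univ.image u := by rw [huB]; exact subset_union_left
    have k2 : Sg2 ⊆ univ.image u := by rw [huB]; exact subset_union_right
    obtain ⟨x1, hx1⟩ : Sg1.Nonempty := by rw [← card_pos]; omega
    obtain ⟨x2, hx2⟩ : Sg2.Nonempty := by rw [← card_pos]; omega
    refine ⟨u, hu, ![S0, T0, T1, T2, univ.filter (fun v => G.Adj x1 v), univ.filter (fun v => G.Adj x2 v)],
      (univ.filter (fun i => u i ∈ Sg1), univ.filter (fun i => u i ∈ Sg2), pat), ?_⟩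
    refine ⟨hd, lS, lT, uT, h4, h5, h6, h9, h10, ?_, ?_, ?_, ?_, ?_⟩
    · rw [Finset.disjoint_left] at hdSg ⊢
      intro i hi hi'
      simp only [mem_filter, mem_univ, true_and] at hi hi'
      exact hdSg hi hi'
    · rw [keyc _ k1, a2]
    · rw [keyc _ k2, b2]
    · intro x hx
      rw [huB, mem_union] at hx
      rcases hx with hx | hx
      · refine ⟨0, ?_⟩
        have := a3 x hx x1 hx1
        simpa [dis] using this
      · refine ⟨1, ?_⟩
        have := b3 x hx x2 hx2
        simpa [dis] using this
    · intro a b ha1 ha2 hb1 hb2 hcon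
      simp only at ha1 ha2 hcon
      rw [key _ k1] at ha1
      rw [key _ k2] at ha2
      obtain ⟨i, j, hij⟩ := hpat a b (a1 ha1) (b1 ha2) hb1 hb2
      have := hcon i j
      rcases hij with h | h
      · exact h.2 (this.1 h.1)
      · exact h.1 (this.2 h.2)
  · intro u hu s l H
    set X := univ.image u with hX
    have hXc : X.card = N + N := by rw [hX, card_image_of_injective _ hu, card_univ, Fintype.card_fin]
    by_cases hs : Disjoint (s 0) (s 1) ∧ (1/2 - ε) * n ≤ (s 0).card ∧ (1/2 - ε) * n ≤ (s 1).card ∧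
      (s 1).card ≤ (1/2 + ε) * n ∧
      s 2 ⊆ s 1 ∧ s 3 ⊆ s 1 ∧ Disjoint (s 2) (s 3) ∧ γ3 * (s 1).card ≤ (s 2).card ∧ γ3 * (s 1).card ≤ (s 3).card ∧
      Disjoint l.1 l.2.1 ∧ l.1.card = N ∧ l.2.1.card = N
    swap
    · refine (Bd.empty _ _).mono_set ?_
      rintro G ⟨-, ⟨h1, h2, h3, h4, h5, h6, h7, h8, h9, h10, h11, h12, -⟩, -⟩
      exact hs ⟨h1, h2, h3, h4, h5, h6, h7, h8, h9, h10, h11, h12⟩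
    obtain ⟨c1, c2, c3, c4, c5, c6, c7, c8, c9, c10, c11, c12⟩ := hs
    set 𝒢 : Set (SimpleGraph (Fin n)) := {G | 
      (∀ x ∈ X, ∃ i, (((s 0).filter (fun v => ¬ (G.Adj x v ↔ v ∈ ![s 4, s 5] i))).card : ℝ) ≤ δ * n) ∧ Agr X G H ∧
      ∀ a b : Fin 2 → Fin n, a 0 ∈ l.1.image u → a 1 ∈ l.2.1.image u → b 0 ∈ s 2 → b 1 ∈ s 3 →
      ¬ ∀ i j, G.Adj (a i) (b j) ↔ l.2.2 (decide (G.Adj (a 0) (a 1))) (decide (G.Adj (b 0) (b 1))) i j = true}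
      with h𝒢
    have h0 : Bd 𝒢 (X ×ˢ Xᶜ) ((((N+N:ℕ):ℝ) / 2 - (6:ℕ) - 1) * n) := by
      have h1 : Bd 𝒢 (X ×ˢ (s 0)) _ :=
        Bd.nearrow hb (by norm_num : 1 ≤ 2) ![s 4, s 5] (card_fin_le (s 0))
          (fun G hG x hx => by obtain ⟨i, hi⟩ := hG.1 x hx; exact ⟨i, by convert hi⟩)
      have hsd : ∀ Z : Finset (Fin n), (Z.card : ℝ) - (N + N) ≤ (Z \ X).card := by
        intro Z
        have := card_le_card_sdiff_add_card (s := Z) (t := X)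
        rw [hXc] at this
        have : (Z.card : ℝ) ≤ (Z \ X).card + (N + N) := by exact_mod_cast this
        linarith
      have h2 : Bd 𝒢 (X ×ˢ (s 1 \ X)) _ := genBlock (𝒢 := 𝒢) H (X := X) (Y := s 1 \ X)
        (X1 := l.1.image u) (X2 := l.2.1.image u) (Y1 := s 2 \ X) (Y2 := s 3 \ X)
        (m1 := N) (m2 := ⌈γ3 * (s 1).card - (N + N)⌉₊)
        (image_subset_image (subset_univ _)) (image_subset_image (subset_univ _))
        ((disjoint_image hu).2 c10) (sdiff_subset_sdiff c5 le_rfl) (sdiff_subset_sdiff c6 le_rfl)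
        (c7.mono sdiff_subset sdiff_subset)
        (by rw [card_image_of_injective _ hu]; exact c11.ge)
        (by rw [card_image_of_injective _ hu]; exact c12.ge)
        (Nat.ceil_le.2 (by linarith [hsd (s 2)])) (Nat.ceil_le.2 (by linarith [hsd (s 3)])) l.2.2
        (by
          rintro G ⟨-, hA, hG⟩ a b ha0 ha1 hb0 hb1 hcon
          rw [Finset.mem_sdiff] at hb0 hb1
          apply hG a b ha0 ha1 hb0.1 hb1.1
          have a0 : a 0 ∈ X := image_subset_image (subset_univ _) ha0
          have a1 : a 1 ∈ X := image_subset_image (subset_univ _) ha1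
          have e1 : G.Adj (a 0) (a 1) ↔ H.Adj (a 0) (a 1) := hA _ _ (by simp [a0, a1])
          have e2 : G.Adj (b 0) (b 1) ↔ H.Adj (b 0) (b 1) := hA _ _ (by simp [hb0.2, hb1.2])
          intro i j
          rw [hcon i j]
          simp only [e1, e2])
      refine (((h1.union h2).union (Bd.triv 𝒢 (X ×ˢ (s 0 ∪ s 1)ᶜ))).mono_E ?_).mono ?_
      · rintro ⟨a, b⟩ h
        simp only [mem_product, mem_union, mem_compl, Finset.mem_sdiff] at h ⊢
        tauto
      · rw [card_product, hXc]
        have h31 : ((s 1 \ X).card : ℝ) ≤ (s 1).card := by exact_mod_cast card_le_card sdiff_subset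
        have h32 : (((s 0 ∪ s 1)ᶜ).card : ℝ) ≤ 2 * ε * n := by
          have := card_compl_add_card (s 0 ∪ s 1)
          rw [card_union_of_disjoint c1, Fintype.card_fin] at this
          have : (((s 0 ∪ s 1)ᶜ).card : ℝ) + ((s 0).card + (s 1).card) = n := by exact_mod_cast this
          linarith
        have hl2 : Real.logb 2 ((2:ℕ):ℝ) = 1 := by
          push_cast; exact Real.logb_self_eq_one (by norm_num)
        rw [hl2]
        have hn' : (0:ℝ) ≤ n := Nat.cast_nonneg _
        have hN' : (0:ℝ) ≤ N := Nat.cast_nonneg _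
        have q2 := Nat.le_ceil (γ3 * (s 1).card - (N + N))
        have q3 := mul_le_mul_of_nonneg_left q2 hN'
        have h7 := mul_le_mul_of_nonneg_left (h31.trans c4) hN'
        have h8 := mul_le_mul_of_nonneg_left h32 hN'
        have h10 : γ3 * N * (n/4) ≤ γ3 * N * (s 1).card := by
          apply mul_le_mul_of_nonneg_left _ (by positivity)
          nlinarith
        have h11 : 2 * N + (N:ℝ)^2 ≤ n := by exact_mod_cast (by omega : 2 * N + N^2 ≤ n)
        have h12 := mul_le_mul_of_nonneg_right hε3 (by positivity : (0:ℝ) ≤ N * n)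
        have h13 := mul_le_mul_of_nonneg_right hN hn'
        push_cast
        nlinarith
    refine h0.mono_set ?_
    rintro G ⟨hG1, ⟨-, -, -, -, -, -, -, -, -, -, -, -, h13, h14⟩, hG3⟩
    exact ⟨h13, hG3, h14⟩

/-- distance of a row to a set -/
noncomputable def rdis {n : ℕ} (G : SimpleGraph (Fin n)) (x : Fin n) (R : Finset (Fin n)) : ℕ :=
  (univ.filter (fun v => ¬ (G.Adj x v ↔ v ∈ R))).card

lemma D6 : ∃ ρ : ℝ, 0 < ρ ∧ ρ ≤ 1 ∧ ∀ M : ℕ, ∃ N' : ℕ, AA (fun n G => ∀ X : Finset (Fin n), N' ≤ X.card →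
    ∀ ℛ : Finset (Finset (Fin n)), ℛ.card ≤ M → ∃ x ∈ X, ∀ R ∈ ℛ, ρ * n < rdis G x R) := by
  obtain ⟨ρ, h0, h1, hb⟩ := ball_bound' (1/4) (by norm_num)
  refine ⟨ρ, h0, h1, fun M0 => ?_⟩
  obtain ⟨M, hM⟩ : ∃ M, M = M0 + 1 := ⟨_, rfl⟩
  obtain ⟨n0, hn0⟩ := exists_nat_ge (8 * Real.logb 2 M)
  refine ⟨8 * (M + 1), ?_⟩
  refine AA.of_dpc (8 * (M+1)) M Unit (by omega) 1 (by norm_num)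
    (fun n u s _ G => ∀ x ∈ univ.image u, ∃ i, (rdis G x (s i) : ℝ) ≤ ρ * n) ?_
  refine ⟨n0, fun n hn => ⟨?_, ?_⟩⟩
  · intro G hG hP
    push Not at hP
    obtain ⟨X, hXc, ℛ, hR, h⟩ := hP
    obtain ⟨X', hX', hXc'⟩ := exists_subset_card_eq hXc
    obtain ⟨u, hu, huX⟩ := exists_inj_image X' hXc'
    obtain ⟨q, hq⟩ := exists_enum ℛ (hR.trans (by omega : M0 ≤ M))
    refine ⟨u, hu, q, (), ?_⟩
    intro x hx
    rw [huX] at hx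
    obtain ⟨R, hR, h⟩ := h x (hX' hx)
    obtain ⟨i, rfl⟩ := hq R hR
    exact ⟨i, h⟩
  · intro u hu s l H
    set X := univ.image u with hX
    have hXc : X.card = 8 * (M+1) := by rw [hX, card_image_of_injective _ hu, card_univ, Fintype.card_fin]
    refine ((Bd.nearrow hb (by omega : 1 ≤ M) s (X := X) (U := Xᶜ) (card_fin_le Xᶜ) ?_)).mono ?_
    · rintro G ⟨-, hG, -⟩ x hx
      obtain ⟨i, hi⟩ := hG x hx
      refine ⟨i, le_trans (Nat.cast_le.2 (card_le_card ?_)) hi⟩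
      intro v hv
      simp only [mem_filter, mem_univ, true_and] at hv ⊢
      exact hv.2
    · rw [hXc]
      have h5 : 8 * Real.logb 2 M ≤ n := hn0.trans (by exact_mod_cast hn)
      have h6 := mul_le_mul_of_nonneg_left h5 (by positivity : (0:ℝ) ≤ M + 1)
      push_cast
      nlinarith

end rs
end C6P
end Part11

section Part12
open SimpleGraph Filter
open scoped Classical
namespace C6P
open Finset

section rs6

structure RSP {n : ℕ} (G : SimpleGraph (Fin n)) (δ : ℝ) (M : ℕ) (S T Q R : Finset (Fin n)) : Prop where
  dST : Disjoint S T
  dSQ : Disjoint S Q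
  dTQ : Disjoint T Q
  cov : ∀ v, v ∈ S ∨ v ∈ T ∨ v ∈ Q
  cQ : Q.card ≤ M
  cR : R.card ≤ M
  cS : (S.card : ℝ) ≤ (1/2 + δ) * n
  cT : (T.card : ℝ) ≤ (1/2 + δ) * n
  nS : ∀ x ∈ S, ∃ q ∈ R, (dis G S x q : ℝ) ≤ δ * n
  nT : ∀ x ∈ T, ∃ q ∈ R, (dis G T x q : ℝ) ≤ δ * n

lemma RSP.symm {n : ℕ} {G : SimpleGraph (Fin n)} {δ : ℝ} {M : ℕ} {S T Q R : Finset (Fin n)}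
    (h : RSP G δ M S T Q R) : RSP G δ M T S Q R :=
  ⟨h.dST.symm, h.dTQ, h.dSQ, fun v => by have := h.cov v; tauto, h.cQ, h.cR, h.cT, h.cS, h.nT, h.nS⟩

lemma rdis_le {n : ℕ} (G : SimpleGraph (Fin n)) {S0 T0 : Finset (Fin n)} (hd : Disjoint S0 T0) (x q q' : Fin n) :
    rdis G x (S0.filter (G.Adj q) ∪ T0.filter (G.Adj q')) ≤ dis G S0 x q + dis G T0 x q' + (S0 ∪ T0)ᶜ.card := by
  unfold rdis dis
  refine (card_le_card ?_).trans ((card_union_le _ _).trans (Nat.add_le_add_right (card_union_le _ _) _))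
  intro v hv
  rw [Finset.disjoint_left] at hd
  have := @hd v
  simp only [mem_filter, mem_univ, true_and, mem_union, mem_compl] at hv ⊢
  tauto

lemma small_part {n : ℕ} {G : SimpleGraph (Fin n)} {S0 T0 : Finset (Fin n)} (hd : Disjoint S0 T0)
    {γ ρ δ' δ3 ε : ℝ} {N N' M : ℕ} (hN : N' ≤ N) (hN1 : 1 ≤ N)
    (hD : ∀ X : Finset (Fin n), N' ≤ X.card →
      ∀ ℛ : Finset (Finset (Fin n)), ℛ.card ≤ M → ∃ x ∈ X, ∀ R ∈ ℛ, ρ * n < rdis G x R)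
    (hLP : LP G T0 γ N δ') (hY : ((S0 ∪ T0)ᶜ.card : ℝ) ≤ 2 * ε * n) (hρ : δ3 + δ' + 2 * ε ≤ ρ)
    (Q : Finset (Fin n)) (hQ : Q.card ≤ M) (W : Finset (Fin n)) (hW : W ⊆ T0)
    (hWQ : ∀ w ∈ W, ∃ q ∈ Q, (dis G S0 w q : ℝ) ≤ δ3 * n) : (W.card : ℝ) < γ * n := by
  by_contra hcon
  push Not at hcon
  obtain ⟨Sg, h1, h2, h3⟩ := hLP W hW hcon
  obtain ⟨y, hy⟩ : Sg.Nonempty := by rw [← card_pos]; omega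
  obtain ⟨x, hx, h⟩ := hD Sg (by omega) (Q.image (fun q => S0.filter (G.Adj q) ∪ T0.filter (G.Adj y)))
    (card_image_le.trans hQ)
  obtain ⟨q, hq, hqd⟩ := hWQ x (h1 hx)
  have h4 := h _ (mem_image_of_mem _ hq)
  have h5 : (rdis G x (S0.filter (G.Adj q) ∪ T0.filter (G.Adj y)) : ℝ) ≤ dis G S0 x q + dis G T0 x y +
    (S0 ∪ T0)ᶜ.card := by exact_mod_cast rdis_le G hd x q y
  have h6 := h3 x hx y hy
  have h7 := mul_le_mul_of_nonneg_right hρ (Nat.cast_nonneg (α := ℝ) n)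
  linarith

set_option maxHeartbeats 800000 in
theorem RS (δ : ℝ) (hδ : 0 < δ) : ∃ M : ℕ, AA (fun _ G => ∃ S T Q R, RSP G δ M S T Q R) := by
  obtain ⟨ρ, hρ0, hρ1, hD6⟩ := D6
  set δ3 := min (δ/4) (ρ/4) with hδ3
  have a0 : 0 < δ3 := by positivity
  have a1 : δ3 ≤ δ/4 := min_le_left _ _
  have a2 : δ3 ≤ ρ/4 := min_le_right _ _
  obtain ⟨M3, γ3, g0, g1, hTL⟩ := TLmax δ3 a0 (by linarith)
  obtain ⟨N', hN'⟩ := hD6 (M3 * M3 + M3)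
  obtain ⟨N0, hN0⟩ := exists_nat_ge (1024 / γ3)
  set N := N' + N0 + 1 with hN
  set γ := min (γ3/8) (δ/8) with hγ
  have b0 : 0 < γ := by positivity
  have b1 : γ ≤ γ3/8 := min_le_left _ _
  have b2 : γ ≤ δ/8 := min_le_right _ _
  obtain ⟨δb, c0, c1, hbb⟩ := ball_bound' (γ3/1024) (by positivity)
  set δ' := min δb (ρ/4) with hδ'
  have d0 : 0 < δ' := by positivity
  have d1 : δ' ≤ ρ/4 := min_le_right _ _
  have d2 : BallB (γ3/1024) δ' := hbb.mono (min_le_left _ _)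
  set ε := min (min (γ3/2048) (1/8)) (min (δ/16) (ρ/8)) with hε
  have e0 : 0 < ε := by positivity
  have e1 : ε ≤ γ3/2048 := (min_le_left _ _).trans (min_le_left _ _)
  have e2 : ε ≤ 1/8 := (min_le_left _ _).trans (min_le_right _ _)
  have e3 : ε ≤ δ/16 := (min_le_right _ _).trans (min_le_left _ _)
  have e4 : ε ≤ ρ/8 := (min_le_right _ _).trans (min_le_right _ _)
  have hNg : 1024 ≤ (N:ℝ) * γ3 := by
    rw [div_le_iff₀ g0] at hN0
    have : (N0:ℝ) ≤ N := by exact_mod_cast (by omega : N0 ≤ N)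
    nlinarith
  refine ⟨N' + M3, ?_⟩
  refine (((RS3 γ δ' ε N b0 d0 e0).and (step5 γ3 δ' ε N g0 e0 (by linarith) e1 d2 hNg γ b1)).and hN').mono
    ⟨1, fun n hn G hG => ?_⟩
  rintro ⟨⟨⟨S0, T0, hd, lS, lT, uS, uT, LS, LT⟩, h5⟩, hD⟩
  have hn' : (0:ℝ) < n := by exact_mod_cast hn
  have hgen := h5 S0 T0 hd lS lT uS uT LS
  have nS : S0.Nonempty := by
    rw [← card_pos]
    have : (0:ℝ) < S0.card := by nlinarith
    exact_mod_cast this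
  have nT : T0.Nonempty := by
    rw [← card_pos]
    have : (0:ℝ) < T0.card := by nlinarith
    exact_mod_cast this
  obtain ⟨Q1, -, hQ1, hQ2⟩ := hTL G S0 T0 hG nS nT hgen univ
  have hY : ((S0 ∪ T0)ᶜ.card : ℝ) ≤ 2 * ε * n := by
    have := card_compl_add_card (S0 ∪ T0)
    rw [card_union_of_disjoint hd, Fintype.card_fin] at this
    have : (((S0 ∪ T0)ᶜ).card : ℝ) + (S0.card + T0.card) = n := by exact_mod_cast this
    linarith
  have hY' : ((T0 ∪ S0)ᶜ.card : ℝ) ≤ 2 * ε * n := by rwa [union_comm]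
  set S : Finset (Fin n) := univ.filter (fun v => ∃ q ∈ Q1, (dis G S0 v q : ℝ) ≤ δ3 * n) with hS
  set T : Finset (Fin n) := univ.filter (fun v => ∃ q ∈ Q1, (dis G T0 v q : ℝ) ≤ δ3 * n) with hT
  have mS : ∀ v, v ∈ S ↔ ∃ q ∈ Q1, (dis G S0 v q : ℝ) ≤ δ3 * n := by simp [hS]
  have mT : ∀ v, v ∈ T ↔ ∃ q ∈ Q1, (dis G T0 v q : ℝ) ≤ δ3 * n := by simp [hT]
  have hcov : ∀ v, v ∈ S ∨ v ∈ T := by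
    intro v
    obtain ⟨q, hq, h | h⟩ := hQ2 v (mem_univ _)
    · left
      exact (mS v).2 ⟨q, hq, h.le.trans (mul_le_mul_of_nonneg_left (card_fin_le _) a0.le)⟩
    · right
      exact (mT v).2 ⟨q, hq, h.le.trans (mul_le_mul_of_nonneg_left (card_fin_le _) a0.le)⟩
  have hSTc : (S ∩ T).card < N' := by
    by_contra hcon
    push Not at hcon
    obtain ⟨x, hx, h⟩ := hD (S ∩ T) hcon
      (Finset.image₂ (fun q q' => S0.filter (G.Adj q) ∪ T0.filter (G.Adj q')) Q1 Q1)
      ((card_image₂_le _ _ _).trans (by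
        have := Nat.mul_le_mul hQ1.le hQ1.le
        omega))
    rw [mem_inter] at hx
    obtain ⟨q, hq, h1⟩ := (mS x).1 hx.1
    obtain ⟨q', hq', h2⟩ := (mT x).1 hx.2
    have h4 := h _ (mem_image₂_of_mem hq hq')
    have h5 : (rdis G x (S0.filter (G.Adj q) ∪ T0.filter (G.Adj q')) : ℝ) ≤ dis G S0 x q + dis G T0 x q' +
      (S0 ∪ T0)ᶜ.card := by exact_mod_cast rdis_le G hd x q q'
    have h7 := mul_le_mul_of_nonneg_right (by linarith : 2 * δ3 + 2 * ε ≤ ρ) hn'.le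
    linarith
  have sT : ((T0 ∩ S).card : ℝ) < γ * n :=
    small_part hd (by omega : N' ≤ N) (by omega) hD LT hY (by linarith) Q1 (by omega) _ inter_subset_left
      (fun w hw => (mS w).1 (mem_inter.1 hw).2)
  have sS : ((S0 ∩ T).card : ℝ) < γ * n :=
    small_part hd.symm (by omega : N' ≤ N) (by omega) hD LS hY' (by linarith) Q1 (by omega) _ inter_subset_left
      (fun w hw => (mT w).1 (mem_inter.1 hw).2)
  have extra : ∀ (S S0 T0 Z : Finset (Fin n)), (((S0 ∪ T0)ᶜ).card : ℝ) ≤ 2 * ε * n → ((T0 ∩ S).card : ℝ) < γ * n → Z ⊆ S →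
      ((Z \ S0).card : ℝ) ≤ (γ + 2 * ε) * n := by
    intro S S0 T0 Z h1 h2 h3
    have : Z \ S0 ⊆ (T0 ∩ S) ∪ (S0 ∪ T0)ᶜ := by
      intro v hv
      have := @h3 v
      simp only [Finset.mem_sdiff, mem_union, mem_inter, mem_compl] at hv ⊢
      tauto
    have : ((Z \ S0).card : ℝ) ≤ (T0 ∩ S).card + (S0 ∪ T0)ᶜ.card := by
      exact_mod_cast (card_le_card this).trans (card_union_le _ _)
    linarith
  have xS := extra S S0 T0 (S \ T) hY sT sdiff_subset
  have xT := extra T T0 S0 (T \ S) hY' sS sdiff_subset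
  have cc : ∀ Z S0 : Finset (Fin n), (Z.card : ℝ) ≤ S0.card + (Z \ S0).card := by
    intro Z S0
    have := card_le_card_sdiff_add_card (s := Z) (t := S0)
    rw [add_comm]
    exact_mod_cast this
  have cd : ∀ (Z S0 : Finset (Fin n)) x q, (dis G Z x q : ℝ) ≤ dis G S0 x q + (Z \ S0).card := by
    intro Z S0 x q
    have h1 : dis G Z x q ≤ dis G S0 x q + dis G (Z \ S0) x q := by
      unfold dis
      refine (card_le_card ?_).trans (card_union_le _ _)
      intro v hv
      simp only [Finset.mem_sdiff, mem_union, mem_filter] at hv ⊢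
      tauto
    have h3 := dis_le G (Z \ S0) x q
    have : dis G Z x q ≤ dis G S0 x q + (Z \ S0).card := by omega
    exact_mod_cast this
  refine ⟨S \ T, T \ S, S ∩ T, Q1, ?_, ?_, ?_, ?_, by omega, by omega, ?_, ?_, ?_, ?_⟩
  · rw [Finset.disjoint_left]; intro v; simp only [Finset.mem_sdiff]; tauto
  · rw [Finset.disjoint_left]; intro v; simp only [Finset.mem_sdiff, mem_inter]; tauto
  · rw [Finset.disjoint_left]; intro v; simp only [Finset.mem_sdiff, mem_inter]; tauto
  · intro v; have := hcov v; simp only [Finset.mem_sdiff, mem_inter]; tauto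
  · have := cc (S \ T) S0
    have h9 := mul_le_mul_of_nonneg_right (by linarith : ε + (γ + 2 * ε) ≤ δ) hn'.le
    linarith
  · have := cc (T \ S) T0
    have h9 := mul_le_mul_of_nonneg_right (by linarith : ε + (γ + 2 * ε) ≤ δ) hn'.le
    linarith
  · intro x hx
    obtain ⟨q, hq, h⟩ := (mS x).1 (Finset.mem_sdiff.1 hx).1
    refine ⟨q, hq, ?_⟩
    have := cd (S \ T) S0 x q
    have h9 := mul_le_mul_of_nonneg_right (by linarith : δ3 + (γ + 2 * ε) ≤ δ) hn'.le
    linarith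
  · intro x hx
    obtain ⟨q, hq, h⟩ := (mT x).1 (Finset.mem_sdiff.1 hx).1
    refine ⟨q, hq, ?_⟩
    have := cd (T \ S) T0 x q
    have h9 := mul_le_mul_of_nonneg_right (by linarith : δ3 + (γ + 2 * ε) ≤ δ) hn'.le
    linarith

end rs6
end C6P
end Part12

section Part13
open SimpleGraph Filter
open scoped Classical
namespace C6P
open Finset

section pcl

/-- an induced copy (indexed by `σ`) of a part of the six-cycle inside `U` -/
def Cop {V : Type} {a : ℕ} (G : SimpleGraph V) (σ : Fin a → Fin 6) (U : Finset V) (p : Fin a → V) : Prop :=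
  Function.Injective p ∧ (∀ i, p i ∈ U) ∧ ∀ i j, G.Adj (p i) (p j) ↔ c6 (σ i) (σ j) = true

/-- `N` disjoint copies -/
def Fam {V : Type} {a : ℕ} (G : SimpleGraph V) (σ : Fin a → Fin 6) (U : Finset V) (N : ℕ) : Prop :=
  ∃ P : Fin N → Fin a → V, (∀ k l i j, P k i = P l j → k = l) ∧ ∀ k, Cop G σ U (P k)

lemma Cop.mono {V : Type} {a : ℕ} {G : SimpleGraph V} {σ : Fin a → Fin 6} {U U' : Finset V} {p : Fin a → V}
    (h : Cop G σ U p) (hU : U ⊆ U') : Cop G σ U' p := ⟨h.1, fun i => hU (h.2.1 i), h.2.2⟩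

lemma Fam.mono {V : Type} {a : ℕ} {G : SimpleGraph V} {σ : Fin a → Fin 6} {U U' : Finset V} {N N' : ℕ}
    (h : Fam G σ U N) (hU : U ⊆ U') (hN : N' ≤ N) : Fam G σ U' N' := by
  obtain ⟨P, h1, h2⟩ := h
  exact ⟨fun k => P (Fin.castLE hN k), fun k l i j e => Fin.castLE_injective hN (h1 _ _ _ _ e),
    fun k => (h2 _).mono hU⟩

lemma cop_block {V : Type} {a b : ℕ} {σ : Fin a → Fin 6} {τ : Fin b → Fin 6}
    (hst : ∀ k, (∃ i, σ i = k) ∨ ∃ j, τ j = k) {p : Fin a → V} {q : Fin b → V} {𝒢 : Set (SimpleGraph V)}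
    {U W : Finset V} (h : ∀ G ∈ 𝒢, C6F G ∧ Cop G σ U p ∧ Cop G τ W q) :
    ∃ Z ⊆ univ.image p ×ˢ univ.image q, ∀ G ∈ 𝒢, tr (univ.image p ×ˢ univ.image q) G ≠ Z := by
  refine ⟨(univ.filter (fun z : Fin a × Fin b => c6 (σ z.1) (τ z.2) = true)).image (fun z => (p z.1, q z.2)), ?_, ?_⟩
  · intro z hz
    rw [mem_image] at hz
    obtain ⟨⟨i, j⟩, -, rfl⟩ := hz
    simp
  · intro G hG he
    obtain ⟨hC, ⟨hp, -, hp2⟩, ⟨hq, -, hq2⟩⟩ := h G hG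
    have key : ∀ i j, G.Adj (p i) (q j) ↔ c6 (σ i) (τ j) = true := by
      intro i j
      have h1 := congrArg ((p i, q j) ∈ ·) he
      simp only [mem_tr, mem_product, mem_image_of_mem, mem_univ, true_and, and_self, eq_iff_iff] at h1
      rw [h1, mem_image]
      constructor
      · rintro ⟨⟨i', j'⟩, h2, h3⟩
        simp only [mem_filter, mem_univ, true_and, Prod.mk.injEq] at h2 h3
        rw [← hp h3.1, ← hq h3.2]; exact h2
      · intro h2
        exact ⟨(i, j), by simpa using h2, rfl⟩
    have : ∀ k, ∃ z : Fin a ⊕ Fin b, Sum.elim σ τ z = k := by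
      intro k
      rcases hst k with ⟨i, hi⟩ | ⟨j, hj⟩
      · exact ⟨Sum.inl i, hi⟩
      · exact ⟨Sum.inr j, hj⟩
    choose κ hκ using this
    apply hC (fun k => Sum.elim p q (κ k))
    intro k l
    have hk := hκ k
    have hl := hκ l
    rcases h1 : κ k with i | i <;> rcases h2 : κ l with j | j <;> rw [h1] at hk <;> rw [h2] at hl <;>
      simp only [Sum.elim_inl, Sum.elim_inr] at hk hl ⊢ <;> rw [← hk, ← hl]
    · exact hp2 i j
    · exact key i j
    · rw [G.adj_comm, key j i, c6_symm]
    · exact hq2 i j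

lemma cop_agr {V : Type} {a : ℕ} {G H : SimpleGraph V} {σ : Fin a → Fin 6} {U : Finset V} {p : Fin a → V}
    {X : Finset V} (hA : Agr X G H) (hU : (∀ i, p i ∈ X) ∨ (∀ i, p i ∉ X)) : Cop G σ U p ↔ Cop H σ U p := by
  unfold Cop
  have : ∀ i j, G.Adj (p i) (p j) ↔ H.Adj (p i) (p j) := by
    intro i j
    apply hA
    rcases hU with h | h
    · simp [h]
    · simp [h]
  simp only [this]

lemma fam_block {V : Type} [Fintype V] {a b N m : ℕ} {σ : Fin a → Fin 6} {τ : Fin b → Fin 6} (ha6 : a ≤ 6) (hb6 : b ≤ 6)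
    (hst : ∀ k, (∃ i, σ i = k) ∨ ∃ j, τ j = k) {X Y : Finset V} (P : Fin N → Fin a → V) (P' : Fin m → Fin b → V)
    {𝒢 : Set (SimpleGraph V)} (hP : ∀ k l i j, P k i = P l j → k = l) (hP' : ∀ k l i j, P' k i = P' l j → k = l)
    (h : ∀ G ∈ 𝒢, C6F G ∧ (∀ k, Cop G σ univ (P k)) ∧ (∀ k, Cop G τ univ (P' k)))
    (hX : ∀ k i, P k i ∈ X) (hY : ∀ k i, P' k i ∈ Y) :
    Bd 𝒢 (X ×ˢ Y) (X.card * Y.card - N * m * (1 / 2 ^ 36)) := by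
  refine Bd.blocks (fun k => univ.image (P k))
    (fun k => univ.image (P' k)) 36 ?_ ?_ ?_ ?_ ?_ ?_
  · intro k; rw [image_subset_iff]; intro i _; exact hX k i
  · intro k; rw [image_subset_iff]; intro i _; exact hY k i
  · intro k k' hk
    rw [Finset.disjoint_left]
    rintro v hv hv'
    rw [mem_image] at hv hv'
    obtain ⟨i, -, rfl⟩ := hv
    obtain ⟨j, -, hj⟩ := hv'
    exact hk (hP _ _ _ _ hj).symm
  · intro k k' hk
    rw [Finset.disjoint_left]
    rintro v hv hv'
    rw [mem_image] at hv hv'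
    obtain ⟨i, -, rfl⟩ := hv
    obtain ⟨j, -, hj⟩ := hv'
    exact hk (hP' _ _ _ _ hj).symm
  · intro k l
    have e1 : (univ.image (P k)).card ≤ 6 := card_image_le.trans (by simpa using ha6)
    have e2 : (univ.image (P' l)).card ≤ 6 := card_image_le.trans (by simpa using hb6)
    exact (Nat.mul_le_mul e1 e2).trans (by norm_num)
  · intro k l
    refine cop_block hst (U := univ) (W := univ) ?_
    intro G hG
    exact ⟨(h G hG).1, (h G hG).2.1 k, (h G hG).2.2 l⟩

lemma pcl_arith {k N M C : ℕ} {n δ h β t m q : ℝ}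
    (f2 : (k:ℝ) * t ≤ k * ((1/2 + δ) * n)) (f3 : (N:ℝ) * (β * n) * (1/2^36) ≤ N * m * (1/2^36))
    (f4 : (k:ℝ) * q ≤ k * M) (f6 : (k:ℝ) * ((δ + h) * n) ≤ (N * 6) * (β / 2^40 * n))
    (f7 : ((M:ℝ) + 6) * n ≤ N * (β / 2 ^ 37) * n) (f8 : (0:ℝ) ≤ N * (β * n))
    (hC : (k:ℝ) * (Real.logb 2 (M + 1 : ℕ) + M) ≤ C) (hn : (C:ℝ) ≤ n) :
    k * t - N * m * (1/2^36) + k * (h * n + Real.logb 2 (M + 1 : ℕ)) + ((k : ℝ) * q) ≤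
      (k / 2 - (2 + (M + 1) : ℕ) - 1) * n := by
  have hn0 : (0:ℝ) ≤ n := le_trans (Nat.cast_nonneg _) hn
  push_cast at *
  have e1 : (N * 6 : ℝ) * (β / 2^40 * n) = (N * (β * n)) * (6/2^40) := by ring
  have e2 : (N : ℝ) * (β / 2^37) * n = (N * (β * n)) * (1/2^37) := by ring
  rw [e1] at f6
  rw [e2] at f7
  have e3 : ((k:ℝ) / 2 - (2 + (M + 1)) - 1) * n = k * n / 2 - (M + 4) * n := by ring
  rw [e3]
  have e4 : (k:ℝ) * ((1/2 + δ) * n) = k * n / 2 + k * (δ * n) := by ring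
  have e5 : (k:ℝ) * ((δ + h) * n) = k * (δ * n) + k * (h * n) := by ring
  rw [e4] at f2
  rw [e5] at f6
  have e6 : ((M:ℝ) + 6) * n = (M+4) * n + 2 * n := by ring
  rw [e6] at f7
  rw [mul_add] at hC ⊢
  linarith

set_option maxHeartbeats 800000 in
lemma PCL {a b : ℕ} (σ : Fin a → Fin 6) (τ : Fin b → Fin 6) (ha : 1 ≤ a) (ha6 : a ≤ 6) (hb6 : b ≤ 6)
    (hst : ∀ k, (∃ i, σ i = k) ∨ ∃ j, τ j = k) (β δ h : ℝ) (hβ : 0 < β) (hδ : 0 < δ) (hh : 0 < h)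
    (hb : BallB h δ) (hs : δ + h ≤ β / 2 ^ 40) (M : ℕ) : ∃ N : ℕ, AA (fun n G => ∀ S T Q R, RSP G δ M S T Q R →
      ¬ (Fam G σ S N ∧ ∃ m : ℕ, β * n ≤ m ∧ Fam G τ T m)) := by
  obtain ⟨N0, hN0⟩ := exists_nat_ge ((M + 6) / (β / 2 ^ 37))
  set N := N0 + 1 with hN
  have hNb : (M:ℝ) + 6 ≤ N * (β / 2 ^ 37) := by
    rw [div_le_iff₀ (by positivity)] at hN0
    have : (N:ℝ) = N0 + 1 := by rw [hN]; push_cast; ring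
    rw [this]
    have : 0 < β / 2 ^ 37 := by positivity
    nlinarith
  refine ⟨N, ?_⟩
  obtain ⟨C, hC⟩ := exists_nat_ge ((N * a : ℕ) * (Real.logb 2 (M + 1) + M))
  refine AA.of_dpc (N * a) (2 + (M + 1)) Unit (Nat.mul_pos (by omega) ha) 1 (by norm_num)
    (fun n u s _ G => (∀ i, u i ∈ s 0) ∧ Disjoint (s 0) (s 1) ∧ (s 0 ∪ s 1)ᶜ.card ≤ M ∧
      ((s 1).card : ℝ) ≤ (1/2 + δ) * n ∧ (∀ k, Cop G σ (s 0) (fun i => u (finProdFinEquiv (k, i)))) ∧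
      (∃ m : ℕ, β * n ≤ m ∧ Fam G τ (s 1) m) ∧
      (∀ i, ∃ j, (((s 0).filter (fun v => ¬ (G.Adj (u i) v ↔ v ∈ s (Fin.natAdd 2 j)))).card : ℝ) ≤ δ * n))
    ⟨C + 1, fun n hn => ⟨?_, ?_⟩⟩
  · intro G hG hbad
    push Not at hbad
    obtain ⟨S, T, Q, R, hR, ⟨P, hP1, hP2⟩, hm⟩ := hbad
    have : Nonempty (Fin n) := ⟨⟨0, by omega⟩⟩
    obtain ⟨q, hq⟩ := exists_enum (M := M + 1) R (hR.cR.trans (by omega))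
    refine ⟨fun z => P (finProdFinEquiv.symm z).1 (finProdFinEquiv.symm z).2, ?_,
      Fin.append ![S, T] (fun j => univ.filter (G.Adj (q j))), (), ?_⟩
    · intro z z' hz
      have h1 := hP1 _ _ _ _ hz
      simp only at hz
      rw [h1] at hz
      have h2 := (hP2 _).1 hz
      exact finProdFinEquiv.symm.injective (Prod.ext h1 h2)
    · have e0 : (Fin.append ![S, T] (fun j => univ.filter (G.Adj (q j)))) 0 = S := rfl
      have e1 : (Fin.append ![S, T] (fun j => univ.filter (G.Adj (q j)))) 1 = T := by
        have : (1 : Fin (2 + (M + 1))) = Fin.castAdd (M + 1) (1 : Fin 2) := by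
          ext; simp only [Fin.val_one', Fin.val_castAdd]; exact Nat.mod_eq_of_lt (by omega)
        rw [this, Fin.append_left]; rfl
      rw [e0, e1]
      refine ⟨fun i => (hP2 _).2.1 _, hR.dST, ?_, hR.cT, fun k => by simpa using hP2 k, hm, ?_⟩
      · refine (card_le_card ?_).trans hR.cQ
        intro v hv
        have := hR.cov v
        simp only [mem_compl, mem_union] at hv
        tauto
      · intro i
        obtain ⟨r, hr, hd⟩ := hR.nS _ ((hP2 (finProdFinEquiv.symm i).1).2.1 (finProdFinEquiv.symm i).2)
        obtain ⟨j, rfl⟩ := hq r hr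
        refine ⟨j, le_trans (le_of_eq ?_) hd⟩
        norm_cast
        unfold dis
        congr 1
        ext v
        simp only [mem_filter, Fin.append_right, mem_univ, true_and]
  · intro u hu s _ H
    set X := univ.image u with hX
    have hXc : X.card = N * a := by rw [hX, card_image_of_injective _ hu]; simp
    by_cases hs' : (∀ i, u i ∈ s 0) ∧ Disjoint (s 0) (s 1) ∧ (s 0 ∪ s 1)ᶜ.card ≤ M ∧
      ((s 1).card : ℝ) ≤ (1/2 + δ) * n ∧ (∃ m : ℕ, β * n ≤ m ∧ Fam H τ (s 1) m)
    swap
    · refine (Bd.empty _ _).mono_set ?_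
      rintro G ⟨hG, ⟨h1, h2, h3, h4, h5, ⟨m, hm, P, hP, hP'⟩, h7⟩, hA⟩
      refine hs' ⟨h1, h2, h3, h4, m, hm, P, hP, fun k => (cop_agr hA (Or.inr ?_)).1 (hP' k)⟩
      intro i hi
      rw [hX, mem_image] at hi
      obtain ⟨z, -, hz⟩ := hi
      have := (hP' k).2.1 i
      rw [← hz] at this
      exact (Finset.disjoint_left.1 h2) (h1 z) this
    obtain ⟨h1, h2, h3, h4, m, hm, P, hP, hP'⟩ := hs'
    have hXS : X ⊆ s 0 := by rw [hX, image_subset_iff]; simpa using h1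
    set 𝒢 := {G : SimpleGraph (Fin n) | C6F G ∧ ((∀ i, u i ∈ s 0) ∧ Disjoint (s 0) (s 1) ∧ (s 0 ∪ s 1)ᶜ.card ≤ M ∧
      ((s 1).card : ℝ) ≤ (1/2 + δ) * n ∧ (∀ k, Cop G σ (s 0) (fun i => u (finProdFinEquiv (k, i)))) ∧
      (∃ m : ℕ, β * n ≤ m ∧ Fam G τ (s 1) m) ∧
      (∀ i, ∃ j, (((s 0).filter (fun v => ¬ (G.Adj (u i) v ↔ v ∈ s (Fin.natAdd 2 j)))).card : ℝ) ≤ δ * n)) ∧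
      Agr X G H} with h𝒢
    have b1 : Bd 𝒢 (X ×ˢ s 1) (X.card * (s 1).card - N * m * (1 / 2 ^ 36)) := by
      refine fam_block ha6 hb6 hst (X := X) (Y := s 1) (fun k i => u (finProdFinEquiv (k, i))) P ?_ hP ?_
        (fun k i => mem_image_of_mem _ (mem_univ _)) (fun k i => (hP' k).2.1 i)
      · intro k l i j hj
        have := finProdFinEquiv.injective (hu hj)
        rw [Prod.mk.injEq] at this
        exact this.1
      · rintro G ⟨hG, ⟨-, -, -, -, h5, -, -⟩, hA⟩
        refine ⟨hG, fun k => (h5 k).mono (subset_univ _), fun l => ((cop_agr hA (Or.inr ?_)).2 (hP' l)).mono (subset_univ _)⟩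
        intro i hi
        exact (Finset.disjoint_left.1 h2) (hXS hi) ((hP' l).2.1 i)
    have b2 : Bd 𝒢 (X ×ˢ s 0) (X.card * (h * n + Real.logb 2 (M + 1 : ℕ))) := by
      refine Bd.nearrow hb (by omega) (fun j => s (Fin.natAdd 2 j)) (card_fin_le _) ?_
      rintro G ⟨hG, ⟨-, -, -, -, -, -, h7⟩, hA⟩ x hx
      rw [hX, mem_image] at hx
      obtain ⟨i, -, rfl⟩ := hx
      obtain ⟨j, hj⟩ := h7 i
      exact ⟨j, by convert hj⟩
    have b3 : Bd 𝒢 (X ×ˢ (s 0 ∪ s 1)ᶜ) ((X.card : ℝ) * (s 0 ∪ s 1)ᶜ.card) := by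
      rw [← Nat.cast_mul, ← card_product]; exact Bd.triv _ _
    have b4 := ((b1.union b2).union b3).mono_E (E := X ×ˢ Xᶜ) (by
      rintro ⟨a, b⟩ h; simp only [mem_product, mem_union, mem_compl] at h ⊢; tauto)
    refine b4.mono ?_
    rw [hXc]
    have f1 : ((s 0 ∪ s 1)ᶜ.card : ℝ) ≤ M := by exact_mod_cast h3
    have f2 : ((N * a : ℕ):ℝ) * (s 1).card ≤ (N * a : ℕ) * ((1/2 + δ) * n) := mul_le_mul_of_nonneg_left h4 (Nat.cast_nonneg _)
    have f3 : (N:ℝ) * (β * n) * (1/2^36) ≤ N * m * (1/2^36) :=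
      mul_le_mul_of_nonneg_right (mul_le_mul_of_nonneg_left hm (Nat.cast_nonneg _)) (by positivity)
    have f4 : ((N * a : ℕ):ℝ) * (s 0 ∪ s 1)ᶜ.card ≤ (N * a : ℕ) * M := mul_le_mul_of_nonneg_left f1 (Nat.cast_nonneg _)
    have f5 : ((N * a : ℕ):ℝ) ≤ N * 6 := by exact_mod_cast Nat.mul_le_mul_left _ ha6
    have hn' : (C:ℝ) ≤ n := by exact_mod_cast (by omega : C ≤ n)
    have hn0 : (0:ℝ) ≤ n := Nat.cast_nonneg _
    have f6 : ((N * a : ℕ):ℝ) * ((δ + h) * n) ≤ (N * 6) * (β / 2^40 * n) :=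
      mul_le_mul f5 (mul_le_mul_of_nonneg_right hs hn0) (by positivity) (by positivity)
    have f7 : ((M:ℝ) + 6) * n ≤ N * (β / 2 ^ 37) * n := mul_le_mul_of_nonneg_right hNb hn0
    have f8 : (0:ℝ) ≤ N * (β * n) := by positivity
    exact pcl_arith f2 f3 f4 f6 f7 f8 (by push_cast at hC ⊢; exact hC) hn'
end pcl

end C6P
end Part13

section Part14
open SimpleGraph Filter
open scoped Classical
namespace C6P
open Finset

section st2
variable {V : Type}

def P4Free (G : SimpleGraph V) (S : Finset V) : Prop :=
  ∀ a ∈ S, ∀ b ∈ S, ∀ c ∈ S, ∀ d ∈ S, G.Adj a b → G.Adj b c → G.Adj c d → ¬ G.Adj a c → ¬ G.Adj b d → G.Adj a d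

lemma P4Free.mono {G : SimpleGraph V} {S S' : Finset V} (h : P4Free G S) (hS : S' ⊆ S) : P4Free G S' :=
  fun a ha b hb c hc d hd => h a (hS ha) b (hS hb) c (hS hc) d (hS hd)

lemma CoG5.mono {G : SimpleGraph V} {S S' : Finset V} (h : CoG5 G S) (hS : S' ⊆ S) : CoG5 G S' :=
  ⟨fun a ha b hb c hc => h.1 a (hS ha) b (hS hb) c (hS hc),
   fun a ha b hb c hc d hd => h.2 a (hS ha) b (hS hb) c (hS hc) d (hS hd)⟩

lemma Stab.mono {G : SimpleGraph V} {S S' : Finset V} (h : Stab G S) (hS : S' ⊆ S) : Stab G S' :=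
  fun a ha b hb => h a (hS ha) b (hS hb)

lemma fam_or [DecidableEq V] {a : ℕ} (ha : 1 ≤ a) (G : SimpleGraph V) (σ : Fin a → Fin 6) (U : Finset V) (N : ℕ) :
    Fam G σ U N ∨ ∃ W ⊆ U, W.card ≤ a * N ∧ ∀ p, ¬ Cop G σ (U \ W) p := by
  induction N with
  | zero => left; exact ⟨fun k => k.elim0, fun k => k.elim0, fun k => k.elim0⟩
  | succ N ih =>
    rcases ih with ⟨P, h1, h2⟩ | ⟨W, h1, h2, h3⟩
    · set W := univ.image (fun z : Fin N × Fin a => P z.1 z.2) with hW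
      by_cases h : ∃ p, Cop G σ (U \ W) p
      · left
        obtain ⟨p, hp⟩ := h
        have hn : ∀ k i j, P k i ≠ p j := by
          intro k i j e
          have := hp.2.1 j
          rw [Finset.mem_sdiff] at this
          exact this.2 (e ▸ mem_image_of_mem (fun z : Fin N × Fin a => P z.1 z.2) (mem_univ (k, i)))
        refine ⟨Fin.snoc P p, ?_, ?_⟩
        · intro k l i j
          refine Fin.lastCases ?_ ?_ k <;> refine Fin.lastCases ?_ ?_ l
          · simp
          · intro l e; simp only [Fin.snoc_last, Fin.snoc_castSucc] at e; exact absurd e.symm (hn _ _ _)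
          · intro l e; simp only [Fin.snoc_last, Fin.snoc_castSucc] at e; exact absurd e (hn _ _ _)
          · intro l k e; simp only [Fin.snoc_castSucc] at e; rw [h1 _ _ _ _ e]
        · intro k
          refine Fin.lastCases ?_ ?_ k
          · simpa using hp.mono sdiff_subset
          · intro k; simpa using h2 k
      · right
        push Not at h
        refine ⟨W, ?_, ?_, h⟩
        · rw [hW, image_subset_iff]; intro z _; exact (h2 _).2.1 _
        · refine card_image_le.trans ?_
          simp; nlinarith
    · right; exact ⟨W, h1, h2.trans (Nat.mul_le_mul_left _ (by omega)), h3⟩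

lemma fam_stab {a : ℕ} {G : SimpleGraph V} {σ : Fin a → Fin 6} {U : Finset V} {N : ℕ} (hU : Stab G U)
    (hσ : ∀ i j, c6 (σ i) (σ j) = false) (hc : a * N ≤ U.card) : Fam G σ U N := by
  have : Fintype.card (Fin N × Fin a) ≤ Fintype.card U := by simp; rwa [mul_comm]
  obtain ⟨e⟩ := Function.Embedding.nonempty_of_card_le this
  refine ⟨fun k i => e (k, i), ?_, ?_⟩
  · intro k l i j h
    have := e.injective (Subtype.ext h)
    exact (Prod.mk.inj this).1
  · intro k
    refine ⟨?_, fun i => (e _).2, ?_⟩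
    · intro i j h
      have := e.injective (Subtype.ext h)
      exact (Prod.mk.inj this).2
    · intro i j
      simp [hσ, hU _ (e (k,i)).2 _ (e (k,j)).2]

lemma p4_of_nocop {G : SimpleGraph V} {U : Finset V} (h : ∀ p, ¬ Cop G ![0,1,2,3] U p) : P4Free G U := by
  intro a ha b hb c hc d hd ab bc cd ac bd
  by_contra ad
  have n1 := ab.ne
  have n2 := bc.ne
  have n3 := cd.ne
  have n4 : a ≠ c := by rintro rfl; exact ad cd
  have n5 : a ≠ d := by rintro rfl; exact bd ab.symm
  have n6 : b ≠ d := by rintro rfl; exact ad ab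
  apply h ![a, b, c, d]
  refine ⟨?_, ?_, ?_⟩
  · intro i j; fin_cases i <;> fin_cases j <;> simp_all [eq_comm]
  · intro i; fin_cases i <;> simp_all
  · intro i j; fin_cases i <;> fin_cases j <;> simp_all [c6, G.adj_comm]

lemma stab_of_nocop {G : SimpleGraph V} {U : Finset V} (h : ∀ p, ¬ Cop G ![4,5] U p) : Stab G U := by
  intro a ha b hb ab
  have n1 := ab.ne
  apply h ![a, b]
  refine ⟨?_, ?_, ?_⟩
  · intro i j; fin_cases i <;> fin_cases j <;> simp_all [eq_comm]
  · intro i; fin_cases i <;> simp_all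
  · intro i j; fin_cases i <;> fin_cases j <;> simp_all [c6, G.adj_comm]

lemma cog5_of_nocop {G : SimpleGraph V} {U : Finset V} (h : ∀ p, ¬ Cop G ![0,2,4] U p)
    (h' : ∀ p, ¬ Cop G ![1,2,4,5] U p) : CoG5 G U := by
  constructor
  · intro a ha b hb c hc ab ac bc
    by_contra hcon
    push Not at hcon
    apply h ![a, b, c]
    refine ⟨?_, ?_, ?_⟩
    · intro i j; fin_cases i <;> fin_cases j <;> simp_all [eq_comm]
    · intro i; fin_cases i <;> simp_all
    · intro i j; fin_cases i <;> fin_cases j <;> simp_all [c6, G.adj_comm]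
  · intro a ha b hb c hc d hd ab cd
    by_contra hcon
    push Not at hcon
    obtain ⟨ac, ad, bc, bd⟩ := hcon
    have n1 := ab.ne
    have n2 := cd.ne
    have n3 : a ≠ c := by rintro rfl; exact ad cd
    have n4 : a ≠ d := by rintro rfl; exact ac cd.symm
    have n5 : b ≠ c := by rintro rfl; exact bd cd
    have n6 : b ≠ d := by rintro rfl; exact ad ab
    apply h' ![a, b, c, d]
    refine ⟨?_, ?_, ?_⟩
    · intro i j; fin_cases i <;> fin_cases j <;> simp_all [eq_comm]
    · intro i; fin_cases i <;> simp_all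
    · intro i j; fin_cases i <;> fin_cases j <;> simp_all [c6, G.adj_comm]

/-- outcome of Stage 2 -/
def ST2P {n : ℕ} (M : ℕ) (G : SimpleGraph (Fin n)) : Prop :=
  ∃ S T : Finset (Fin n), Disjoint S T ∧ (S ∪ T)ᶜ.card ≤ M ∧ n ≤ 4 * S.card ∧ n ≤ 4 * T.card ∧
    P4Free G S ∧ (P4Free G T ∨ CoG5 G T)

lemma st2_mk {n M M' : ℕ} {G : SimpleGraph (Fin n)} {S T Q W W' : Finset (Fin n)} (hd : Disjoint S T)
    (hcov : ∀ v, v ∈ S ∨ v ∈ T ∨ v ∈ Q) (hQ : Q.card ≤ M) (hW : W.card ≤ M') (hW' : W'.card ≤ M')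
    (hS : n + 4 * M' ≤ 4 * S.card) (hT : n + 4 * M' ≤ 4 * T.card)
    (h1 : P4Free G (S \ W)) (h2 : P4Free G (T \ W') ∨ CoG5 G (T \ W')) : ST2P (M + 2 * M') G := by
  refine ⟨S \ W, T \ W', Finset.disjoint_of_subset_left sdiff_subset (Finset.disjoint_of_subset_right sdiff_subset hd),
    ?_, ?_, ?_, h1, h2⟩
  · have : (S \ W ∪ T \ W')ᶜ ⊆ Q ∪ W ∪ W' := by
      intro v hv
      have := hcov v
      simp only [mem_compl, mem_union, Finset.mem_sdiff] at hv ⊢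
      tauto
    have h3 := card_le_card this
    have h4 := card_union_le (Q ∪ W) W'
    have h5 := card_union_le Q W
    omega
  · have := Finset.le_card_sdiff W S; omega
  · have := Finset.le_card_sdiff W' T; omega

set_option maxHeartbeats 800000 in
theorem ST2 : ∃ M, AA (fun _ G => ST2P M G) := by
  obtain ⟨δ0, d0, d1, hb0⟩ := ball_bound' (1/2^60) (by positivity)
  set δ := min δ0 (1/2^60) with hδ
  have hδ0 : 0 < δ := by positivity
  have hδ1 : δ ≤ 1/2^60 := min_le_right _ _
  have hb : BallB (1/2^60) δ := hb0.mono (min_le_left _ _)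
  have hs : δ + 1/2^60 ≤ (1/100:ℝ) / 2^40 := by
    have : (1/2^60 + 1/2^60 : ℝ) ≤ (1/100:ℝ) / 2^40 := by norm_num
    linarith
  obtain ⟨M, hM⟩ := RS δ hδ0
  obtain ⟨N1, hN1⟩ := PCL ![0,1,2,3] ![4,5] (by norm_num) (by norm_num) (by norm_num) (by decide)
    (1/100) δ (1/2^60) (by norm_num) hδ0 (by positivity) hb hs M
  obtain ⟨N2, hN2⟩ := PCL ![1,2,4,5] ![0,3] (by norm_num) (by norm_num) (by norm_num) (by decide)
    (1/100) δ (1/2^60) (by norm_num) hδ0 (by positivity) hb hs M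
  obtain ⟨N3, hN3⟩ := PCL ![0,2,4] ![1,3,5] (by norm_num) (by norm_num) (by norm_num) (by decide)
    (1/100) δ (1/2^60) (by norm_num) hδ0 (by positivity) hb hs M
  set M' := 4 * N1 + 4 * N2 + 3 * N3 with hM'
  refine ⟨M + 2 * M', (((hM.and hN1).and hN2).and hN3).mono ⟨100 * (M + 4 * M' + 100), fun n hn G hG => ?_⟩⟩
  rintro ⟨⟨⟨⟨S, T, Q, R, hR⟩, h1⟩, h2⟩, h3⟩
  set m := n / 100 + 1 with hm
  have hmn : (1/100:ℝ) * n ≤ m := by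
    have : (n:ℝ) ≤ 100 * m := by exact_mod_cast (by omega : n ≤ 100 * m)
    linarith
  have size : ∀ S T, RSP G δ M S T Q R → 49 * n ≤ 100 * S.card + 100 * M := by
    intro S T hR
    have : n ≤ S.card + T.card + Q.card := by
      have : (univ : Finset (Fin n)) ⊆ S ∪ T ∪ Q := by
        intro v _; have := hR.cov v; simp only [mem_union]; tauto
      have := (card_le_card this).trans ((card_union_le _ _).trans (Nat.add_le_add_right (card_union_le _ _) _))
      simpa using this
    have h1 := hR.cQ
    have h2 := hR.cT
    have h3 : (n:ℝ) ≤ S.card + T.card + M := by exact_mod_cast (by omega : n ≤ S.card + T.card + M)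
    have h4 : (49 * n : ℝ) ≤ 100 * S.card + 100 * M := by
      have h5 : δ * n ≤ 1/100 * n := mul_le_mul_of_nonneg_right (hδ1.trans (by norm_num)) (Nat.cast_nonneg _)
      linarith
    exact_mod_cast h4
  have sS := size S T hR
  have sT := size T S hR.symm
  -- the main asymmetric case
  have main : ∀ S T, RSP G δ M S T Q R → 49 * n ≤ 100 * S.card + 100 * M → 49 * n ≤ 100 * T.card + 100 * M →
      Fam G ![4,5] T m → ST2P (M + 2 * M') G := by
    intro S T hR sS sT hF
    have hW : ∃ W ⊆ S, W.card ≤ 4 * N1 ∧ ∀ p, ¬ Cop G ![0,1,2,3] (S \ W) p := by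
      rcases fam_or (by norm_num) G ![0,1,2,3] S N1 with h | h
      · exact absurd ⟨h, m, hmn, hF⟩ (h1 S T Q R hR)
      · exact h
    obtain ⟨W, -, hW, hW2⟩ := hW
    rcases fam_or (by norm_num) G ![4,5] S m with h | ⟨Y, hYS, hY, hY2⟩
    · have hW' : ∃ W ⊆ T, W.card ≤ 4 * N1 ∧ ∀ p, ¬ Cop G ![0,1,2,3] (T \ W) p := by
        rcases fam_or (by norm_num) G ![0,1,2,3] T N1 with h' | h'
        · exact absurd ⟨h', m, hmn, h⟩ (h1 T S Q R hR.symm)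
        · exact h'
      obtain ⟨W', -, hW', hW2'⟩ := hW'
      exact st2_mk hR.dST hR.cov hR.cQ (by omega) (by omega) (by omega) (by omega) (p4_of_nocop hW2)
        (Or.inl (p4_of_nocop hW2'))
    · have hst := stab_of_nocop hY2
      have hc := Finset.le_card_sdiff Y S
      have f3 : Fam G ![1,3,5] S m := (fam_stab hst (by decide) (by omega)).mono sdiff_subset le_rfl
      have f2 : Fam G ![0,3] S m := (fam_stab hst (by decide) (by omega)).mono sdiff_subset le_rfl
      obtain ⟨W3, -, w3, w3'⟩ := (fam_or (by norm_num) G ![0,2,4] T N3).resolve_left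
        (fun h => h3 T S Q R hR.symm ⟨h, m, hmn, f3⟩)
      obtain ⟨W2, -, w2, w2'⟩ := (fam_or (by norm_num) G ![1,2,4,5] T N2).resolve_left
        (fun h => h2 T S Q R hR.symm ⟨h, m, hmn, f2⟩)
      have hcu := card_union_le W2 W3
      refine st2_mk (W' := W2 ∪ W3) hR.dST hR.cov hR.cQ (by omega) (by omega) (by omega) (by omega) (p4_of_nocop hW2)
        (Or.inr (cog5_of_nocop ?_ ?_))
      · exact fun p hp => w3' p (hp.mono (sdiff_subset_sdiff Subset.rfl (by intro v hv; simp [hv])))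
      · exact fun p hp => w2' p (hp.mono (sdiff_subset_sdiff Subset.rfl (by intro v hv; simp [hv])))
  rcases fam_or (by norm_num) G ![4,5] T m with h | ⟨Y, hYS, hY, hY2⟩
  · exact main S T hR sS sT h
  rcases fam_or (by norm_num) G ![4,5] S m with h | ⟨Y', hYS', hY', hY2'⟩
  · exact main T S hR.symm sT sS h
  exfalso
  have hst := stab_of_nocop hY2
  have hst' := stab_of_nocop hY2'
  have hc := Finset.le_card_sdiff Y T
  have hc' := Finset.le_card_sdiff Y' S
  have f3 : Fam G ![0,2,4] S N3 := (fam_stab hst' (by decide) (by omega)).mono sdiff_subset le_rfl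
  have f3' : Fam G ![1,3,5] T m := (fam_stab hst (by decide) (by omega)).mono sdiff_subset le_rfl
  exact h3 S T Q R hR ⟨f3, m, hmn, f3'⟩

end st2
end C6P
end Part14

section Part15
open SimpleGraph Filter
open scoped Classical
namespace C6P
open Finset

section cog
variable {V : Type} [DecidableEq V]

lemma Bd.det {𝒢 : Set (SimpleGraph V)} {E E' : Finset (V × V)} {x : ℝ} (h : Bd 𝒢 E x)
    (hd : ∀ G ∈ 𝒢, ∀ G' ∈ 𝒢, tr E G = tr E G' → tr E' G = tr E' G') : Bd 𝒢 E' x := by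
  refine le_trans ?_ h
  norm_cast
  set φ : Finset (V × V) → Finset (V × V) := fun Z =>
    if h : ∃ G ∈ 𝒢, tr E G = Z then tr E' h.choose else ∅ with hφ
  have : (tr E') '' 𝒢 ⊆ φ '' (tr E '' 𝒢) := by
    rintro _ ⟨G, hG, rfl⟩
    refine ⟨tr E G, ⟨G, hG, rfl⟩, ?_⟩
    have hex : ∃ G' ∈ 𝒢, tr E G' = tr E G := ⟨G, hG, rfl⟩
    simp only [hφ]
    rw [dif_pos hex]
    exact hd _ hex.choose_spec.1 _ hG hex.choose_spec.2
  exact (Set.ncard_le_ncard this ((tr_fin _ _).image _)).trans (Set.ncard_image_le (tr_fin _ _))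

lemma Bd.sym {𝒢 : Set (SimpleGraph V)} {E E' : Finset (V × V)} {x : ℝ} (h : Bd 𝒢 E x)
    (hE : ∀ a b, (a, b) ∈ E' → a ≠ b → (a, b) ∈ E ∨ (b, a) ∈ E) : Bd 𝒢 E' x := by
  refine h.det ?_
  intro G _ G' _ he
  have key : ∀ a b, (a, b) ∈ E → (G.Adj a b ↔ G'.Adj a b) := by
    intro a b hab
    have := congrArg ((a, b) ∈ ·) he
    simpa [mem_tr, hab] using this
  ext ⟨a, b⟩
  simp only [mem_tr]
  refine and_congr_right fun hab => ?_
  by_cases hne : a = b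
  · subst hne; simp
  · rcases hE a b hab hne with h | h
    · exact key a b h
    · rw [G.adj_comm, G'.adj_comm]; exact key b a h

lemma ball_card {α : Type} [DecidableEq α] (E : Finset α) (d : ℕ) : (ball E (d:ℝ)).card ≤ (E.card + 1) ^ d := by
  have h1 : ball E (d:ℝ) ⊆ (univ : Finset (Fin d → Option E)).image
      (fun q => (univ.filter (fun e : E => ∃ i, q i = some e)).map (Function.Embedding.subtype _)) := by
    intro D hD
    simp only [ball, mem_filter, mem_powerset, Nat.cast_le] at hD
    rw [mem_image]
    refine ⟨fun i => if h : (i:ℕ) < D.card then some ⟨(D.equivFin.symm ⟨i, h⟩ : D), hD.1 (D.equivFin.symm ⟨i, h⟩).2⟩ else none,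
      mem_univ _, ?_⟩
    ext v
    simp only [Finset.mem_map, mem_filter, mem_univ, true_and, Function.Embedding.subtype_apply]
    constructor
    · rintro ⟨e, ⟨i, hi⟩, rfl⟩
      split_ifs at hi with h
      rw [Option.some.injEq] at hi
      rw [← hi]
      exact (D.equivFin.symm ⟨i, h⟩).2
    · intro hv
      refine ⟨⟨v, hD.1 hv⟩, ⟨⟨D.equivFin ⟨v, hv⟩, lt_of_lt_of_le (D.equivFin ⟨v, hv⟩).2 hD.2⟩, ?_⟩, rfl⟩
      simp
  refine (card_le_card h1).trans (card_image_le.trans ?_)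
  simp

/-- few deviations from the constant pattern -/
lemma Bd.few (c : Bool) {𝒢 : Set (SimpleGraph V)} {E : Finset (V × V)} (d : ℕ)
    (h : ∀ G ∈ 𝒢, (E.filter (fun z => ¬ (G.Adj z.1 z.2 ↔ c = true))).card ≤ d) :
    Bd 𝒢 E (d * Real.logb 2 (E.card + 1)) := by
  have := Bd.ball (𝒢 := 𝒢) (E := E) (d := (d:ℝ)) (x := d * Real.logb 2 (E.card + 1)) (y := 0)
    {if c = true then E else ∅} ?_ ?_ (by simp)
  · simpa using this
  · intro G hG
    refine ⟨_, mem_singleton_self _, ?_⟩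
    refine Nat.cast_le.2 (le_trans (le_of_eq ?_) (h G hG))
    congr 1
    ext z
    cases c <;> simp [mem_symmDiff, mem_tr] <;> tauto
  · rw [mul_comm, Real.rpow_mul (by norm_num), Real.rpow_logb (by norm_num) (by norm_num) (by positivity),
      Real.rpow_natCast]
    exact_mod_cast ball_card E d

/-- Seinsche's theorem, one step -/
lemma seinsche_step {G : SimpleGraph V} {W A B : Finset V} {v : V} (hv : v ∉ W) (hP : P4Free G (insert v W))
    (hA : A.Nonempty) (hB : B.Nonempty) (hd : Disjoint A B) (hu : A ∪ B = W) (h0 : ∀ a ∈ A, ∀ b ∈ B, ¬ G.Adj a b) :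
    ∃ (A B : Finset V) (c : Bool), A.Nonempty ∧ B.Nonempty ∧ Disjoint A B ∧ A ∪ B = insert v W ∧
      ∀ a ∈ A, ∀ b ∈ B, (G.Adj a b ↔ c = true) := by
  subst hu
  rw [mem_union] at hv
  push Not at hv
  rw [Finset.disjoint_left] at hd
  -- a general construction from a part `D` not adjacent to the rest
  have mk : ∀ D : Finset V, D.Nonempty → D ⊆ A ∪ B → (∀ a ∈ D, ∀ b ∈ insert v (A ∪ B), b ∉ D → ¬ G.Adj a b) →
      ∃ (A' B' : Finset V) (c : Bool), A'.Nonempty ∧ B'.Nonempty ∧ Disjoint A' B' ∧ A' ∪ B' = insert v (A ∪ B) ∧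
      ∀ a ∈ A', ∀ b ∈ B', (G.Adj a b ↔ c = true) := by
    intro D hD hDs h
    have hvD : v ∉ D := fun hh => by
      have := hDs hh
      rw [mem_union] at this
      tauto
    refine ⟨D, insert v (A ∪ B) \ D, false, hD, ⟨v, by simp [hvD]⟩, disjoint_sdiff, ?_, ?_⟩
    · exact Finset.union_sdiff_of_subset (hDs.trans (subset_insert _ _))
    · intro a ha b hb
      rw [Finset.mem_sdiff] at hb
      simp [h a ha b hb.1 hb.2]
  by_cases h1 : ∀ w ∈ A ∪ B, G.Adj v w
  · refine ⟨{v}, A ∪ B, true, by simp, hA.mono subset_union_left, by simp [hv], by rw [insert_eq], ?_⟩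
    intro a ha b hb
    rw [mem_singleton] at ha
    subst ha
    simp [h1 b hb]
  push Not at h1
  -- the symmetric main argument
  have main : ∀ A' B' : Finset V, A' ∪ B' = A ∪ B → B'.Nonempty → (∀ a, a ∈ A' → a ∉ B') →
      (∀ a ∈ A', ∀ b ∈ B', ¬ G.Adj a b) → v ∉ A' → v ∉ B' →
      (∃ w ∈ A', ¬ G.Adj v w) → ∃ (A' B' : Finset V) (c : Bool), A'.Nonempty ∧ B'.Nonempty ∧ Disjoint A' B' ∧
        A' ∪ B' = insert v (A ∪ B) ∧ ∀ a ∈ A', ∀ b ∈ B', (G.Adj a b ↔ c = true) := by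
    rintro A' B' hu hB' hd h0 hvA hvB ⟨w, hw, hvw⟩
    have hAs : A' ⊆ A ∪ B := hu ▸ subset_union_left
    have hBs : B' ⊆ A ∪ B := hu ▸ subset_union_right
    by_cases h2 : ∃ d ∈ B', G.Adj v d
    · obtain ⟨d, hd', hvd⟩ := h2
      by_cases h3 : ∃ a ∈ A', ∃ b ∈ A', G.Adj v a ∧ ¬ G.Adj v b ∧ G.Adj a b
      · exfalso
        obtain ⟨a, ha, b, hb, va, vb, ab⟩ := h3
        have := hP d (by simp [hBs hd', -mem_union]) v (by simp) a (by simp [hAs ha, -mem_union]) b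
          (by simp [hAs hb, -mem_union]) hvd.symm va ab (fun h => h0 a ha d hd' h.symm) vb
        exact h0 b hb d hd' this.symm
      · push Not at h3
        refine mk (A'.filter (fun w => ¬ G.Adj v w)) ⟨w, by simp [hw, hvw]⟩ ((filter_subset _ _).trans hAs) ?_
        intro a ha b hb hbn hab
        simp only [mem_filter] at ha hbn
        rw [← hu, mem_insert, mem_union] at hb
        rcases hb with rfl | hb | hb
        · exact ha.2 hab.symm
        · have : G.Adj v b := by by_contra hh; exact hbn ⟨hb, hh⟩
          exact h3 b hb a ha.1 this ha.2 hab.symm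
        · exact h0 a ha.1 b hb hab
    · push Not at h2
      refine mk B' hB' hBs ?_
      intro a ha b hb hbn hab
      rw [← hu, mem_insert, mem_union] at hb
      rcases hb with rfl | hb | hb
      · exact h2 a ha hab.symm
      · exact h0 b hb a ha hab.symm
      · exact hbn hb
  obtain ⟨w, hw, hvw⟩ := h1
  rw [mem_union] at hw
  rcases hw with hw | hw
  · exact main A B rfl hB (fun a ha => hd ha) h0 hv.1 hv.2 ⟨w, hw, hvw⟩
  · exact main B A (union_comm _ _) hA (fun a ha ha' => hd ha' ha) (fun a ha b hb h => h0 b hb a ha h.symm)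
      hv.2 hv.1 ⟨w, hw, hvw⟩

lemma P4Free.compl {G : SimpleGraph V} {W : Finset V} (h : P4Free G W) : P4Free Gᶜ W := by
  intro a ha b hb c hc d hd ab bc cd ac bd
  by_contra ad
  simp only [compl_adj, not_and, not_not] at *
  have n1 : a ≠ c := by rintro rfl; exact cd.2 (ad cd.1)
  have n2 : a ≠ d := by rintro rfl; exact ab.2 (bd ab.1.symm).symm
  have n3 : b ≠ d := by rintro rfl; exact ab.2 (ad ab.1)
  exact bc.2 (h b hb d hd a ha c hc (bd n3) (ad n2).symm (ac n1) (fun h => ab.2 h.symm) (fun h => cd.2 h.symm))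

lemma seinsche {G : SimpleGraph V} (W : Finset V) : P4Free G W → 2 ≤ W.card →
    ∃ (A B : Finset V) (c : Bool), A.Nonempty ∧ B.Nonempty ∧ Disjoint A B ∧ A ∪ B = W ∧
      ∀ a ∈ A, ∀ b ∈ B, (G.Adj a b ↔ c = true) := by
  induction W using Finset.induction_on with
  | empty => intro _ h; simp at h
  | insert v W hv ih =>
    intro hP hc
    by_cases h2 : 2 ≤ W.card
    · obtain ⟨A, B, c, hA, hB, hd, hu, h⟩ := ih (hP.mono (subset_insert _ _)) h2
      cases c
      · exact seinsche_step hv hP hA hB hd hu (fun a ha b hb => by simp [h a ha b hb])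
      · obtain ⟨A', B', c, hA', hB', hd', hu', h'⟩ := seinsche_step (G := Gᶜ) hv hP.compl hA hB hd hu
          (fun a ha b hb => by simp [h a ha b hb])
        refine ⟨A', B', !c, hA', hB', hd', hu', ?_⟩
        intro a ha b hb
        have hne : a ≠ b := by rintro rfl; exact (Finset.disjoint_left.1 hd') ha hb
        have := h' a ha b hb
        rw [compl_adj] at this
        cases c <;> simp_all
    · rw [card_insert_of_notMem hv] at hc
      have : W.card = 1 := by omega
      obtain ⟨w, rfl⟩ := card_eq_one.1 this
      refine ⟨{v}, {w}, decide (G.Adj v w), by simp, by simp, by simpa using hv, by rw [insert_eq], by simp⟩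

lemma twins {G : SimpleGraph V} : ∀ (m : ℕ) (W : Finset V), W.card = m → P4Free G W → 2 ≤ W.card →
    ∃ x ∈ W, ∃ y ∈ W, x ≠ y ∧ ∀ z ∈ W, z ≠ x → z ≠ y → (G.Adj x z ↔ G.Adj y z) := by
  intro m
  induction m using Nat.strong_induction_on with
  | _ m ih =>
    intro W hm hP h2
    obtain ⟨A, B, c, hA, hB, hd, rfl, h⟩ := seinsche W hP h2
    have hcu := card_union_of_disjoint hd
    have a1 := hA.card_pos
    have b1 := hB.card_pos
    by_cases hA2 : 2 ≤ A.card
    · obtain ⟨x, hx, y, hy, hne, hxy⟩ := ih A.card (by omega) A rfl (hP.mono subset_union_left) hA2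
      refine ⟨x, by simp [hx], y, by simp [hy], hne, fun z hz h1 h2 => ?_⟩
      rcases mem_union.1 hz with hz | hz
      · exact hxy z hz h1 h2
      · rw [h x hx z hz, h y hy z hz]
    by_cases hB2 : 2 ≤ B.card
    · obtain ⟨x, hx, y, hy, hne, hxy⟩ := ih B.card (by omega) B rfl (hP.mono subset_union_right) hB2
      refine ⟨x, by simp [hx], y, by simp [hy], hne, fun z hz h1 h2 => ?_⟩
      rcases mem_union.1 hz with hz | hz
      · rw [G.adj_comm, G.adj_comm y, h z hz x hx, h z hz y hy]
      · exact hxy z hz h1 h2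
    obtain ⟨x, hx⟩ := card_eq_one.1 (by omega : A.card = 1)
    obtain ⟨y, hy⟩ := card_eq_one.1 (by omega : B.card = 1)
    subst hx hy
    refine ⟨x, by simp, y, by simp, by simpa using hd, ?_⟩
    intro z hz h1 h2
    simp at hz; tauto

/-- number of cographs -/
lemma cog_count [Fintype V] (hV : 2 ≤ Fintype.card V) (m : ℕ) : ∀ S : Finset V, S.card = m →
    Bd {G : SimpleGraph V | P4Free G S} (S ×ˢ S) (m * (3 * Real.logb 2 (Fintype.card V))) := by
  have hl : 1 ≤ Real.logb 2 (Fintype.card V) := by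
    rw [Real.le_logb_iff_rpow_le (by norm_num) (by exact_mod_cast (by omega : 0 < Fintype.card V))]
    simpa using hV
  induction m with
  | zero =>
    intro S hS
    rw [card_eq_zero] at hS; subst hS
    simpa using Bd.triv {G : SimpleGraph V | P4Free G ∅} ∅
  | succ m ih =>
    intro S hS
    by_cases hm : m = 0
    · subst hm
      obtain ⟨v, rfl⟩ := card_eq_one.1 hS
      refine ((Bd.triv _ _).sym (E := ∅) ?_).mono ?_
      · rintro a b h hne; simp at h; exact absurd (h.1.trans h.2.symm) hne
      · simp; linarith
    have := Bd.lab (L := V × V) (𝒢 := {G : SimpleGraph V | P4Free G S}) (E := S ×ˢ S)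
      (x := m * (3 * Real.logb 2 (Fintype.card V)) + 1) (y := 2 * Real.logb 2 (Fintype.card V))
      (fun l => {G | P4Free G S ∧ l.1 ∈ S ∧ l.2 ∈ S ∧ l.1 ≠ l.2 ∧ ∀ z ∈ S, z ≠ l.1 → z ≠ l.2 → (G.Adj l.1 z ↔ G.Adj l.2 z)})
      ?_ ?_ ?_
    · refine this.mono ?_
      push_cast
      linarith
    · intro G hG
      obtain ⟨x, hx, y, hy, hne, h⟩ := twins _ S rfl hG (by omega)
      exact ⟨(x, y), hG, hx, hy, hne, h⟩
    · rintro ⟨x, y⟩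
      by_cases hs : x ∈ S ∧ y ∈ S ∧ x ≠ y
      swap
      · refine (Bd.empty _ _).mono_set ?_
        rintro G ⟨-, h1, h2, h3, -⟩
        exact hs ⟨h1, h2, h3⟩
      obtain ⟨hx, hy, hne⟩ := hs
      have h1 := ih (S.erase x) (by rw [card_erase_of_mem hx]; omega)
      have h2 := (h1.mono_set (𝒢 := {G | P4Free G S ∧ x ∈ S ∧ y ∈ S ∧ x ≠ y ∧
        ∀ z ∈ S, z ≠ x → z ≠ y → (G.Adj x z ↔ G.Adj y z)}) (fun G hG => hG.1.mono (erase_subset _ _))).union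
        (Bd.triv _ {(x, y)})
      rw [card_singleton, Nat.cast_one] at h2
      refine h2.det ?_
      rintro G ⟨-, -, -, -, hG⟩ G' ⟨-, -, -, -, hG'⟩ he
      have key : ∀ a b, (a, b) ∈ (S.erase x) ×ˢ (S.erase x) ∪ {(x, y)} → (G.Adj a b ↔ G'.Adj a b) := by
        intro a b hab
        have := congrArg ((a, b) ∈ ·) he
        simpa only [mem_tr, hab, true_and, eq_iff_iff] using this
      have kx : ∀ b ∈ S, (G.Adj x b ↔ G'.Adj x b) := by
        intro b hb
        by_cases hbx : b = x
        · subst hbx; simp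
        by_cases hby : b = y
        · subst hby; exact key _ _ (by simp)
        rw [hG b hb hbx hby, hG' b hb hbx hby]
        exact key _ _ (by simp [hb, hbx, hy, hne.symm])
      ext ⟨a, b⟩
      simp only [mem_tr, mem_product]
      refine and_congr_right fun hab => ?_
      by_cases ha : a = x
      · subst ha; exact kx b hab.2
      by_cases hb : b = x
      · subst hb; rw [G.adj_comm, G'.adj_comm]; exact kx a hab.1
      exact key _ _ (by simp [ha, hb, hab])
    · have h0 : (0:ℝ) < Fintype.card V := by exact_mod_cast (by omega : 0 < Fintype.card V)
      rw [mul_comm, Real.rpow_mul (by norm_num), Real.rpow_logb (by norm_num) (by norm_num) h0]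
      simp [sq]

end cog
end C6P
end Part15

section Part16
open SimpleGraph Filter
open scoped Classical
namespace C6P
open Finset

section scale

noncomputable def sc (n : ℕ) : ℕ := Nat.findGreatest (fun L => L ^ 20 ≤ n) n

lemma sc_le (n : ℕ) : sc n ^ 20 ≤ n :=
  Nat.findGreatest_spec (P := fun L => L ^ 20 ≤ n) (m := 0) (Nat.zero_le _) (by simp)

lemma le_sc {n c : ℕ} (h : c ^ 20 ≤ n) : c ≤ sc n :=
  Nat.le_findGreatest ((Nat.le_self_pow (by norm_num) c).trans h) h

lemma lt_sc (n : ℕ) : n < (sc n + 1) ^ 20 := by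
  by_contra h
  have := le_sc (not_lt.mp h)
  omega

lemma scale (η : ℝ) (hη : 0 < η) (c : ℕ) : ∃ n0, ∀ n ≥ n0, c ≤ sc n ∧ sc n ^ 20 ≤ n ∧ n ≤ 2 * sc n ^ 20 ∧
    Real.logb 2 n ≤ η * sc n ∧ 1 ≤ Real.logb 2 n ∧ 100 ≤ sc n := by
  obtain ⟨n1, h1⟩ := log_small η hη 20
  refine ⟨(c + n1 + 100) ^ 20, fun n hn => ?_⟩
  have h2 : c + n1 + 100 ≤ sc n := le_sc hn
  have h3 : n ≤ 2 * sc n ^ 20 := by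
    have h4 : ((sc n + 1 : ℕ) : ℝ) ^ 20 ≤ 2 * (sc n : ℝ) ^ 20 := by
      have h5 : (100:ℝ) * ((sc n + 1 : ℕ) : ℝ) ≤ 101 * sc n := by
        have : 100 ≤ sc n := by omega
        have : (100:ℝ) ≤ sc n := by exact_mod_cast this
        push_cast; linarith
      have h6 : ((100:ℝ) * ((sc n + 1 : ℕ) : ℝ)) ^ 20 ≤ (101 * sc n) ^ 20 :=
        pow_le_pow_left₀ (by positivity) h5 20
      rw [mul_pow, mul_pow] at h6
      have h7 : (101:ℝ)^20 ≤ 2 * 100^20 := by norm_num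
      have h8 : (0:ℝ) ≤ (sc n : ℝ)^20 := by positivity
      have h9 : (100:ℝ)^20 * ((sc n + 1 : ℕ) : ℝ) ^ 20 ≤ 100^20 * (2 * (sc n : ℝ) ^ 20) := by
        calc _ ≤ _ := h6
          _ ≤ (2 * 100^20) * (sc n : ℝ)^20 := mul_le_mul_of_nonneg_right h7 h8
          _ = _ := by ring
      exact le_of_mul_le_mul_left h9 (by positivity)
    have h5 : (sc n + 1) ^ 20 ≤ 2 * sc n ^ 20 := by exact_mod_cast h4
    exact (lt_sc n).le.trans h5
  have hn2 : 2 ≤ n := by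
    have : 2 ^ 1 ≤ sc n ^ 20 := by
      calc 2 ^ 1 ≤ 2 ^ 20 := by norm_num
        _ ≤ sc n ^ 20 := Nat.pow_le_pow_left (by omega) _
    exact this.trans (sc_le n)
  refine ⟨by omega, sc_le n, h3, ?_, ?_, by omega⟩
  · have h4 := h1 (sc n) (by omega)
    refine le_trans ?_ h4
    have h5 : (n:ℝ) ≤ 2 * (sc n:ℝ)^20 := by exact_mod_cast h3
    have h0 : (0:ℝ) < sc n := by exact_mod_cast (by omega : 0 < sc n)
    calc Real.logb 2 n ≤ Real.logb 2 (2 * (sc n:ℝ)^20) :=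
          Real.logb_le_logb_of_le (by norm_num) (by exact_mod_cast (by omega : 0 < n)) h5
      _ = 1 + 20 * Real.logb 2 (sc n) := by
        rw [Real.logb_mul (by norm_num) (by positivity), Real.logb_pow]; simp
      _ ≤ _ := by linarith
  · rw [Real.le_logb_iff_rpow_le (by norm_num) (by exact_mod_cast (by omega : 0 < n))]
    simpa using (by exact_mod_cast hn2 : (2:ℝ) ≤ n)

lemma g_two' {n k L : ℕ} (hk : 8 ≤ k) (h : 2 * k ≤ n) (hL : L ^ 2 ≤ k) :
    (g (n - 2 * k) : ℝ) * 2 ^ ((k:ℝ) * (n - 2 * k) + k ^ 2 + L ^ 3 / 64) ≤ g n := by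
  obtain ⟨K, hK, p, hp, he⟩ := exists_thin k hk
  have h1 := g_two (n - 2 * k) k K hK
  rw [show n - 2 * k + (k + k) = n by omega] at h1
  have h2 : (g (n - 2 * k) : ℝ) * 2 ^ (k * (n - 2 * k) + k * k + K.edgeFinset.card) ≤ g n := by exact_mod_cast h1
  refine le_trans ?_ h2
  refine mul_le_mul_of_nonneg_left ?_ (Nat.cast_nonneg _)
  rw [← Real.rpow_natCast (2:ℝ)]
  refine Real.rpow_le_rpow_of_exponent_le (by norm_num) ?_
  push_cast [Nat.cast_sub h]
  have h3 : L ≤ 4 * p := by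
    have : L ^ 2 ≤ (4 * p) ^ 2 := by rw [mul_pow]; omega
    exact (Nat.pow_le_pow_iff_left (by norm_num)).mp this
  have h4 : L ^ 3 ≤ 64 * K.edgeFinset.card := by
    calc L ^ 3 ≤ (4 * p) ^ 3 := Nat.pow_le_pow_left h3 3
      _ = 64 * p ^ 3 := by ring
      _ ≤ _ := by omega
  have h5 : (L:ℝ) ^ 3 ≤ 64 * K.edgeFinset.card := by exact_mod_cast h4
  nlinarith

lemma g_low {n L : ℕ} (hn : 20 ≤ n) (hL : (L ^ 10) ^ 2 ≤ n) :
    (2:ℝ) ^ ((n:ℝ) ^ 2 / 4 - 1 + L ^ 30 / 64) ≤ g n := by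
  obtain ⟨K, hK, p, hp, he⟩ := exists_thin (n / 2) (by omega)
  have h1 := g_two (n % 2) (n / 2) K hK
  rw [show n % 2 + (n / 2 + n / 2) = n by omega] at h1
  have h0 : 1 ≤ g (n % 2) := g_pos _
  have h2 : (2:ℝ) ^ ((n/2) * (n % 2) + (n/2) * (n/2) + K.edgeFinset.card) ≤ g n := by
    exact_mod_cast (Nat.le_mul_of_pos_left _ h0).trans h1
  refine le_trans ?_ h2
  rw [← Real.rpow_natCast (2:ℝ)]
  refine Real.rpow_le_rpow_of_exponent_le (by norm_num) ?_
  have h3 : L ^ 10 ≤ 4 * p := by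
    have : (L ^ 10) ^ 2 ≤ (4 * p) ^ 2 := by rw [mul_pow]; omega
    exact (Nat.pow_le_pow_iff_left (by norm_num)).mp this
  have h4 : L ^ 30 ≤ 64 * K.edgeFinset.card := by
    calc L ^ 30 = (L ^ 10) ^ 3 := by ring
      _ ≤ (4 * p) ^ 3 := Nat.pow_le_pow_left h3 3
      _ = 64 * p ^ 3 := by ring
      _ ≤ _ := by omega
  have h5 : (L:ℝ) ^ 30 ≤ 64 * K.edgeFinset.card := by exact_mod_cast h4
  have h6 : n ^ 2 ≤ 4 * ((n/2) * (n % 2) + (n/2) * (n/2)) + 1 := by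
    have ha : n = 2 * (n/2) + n % 2 := by omega
    rcases Nat.mod_two_eq_zero_or_one n with h | h <;> rw [h] at ha ⊢ <;> nlinarith
  have h7 : (n:ℝ)^2 ≤ 4 * (((n/2) * (n % 2) + (n/2) * (n/2) : ℕ) : ℝ) + 1 := by exact_mod_cast h6
  push_cast at h7 ⊢
  linarith

end scale

section cd
variable {V : Type} [DecidableEq V]

/-- number of non-neighbours of `t` in `W` (counting `t` itself) -/
noncomputable def cdeg (G : SimpleGraph V) (W : Finset V) (t : V) : ℕ := (W.filter (fun w => ¬ G.Adj t w)).card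

lemma cdeg_mono {G : SimpleGraph V} {W W' : Finset V} (h : W ⊆ W') (t : V) : cdeg G W t ≤ cdeg G W' t :=
  card_le_card (filter_subset_filter _ h)

lemma cog5_pairs {G : SimpleGraph V} {T W : Finset V} (h : CoG5 G T) (hW : W ⊆ T) :
    ∑ t ∈ T, ((W.filter (fun w => w ≠ t ∧ ¬ G.Adj t w)).offDiag).card ≤ W.card ^ 2 := by
  rw [← card_sigma, pow_two, ← card_product]
  refine card_le_card_of_injOn (fun z => z.2) ?_ ?_
  · rintro ⟨t, w, w'⟩ hz
    simp at hz ⊢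
    tauto
  · rintro ⟨t, w, w'⟩ hz ⟨t', v, v'⟩ hz' he
    simp at hz hz' he
    obtain ⟨rfl, rfl⟩ := he
    obtain ⟨ht, ⟨hw, wt, tw⟩, ⟨hw', wt', tw'⟩, ww⟩ := hz
    obtain ⟨ht', ⟨_, vt, tv⟩, ⟨_, vt', tv'⟩, _⟩ := hz'
    by_contra hne
    have hne : t ≠ t' := by rintro rfl; exact hne rfl
    have e1 : G.Adj w w' := by
      rcases h.1 t ht w (hW hw) w' (hW hw') (Ne.symm wt) (Ne.symm wt') ww with h | h | h <;> tauto
    have e2 : G.Adj t t' := by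
      rcases h.1 t ht t' ht' w (hW hw) hne (Ne.symm wt) (Ne.symm vt) with h | h | h <;> tauto
    have := h.2 t ht t' ht' w (hW hw) w' (hW hw') e2 e1
    tauto

lemma cog5_sum {G : SimpleGraph V} {T W : Finset V} (h : CoG5 G T) (hW : W ⊆ T) (K : ℕ) :
    K * ∑ t ∈ T, cdeg G W t ≤ (K ^ 2 + K) * T.card + W.card ^ 2 := by
  have h1 := cog5_pairs h hW
  have h2 : ∀ t ∈ T, K * cdeg G W t ≤ (K ^ 2 + K) + ((W.filter (fun w => w ≠ t ∧ ¬ G.Adj t w)).offDiag).card := by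
    intro t _
    have h3 : cdeg G W t ≤ (W.filter (fun w => w ≠ t ∧ ¬ G.Adj t w)).card + 1 := by
      have : W.filter (fun w => ¬ G.Adj t w) ⊆ insert t (W.filter (fun w => w ≠ t ∧ ¬ G.Adj t w)) := by
        intro w hw
        simp at hw ⊢
        tauto
      exact (card_le_card this).trans (card_insert_le _ _)
    rw [offDiag_card]
    set d := (W.filter (fun w => w ≠ t ∧ ¬ G.Adj t w)).card
    have h4 : K * d ≤ K ^ 2 + (d * d - d) := by
      by_cases hd : d ≤ K
      · nlinarith [Nat.mul_le_mul_left K hd]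
      · have : d * d - d = d * (d - 1) := by rw [Nat.mul_sub]; simp
        rw [this]
        have : d * K ≤ d * (d - 1) := Nat.mul_le_mul_left _ (by omega)
        nlinarith
    nlinarith [Nat.mul_le_mul_left K h3]
  calc K * ∑ t ∈ T, cdeg G W t = ∑ t ∈ T, K * cdeg G W t := mul_sum _ _ _
    _ ≤ ∑ t ∈ T, ((K ^ 2 + K) + ((W.filter (fun w => w ≠ t ∧ ¬ G.Adj t w)).offDiag).card) := sum_le_sum h2
    _ = T.card * (K ^ 2 + K) + ∑ t ∈ T, ((W.filter (fun w => w ≠ t ∧ ¬ G.Adj t w)).offDiag).card := by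
      rw [sum_add_distrib, sum_const, smul_eq_mul]
    _ ≤ _ := by rw [mul_comm]; omega

lemma cog5_prod {G : SimpleGraph V} {T W : Finset V} :
    ((T ×ˢ W).filter (fun z => ¬ (G.Adj z.1 z.2 ↔ true = true))).card = ∑ t ∈ T, cdeg G W t := by
  unfold cdeg
  rw [← card_sigma]
  refine card_bij' (fun z _ => ⟨z.1, z.2⟩) (fun z _ => (z.1, z.2)) ?_ ?_ ?_ ?_ <;> simp
  · tauto
  · intro a h1 h2 h3; tauto

/-- at most `d` entries differ from `c` -/
lemma Bd.few' [Fintype V] (hV : 2 ≤ Fintype.card V) (c : Bool) {𝒢 : Set (SimpleGraph V)} {E : Finset (V × V)} (d : ℕ)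
    (h : ∀ G ∈ 𝒢, (E.filter (fun z => ¬ (G.Adj z.1 z.2 ↔ c = true))).card ≤ d) :
    Bd 𝒢 E (d * (3 * Real.logb 2 (Fintype.card V))) := by
  refine (Bd.few c d h).mono ?_
  refine mul_le_mul_of_nonneg_left ?_ (Nat.cast_nonneg _)
  have h1 : E.card + 1 ≤ (Fintype.card V) ^ 3 := by
    have : E.card ≤ Fintype.card V * Fintype.card V := by
      have := card_le_univ E; simpa using this
    have h2 : 2 * (Fintype.card V) ^ 2 ≤ Fintype.card V ^ 3 := by
      rw [pow_succ _ 2, mul_comm]; exact Nat.mul_le_mul_left _ hV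
    nlinarith
  have h2 : ((E.card : ℝ) + 1) ≤ (Fintype.card V : ℝ) ^ 3 := by exact_mod_cast h1
  calc Real.logb 2 (E.card + 1) ≤ Real.logb 2 ((Fintype.card V : ℝ) ^ 3) :=
        Real.logb_le_logb_of_le (by norm_num) (by positivity) h2
    _ = _ := by rw [Real.logb_pow]; norm_num

end cd
end C6P
end Part16

section Part17
open SimpleGraph Filter
open scoped Classical
namespace C6P
open Finset

section a2

def A2bad {n : ℕ} (M L : ℕ) (G : SimpleGraph (Fin n)) (S T W : Finset (Fin n)) : Prop :=
  Disjoint S T ∧ (S ∪ T)ᶜ.card ≤ M ∧ P4Free G S ∧ W ⊆ T ∧ W.card ≤ 8 * L ^ 19 ∧ P4Free G (T \ W) ∧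
    (CoG5 G T ∨ W = ∅)

lemma disj_card {n : ℕ} {S T : Finset (Fin n)} (h : Disjoint S T) : S.card + T.card ≤ n := by
  rw [← card_union_of_disjoint h]
  simpa using card_le_univ (S ∪ T)

lemma disj_prod {n : ℕ} {S T : Finset (Fin n)} (h : Disjoint S T) : ((S ×ˢ T).card : ℝ) ≤ (n:ℝ)^2/4 := by
  have h1 : (S.card + T.card : ℝ) ≤ n := by exact_mod_cast disj_card h
  rw [card_product]; push_cast
  have h2 : (S.card + T.card : ℝ)^2 ≤ (n:ℝ)^2 := pow_le_pow_left₀ (by positivity) h1 2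
  nlinarith [sq_nonneg ((S.card:ℝ) - T.card)]

lemma a2_sum {n L : ℕ} (hL : 1 ≤ L) (hn : n ≤ 2 * L ^ 20) {G : SimpleGraph (Fin n)} {T W : Finset (Fin n)}
    (h : CoG5 G T) (hW : W ⊆ T) (hc : W.card ≤ 8 * L ^ 19) : ∑ t ∈ T, cdeg G W t ≤ 68 * L ^ 29 := by
  have h1 := cog5_sum h hW (L ^ 9)
  have h2 : T.card ≤ 2 * L ^ 20 := by
    have := card_le_univ T
    simp at this; omega
  have h3 : ((L^9)^2 + L^9) * T.card ≤ ((L^9)^2 + (L^9)^2) * (2 * L ^ 20) :=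
    Nat.mul_le_mul (Nat.add_le_add_left (Nat.le_self_pow (by norm_num) _) _) h2
  have h4 : W.card ^ 2 ≤ (8 * L^19)^2 := Nat.pow_le_pow_left hc 2
  have h5 : L ^ 9 * ∑ t ∈ T, cdeg G W t ≤ L ^ 9 * (68 * L ^ 29) := by
    calc _ ≤ _ := h1
      _ ≤ ((L^9)^2 + (L^9)^2) * (2 * L ^ 20) + (8 * L^19)^2 := Nat.add_le_add h3 h4
      _ = _ := by ring
  exact Nat.le_of_mul_le_mul_left h5 (by positivity)

lemma a2_fib {n M L : ℕ} (hn2 : 2 ≤ n) (hL : 1 ≤ L) (hn : n ≤ 2 * L ^ 20) (S T W : Finset (Fin n)) :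
    Bd {G | A2bad M L G S T W} ((univ : Finset (Fin n)) ×ˢ univ)
      ((n:ℝ)^2/4 + M * n + 6 * n * Real.logb 2 n + (68 * L ^ 29) * (3 * Real.logb 2 n)) := by
  by_cases hs : Disjoint S T ∧ (S ∪ T)ᶜ.card ≤ M ∧ W ⊆ T ∧ W.card ≤ 8 * L ^ 19
  swap
  · refine (Bd.empty _ _).mono_set ?_
    rintro G ⟨h1, h2, h3, h4, h5, h6, h7⟩
    exact hs ⟨h1, h2, h4, h5⟩
  obtain ⟨hd, hQ, hW, hWc⟩ := hs
  have hl : 0 ≤ Real.logb 2 n := Real.logb_nonneg (by norm_num) (by exact_mod_cast (by omega : 1 ≤ n))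
  set 𝒢 := {G | A2bad M L G S T W} with h𝒢
  have b1 : Bd 𝒢 (S ×ˢ T) ((n:ℝ)^2/4) := (Bd.triv _ _).mono (disj_prod hd)
  have b2 : ∀ U, (∀ G ∈ 𝒢, P4Free G U) → Bd 𝒢 (U ×ˢ U) (3 * n * Real.logb 2 n) := by
    intro U hU
    have := (cog_count (V := Fin n) (by simpa using hn2) U.card U rfl).mono_set (𝒢 := 𝒢) hU
    refine this.mono ?_
    have h1 := card_fin_le U
    simp only [Fintype.card_fin]
    nlinarith [mul_le_mul_of_nonneg_right h1 hl]
  have b3 := b2 S (fun G hG => hG.2.2.1)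
  have b4 := b2 (T \ W) (fun G hG => hG.2.2.2.2.2.1)
  have b5 : Bd 𝒢 (T ×ˢ W) ((68 * L ^ 29) * (3 * Real.logb 2 n)) := by
    have := Bd.few' (V := Fin n) (by simpa using hn2) true (𝒢 := 𝒢) (E := T ×ˢ W) (68 * L ^ 29) ?_
    · simpa using this
    · intro G hG
      rw [cog5_prod]
      rcases hG.2.2.2.2.2.2 with h | h
      · exact a2_sum hL hn h hW hWc
      · subst h; simp [cdeg]
  have b6 : Bd 𝒢 ((S ∪ T)ᶜ ×ˢ univ) (M * n) := by
    refine (Bd.triv _ _).mono ?_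
    rw [card_product]; push_cast
    simp only [card_univ, Fintype.card_fin]
    exact mul_le_mul_of_nonneg_right (by exact_mod_cast hQ) (Nat.cast_nonneg _)
  refine Bd.sym (((((b1.union b3).union b4).union b5).union b6).mono ?_) ?_
  · exact le_of_eq (by ring)
  · intro a b _ _
    simp only [mem_product, mem_union, mem_compl, Finset.mem_sdiff, mem_univ]
    clear b1 b2 b3 b4 b5 b6
    by_cases h1 : a ∈ S <;> by_cases h2 : a ∈ T <;> by_cases h3 : a ∈ W <;> by_cases h4 : b ∈ S <;>
      by_cases h5 : b ∈ T <;> by_cases h6 : b ∈ W <;> simp only [h1, h2, h3, h4, h5, h6] <;> simp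

lemma a2_arith {n M L : ℕ} {l ε : ℝ} (hM : 1000000 + M ≤ L) (hε : 2 ^ (-(L:ℝ)) ≤ ε) (h1 : n ≤ 2 * L ^ 20)
    (h2 : L ^ 20 ≤ n) (hl : l ≤ 1 / 2 ^ 16 * L) (hl1 : 1 ≤ l) :
    (2:ℝ) ^ (((n:ℝ)^2/4 + M * n + 6 * n * l + (68 * L ^ 29) * (3 * l)) + (3:ℕ) * (n:ℝ)) ≤ ε * g n := by
  have hL0 : (1000000:ℝ) ≤ L := by exact_mod_cast (by omega : 1000000 ≤ L)
  have g1 := g_low (n := n) (L := L) (by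
    calc 20 ≤ L := by omega
      _ ≤ L ^ 20 := Nat.le_self_pow (by norm_num) _
      _ ≤ n := h2) (by rw [← pow_mul]; exact h2)
  have g2 : (2:ℝ) ^ (-(L:ℝ)) * (2:ℝ) ^ ((n:ℝ) ^ 2 / 4 - 1 + L ^ 30 / 64) ≤ ε * g n :=
    mul_le_mul hε g1 (by positivity) (by
      have : (0:ℝ) ≤ 2 ^ (-(L:ℝ)) := by positivity
      linarith)
  refine le_trans ?_ g2
  rw [← Real.rpow_add (by norm_num)]
  refine Real.rpow_le_rpow_of_exponent_le (by norm_num) ?_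
  have hMr : (M:ℝ) ≤ L := by exact_mod_cast (by omega : M ≤ L)
  have hnr : (n:ℝ) ≤ 2 * (L:ℝ)^20 := by exact_mod_cast h1
  have hn0 : (0:ℝ) ≤ n := Nat.cast_nonneg _
  have a1 : (M:ℝ) * n ≤ L * (2 * (L:ℝ)^20) := mul_le_mul hMr hnr hn0 (by positivity)
  have a2 : (n:ℝ) * l ≤ (2 * (L:ℝ)^20) * L := by
    refine mul_le_mul hnr (hl.trans ?_) (by linarith) (by positivity)
    nlinarith
  have a3 : (L:ℝ)^29 * l ≤ L^29 * (1/2^16 * L) := mul_le_mul_of_nonneg_left hl (by positivity)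
  have a4 : (1000000:ℝ) * (L:ℝ)^21 ≤ L^30 := by
    calc (1000000:ℝ) * (L:ℝ)^21 ≤ L * L^21 := mul_le_mul_of_nonneg_right hL0 (by positivity)
      _ = L^22 := by ring
      _ ≤ L^30 := pow_le_pow_right₀ (by linarith) (by norm_num)
  have a5 : (L:ℝ)^20 ≤ L^21 := pow_le_pow_right₀ (by linarith) (by norm_num)
  have a6 : (L:ℝ)^1 ≤ L^21 := pow_le_pow_right₀ (by linarith) (by norm_num)
  have a7 : (L:ℝ)^29 * (1/2^16 * L) = 1/2^16 * L^30 := by ring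
  have a8 : (L:ℝ) * (2 * (L:ℝ)^20) = 2 * L^21 := by ring
  have a9 : (2 * (L:ℝ)^20) * L = 2 * L^21 := by ring
  have a10 : (0:ℝ) ≤ L^30 := by positivity
  rw [a7] at a3; rw [a8] at a1; rw [a9] at a2
  push_cast
  norm_num at a3 ⊢
  nlinarith

theorem A2 (M : ℕ) : AA (fun n G => ¬ ∃ S T W, A2bad M (sc n) G S T W) := by
  apply AA.of_count
  intro ε hε
  obtain ⟨c, hc⟩ := exists_nat_gt (-Real.logb 2 ε)
  obtain ⟨n0, h0⟩ := scale (1/2^16) (by positivity) (1000000 + M + c)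
  refine ⟨n0, fun n hn => ?_⟩
  obtain ⟨h1, h2, h3, h4, h5, h6⟩ := h0 n hn
  have hn2 : 2 ≤ n := by
    calc 2 ≤ sc n := by omega
      _ ≤ sc n ^ 20 := Nat.le_self_pow (by norm_num) _
      _ ≤ n := h2
  have hε' : (2:ℝ) ^ (-(sc n:ℝ)) ≤ ε := by
    rw [← Real.le_logb_iff_rpow_le (by norm_num) hε]
    have : (c:ℝ) ≤ sc n := by exact_mod_cast (by omega : c ≤ sc n)
    linarith
  refine le_trans ?_ (a2_arith (M := M) (by omega) hε' h3 h2 h4 h5)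
  set 𝒢 : Set (SimpleGraph (Fin n)) := {G | ∃ S T W, A2bad M (sc n) G S T W} with h𝒢
  have hb : Bd 𝒢 ((univ : Finset (Fin n)) ×ˢ univ) _ :=
    Bd.labSs 3 (fun s => {G | A2bad M (sc n) G (s 0) (s 1) (s 2)})
      (by rintro G ⟨S, T, W, h⟩; exact ⟨![S, T, W], by simpa using h⟩)
      (fun s => a2_fib hn2 (by omega) h3 (s 0) (s 1) (s 2))
  have := fiber_card (X := univ) (H := ⊥) (𝒢 := 𝒢) (by
    intro G _; ext a b; simp [out]) hb
  rw [Fintype.card_fin] at this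
  refine le_trans ?_ this
  norm_cast
  rw [← Set.ncard_coe_finset]
  refine Set.ncard_le_ncard ?_ (Set.toFinite _)
  intro G hG
  simp at hG
  exact hG.2

end a2
end C6P
end Part17

section Part18
open SimpleGraph Filter
open scoped Classical
namespace C6P
open Finset

section f1

structure F1 {n : ℕ} (L : ℕ) (G : SimpleGraph (Fin n)) (S T : Finset (Fin n)) : Prop where
  dST : Disjoint S T
  cQ : (S ∪ T)ᶜ.card ≤ 6 * L ^ 4
  cS : n ≤ 5 * S.card
  cT : n ≤ 5 * T.card
  pS : P4Free G S
  gT : CoG5 G T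
  dT : ∀ t ∈ T, cdeg G T t ≤ L ^ 16
  fT : Fam G ![0,1,2,3] T (L ^ 19)

lemma cdeg_swap {V : Type} [DecidableEq V] (G : SimpleGraph V) (T W : Finset V) :
    ∑ t ∈ T, cdeg G W t = ∑ w ∈ W, cdeg G T w := by
  unfold cdeg
  simp only [card_filter]
  rw [sum_comm]
  simp only [G.adj_comm]

lemma thigh {n L : ℕ} (hL : 100 ≤ L) (hn : n ≤ 2 * L ^ 20) {G : SimpleGraph (Fin n)} {T : Finset (Fin n)}
    (h : CoG5 G T) : (T.filter (fun t => ¬ cdeg G T t ≤ L ^ 16)).card ≤ 5 * L ^ 4 := by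
  by_contra hcon
  push Not at hcon
  obtain ⟨W, hW, hWc⟩ := exists_subset_card_eq hcon.le
  have hWT : W ⊆ T := hW.trans (filter_subset _ _)
  have h1 := cog5_sum h hWT 1
  rw [cdeg_swap] at h1
  have h2 : W.card * L ^ 16 ≤ ∑ w ∈ W, cdeg G T w := by
    rw [← smul_eq_mul]
    refine card_nsmul_le_sum _ _ _ ?_
    intro w hw
    have := (mem_filter.1 (hW hw)).2
    omega
  have h3 : T.card ≤ 2 * L ^ 20 := by
    have := card_le_univ T
    simp at this; omega
  rw [hWc] at h1 h2
  have e1 : 5 * L ^ 4 * L ^ 16 = 5 * L ^ 20 := by ring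
  have e2 : (5 * L ^ 4) ^ 2 = 25 * L ^ 8 := by ring
  have e3 : 100 * L ^ 8 ≤ L ^ 20 := by
    calc 100 * L ^ 8 ≤ L * L ^ 8 := Nat.mul_le_mul_right _ hL
      _ = L ^ 9 := by ring
      _ ≤ L ^ 20 := Nat.pow_le_pow_right (by omega) (by norm_num)
  have e4 : 0 < L ^ 8 := by positivity
  rw [e1] at h2; rw [e2] at h1
  omega

theorem AF1 : AA (fun n G => ∃ S T, F1 (sc n) G S T) := by
  obtain ⟨M, hM⟩ := ST2
  obtain ⟨n0, h0⟩ := scale 1 (by norm_num) M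
  refine (hM.and (A2 M)).mono ⟨n0, fun n hn G hG => ?_⟩
  rintro ⟨⟨S, T, hd, hQ, hS, hT, pS, hPT⟩, h2⟩
  obtain ⟨s1, s2, s3, s4, s5, s6⟩ := h0 n hn
  set L := sc n with hLdef
  have gT : CoG5 G T := by
    rcases hPT with h | h
    · exact absurd ⟨S, T, ∅, hd, hQ, pS, by simp, by simp, by simpa using h, Or.inr rfl⟩ h2
    · exact h
  set Z := T.filter (fun t => ¬ cdeg G T t ≤ L ^ 16) with hZ
  have hZc : Z.card ≤ 5 * L ^ 4 := thigh s6 s3 gT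
  have p1 : L ^ 4 * 100 ≤ L ^ 19 := by
    calc L ^ 4 * 100 ≤ L ^ 4 * L := Nat.mul_le_mul_left _ s6
      _ = L ^ 5 := by ring
      _ ≤ L ^ 19 := Nat.pow_le_pow_right (by omega) (by norm_num)
  have p2 : L ^ 19 * 100 ≤ n := by
    calc L ^ 19 * 100 ≤ L ^ 19 * L := Nat.mul_le_mul_left _ s6
      _ = L ^ 20 := by ring
      _ ≤ n := s2
  have p3 : L ≤ L ^ 4 := Nat.le_self_pow (by norm_num) _
  have hsub : Z ⊆ T := filter_subset _ _
  refine ⟨S, T \ Z, Finset.disjoint_of_subset_right sdiff_subset hd, ?_, by omega, ?_, pS, gT.mono sdiff_subset, ?_, ?_⟩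
  · have : (S ∪ T \ Z)ᶜ ⊆ (S ∪ T)ᶜ ∪ Z := by
      intro v hv
      simp only [mem_compl, mem_union, Finset.mem_sdiff] at hv ⊢
      tauto
    have h3 := (card_le_card this).trans (card_union_le _ _)
    omega
  · have := Finset.le_card_sdiff Z T
    omega
  · intro t ht
    rw [Finset.mem_sdiff] at ht
    refine (cdeg_mono sdiff_subset t).trans ?_
    by_contra hc
    exact ht.2 (mem_filter.2 ⟨ht.1, hc⟩)
  · rcases fam_or (by norm_num) G ![0,1,2,3] (T \ Z) (L ^ 19) with h | ⟨W, hW, hWc, hW2⟩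
    · exact h
    · exfalso
      refine h2 ⟨S, T, Z ∪ W, hd, hQ, pS, union_subset hsub (hW.trans sdiff_subset), ?_, ?_, Or.inl gT⟩
      · have := card_union_le Z W; omega
      · refine (p4_of_nocop hW2).mono ?_
        intro v hv
        simp only [mem_union, Finset.mem_sdiff] at hv ⊢
        tauto

end f1
end C6P
end Part18

section Part19
open SimpleGraph Filter
open scoped Classical
namespace C6P
open Finset

section d8

lemma few_cdeg {n : ℕ} (hn : 2 ≤ n) {𝒢 : Set (SimpleGraph (Fin n))} {X T : Finset (Fin n)} (d : ℕ)
    (h : ∀ G ∈ 𝒢, ∀ x ∈ X, cdeg G T x ≤ d) : Bd 𝒢 (X ×ˢ T) (X.card * d * (3 * Real.logb 2 n)) := by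
  have := Bd.few' (V := Fin n) (by simpa using hn) true (𝒢 := 𝒢) (E := X ×ˢ T) (X.card * d) ?_
  · simpa using this
  · intro G hG
    rw [cog5_prod]
    exact sum_le_card_nsmul _ _ _ (h G hG)

lemma cross_triv {n : ℕ} (𝒢 : Set (SimpleGraph (Fin n))) (X Q : Finset (Fin n)) (d : ℕ) (h : Q.card ≤ d) :
    Bd 𝒢 (X ×ˢ Q) (X.card * d) := by
  refine (Bd.triv _ _).mono ?_
  rw [card_product]; push_cast
  exact mul_le_mul_of_nonneg_left (by exact_mod_cast h) (Nat.cast_nonneg _)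

lemma cog_cross {n : ℕ} (hn : 2 ≤ n) {𝒢 : Set (SimpleGraph (Fin n))} {X S : Finset (Fin n)} (hX : X ⊆ S)
    (h : ∀ G ∈ 𝒢, P4Free G S) : Bd 𝒢 (X ×ˢ S) (n * (3 * Real.logb 2 n)) := by
  have hl : 0 ≤ Real.logb 2 n := Real.logb_nonneg (by norm_num) (by exact_mod_cast (by omega : 1 ≤ n))
  have := (cog_count (V := Fin n) (by simpa using hn) S.card S rfl).mono_set (𝒢 := 𝒢) h
  refine (this.mono_E (product_subset_product_left hX)).mono ?_
  simp only [Fintype.card_fin]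
  exact mul_le_mul_of_nonneg_right (card_fin_le S) (by positivity)

lemma cross_split {n : ℕ} {𝒢 : Set (SimpleGraph (Fin n))} {X Y S T : Finset (Fin n)} {x y z : ℝ}
    (h1 : Bd 𝒢 (X ×ˢ S) x) (h2 : Bd 𝒢 (X ×ˢ T) y) (h3 : Bd 𝒢 (X ×ˢ (S ∪ T)ᶜ) z) : Bd 𝒢 (X ×ˢ Y) (x + y + z) := by
  refine ((h1.union h2).union h3).mono_E ?_
  rintro ⟨a, b⟩ h
  simp only [mem_product, mem_union, mem_compl] at h ⊢
  tauto

lemma d8_arith {n L s k : ℕ} {l : ℝ} (hL : 100 ≤ L) (h1 : n ≤ 2 * L ^ 20) (hl : l ≤ 1 / 100 * L) (hl0 : 0 ≤ l)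
    (hs : 2 * s + 2 * L ^ 17 < n) (hk : k = L ^ 5) :
    (k * s + (k * (L^16:ℕ) * (3 * l) + n * (3 * l)) + k * (6 * L ^ 4:ℕ)) + 2 * n + 3 * (k:ℝ) ^ 2 + 1 + (2 * k + 1) * l
      ≤ k * n / 2 := by
  subst hk
  have hL0 : (100:ℝ) ≤ L := by exact_mod_cast hL
  have hnr : (n:ℝ) ≤ 2 * (L:ℝ)^20 := by exact_mod_cast h1
  have hsr : 2 * (s:ℝ) + 2 * (L:ℝ)^17 ≤ n := by exact_mod_cast hs.le
  have q1 : (L:ℝ)^5 * (2 * (s:ℝ) + 2 * (L:ℝ)^17) ≤ (L:ℝ)^5 * n := mul_le_mul_of_nonneg_left hsr (by positivity)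
  have q2 : (L:ℝ)^21 * l ≤ L^21 * (1/100 * L) := mul_le_mul_of_nonneg_left hl (by positivity)
  have q3 : (n:ℝ) * l ≤ (2 * (L:ℝ)^20) * (1/100 * L) := mul_le_mul hnr hl hl0 (by positivity)
  have q4 : (L:ℝ)^5 * l ≤ L^5 * (1/100 * L) := mul_le_mul_of_nonneg_left hl (by positivity)
  have r1 : (100:ℝ) * (L:ℝ)^21 ≤ L^22 := by
    rw [pow_succ (L:ℝ) 21, mul_comm]; exact mul_le_mul_of_nonneg_left hL0 (by positivity)
  have r2 : (100:ℝ) * (L:ℝ)^20 ≤ L^21 := by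
    rw [pow_succ (L:ℝ) 20, mul_comm]; exact mul_le_mul_of_nonneg_left hL0 (by positivity)
  have r3 : (L:ℝ)^10 ≤ L^20 := pow_le_pow_right₀ (by linarith) (by norm_num)
  have r4 : (L:ℝ)^9 ≤ L^20 := pow_le_pow_right₀ (by linarith) (by norm_num)
  have r5 : (L:ℝ)^6 ≤ L^20 := pow_le_pow_right₀ (by linarith) (by norm_num)
  have r6 : (L:ℝ) ≤ L^20 := le_self_pow₀ (by linarith) (by norm_num)
  push_cast
  have e1 : (L:ℝ)^5 * (2 * (s:ℝ) + 2 * (L:ℝ)^17) = 2 * (L^5 * s) + 2 * L^22 := by ring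
  have e2 : (L:ℝ)^21 * (1/100 * L) = 1/100 * L^22 := by ring
  have e3 : (2 * (L:ℝ)^20) * (1/100 * L) = 1/50 * L^21 := by ring
  have e4 : (L:ℝ)^5 * (1/100 * L) = 1/100 * L^6 := by ring
  rw [e1] at q1; rw [e2] at q2; rw [e3] at q3; rw [e4] at q4
  have : ((L:ℝ)^5 * s + (L^5 * L^16 * (3 * l) + n * (3 * l)) + L^5 * (6 * L^4)) + 2 * n + 3 * (L^5)^2 + 1 + (2 * L^5 + 1) * l
    = L^5 * s + 3 * (L^21 * l) + 3 * (n * l) + 6 * L^9 + 2 * n + 3 * L^10 + 1 + 2 * (L^5 * l) + l := by ring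
  rw [this]
  linarith

lemma lab2_card (n : ℕ) : (Fintype.card (Finset (Fin n) × Finset (Fin n)) : ℝ) ≤ 2 ^ (2 * (n:ℝ)) := by
  rw [Fintype.card_prod]
  simp only [Fintype.card_finset, Fintype.card_fin]
  push_cast
  rw [two_mul, Real.rpow_add (by norm_num), Real.rpow_natCast]

lemma exists_inj_in {n k : ℕ} (S : Finset (Fin n)) (h : k ≤ S.card) :
    ∃ u : Fin k → Fin n, Function.Injective u ∧ ∀ i, u i ∈ S := by
  obtain ⟨B, hB, hBc⟩ := exists_subset_card_eq h
  obtain ⟨u, hu, he⟩ := exists_inj_image B hBc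
  exact ⟨u, hu, fun i => hB (he ▸ mem_image_of_mem u (mem_univ i))⟩

lemma card_image_fin {n k : ℕ} {u : Fin k → Fin n} (hu : Function.Injective u) : (univ.image u).card = k := by
  rw [card_image_of_injective _ hu]; simp

theorem D8 : AA (fun n G => ∀ S T, F1 (sc n) G S T → n ≤ 2 * S.card + 2 * sc n ^ 17 ∧ n ≤ 2 * T.card + 2 * sc n ^ 17) := by
  obtain ⟨n0, h0⟩ := scale (1/100) (by norm_num) 0
  have hA : AA (fun n G => ∀ S T, F1 (sc n) G S T → n ≤ 2 * S.card + 2 * sc n ^ 17) := by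
    apply AA.of_dpg
    refine ⟨n0, fun n hn => ?_⟩
    obtain ⟨-, s2, s3, s4, s5, s6⟩ := h0 n hn
    set L := sc n with hLdef
    have p0 : L ^ 5 * 100 ≤ n := by
      calc L ^ 5 * 100 ≤ L ^ 5 * L := Nat.mul_le_mul_left _ s6
        _ = L ^ 6 := by ring
        _ ≤ L ^ 20 := Nat.pow_le_pow_right (by omega) (by norm_num)
        _ ≤ n := s2
    have p1 : 1 ≤ L ^ 5 := Nat.one_le_pow _ _ (by omega)
    by_cases hcase : ∃ s, 2 * s + 2 * L ^ 17 < n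
    swap
    · push Not at hcase
      refine ⟨L ^ 5, Finset (Fin n) × Finset (Fin n), inferInstance, fun _ _ _ => False,
        - (2 * n + 3 * ((L^5:ℕ):ℝ) ^ 2 + 1 + (2 * (L^5:ℕ) + 1) * Real.logb 2 n), 2 * n, p1, by omega, lab2_card n, ?_, ?_, ?_⟩
      · have : (0:ℝ) ≤ (L^5:ℕ) * n / 2 := by positivity
        linarith
      · intro G hG h
        exfalso; apply h
        intro S T _
        have := hcase S.card
        omega
      · intro u _ l H
        refine (Bd.empty _ _).mono_set ?_
        rintro G ⟨_, h, _⟩; exact h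
    set s := (n - 2 * L ^ 17 - 1) / 2 with hs
    have hs1 : 2 * s + 2 * L ^ 17 < n := by obtain ⟨s', h'⟩ := hcase; omega
    have hs2 : ∀ m, 2 * m + 2 * L ^ 17 < n → m ≤ s := by intro m hm; omega
    refine ⟨L ^ 5, Finset (Fin n) × Finset (Fin n), inferInstance,
      fun u l G => F1 L G l.1 l.2 ∧ 2 * l.1.card + 2 * L ^ 17 < n ∧ ∀ i, u i ∈ l.2,
      _, 2 * n, p1, by omega, lab2_card n, d8_arith (k := L ^ 5) s6 s3 s4 (by linarith) hs1 rfl, ?_, ?_⟩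
    · intro G hG h
      push Not at h
      obtain ⟨S, T, hF, hlt⟩ := h
      obtain ⟨u, hu, hu2⟩ := exists_inj_in (k := L ^ 5) T (by have := hF.cT; omega)
      exact ⟨u, hu, (S, T), hF, hlt, hu2⟩
    · rintro u hu ⟨S, T⟩ H
      by_cases hq : 2 * S.card + 2 * L ^ 17 < n ∧ (∀ i, u i ∈ T) ∧ (S ∪ T)ᶜ.card ≤ 6 * L ^ 4
      swap
      · refine (Bd.empty _ _).mono_set ?_
        rintro G ⟨_, ⟨h1, h2, h3⟩, _⟩; exact hq ⟨h2, h3, h1.cQ⟩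
      obtain ⟨q1, q2, q3⟩ := hq
      have hc := card_image_fin hu
      have b1 := cross_triv {G | C6F G ∧ (F1 L G S T ∧ 2 * S.card + 2 * L ^ 17 < n ∧ ∀ i, u i ∈ T) ∧ Agr (univ.image u) G H}
        (univ.image u) S s (hs2 _ q1)
      have b3 := cross_triv {G | C6F G ∧ (F1 L G S T ∧ 2 * S.card + 2 * L ^ 17 < n ∧ ∀ i, u i ∈ T) ∧ Agr (univ.image u) G H}
        (univ.image u) (S ∪ T)ᶜ (6 * L ^ 4) q3
      have b2 := few_cdeg (by omega) (𝒢 := {G | C6F G ∧ (F1 L G S T ∧ 2 * S.card + 2 * L ^ 17 < n ∧ ∀ i, u i ∈ T) ∧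
        Agr (univ.image u) G H}) (X := univ.image u) (T := T) (L ^ 16) (by
          rintro G ⟨_, ⟨h1, _⟩, _⟩ x hx
          rw [mem_image] at hx
          obtain ⟨i, _, rfl⟩ := hx
          exact h1.dT _ (q2 i))
      rw [hc] at b1 b2 b3
      refine (cross_split b1 b2 b3).mono ?_
      have : (0:ℝ) ≤ n * (3 * Real.logb 2 n) := by positivity
      linarith
  have hB : AA (fun n G => ∀ S T, F1 (sc n) G S T → n ≤ 2 * T.card + 2 * sc n ^ 17) := by
    apply AA.of_dpg
    refine ⟨n0, fun n hn => ?_⟩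
    obtain ⟨-, s2, s3, s4, s5, s6⟩ := h0 n hn
    set L := sc n with hLdef
    have p0 : L ^ 5 * 100 ≤ n := by
      calc L ^ 5 * 100 ≤ L ^ 5 * L := Nat.mul_le_mul_left _ s6
        _ = L ^ 6 := by ring
        _ ≤ L ^ 20 := Nat.pow_le_pow_right (by omega) (by norm_num)
        _ ≤ n := s2
    have p1 : 1 ≤ L ^ 5 := Nat.one_le_pow _ _ (by omega)
    by_cases hcase : ∃ s, 2 * s + 2 * L ^ 17 < n
    swap
    · push Not at hcase
      refine ⟨L ^ 5, Finset (Fin n) × Finset (Fin n), inferInstance, fun _ _ _ => False,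
        - (2 * n + 3 * ((L^5:ℕ):ℝ) ^ 2 + 1 + (2 * (L^5:ℕ) + 1) * Real.logb 2 n), 2 * n, p1, by omega, lab2_card n, ?_, ?_, ?_⟩
      · have : (0:ℝ) ≤ (L^5:ℕ) * n / 2 := by positivity
        linarith
      · intro G hG h
        exfalso; apply h
        intro S T _
        have := hcase T.card
        omega
      · intro u _ l H
        refine (Bd.empty _ _).mono_set ?_
        rintro G ⟨_, h, _⟩; exact h
    set s := (n - 2 * L ^ 17 - 1) / 2 with hs
    have hs1 : 2 * s + 2 * L ^ 17 < n := by obtain ⟨s', h'⟩ := hcase; omega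
    have hs2 : ∀ m, 2 * m + 2 * L ^ 17 < n → m ≤ s := by intro m hm; omega
    refine ⟨L ^ 5, Finset (Fin n) × Finset (Fin n), inferInstance,
      fun u l G => F1 L G l.1 l.2 ∧ 2 * l.2.card + 2 * L ^ 17 < n ∧ ∀ i, u i ∈ l.1,
      _, 2 * n, p1, by omega, lab2_card n, d8_arith (k := L ^ 5) s6 s3 s4 (by linarith) hs1 rfl, ?_, ?_⟩
    · intro G hG h
      push Not at h
      obtain ⟨S, T, hF, hlt⟩ := h
      obtain ⟨u, hu, hu2⟩ := exists_inj_in (k := L ^ 5) S (by have := hF.cS; omega)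
      exact ⟨u, hu, (S, T), hF, hlt, hu2⟩
    · rintro u hu ⟨S, T⟩ H
      by_cases hq : 2 * T.card + 2 * L ^ 17 < n ∧ (∀ i, u i ∈ S) ∧ (S ∪ T)ᶜ.card ≤ 6 * L ^ 4
      swap
      · refine (Bd.empty _ _).mono_set ?_
        rintro G ⟨_, ⟨h1, h2, h3⟩, _⟩; exact hq ⟨h2, h3, h1.cQ⟩
      obtain ⟨q1, q2, q3⟩ := hq
      have hc := card_image_fin hu
      have hXS : univ.image u ⊆ S := by
        rw [image_subset_iff]; intro i _; exact q2 i
      have b1 := cross_triv {G | C6F G ∧ (F1 L G S T ∧ 2 * T.card + 2 * L ^ 17 < n ∧ ∀ i, u i ∈ S) ∧ Agr (univ.image u) G H}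
        (univ.image u) T s (hs2 _ q1)
      have b3 := cross_triv {G | C6F G ∧ (F1 L G S T ∧ 2 * T.card + 2 * L ^ 17 < n ∧ ∀ i, u i ∈ S) ∧ Agr (univ.image u) G H}
        (univ.image u) (S ∪ T)ᶜ (6 * L ^ 4) q3
      have b2 := cog_cross (by omega) (𝒢 := {G | C6F G ∧ (F1 L G S T ∧ 2 * T.card + 2 * L ^ 17 < n ∧ ∀ i, u i ∈ S) ∧
        Agr (univ.image u) G H}) hXS (by
          rintro G ⟨_, ⟨h1, _⟩, _⟩
          exact h1.pS)
      rw [hc] at b1 b3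
      refine (cross_split b2 b1 b3).mono ?_
      have : (0:ℝ) ≤ (L^5:ℕ) * (L^16:ℕ) * (3 * Real.logb 2 n) := by positivity
      linarith
  exact (hA.and hB).mono ⟨0, fun n _ G _ h S T hF => ⟨h.1 S T hF, h.2 S T hF⟩⟩

end d8
end C6P
end Part19

section Part20
open SimpleGraph Filter
open scoped Classical
namespace C6P
open Finset

section d9

lemma d9_arith {n L k : ℕ} {l : ℝ} (hL : 2 ^ 50 ≤ L) (h1 : n ≤ 2 * L ^ 20) (hl : l ≤ 1 * L) (hl0 : 0 ≤ l)
    (hk : k = L ^ 3 * 2) :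
    (n * (3 * l) + (k * (n / 2 + (L:ℝ)^17) - (L^3:ℕ) * (L^19:ℕ) * (1 / 2 ^ 36)) + k * (6 * L ^ 4:ℕ)) + 2 * n + 3 * (k:ℝ) ^ 2 + 1
      + (2 * k + 1) * l ≤ k * n / 2 := by
  subst hk
  have hL0 : (2^50:ℝ) ≤ L := by exact_mod_cast hL
  have hL1 : (1:ℝ) ≤ L := le_trans (by norm_num) hL0
  have hnr : (n:ℝ) ≤ 2 * (L:ℝ)^20 := by exact_mod_cast h1
  have q3 : (n:ℝ) * l ≤ (2 * (L:ℝ)^20) * (1 * L) := mul_le_mul hnr hl hl0 (by positivity)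
  have q4 : (L:ℝ)^3 * l ≤ L^3 * (1 * L) := mul_le_mul_of_nonneg_left hl (by positivity)
  have r1 : (2^50:ℝ) * (L:ℝ)^21 ≤ L^22 := by
    rw [pow_succ (L:ℝ) 21, mul_comm]; exact mul_le_mul_of_nonneg_left hL0 (by positivity)
  have r2 : (L:ℝ)^20 ≤ L^21 := pow_le_pow_right₀ hL1 (by norm_num)
  have r3 : (L:ℝ)^6 ≤ L^21 := pow_le_pow_right₀ hL1 (by norm_num)
  have r4 : (L:ℝ)^7 ≤ L^21 := pow_le_pow_right₀ hL1 (by norm_num)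
  have r5 : (L:ℝ)^4 ≤ L^21 := pow_le_pow_right₀ hL1 (by norm_num)
  have r6 : (L:ℝ) ≤ L^21 := le_self_pow₀ hL1 (by norm_num)
  push_cast
  have e3 : (2 * (L:ℝ)^20) * (1 * L) = 2 * L^21 := by ring
  have e4 : (L:ℝ)^3 * (1 * L) = L^4 := by ring
  rw [e3] at q3; rw [e4] at q4
  have : (n * (3 * l) + ((L:ℝ)^3 * 2 * (n / 2 + L^17) - L^3 * L^19 * (1/2^36)) + L^3 * 2 * (6 * L^4)) + 2 * n + 3 * (L^3*2)^2 + 1 + (2 * (L^3 * 2) + 1) * l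
    = 3 * (n * l) + L^3 * 2 * n / 2 + 2 * L^20 - L^22 * (1/2^36) + 12 * L^7 + 2 * n + 12 * L^6 + 1 + 4 * (L^3 * l) + l := by ring
  rw [this]
  norm_num at r1 ⊢
  linarith

/-- a family of P4's in `T` is visible from the part outside `X`. -/
lemma fam_transfer {n a N : ℕ} {σ : Fin a → Fin 6} {𝒢 : Set (SimpleGraph (Fin n))} {X T : Finset (Fin n)} {H : SimpleGraph (Fin n)}
    (hX : ∀ x ∈ T, x ∉ X) (hA : ∀ G ∈ 𝒢, Agr X G H) (hF : ∀ G ∈ 𝒢, Fam G σ T N) (hne : 𝒢.Nonempty) :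
    ∃ P : Fin N → Fin a → Fin n, (∀ k l i j, P k i = P l j → k = l) ∧ (∀ k i, P k i ∈ T) ∧
      ∀ G ∈ 𝒢, ∀ k, Cop G σ univ (P k) := by
  obtain ⟨G0, h0⟩ := hne
  obtain ⟨P, hP, hc⟩ := hF G0 h0
  refine ⟨P, hP, fun k i => (hc k).2.1 i, fun G hG k => ?_⟩
  have hx : (∀ i, P k i ∈ X) ∨ (∀ i, P k i ∉ X) := Or.inr (fun i => hX _ ((hc k).2.1 i))
  rw [cop_agr (hA G hG) hx, ← cop_agr (hA G0 h0) hx]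
  exact (hc k).mono (subset_univ _)

theorem D9 : AA (fun n G => ∀ S T, F1 (sc n) G S T → n ≤ 2 * S.card + 2 * sc n ^ 17 → ¬ Fam G ![4,5] S (sc n ^ 3)) := by
  obtain ⟨n0, h0⟩ := scale 1 (by norm_num) (2 ^ 50)
  apply AA.of_dpg
  refine ⟨n0, fun n hn => ?_⟩
  obtain ⟨s1, s2, s3, s4, s5, s6⟩ := h0 n hn
  set L := sc n with hLdef
  have p0 : L ^ 3 * 100 ≤ n := by
    calc L ^ 3 * 100 ≤ L ^ 3 * L := Nat.mul_le_mul_left _ s6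
      _ = L ^ 4 := by ring
      _ ≤ L ^ 20 := Nat.pow_le_pow_right (by omega) (by norm_num)
      _ ≤ n := s2
  have p1 : 1 ≤ L ^ 3 := Nat.one_le_pow _ _ (by omega)
  refine ⟨L ^ 3 * 2, Finset (Fin n) × Finset (Fin n), inferInstance,
    fun u l G => F1 L G l.1 l.2 ∧ n ≤ 2 * l.1.card + 2 * L ^ 17 ∧
      ∀ k, Cop G ![4,5] l.1 (fun i => u (finProdFinEquiv (k, i))),
    _, 2 * n, by omega, by omega, lab2_card n, d9_arith (k := L ^ 3 * 2) s1 s3 s4 (by linarith) rfl, ?_, ?_⟩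
  · intro G hG h
    push Not at h
    obtain ⟨S, T, hF, hS, P, hP, hPc⟩ := h
    refine ⟨fun j => P (finProdFinEquiv.symm j).1 (finProdFinEquiv.symm j).2, ?_, (S, T), hF, hS, ?_⟩
    · intro i j hij
      have h1 := hP _ _ _ _ hij
      simp only [h1] at hij
      have h2 := (hPc _).1 hij
      exact finProdFinEquiv.symm.injective (Prod.ext h1 h2)
    · intro k
      simpa using hPc k
  · rintro u hu ⟨S, T⟩ H
    set 𝒢 := {G | C6F G ∧ (F1 L G S T ∧ n ≤ 2 * S.card + 2 * L ^ 17 ∧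
      ∀ k, Cop G ![4,5] S (fun i => u (finProdFinEquiv (k, i)))) ∧ Agr (univ.image u) G H} with h𝒢
    by_cases hne : 𝒢.Nonempty
    swap
    · rw [Set.not_nonempty_iff_eq_empty] at hne
      show Bd 𝒢 _ _
      rw [hne]; exact Bd.empty _ _
    obtain ⟨G0, hG0⟩ := id hne
    have hc := card_image_fin hu
    have hXS : univ.image u ⊆ S := by
      rw [image_subset_iff]; intro i _
      have := (hG0.2.1.2.2 (finProdFinEquiv.symm i).1).2.1 (finProdFinEquiv.symm i).2
      simpa only [Prod.mk.eta, Equiv.apply_symm_apply] using this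
    have hd := hG0.2.1.1.dST
    have hXT : ∀ x ∈ T, x ∉ univ.image u := fun x hx hx' => Finset.disjoint_left.1 hd (hXS hx') hx
    obtain ⟨P', hP', hPT, hPc⟩ := fam_transfer hXT (fun G hG => hG.2.2) (fun G hG => hG.2.1.1.fT) hne
    have b1 := cog_cross (by omega) (𝒢 := 𝒢) hXS (fun G hG => hG.2.1.1.pS)
    have b3 := cross_triv 𝒢 (univ.image u) (S ∪ T)ᶜ (6 * L ^ 4) hG0.2.1.1.cQ
    have b2 : Bd 𝒢 (univ.image u ×ˢ T) _ := fam_block (by norm_num) (by norm_num) (by decide)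
      (fun (k : Fin (L ^ 3)) i => u (finProdFinEquiv (k, i))) P' (σ := ![4,5])
      (by
        intro k l i j h
        have := finProdFinEquiv.injective (hu h)
        exact (Prod.mk.inj this).1) hP'
      (fun G hG => ⟨hG.1, fun k => (hG.2.1.2.2 k).mono (subset_univ _), hPc G hG⟩)
      (fun k i => mem_image_of_mem u (mem_univ _)) hPT
    rw [hc] at b2 b3
    refine (cross_split b1 b2 b3).mono ?_
    have hT : 2 * T.card ≤ n + 2 * L ^ 17 := by
      have := disj_card hd; have := hG0.2.1.2.1; omega
    have hTr : (T.card:ℝ) ≤ n / 2 + (L:ℝ)^17 := by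
      have : (2 * T.card : ℝ) ≤ n + 2 * (L:ℝ)^17 := by exact_mod_cast hT
      linarith
    have := mul_le_mul_of_nonneg_left hTr (Nat.cast_nonneg (L ^ 3 * 2))
    linarith

/-- the final fine structure -/
structure FS {n : ℕ} (L : ℕ) (G : SimpleGraph (Fin n)) (S T : Finset (Fin n)) : Prop where
  dST : Disjoint S T
  cQ : (S ∪ T)ᶜ.card ≤ 10 * L ^ 4
  cS : n ≤ 2 * S.card + 4 * L ^ 17
  cT : n ≤ 2 * T.card + 4 * L ^ 17
  sS : Stab G S
  gT : CoG5 G T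
  dT : ∀ t ∈ T, cdeg G T t ≤ L ^ 16
  fT : Fam G ![0,1,2,3] T (L ^ 19)

theorem AFS : AA (fun n G => ∃ S T, FS (sc n) G S T) := by
  obtain ⟨n0, h0⟩ := scale 1 (by norm_num) 0
  refine ((AF1.and D8).and D9).mono ⟨n0, fun n hn G hG => ?_⟩
  rintro ⟨⟨⟨S, T, h⟩, h8⟩, h9⟩
  obtain ⟨-, s2, s3, s4, s5, s6⟩ := h0 n hn
  obtain ⟨hS, hT⟩ := h8 S T h
  obtain ⟨W, hW, hWc, hW2⟩ := (fam_or (by norm_num) G ![4,5] S (sc n ^ 3)).resolve_left (h9 S T h hS)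
  have hc := Finset.le_card_sdiff W S
  have p1 : sc n ^ 3 * 100 ≤ sc n ^ 17 := by
    calc sc n ^ 3 * 100 ≤ sc n ^ 3 * sc n := Nat.mul_le_mul_left _ s6
      _ = sc n ^ 4 := by ring
      _ ≤ _ := Nat.pow_le_pow_right (by omega) (by norm_num)
  have p2 : sc n ^ 3 ≤ sc n ^ 4 := Nat.pow_le_pow_right (by omega) (by norm_num)
  have hQ := h.cQ
  refine ⟨S \ W, T, Finset.disjoint_of_subset_left sdiff_subset h.dST, ?_, by omega, by omega, stab_of_nocop hW2, h.gT, h.dT, h.fT⟩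
  have : (S \ W ∪ T)ᶜ ⊆ (S ∪ T)ᶜ ∪ W := by
    intro v hv
    simp only [mem_compl, mem_union, Finset.mem_sdiff] at hv ⊢
    tauto
  have h3 := (card_le_card this).trans (card_union_le _ _)
  omega

end d9
end C6P
end Part20

section Part21
open SimpleGraph Filter
open scoped Classical
namespace C6P
open Finset

section offs

lemma stab_cog5 {n : ℕ} {G G0 H : SimpleGraph (Fin n)} {X S T : Finset (Fin n)} (hS : Stab G S) (hT : CoG5 G0 T)
    (h1 : Agr X G H) (h0 : Agr X G0 H) : ((S ∩ T) \ X).card ≤ 2 := by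
  by_contra hcon
  push Not at hcon
  obtain ⟨a, b, c, ha, hb, hc, ab, ac, bc⟩ := two_lt_card_iff.1 hcon
  simp only [Finset.mem_sdiff, mem_inter] at ha hb hc
  have key : ∀ x y, x ∉ X → y ∉ X → x ∈ S → y ∈ S → ¬ G0.Adj x y := by
    intro x y hx hy hxs hys h
    have e : (x ∈ X ↔ y ∈ X) := by simp [hx, hy]
    rw [h0 _ _ e, ← h1 _ _ e] at h
    exact hS x hxs y hys h
  rcases hT.1 a ha.1.2 b hb.1.2 c hc.1.2 ab ac bc with h | h | h
  · exact key _ _ ha.2 hb.2 ha.1.1 hb.1.1 h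
  · exact key _ _ ha.2 hc.2 ha.1.1 hc.1.1 h
  · exact key _ _ hb.2 hc.2 hb.1.1 hc.1.1 h

lemma fs_close {n L : ℕ} {G G0 H : SimpleGraph (Fin n)} {X S T S0 T0 : Finset (Fin n)} (h : FS L G S T) (h0 : FS L G0 S0 T0)
    (a : Agr X G H) (a0 : Agr X G0 H) (hX : X.card + 4 ≤ L ^ 4) :
    (symmDiff S S0).card ≤ 21 * L ^ 4 ∧ (symmDiff T T0).card ≤ 21 * L ^ 4 := by
  have e1 := stab_cog5 h.sS h0.gT a a0
  have e2 := stab_cog5 h0.sS h.gT a0 a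
  have q := h.cQ
  have q0 := h0.cQ
  have d := h.dST
  have d0 := h0.dST
  have fin : ∀ Z : Finset (Fin n), Z ⊆ X ∪ (S ∩ T0) \ X ∪ (S0 ∩ T) \ X ∪ (S ∪ T)ᶜ ∪ (S0 ∪ T0)ᶜ → Z.card ≤ 21 * L ^ 4 := by
    intro Z hZ
    have u1 := card_le_card hZ
    have u2 := card_union_le (X ∪ (S ∩ T0) \ X ∪ (S0 ∩ T) \ X ∪ (S ∪ T)ᶜ) (S0 ∪ T0)ᶜ
    have u3 := card_union_le (X ∪ (S ∩ T0) \ X ∪ (S0 ∩ T) \ X) (S ∪ T)ᶜ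
    have u4 := card_union_le (X ∪ (S ∩ T0) \ X) ((S0 ∩ T) \ X)
    have u5 := card_union_le X ((S ∩ T0) \ X)
    omega
  constructor
  · apply fin
    intro v hv
    have d1 : v ∈ S → v ∉ T := fun h => Finset.disjoint_left.1 d h
    have d2 : v ∈ S0 → v ∉ T0 := fun h => Finset.disjoint_left.1 d0 h
    simp only [mem_symmDiff, mem_union, mem_inter, Finset.mem_sdiff, mem_compl] at hv ⊢
    tauto
  · apply fin
    intro v hv
    have d1 : v ∈ S → v ∉ T := fun h => Finset.disjoint_left.1 d h
    have d2 : v ∈ S0 → v ∉ T0 := fun h => Finset.disjoint_left.1 d0 h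
    simp only [mem_symmDiff, mem_union, mem_inter, Finset.mem_sdiff, mem_compl] at hv ⊢
    tauto

lemma ball_two {n d : ℕ} (hn : 2 ≤ n) :
    (Fintype.card {z // z ∈ ball (univ : Finset (Fin n)) (d:ℝ) ×ˢ ball (univ : Finset (Fin n)) (d:ℝ)} : ℝ) ≤
      2 ^ (4 * d * Real.logb 2 n) := by
  rw [Fintype.card_coe, card_product]
  have h1 : ((ball (univ : Finset (Fin n)) (d:ℝ)).card : ℝ) ≤ 2 ^ (2 * d * Real.logb 2 n) := by
    have h2 := ball_card (univ : Finset (Fin n)) d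
    simp only [card_univ, Fintype.card_fin] at h2
    have h3 : (n + 1) ^ d ≤ (n ^ 2) ^ d := Nat.pow_le_pow_left (by nlinarith) d
    have h4 : ((ball (univ : Finset (Fin n)) (d:ℝ)).card : ℝ) ≤ ((n:ℝ) ^ 2) ^ d := by exact_mod_cast h2.trans h3
    refine h4.trans (le_of_eq ?_)
    rw [show (2 * (d:ℝ) * Real.logb 2 n) = Real.logb 2 n * ((2 * d : ℕ) : ℝ) by push_cast; ring, Real.rpow_mul (by norm_num),
      Real.rpow_logb (by norm_num) (by norm_num) (by exact_mod_cast (by omega : 0 < n)), Real.rpow_natCast, pow_mul]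
  push_cast
  calc _ ≤ (2:ℝ) ^ (2 * d * Real.logb 2 n) * 2 ^ (2 * d * Real.logb 2 n) := mul_le_mul h1 h1 (by positivity) (by positivity)
    _ = _ := by rw [← Real.rpow_add (by norm_num)]; congr 1; ring

theorem AA.of_fs (k : ℕ) (hk : 1 ≤ k)
    (B : ∀ n, (Fin k → Fin n) → Fin n → Finset (Fin n) → Finset (Fin n) → SimpleGraph (Fin n) → Prop)
    (h : ∃ n0 : ℕ, ∀ n ≥ n0, ∀ u, Function.Injective u → ∀ r S T H (𝒢 : Set (SimpleGraph (Fin n))),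
      (∀ G ∈ 𝒢, C6F G ∧ FS (sc n) G S T ∧ B n u r S T G ∧ Agr (univ.image u) G H) → 𝒢.Nonempty →
      Bd 𝒢 (univ.image u ×ˢ (univ.image u)ᶜ) (k * n / 2 - (sc n : ℝ) ^ 17)) :
    AA (fun n G => ∀ S T, FS (sc n) G S T → ∀ u, Function.Injective u → ∀ r, ¬ B n u r S T G) := by
  obtain ⟨n1, h⟩ := h
  obtain ⟨n0, h0⟩ := scale 1 (by norm_num) (k + 4)
  apply AA.of_dpg
  refine ⟨n0 + n1, fun n hn => ?_⟩
  obtain ⟨s1, s2, s3, s4, s5, s6⟩ := h0 n (by omega)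
  have hh := h n (by omega)
  clear h h0
  set L := sc n with hLdef
  have p1 : L ≤ L ^ 20 := Nat.le_self_pow (by norm_num) _
  have p2 : L ≤ L ^ 4 := Nat.le_self_pow (by norm_num) _
  have hn0 : 0 < n := by omega
  refine ⟨k, Fin n, inferInstance, fun u r G => ∃ S T, FS L G S T ∧ B n u r S T G,
    (k * n / 2 - (L : ℝ) ^ 17) + 4 * (21 * L ^ 4 : ℕ) * Real.logb 2 n, Real.logb 2 n, hk, by omega, ?_, ?_, ?_, ?_⟩
  · rw [Real.rpow_logb (by norm_num) (by norm_num) (by exact_mod_cast hn0)]; simp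
  · have hL0 : (100:ℝ) ≤ L := by exact_mod_cast s6
    have hkr : (k:ℝ) ≤ L := by exact_mod_cast (by omega : k ≤ L)
    have hk0 : (0:ℝ) ≤ k := Nat.cast_nonneg _
    set l := Real.logb 2 (n:ℝ)
    have a1 : (k:ℝ) ^ 2 ≤ (L:ℝ) ^ 2 := pow_le_pow_left₀ hk0 hkr 2
    have a2 : (k:ℝ) * l ≤ L * (1 * L) := mul_le_mul hkr s4 (by linarith) (by linarith)
    have a3 : (L:ℝ)^4 * l ≤ L^4 * (1 * L) := mul_le_mul_of_nonneg_left s4 (by positivity)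
    have a4 : (L:ℝ)^2 ≤ L^5 := pow_le_pow_right₀ (by linarith) (by norm_num)
    have a5 : (L:ℝ) ≤ L^5 := le_self_pow₀ (by linarith) (by norm_num)
    have a6 : (100:ℝ) * (L:ℝ)^5 ≤ L^6 := by
      rw [pow_succ (L:ℝ) 5, mul_comm]; exact mul_le_mul_of_nonneg_left hL0 (by positivity)
    have a7 : (L:ℝ)^6 ≤ L^17 := pow_le_pow_right₀ (by linarith) (by norm_num)
    push_cast
    have e1 : (L:ℝ)^4 * (1 * L) = L^5 := by ring
    have e2 : (L:ℝ) * (1 * L) = L^2 := by ring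
    rw [e1] at a3; rw [e2] at a2
    have e3 : (L:ℝ)^5 * 100 ≤ L^6 := by linarith
    have : (L:ℝ)^7 * 1 ≤ L^17 := by rw [mul_one]; exact pow_le_pow_right₀ (by linarith) (by norm_num)
    have a8 : (100:ℝ) * (L:ℝ)^6 ≤ L^7 := by
      rw [pow_succ (L:ℝ) 6, mul_comm]; exact mul_le_mul_of_nonneg_left hL0 (by positivity)
    nlinarith
  · intro G hG hb
    push Not at hb
    obtain ⟨S, T, hF, u, hu, r, hr⟩ := hb
    exact ⟨u, hu, r, S, T, hF, hr⟩
  · intro u hu r H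
    have hX4 : (univ.image u).card + 4 ≤ L ^ 4 := by
      have := card_image_fin hu
      omega
    by_cases hne : ∃ G0 S0 T0, FS L G0 S0 T0 ∧ Agr (univ.image u) G0 H
    swap
    · refine (Bd.empty _ _).mono_set ?_
      rintro G ⟨_, ⟨S, T, hF, _⟩, hA⟩
      exact hne ⟨G, S, T, hF, hA⟩
    obtain ⟨G0, S0, T0, hF0, hA0⟩ := hne
    have hn2 : 2 ≤ n := by omega
    generalize hd : 21 * L ^ 4 = d
    refine Bd.lab (L := {z // z ∈ ball (univ : Finset (Fin n)) (d:ℝ) ×ˢ ball (univ : Finset (Fin n)) (d:ℝ)})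
      (fun z => {G | C6F G ∧ FS L G (symmDiff z.1.1 S0) (symmDiff z.1.2 T0) ∧
        B n u r (symmDiff z.1.1 S0) (symmDiff z.1.2 T0) G ∧ Agr (univ.image u) G H}) ?_ ?_ (ball_two hn2)
    · rintro G ⟨hC, ⟨S, T, hF, hB⟩, hA⟩
      have hcl := fs_close hF hF0 hA hA0 hX4
      rw [hd] at hcl
      refine ⟨⟨(symmDiff S S0, symmDiff T T0), ?_⟩, ?_⟩
      · simp only [mem_product, ball, mem_filter, mem_powerset, subset_univ, true_and]
        exact ⟨by exact_mod_cast hcl.1, by exact_mod_cast hcl.2⟩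
      · simp only [Set.mem_ofPred_eq, symmDiff_symmDiff_cancel_right]
        exact ⟨hC, hF, hB, hA⟩
    · intro z
      by_cases he : Set.Nonempty {G | C6F G ∧ FS L G (symmDiff z.1.1 S0) (symmDiff z.1.2 T0) ∧
        B n u r (symmDiff z.1.1 S0) (symmDiff z.1.2 T0) G ∧ Agr (univ.image u) G H}
      · exact hh u hu r _ _ H _ (fun G hG => hG) he
      · rw [Set.not_nonempty_iff_eq_empty] at he
        rw [he]; exact Bd.empty _ _

end offs
end C6P
end Part21

section Part22
open SimpleGraph Filter
open scoped Classical
namespace C6P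
open Finset

section claims

/-- `x` has few neighbours or few non-neighbours in `S` -/
def Sm {n : ℕ} (G : SimpleGraph (Fin n)) (S : Finset (Fin n)) (t : ℕ) (x : Fin n) : Prop :=
  (S.filter (fun y => G.Adj x y)).card ≤ t ∨ cdeg G S x ≤ t

lemma sm_row {n t : ℕ} (hn : 2 ≤ n) {𝒢 : Set (SimpleGraph (Fin n))} {S : Finset (Fin n)} {x : Fin n}
    (h : ∀ G ∈ 𝒢, Sm G S t x) : Bd 𝒢 ({x} ×ˢ S) (t * (3 * Real.logb 2 n) + 1) := by
  refine Bd.lab (L := Bool) (fun c => {G | G ∈ 𝒢 ∧ ((({x} ×ˢ S).filter (fun z : Fin n × Fin n => ¬ (G.Adj z.1 z.2 ↔ c = true))).card ≤ t)}) ?_ ?_ (by simp)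
  · intro G hG
    rcases h G hG with h | h
    · refine ⟨false, hG, le_trans ?_ h⟩
      refine card_le_card_of_injOn (fun z => z.2) ?_ ?_
      · rintro ⟨a, b⟩ hz
        simp at hz ⊢
        obtain ⟨⟨h1, rfl⟩, h2⟩ := hz
        exact ⟨h1, h2⟩
      · rintro ⟨a, b⟩ hz ⟨c, d⟩ hz' he
        simp at hz hz' he
        rw [← hz.1.2, ← hz'.1.2, he]
    · refine ⟨true, hG, le_trans ?_ h⟩
      refine card_le_card_of_injOn (fun z => z.2) ?_ ?_
      · rintro ⟨a, b⟩ hz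
        simp at hz ⊢
        obtain ⟨⟨h1, rfl⟩, h2⟩ := hz
        exact ⟨h1, h2⟩
      · rintro ⟨a, b⟩ hz ⟨c, d⟩ hz' he
        simp at hz hz' he
        rw [← hz.1.2, ← hz'.1.2, he]
  · intro c
    have := Bd.few' (V := Fin n) (by simpa using hn) c (𝒢 := {G | G ∈ 𝒢 ∧ ((({x} ×ˢ S).filter (fun z : Fin n × Fin n => ¬ (G.Adj z.1 z.2 ↔ c = true))).card ≤ t)})
      (E := {x} ×ˢ S) t (fun G hG => hG.2)
    simpa using this

lemma bd_rows {n : ℕ} {𝒢 : Set (SimpleGraph (Fin n))} (X S : Finset (Fin n)) (y : ℝ)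
    (h : ∀ x ∈ X, Bd 𝒢 (({x} : Finset (Fin n)) ×ˢ S) y) : Bd 𝒢 (X ×ˢ S) (X.card * y) := by
  have h1 := Bd.biUnion_const (𝒢 := 𝒢) X (fun x : Fin n => ({x} : Finset (Fin n)) ×ˢ S) y h
  have h2 : X ×ˢ S = X.biUnion (fun x : Fin n => ({x} : Finset (Fin n)) ×ˢ S) := by
    ext ⟨a, b⟩
    simp
  rw [h2]
  convert h1

lemma sm_rows {n t : ℕ} (hn : 2 ≤ n) {𝒢 : Set (SimpleGraph (Fin n))} {X S : Finset (Fin n)}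
    (h : ∀ G ∈ 𝒢, ∀ x ∈ X, Sm G S t x) : Bd 𝒢 (X ×ˢ S) (X.card * (t * (3 * Real.logb 2 n) + 1)) :=
  bd_rows X S _ (fun x hx => sm_row hn (fun G hG => h G hG x hx))

lemma cl_arith {n L k A : ℕ} {l : ℝ} (hL : 2 ^ 60 ≤ L) (hl : l ≤ 1 / 2 ^ 50 * L) (hk : k ≤ 4)
    (hA : 2 * A ≤ n + 4 * L ^ 17) :
    ((k:ℝ) * ((L^18:ℕ) * (3 * l) + 1)) + (k * A - (1:ℕ) * (L ^ 19 : ℕ) * (1 / 2 ^ 36)) + k * (10 * L ^ 4 : ℕ) ≤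
      k * n / 2 - (L:ℝ) ^ 17 := by
  have hL0 : (2^60:ℝ) ≤ L := by exact_mod_cast hL
  have hL1 : (1:ℝ) ≤ L := le_trans (by norm_num) hL0
  have hk4 : (k:ℝ) ≤ 4 := by exact_mod_cast hk
  have hk0 : (0:ℝ) ≤ k := Nat.cast_nonneg _
  have hAr : 2 * (A:ℝ) ≤ n + 4 * (L:ℝ)^17 := by exact_mod_cast hA
  have q1 : (k:ℝ) * (2 * A) ≤ k * (n + 4 * (L:ℝ)^17) := mul_le_mul_of_nonneg_left hAr hk0
  have q2 : (L:ℝ)^18 * l ≤ L^18 * (1/2^50 * L) := mul_le_mul_of_nonneg_left hl (by positivity)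
  have r1 : (2^60:ℝ) * (L:ℝ)^17 ≤ L^18 := by
    rw [pow_succ (L:ℝ) 17, mul_comm]; exact mul_le_mul_of_nonneg_left hL0 (by positivity)
  have r0 : (L:ℝ)^18 ≤ L^19 := pow_le_pow_right₀ hL1 (by norm_num)
  have r2 : (L:ℝ)^4 ≤ L^17 := pow_le_pow_right₀ hL1 (by norm_num)
  have r3 : (1:ℝ) ≤ L^17 := one_le_pow₀ hL1
  have e1 : (L:ℝ)^18 * (1/2^50 * L) = 1/2^50 * L^19 := by ring
  rw [e1] at q2
  have q3 : (k:ℝ) * (3 * (L^18 * l) + 1 + 2 * L^17 + 10 * L^4) ≤ 4 * (3 * (1/2^50 * L^19) + L^17 + 2 * L^17 + 10 * L^17) := by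
    calc (k:ℝ) * (3 * (L^18 * l) + 1 + 2 * L^17 + 10 * L^4) ≤ k * (3 * (1/2^50 * L^19) + L^17 + 2 * L^17 + 10 * L^17) :=
          mul_le_mul_of_nonneg_left (by linarith) hk0
      _ ≤ _ := mul_le_mul_of_nonneg_right hk4 (by positivity)
  push_cast
  have e2 : ((k:ℝ) * (L^18 * (3 * l) + 1)) + (k * A - 1 * L^19 * (1 / 2^36)) + k * (10 * L^4) =
    k * (3 * (L^18 * l) + 1 + 2 * L^17 + 10 * L^4) + (k * (2 * A)) / 2 - 2 * (k * L^17) - L^19 * (1/2^36) := by ring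
  rw [e2]
  have e3 : (k:ℝ) * (n + 4 * L^17) = k * n + 4 * (k * L^17) := by ring
  rw [e3] at q1
  norm_num at q3 r1 ⊢
  linarith

lemma FS.half {n L : ℕ} {G : SimpleGraph (Fin n)} {S T : Finset (Fin n)} (h : FS L G S T) :
    2 * S.card ≤ n + 4 * L ^ 17 ∧ 2 * T.card ≤ n + 4 * L ^ 17 := by
  have := disj_card h.dST
  have := h.cS
  have := h.cT
  omega

lemma fam_one {n a : ℕ} (u : Fin a → Fin n) : ∀ (k l : Fin 1) (i j : Fin a), u i = u j → k = l :=
  fun k l _ _ _ => Subsingleton.elim k l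

/-- Claim 1 -/
theorem CL1 : AA (fun n G => ∀ S T, FS (sc n) G S T → ∀ u : Fin 2 → Fin n, Function.Injective u → ∀ _ : Fin n,
    ¬ (Cop G ![4,5] univ u ∧ (∀ i, u i ∉ T) ∧ ∀ i, Sm G S (sc n ^ 18) (u i))) := by
  obtain ⟨n0, h0⟩ := scale (1/2^50) (by positivity) (2 ^ 60)
  refine AA.of_fs 2 (by norm_num) (fun n u _ S T G => Cop G ![4,5] univ u ∧ (∀ i, u i ∉ T) ∧ ∀ i, Sm G S (sc n ^ 18) (u i)) ⟨n0, fun n hn u hu r S T H 𝒢 h hne => ?_⟩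
  obtain ⟨s1, s2, s3, s4, s5, s6⟩ := h0 n hn
  set L := sc n with hLdef
  have hn2 : 2 ≤ n := by
    have : L ≤ L ^ 20 := Nat.le_self_pow (by norm_num) _
    omega
  obtain ⟨G0, hG0⟩ := id hne
  have hc := card_image_fin hu
  have hXT : ∀ x ∈ T, x ∉ univ.image u := by
    intro x hx hx'
    rw [mem_image] at hx'
    obtain ⟨i, _, rfl⟩ := hx'
    exact (h G0 hG0).2.2.1.2.1 i hx
  obtain ⟨P', hP', hPT, hPc⟩ := fam_transfer hXT (fun G hG => (h G hG).2.2.2) (fun G hG => (h G hG).2.1.fT) hne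
  have b1 := sm_rows hn2 (𝒢 := 𝒢) (X := univ.image u) (S := S) (t := L ^ 18) (by
    intro G hG x hx
    rw [mem_image] at hx
    obtain ⟨i, _, rfl⟩ := hx
    exact (h G hG).2.2.1.2.2 i)
  have b3 := cross_triv 𝒢 (univ.image u) (S ∪ T)ᶜ (10 * L ^ 4) (h G0 hG0).2.1.cQ
  have b2 : Bd 𝒢 (univ.image u ×ˢ T) _ := fam_block (by norm_num) (by norm_num) (by decide)
    (fun (_ : Fin 1) i => u i) P' (σ := ![4,5]) (fam_one u) hP'
    (fun G hG => ⟨(h G hG).1, fun _ => (h G hG).2.2.1.1, hPc G hG⟩)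
    (fun k i => mem_image_of_mem u (mem_univ _)) hPT
  rw [hc] at b1 b2 b3
  exact (cross_split b1 b2 b3).mono (cl_arith s1 s4 (by norm_num) (h G0 hG0).2.1.half.2)

/-- Claim 4 -/
theorem CL4 {a b : ℕ} (σ : Fin a → Fin 6) (τ : Fin b → Fin 6) (ha : 1 ≤ a) (ha4 : a ≤ 4) (hb : b ≤ 6)
    (hst : ∀ k, (∃ i, σ i = k) ∨ ∃ j, τ j = k) (hτ : ∀ i j, c6 (τ i) (τ j) = false) :
    AA (fun n G => ∀ S T, FS (sc n) G S T → ∀ u : Fin a → Fin n, Function.Injective u → ∀ _ : Fin n,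
    ¬ (Cop G σ univ u ∧ (∀ i, u i ∉ S) ∧ ∀ i, cdeg G T (u i) ≤ sc n ^ 18)) := by
  obtain ⟨n0, h0⟩ := scale (1/2^50) (by positivity) (2 ^ 60)
  refine AA.of_fs a ha (fun n u _ S T G => Cop G σ univ u ∧ (∀ i, u i ∉ S) ∧ ∀ i, cdeg G T (u i) ≤ sc n ^ 18) ⟨n0, fun n hn u hu r S T H 𝒢 h hne => ?_⟩
  obtain ⟨s1, s2, s3, s4, s5, s6⟩ := h0 n hn
  set L := sc n with hLdef
  have hn2 : 2 ≤ n := by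
    have : L ≤ L ^ 20 := Nat.le_self_pow (by norm_num) _
    omega
  obtain ⟨G0, hG0⟩ := id hne
  have hc := card_image_fin hu
  have hXT : ∀ x ∈ S, x ∉ univ.image u := by
    intro x hx hx'
    rw [mem_image] at hx'
    obtain ⟨i, _, rfl⟩ := hx'
    exact (h G0 hG0).2.2.1.2.1 i hx
  have hsz : b * L ^ 19 ≤ S.card := by
    have e1 : L ^ 19 * 100 ≤ L ^ 20 := by
      rw [pow_succ L 19]; exact Nat.mul_le_mul_left _ s6
    have e2 : L ^ 17 ≤ L ^ 19 := Nat.pow_le_pow_right (by omega) (by norm_num)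
    have e3 := (h G0 hG0).2.1.cS
    have e4 : b * L ^ 19 ≤ 6 * L ^ 19 := Nat.mul_le_mul_right _ hb
    omega
  obtain ⟨P', hP', hPT, hPc⟩ := fam_transfer (N := L ^ 19) hXT (fun G hG => (h G hG).2.2.2)
    (fun G hG => fam_stab (h G hG).2.1.sS hτ hsz) hne
  have b1 := sm_rows hn2 (𝒢 := 𝒢) (X := univ.image u) (S := T) (t := L ^ 18) (by
    intro G hG x hx
    rw [mem_image] at hx
    obtain ⟨i, _, rfl⟩ := hx
    exact Or.inr ((h G hG).2.2.1.2.2 i))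
  have b3 := cross_triv 𝒢 (univ.image u) (S ∪ T)ᶜ (10 * L ^ 4) (h G0 hG0).2.1.cQ
  have b2 : Bd 𝒢 (univ.image u ×ˢ S) _ := fam_block (by omega) hb hst
    (fun (_ : Fin 1) i => u i) P' (fam_one u) hP'
    (fun G hG => ⟨(h G hG).1, fun _ => (h G hG).2.2.1.1, hPc G hG⟩)
    (fun k i => mem_image_of_mem u (mem_univ _)) hPT
  rw [hc] at b1 b2 b3
  refine (cross_split b2 b1 b3).mono ?_
  have := cl_arith s1 s4 ha4 (h G0 hG0).2.1.half.1
  linarith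

end claims
end C6P
end Part22

section Part23
open SimpleGraph Filter
open scoped Classical
namespace C6P
open Finset

section claimthree

lemma cop_block_r {V : Type} {a b : ℕ} {σ : Fin a → Fin 6} {τ : Fin b → Fin 6} {ρ : Fin 6} {r : V}
    (hst : ∀ k, (∃ i, σ i = k) ∨ (∃ j, τ j = k) ∨ k = ρ) {p : Fin a → V} {q : Fin b → V} {𝒢 : Set (SimpleGraph V)}
    {U W : Finset V} (h : ∀ G ∈ 𝒢, C6F G ∧ Cop G σ U p ∧ Cop G τ W q ∧
      (∀ i, G.Adj r (p i) ↔ c6 ρ (σ i) = true) ∧ (∀ i, G.Adj r (q i) ↔ c6 ρ (τ i) = true)) :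
    ∃ Z ⊆ univ.image p ×ˢ univ.image q, ∀ G ∈ 𝒢, tr (univ.image p ×ˢ univ.image q) G ≠ Z := by
  refine ⟨(univ.filter (fun z : Fin a × Fin b => c6 (σ z.1) (τ z.2) = true)).image (fun z => (p z.1, q z.2)), ?_, ?_⟩
  · intro z hz
    rw [mem_image] at hz
    obtain ⟨⟨i, j⟩, -, rfl⟩ := hz
    simp
  · intro G hG he
    obtain ⟨hC, ⟨hp, -, hp2⟩, ⟨hq, -, hq2⟩, hr1, hr2⟩ := h G hG
    have key : ∀ i j, G.Adj (p i) (q j) ↔ c6 (σ i) (τ j) = true := by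
      intro i j
      have h1 := congrArg ((p i, q j) ∈ ·) he
      simp only [mem_tr, mem_product, mem_image_of_mem, mem_univ, true_and, and_self, eq_iff_iff] at h1
      rw [h1, mem_image]
      constructor
      · rintro ⟨⟨i', j'⟩, h2, h3⟩
        simp only [mem_filter, mem_univ, true_and, Prod.mk.injEq] at h2 h3
        rw [← hp h3.1, ← hq h3.2]; exact h2
      · intro h2
        exact ⟨(i, j), by simpa using h2, rfl⟩
    have : ∀ k, ∃ z : (Fin a ⊕ Fin b) ⊕ Unit, Sum.elim (Sum.elim σ τ) (fun _ => ρ) z = k := by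
      intro k
      rcases hst k with ⟨i, hi⟩ | ⟨j, hj⟩ | hk
      · exact ⟨Sum.inl (Sum.inl i), hi⟩
      · exact ⟨Sum.inl (Sum.inr j), hj⟩
      · exact ⟨Sum.inr (), hk.symm⟩
    choose κ hκ using this
    apply hC (fun k => Sum.elim (Sum.elim p q) (fun _ => r) (κ k))
    intro k l
    have hk := hκ k
    have hl := hκ l
    rcases h1 : κ k with (i | i) | i <;> rcases h2 : κ l with (j | j) | j <;> rw [h1] at hk <;> rw [h2] at hl <;>
      simp only [Sum.elim_inl, Sum.elim_inr] at hk hl ⊢ <;> rw [← hk, ← hl]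
    · exact hp2 i j
    · exact key i j
    · rw [G.adj_comm, hr1 i, c6_symm]
    · rw [G.adj_comm, key j i, c6_symm]
    · exact hq2 i j
    · rw [G.adj_comm, hr2 i, c6_symm]
    · exact hr1 j
    · exact hr2 j
    · have : ∀ ρ, c6 ρ ρ = false := by decide
      simp [this]

lemma fam_block_r {V : Type} [Fintype V] {a b N m : ℕ} {σ : Fin a → Fin 6} {τ : Fin b → Fin 6} {ρ : Fin 6} {r : V}
    (ha6 : a ≤ 6) (hb6 : b ≤ 6)
    (hst : ∀ k, (∃ i, σ i = k) ∨ (∃ j, τ j = k) ∨ k = ρ) {X Y : Finset V} (P : Fin N → Fin a → V) (P' : Fin m → Fin b → V)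
    {𝒢 : Set (SimpleGraph V)} (hP : ∀ k l i j, P k i = P l j → k = l) (hP' : ∀ k l i j, P' k i = P' l j → k = l)
    (h : ∀ G ∈ 𝒢, C6F G ∧ (∀ k, Cop G σ univ (P k)) ∧ (∀ k, Cop G τ univ (P' k)) ∧
      (∀ k i, G.Adj r (P k i) ↔ c6 ρ (σ i) = true) ∧ (∀ k i, G.Adj r (P' k i) ↔ c6 ρ (τ i) = true))
    (hX : ∀ k i, P k i ∈ X) (hY : ∀ k i, P' k i ∈ Y) :
    Bd 𝒢 (X ×ˢ Y) (X.card * Y.card - N * m * (1 / 2 ^ 36)) := by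
  refine Bd.blocks (fun k => univ.image (P k))
    (fun k => univ.image (P' k)) 36 ?_ ?_ ?_ ?_ ?_ ?_
  · intro k; rw [image_subset_iff]; intro i _; exact hX k i
  · intro k; rw [image_subset_iff]; intro i _; exact hY k i
  · intro k k' hk
    rw [Finset.disjoint_left]
    rintro v hv hv'
    rw [mem_image] at hv hv'
    obtain ⟨i, -, rfl⟩ := hv
    obtain ⟨j, -, hj⟩ := hv'
    exact hk (hP _ _ _ _ hj).symm
  · intro k k' hk
    rw [Finset.disjoint_left]
    rintro v hv hv'
    rw [mem_image] at hv hv'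
    obtain ⟨i, -, rfl⟩ := hv
    obtain ⟨j, -, hj⟩ := hv'
    exact hk (hP' _ _ _ _ hj).symm
  · intro k l
    have e1 : (univ.image (P k)).card ≤ 6 := card_image_le.trans (by simpa using ha6)
    have e2 : (univ.image (P' l)).card ≤ 6 := card_image_le.trans (by simpa using hb6)
    exact (Nat.mul_le_mul e1 e2).trans (by norm_num)
  · intro k l
    refine cop_block_r (r := r) hst (U := univ) (W := univ) ?_
    intro G hG
    obtain ⟨h1, h2, h3, h4, h5⟩ := h G hG
    exact ⟨h1, h2 k, h3 l, h4 k, h5 l⟩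

lemma fam_split {n b m : ℕ} (A B : Finset (Fin n)) (hAB : Disjoint A B) (χ : Fin b → Bool)
    (hA : m * b ≤ A.card) (hB : m * b ≤ B.card) : ∃ P : Fin m → Fin b → Fin n,
    (∀ k l i j, P k i = P l j → k = l ∧ i = j) ∧ ∀ k i, P k i ∈ (if χ i = true then A else B) := by
  obtain ⟨uA, hA1, hA2⟩ := exists_inj_in A hA
  obtain ⟨uB, hB1, hB2⟩ := exists_inj_in B hB
  refine ⟨fun k i => if χ i = true then uA (finProdFinEquiv (k, i)) else uB (finProdFinEquiv (k, i)), ?_, ?_⟩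
  · intro k l i j h
    by_cases hi : χ i = true <;> by_cases hj : χ j = true <;> simp only [hi, hj, if_true, if_false, Bool.false_eq_true] at h
    · exact Prod.mk.inj (finProdFinEquiv.injective (hA1 h))
    · exact absurd (hB2 (finProdFinEquiv (l, j))) (Finset.disjoint_left.1 hAB (h ▸ hA2 _))
    · exact absurd (hB2 (finProdFinEquiv (k, i))) (Finset.disjoint_left.1 hAB (h ▸ hA2 _))
    · exact Prod.mk.inj (finProdFinEquiv.injective (hB1 h))
  · intro k i
    by_cases hi : χ i = true <;> simp only [hi, if_true, if_false]
    · exact hA2 _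
    · exact hB2 _

lemma cl3_arith {n L k A : ℕ} {l : ℝ} (hL : 2 ^ 60 ≤ L) (hl : l ≤ 1 / 2 ^ 50 * L) (hk : k ≤ 4)
    (hA : 2 * A ≤ n + 4 * L ^ 17) :
    (k * A - (1:ℕ) * (2 ^ 50 * L ^ 17 : ℕ) * (1 / 2 ^ 36)) + ((k:ℝ) * (L^16:ℕ) * (3 * l)) + k * (10 * L ^ 4 : ℕ) ≤
      k * n / 2 - (L:ℝ) ^ 17 := by
  have hL0 : (2^60:ℝ) ≤ L := by exact_mod_cast hL
  have hL1 : (1:ℝ) ≤ L := le_trans (by norm_num) hL0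
  have hk4 : (k:ℝ) ≤ 4 := by exact_mod_cast hk
  have hk0 : (0:ℝ) ≤ k := Nat.cast_nonneg _
  have hAr : 2 * (A:ℝ) ≤ n + 4 * (L:ℝ)^17 := by exact_mod_cast hA
  have q1 : (k:ℝ) * (2 * A) ≤ k * (n + 4 * (L:ℝ)^17) := mul_le_mul_of_nonneg_left hAr hk0
  have q2 : (L:ℝ)^16 * l ≤ L^16 * (1/2^50 * L) := mul_le_mul_of_nonneg_left hl (by positivity)
  have r2 : (L:ℝ)^4 ≤ L^17 := pow_le_pow_right₀ hL1 (by norm_num)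
  have r3 : (1:ℝ) ≤ L^17 := one_le_pow₀ hL1
  have e1 : (L:ℝ)^16 * (1/2^50 * L) = 1/2^50 * L^17 := by ring
  rw [e1] at q2
  have q3 : (k:ℝ) * (3 * (L^16 * l) + 2 * L^17 + 10 * L^4) ≤ 4 * (3 * (1/2^50 * L^17) + 2 * L^17 + 10 * L^17) := by
    calc (k:ℝ) * (3 * (L^16 * l) + 2 * L^17 + 10 * L^4) ≤ k * (3 * (1/2^50 * L^17) + 2 * L^17 + 10 * L^17) :=
          mul_le_mul_of_nonneg_left (by linarith) hk0
      _ ≤ _ := mul_le_mul_of_nonneg_right hk4 (by positivity)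
  push_cast
  have e2 : (k * A - 1 * (1125899906842624 * L^17) * (1 / 2^36)) + ((k:ℝ) * L^16 * (3 * l)) + k * (10 * L^4) =
    k * (3 * (L^16 * l) + 2 * L^17 + 10 * L^4) + (k * (2 * A)) / 2 - 2 * (k * L^17) - L^17 * 2 ^ 14 := by ring
  rw [e2]
  have e3 : (k:ℝ) * (n + 4 * L^17) = k * n + 4 * (k * L^17) := by ring
  rw [e3] at q1
  norm_num at q3 ⊢
  linarith

/-- Claim 3 -/
theorem CL3 {a b : ℕ} (σ : Fin a → Fin 6) (τ : Fin b → Fin 6) (ρ : Fin 6) (ha : 1 ≤ a) (ha4 : a ≤ 4) (hb : b ≤ 6)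
    (hst : ∀ k, (∃ i, σ i = k) ∨ (∃ j, τ j = k) ∨ k = ρ) (hτ : ∀ i j, c6 (τ i) (τ j) = false) :
    AA (fun n G => ∀ S T, FS (sc n) G S T → ∀ u : Fin a → Fin n, Function.Injective u → ∀ r : Fin n,
    ¬ (Cop G σ univ u ∧ (∀ i, u i ∈ T) ∧ r ∉ T ∧ ¬ Sm G S (sc n ^ 18) r ∧ ∀ i, (G.Adj r (u i) ↔ c6 ρ (σ i) = true))) := by
  obtain ⟨n0, h0⟩ := scale (1/2^50) (by positivity) (2 ^ 60)
  refine AA.of_fs a ha (fun n u r S T G => Cop G σ univ u ∧ (∀ i, u i ∈ T) ∧ r ∉ T ∧ ¬ Sm G S (sc n ^ 18) r ∧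
    ∀ i, (G.Adj r (u i) ↔ c6 ρ (σ i) = true)) ⟨n0, fun n hn u hu r S T H 𝒢 h hne => ?_⟩
  obtain ⟨s1, s2, s3, s4, s5, s6⟩ := h0 n hn
  set L := sc n with hLdef
  have hn2 : 2 ≤ n := by
    have : L ≤ L ^ 20 := Nat.le_self_pow (by norm_num) _
    omega
  obtain ⟨G0, hG0⟩ := id hne
  have hc := card_image_fin hu
  obtain ⟨hC0, hF0, ⟨hB1, hB2, hB3, hB4, hB5⟩, hA0⟩ := h G0 hG0
  have hXT : ∀ x ∈ univ.image u, x ∈ T := by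
    intro x hx'
    rw [mem_image] at hx'
    obtain ⟨i, _, rfl⟩ := hx'
    exact hB2 i
  have hSX : ∀ x ∈ S, x ∉ univ.image u := fun x hx hx' => Finset.disjoint_left.1 hF0.dST hx (hXT x hx')
  have hrX : r ∉ univ.image u := fun hx => hB3 (hXT r hx)
  have hsz : 2 ^ 50 * L ^ 17 * b ≤ L ^ 18 := by
    calc 2 ^ 50 * L ^ 17 * b ≤ 2 ^ 50 * L ^ 17 * 6 := Nat.mul_le_mul_left _ hb
      _ = L ^ 17 * (6 * 2 ^ 50) := by ring
      _ ≤ L ^ 17 * L := Nat.mul_le_mul_left _ (le_trans (by norm_num) s1)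
      _ = L ^ 18 := by ring
  unfold Sm at hB4
  push Not at hB4
  obtain ⟨P', hP', hPm⟩ := fam_split (m := 2 ^ 50 * L ^ 17) (S.filter (fun y => G0.Adj r y)) (S.filter (fun y => ¬ G0.Adj r y))
    (disjoint_filter_filter_not _ _ _) (fun i => c6 ρ (τ i)) (hsz.trans hB4.1.le) (hsz.trans (by
      have := hB4.2.le
      unfold cdeg at this
      exact this))
  have hPS : ∀ k i, P' k i ∈ S := by
    intro k i
    have := hPm k i
    split_ifs at this
    · exact (mem_filter.1 this).1
    · exact (mem_filter.1 this).1
  have hPr0 : ∀ k i, G0.Adj r (P' k i) ↔ c6 ρ (τ i) = true := by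
    intro k i
    have := hPm k i
    split_ifs at this with hh
    · simp [hh, (mem_filter.1 this).2]
    · simp [hh, (mem_filter.1 this).2]
  have hPr : ∀ G ∈ 𝒢, ∀ k i, G.Adj r (P' k i) ↔ c6 ρ (τ i) = true := by
    intro G hG k i
    have e : (r ∈ univ.image u ↔ P' k i ∈ univ.image u) := iff_of_false hrX (hSX _ (hPS k i))
    rw [(h G hG).2.2.2 _ _ e, ← hA0 _ _ e]
    exact hPr0 k i
  have hPc : ∀ G ∈ 𝒢, ∀ k, Cop G τ univ (P' k) := by
    intro G hG k
    refine ⟨fun i j hij => (hP' _ _ _ _ hij).2, fun i => mem_univ _, fun i j => ?_⟩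
    rw [hτ i j]
    exact iff_of_false ((h G hG).2.1.sS _ (hPS k i) _ (hPS k j)) (by simp)
  have b2 := few_cdeg hn2 (𝒢 := 𝒢) (X := univ.image u) (T := T) (L ^ 16) (by
    intro G hG x hx
    exact (h G hG).2.1.dT x (hXT x hx))
  have b3 := cross_triv 𝒢 (univ.image u) (S ∪ T)ᶜ (10 * L ^ 4) hF0.cQ
  have b1 : Bd 𝒢 (univ.image u ×ˢ S) _ := fam_block_r (by omega) hb hst
    (fun (_ : Fin 1) i => u i) P' (fam_one u) (fun k l i j hh => (hP' k l i j hh).1)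
    (fun G hG => ⟨(h G hG).1, fun _ => (h G hG).2.2.1.1, hPc G hG, fun _ => (h G hG).2.2.1.2.2.2.2, hPr G hG⟩)
    (fun k i => mem_image_of_mem u (mem_univ _)) hPS
  rw [hc] at b1 b2 b3
  exact (cross_split b1 b2 b3).mono (cl3_arith s1 s4 ha4 hF0.half.1)

end claimthree
end C6P
end Part23

section Part24
open SimpleGraph Filter
open scoped Classical
namespace C6P
open Finset

section dten

lemma AA.of_dp2 {P : ∀ n, SimpleGraph (Fin n) → Prop}
    (h : ∃ n0 : ℕ, ∀ n ≥ n0, ∃ (k L : ℕ) (R : Finset (Fin n) → SimpleGraph (Fin n) → Prop) (x : ℝ),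
      8 ≤ k ∧ 2 * k ≤ n ∧ L ^ 2 ≤ k ∧ x + ((2 * k : ℕ) + 1) * Real.logb 2 n ≤ (k:ℝ) * (n - 2 * k) + k ^ 2 + L ^ 3 / 64 ∧
      (∀ G, C6F G → ¬ P n G → ∃ X, X.card = 2 * k ∧ R X G) ∧
      (∀ X, X.card = 2 * k → ∀ H, Bd {G | C6F G ∧ R X G ∧ out X G = H} (X ×ˢ univ) x)) : AA P := by
  intro ε hε
  obtain ⟨n0, h0⟩ := h
  obtain ⟨n1, hn1⟩ := exists_nat_gt (1 / ε)
  refine ⟨max n0 (max n1 1), fun n hn C hC hI => ?_⟩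
  have hna : n0 ≤ n := le_trans (le_max_left _ _) hn
  have hnb : n1 ≤ n := le_trans (le_trans (le_max_left _ _) (le_max_right _ _)) hn
  have hnc : 1 ≤ n := le_trans (le_trans (le_max_right _ _) (le_max_right _ _)) hn
  have hn0 : (0:ℝ) < n := by exact_mod_cast hnc
  obtain ⟨k, L, R, x, hk1, hkn, hL, hx, hbad, hfib⟩ := h0 n hna
  have h1 := dp_count (P n) R x hbad hfib
  have h2 := hI (n - 2 * k) (by omega)
  have h3 := g_two' hk1 hkn hL
  set y := (k:ℝ) * (n - 2 * k) + k ^ 2 + L ^ 3 / 64 with hy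
  have hpow : (n:ℝ) ^ (2 * k) * 2 ^ x ≤ 1 / n * 2 ^ y := by
    have e : (n:ℝ) = 2 ^ (Real.logb 2 n) := by
      rw [Real.rpow_logb (by norm_num) (by norm_num) hn0]
    have e1 : (n:ℝ) ^ (2 * k) = 2 ^ ((2 * k : ℕ) * Real.logb 2 n) := by
      rw [mul_comm ((2 * k : ℕ):ℝ), Real.rpow_mul (by norm_num), ← e, Real.rpow_natCast]
    have e2 : 1 / (n:ℝ) = 2 ^ (- Real.logb 2 n) := by
      rw [Real.rpow_neg (by norm_num), ← e, one_div]
    rw [e1, e2, ← Real.rpow_add (by norm_num), ← Real.rpow_add (by norm_num)]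
    apply Real.rpow_le_rpow_of_exponent_le (by norm_num)
    linarith
  calc (((Fs n).filter (fun G => ¬ P n G)).card : ℝ) ≤ (n:ℝ) ^ (2 * k) * f (n - 2 * k) * 2 ^ x := h1
    _ = f (n - 2 * k) * ((n:ℝ) ^ (2 * k) * 2 ^ x) := by ring
    _ ≤ (C * g (n - 2 * k)) * (1 / n * 2 ^ y) :=
        mul_le_mul h2 hpow (by positivity) (by positivity)
    _ = (1 / n) * C * (g (n - 2 * k) * 2 ^ y) := by ring
    _ ≤ (1 / n) * C * g n := mul_le_mul_of_nonneg_left h3 (by positivity)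
    _ ≤ ε * C * g n := by
        have : 1 / (n:ℝ) ≤ ε := by
          rw [div_le_iff₀ hn0]
          have h5 : (n1:ℝ) ≤ n := by exact_mod_cast hnb
          have h6 : 1 / ε < n := lt_of_lt_of_le hn1 h5
          rw [div_lt_iff₀ hε] at h6
          linarith
        have hc : 0 ≤ C * (g n : ℝ) := by positivity
        nlinarith

/-- no edges: cost zero -/
lemma bd_stab {n : ℕ} {𝒢 : Set (SimpleGraph (Fin n))} {X S : Finset (Fin n)}
    (h : ∀ G ∈ 𝒢, Stab G S) (hX : X ⊆ S) : Bd 𝒢 (X ×ˢ S) 0 := by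
  refine Bd.code {∅} ?_ (by simp)
  intro G hG
  rw [mem_singleton, Finset.eq_empty_iff_forall_notMem]
  rintro ⟨a, b⟩ hab
  rw [mem_tr, mem_product] at hab
  exact h G hG a (hX hab.1.1) b hab.1.2 hab.2

lemma d10_arith {n L s t k : ℕ} {l : ℝ} (hL : 10 ^ 4 ≤ L) (hn : n ≤ 2 * L ^ 20) (hl : l ≤ 1 * L) (hl1 : 1 ≤ l)
    (hk : k = L ^ 16) (hst : s + t ≤ n) :
    ((k:ℝ) * (4 * L ^ 2 : ℕ) * (3 * l) + (k * s + (k * (t - k) + (0 + (2 * k : ℕ) * (10 * L ^ 4 : ℕ))))) + 3 * n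
      + ((2 * k : ℕ) + 1) * l ≤ (k:ℝ) * (n - 2 * k) + k ^ 2 + (L ^ 8 : ℕ) ^ 3 / 64 := by
  have hL0 : (10^4:ℝ) ≤ L := by exact_mod_cast hL
  have hL1 : (1:ℝ) ≤ L := le_trans (by norm_num) hL0
  have hnr : (n:ℝ) ≤ 2 * (L:ℝ)^20 := by exact_mod_cast hn
  have hstr : (s:ℝ) + t ≤ n := by exact_mod_cast hst
  have hkr : (k:ℝ) = (L:ℝ)^16 := by rw [hk]; push_cast; ring
  have k0 : (0:ℝ) ≤ k := Nat.cast_nonneg _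
  have a1 : (k:ℝ) * (s + t) ≤ k * n := mul_le_mul_of_nonneg_left hstr k0
  have a2 : (L:ℝ)^18 * l ≤ L^18 * (1 * L) := mul_le_mul_of_nonneg_left hl (by positivity)
  have a3 : (L:ℝ)^16 * l ≤ L^16 * (1 * L) := mul_le_mul_of_nonneg_left hl (by positivity)
  have b1 : (L:ℝ)^19 ≤ L^20 := pow_le_pow_right₀ hL1 (by norm_num)
  have b2 : (L:ℝ)^17 ≤ L^20 := pow_le_pow_right₀ hL1 (by norm_num)
  have b3 : (L:ℝ) ≤ L^20 := le_self_pow₀ hL1 (by norm_num)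
  have b4 : (10^4:ℝ) * L^20 ≤ L^21 := by
    rw [pow_succ (L:ℝ) 20, mul_comm]; exact mul_le_mul_of_nonneg_left hL0 (by positivity)
  have b5 : (L:ℝ)^21 ≤ L^24 := pow_le_pow_right₀ hL1 (by norm_num)
  have b6 : (0:ℝ) ≤ L^20 := by positivity
  push_cast
  have e1 : (k:ℝ) * (4 * L^2) * (3 * l) = 12 * (L^18 * l) := by rw [hkr]; ring
  have e2 : (2 * (k:ℝ)) * (10 * L^4) = 20 * L^20 := by rw [hkr]; ring
  have e3 : (2 * (k:ℝ) + 1) * l = 2 * (L^16 * l) + l := by rw [hkr]; ring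
  have e4 : ((L:ℝ)^8)^3 = L^24 := by ring
  have e5 : (L:ℝ)^18 * (1 * L) = L^19 := by ring
  have e6 : (L:ℝ)^16 * (1 * L) = L^17 := by ring
  rw [e1, e2, e3, e4]
  rw [e5] at a2; rw [e6] at a3
  have e7 : (k:ℝ) * (s + t) = k * s + k * t := by ring
  have e8 : (k:ℝ) * (t - k) = k * t - k^2 := by ring
  have e9 : (k:ℝ) * (n - 2 * k) = k * n - 2 * k^2 := by ring
  rw [e8, e9]
  rw [e7] at a1
  norm_num at b4
  linarith

lemma lab3_card (n : ℕ) : (Fintype.card (Finset (Fin n) × Finset (Fin n) × Finset (Fin n)) : ℝ) ≤ 2 ^ (3 * (n:ℝ)) := by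
  rw [Fintype.card_prod, Nat.cast_mul, show (3 * (n:ℝ)) = n + 2 * n by ring, Real.rpow_add (by norm_num)]
  refine mul_le_mul ?_ (lab2_card n) (by positivity) (by positivity)
  simp only [Fintype.card_finset, Fintype.card_fin]
  push_cast
  rw [Real.rpow_natCast]

theorem D10 : AA (fun n G => ∀ S T, FS (sc n) G S T → (T.filter (fun t => cdeg G T t ≤ 4 * sc n ^ 2)).card < sc n ^ 16) := by
  obtain ⟨n0, h0⟩ := scale 1 (by norm_num) (10 ^ 4)
  apply AA.of_dp2
  refine ⟨n0, fun n hn => ?_⟩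
  obtain ⟨s1, s2, s3, s4, s5, s6⟩ := h0 n hn
  set L := sc n with hLdef
  have p1 : L ^ 17 * 100 ≤ L ^ 20 := by
    calc L ^ 17 * 100 ≤ L ^ 17 * L := Nat.mul_le_mul_left _ s6
      _ = L ^ 18 := by ring
      _ ≤ L ^ 20 := Nat.pow_le_pow_right (by omega) (by norm_num)
  have p2 : L ^ 16 ≤ L ^ 17 := Nat.pow_le_pow_right (by omega) (by norm_num)
  have p3 : L ≤ L ^ 16 := Nat.le_self_pow (by norm_num) _
  generalize hk : L ^ 16 = k at *
  set R : (Finset (Fin n)) → (Finset (Fin n) × Finset (Fin n) × Finset (Fin n)) → SimpleGraph (Fin n) → Prop :=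
    fun X z G => FS L G z.1 z.2.1 ∧ z.2.2 ⊆ X ∧ z.2.2 ⊆ z.2.1 ∧ X \ z.2.2 ⊆ z.1 ∧ z.2.2.card = k ∧
      ∀ t ∈ z.2.2, cdeg G z.2.1 t ≤ 4 * L ^ 2 with hR
  by_cases hex : ∃ s t : ℕ, s + t ≤ n
  swap
  · exact absurd ⟨0, 0, by omega⟩ hex
  refine ⟨k, L ^ 8, fun X G => ∃ z, R X z G, (k:ℝ) * (4 * L ^ 2 : ℕ) * (3 * Real.logb 2 n) + ((k:ℝ) * (n - k) + (0 + (2 * k : ℕ) * (10 * L ^ 4 : ℕ))) + 3 * n,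
    by omega, by omega, by rw [← hk]; exact le_of_eq (by ring), ?_, ?_, ?_⟩
  · have := d10_arith (s := 0) (t := n) s1 s3 s4 s5 hk.symm (by omega)
    push_cast at this ⊢
    linarith
  · intro G hG hb
    push Not at hb
    obtain ⟨S, T, hF, hc⟩ := hb
    obtain ⟨K, hK, hKc⟩ := exists_subset_card_eq hc
    obtain ⟨K', hK', hKc'⟩ := exists_subset_card_eq (s := S) (n := k) (by have := hF.cS; omega)
    have hKT : K ⊆ T := hK.trans (filter_subset _ _)
    have hd : Disjoint K K' := (Finset.disjoint_of_subset_left hKT (Finset.disjoint_of_subset_right hK' hF.dST.symm))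
    refine ⟨K ∪ K', by rw [card_union_of_disjoint hd]; omega, (S, T, K), hF, subset_union_left, hKT, ?_, hKc, ?_⟩
    · rw [union_sdiff_cancel_left hd]; exact hK'
    · intro t ht
      exact (mem_filter.1 (hK ht)).2
  · intro X hX H
    refine Bd.lab (L := Finset (Fin n) × Finset (Fin n) × Finset (Fin n)) (fun z => {G | R X z G}) ?_ ?_ (lab3_card n)
    · rintro G ⟨_, ⟨z, hz⟩, _⟩
      exact ⟨z, hz⟩
    rintro ⟨S, T, K⟩
    by_cases hne : Set.Nonempty {G | R X (S, T, K) G}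
    swap
    · rw [Set.not_nonempty_iff_eq_empty] at hne
      rw [hne]; exact Bd.empty _ _
    set 𝒢 := {G | R X (S, T, K) G} with h𝒢
    obtain ⟨G0, hG0⟩ := hne
    have hG0' : FS L G0 S T ∧ K ⊆ X ∧ K ⊆ T ∧ X \ K ⊆ S ∧ K.card = k ∧ ∀ t ∈ K, cdeg G0 T t ≤ 4 * L ^ 2 := hG0
    obtain ⟨hF, hKX, hKT, hXS, hKc, hdeg⟩ := hG0'
    have hXKc : (X \ K).card = k := by
      rw [card_sdiff_of_subset hKX]; omega
    have b1 := few_cdeg (by omega) (𝒢 := 𝒢) (X := K) (T := T) (4 * L ^ 2) (fun G hG => hG.2.2.2.2.2)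
    have b2 := Bd.triv 𝒢 (K ×ˢ S)
    have b3 := Bd.triv 𝒢 ((X \ K) ×ˢ (T \ K))
    have b4 := bd_stab (𝒢 := 𝒢) (fun G hG => hG.1.sS) hXS
    have b5 := cross_triv 𝒢 X (S ∪ T)ᶜ (10 * L ^ 4) hF.cQ
    have hTK : (T \ K).card + k ≤ T.card := by
      rw [card_sdiff_of_subset hKT, hKc]
      have := card_le_card hKT
      omega
    rw [hKc] at b1
    rw [hX] at b5
    rw [card_product, hKc] at b2
    rw [card_product, hXKc] at b3
    have b := (b1.union (b2.union (b3.union (b4.union b5))))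
    refine (Bd.sym b ?_).mono ?_
    · intro x y hxy _
      simp only [mem_product, mem_univ, and_true] at hxy
      simp only [mem_union, mem_product, Finset.mem_sdiff, mem_compl]
      have q1 : x ∈ K → x ∈ T := fun h => hKT h
      have q2 : y ∈ K → y ∈ X := fun h => hKX h
      have q3 : x ∉ K → x ∈ S := fun h => hXS (Finset.mem_sdiff.2 ⟨hxy, h⟩)
      by_cases x1 : x ∈ K <;> by_cases y1 : y ∈ K <;> by_cases y2 : y ∈ S <;> by_cases y3 : y ∈ T <;>
        simp_all
    · have hd := disj_card hF.dST
      have e1 : (k:ℝ) * (S.card + (T \ K).card) ≤ k * (n - k) := by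
        refine mul_le_mul_of_nonneg_left ?_ (Nat.cast_nonneg _)
        have : S.card + (T \ K).card + k ≤ n := by omega
        have : (S.card:ℝ) + (T \ K).card + k ≤ n := by exact_mod_cast this
        linarith
      push_cast at e1 ⊢
      linarith

end dten
end C6P
end Part24

section Part25
open SimpleGraph Filter
open scoped Classical
namespace C6P
open Finset

section fin

lemma inj_two {V : Type} {a b : V} (h : a ≠ b) : Function.Injective ![a, b] := by
  intro i j hij
  fin_cases i <;> fin_cases j <;> simp_all

lemma inj_three {V : Type} {a b c : V} (h1 : a ≠ b) (h2 : a ≠ c) (h3 : b ≠ c) : Function.Injective ![a, b, c] := by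
  intro i j hij
  fin_cases i <;> fin_cases j <;> simp_all

lemma cop_two {V : Type} [Fintype V] {G : SimpleGraph V} {a b : V} (h : a ≠ b) (hadj : ¬ G.Adj a b) :
    Cop G ![2,4] univ ![a, b] := by
  refine ⟨inj_two h, fun _ => mem_univ _, ?_⟩
  have hadj' : ¬ G.Adj b a := fun h => hadj h.symm
  intro i j
  fin_cases i <;> fin_cases j <;> simp [hadj, hadj'] <;> decide

lemma cop_three {V : Type} [Fintype V] {G : SimpleGraph V} {t a b : V} (n1 : t ≠ a) (n2 : t ≠ b) (n3 : a ≠ b)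
    (h1 : ¬ G.Adj t a) (h2 : ¬ G.Adj t b) (h3 : G.Adj a b) :
    Cop G ![1,3,4] univ ![t, a, b] := by
  refine ⟨inj_three n1 n2 n3, fun _ => mem_univ _, ?_⟩
  have m1 : ¬ G.Adj a t := fun h => h1 h.symm
  have m2 : ¬ G.Adj b t := fun h => h2 h.symm
  intro i j
  fin_cases i <;> fin_cases j <;> simp [h1, h2, m1, m2, h3, h3.symm] <;> decide

lemma cl3_use {n L : ℕ} {G : SimpleGraph (Fin n)} {S T : Finset (Fin n)} {r : Fin n} (hL : 100 ≤ L) (hn : n ≤ 2 * L ^ 20)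
    (hr : r ∉ T) (hsm : ¬ Sm G S (L ^ 18) r)
    (h10 : (T.filter (fun t => cdeg G T t ≤ 4 * L ^ 2)).card < L ^ 16)
    (h3a : ∀ u : Fin 2 → Fin n, Function.Injective u → ∀ r : Fin n,
      ¬ (Cop G ![2,4] univ u ∧ (∀ i, u i ∈ T) ∧ r ∉ T ∧ ¬ Sm G S (L ^ 18) r ∧ ∀ i, (G.Adj r (u i) ↔ c6 0 ((![2,4] : Fin 2 → Fin 6) i) = true)))
    (h3b : ∀ u : Fin 3 → Fin n, Function.Injective u → ∀ r : Fin n,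
      ¬ (Cop G ![1,3,4] univ u ∧ (∀ i, u i ∈ T) ∧ r ∉ T ∧ ¬ Sm G S (L ^ 18) r ∧ ∀ i, (G.Adj r (u i) ↔ c6 0 ((![1,3,4] : Fin 3 → Fin 6) i) = true))) :
    cdeg G T r ≤ L ^ 18 := by
  by_contra hcon
  push Not at hcon
  set D := T.filter (fun w => ¬ G.Adj r w) with hD
  have hDc : L ^ 18 < D.card := hcon
  have hDm : ∀ d ∈ D, d ∈ T ∧ ¬ G.Adj r d := fun d hd => mem_filter.1 hd
  have cl : ∀ a ∈ D, ∀ b ∈ D, a ≠ b → G.Adj a b := by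
    intro a ha b hb hab
    by_contra hadj
    apply h3a ![a, b] (inj_two hab) r
    refine ⟨cop_two hab hadj, ?_, hr, hsm, ?_⟩
    · intro i; fin_cases i
      · exact (hDm a ha).1
      · exact (hDm b hb).1
    · intro i; fin_cases i
      · exact iff_of_false (hDm a ha).2 (by decide)
      · exact iff_of_false (hDm b hb).2 (by decide)
  have one : ∀ t ∈ T, cdeg G D t ≤ 1 := by
    intro t ht
    unfold cdeg
    rw [card_le_one]
    intro d1 h1 d2 h2
    rw [mem_filter] at h1 h2
    by_contra hne
    by_cases htD : t ∈ D
    · have e1 : t = d1 := by by_contra h; exact h1.2 (cl t htD d1 h1.1 h)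
      have e2 : t = d2 := by by_contra h; exact h2.2 (cl t htD d2 h2.1 h)
      exact hne (e1.symm.trans e2)
    · have hrt : G.Adj r t := by
        by_contra h
        exact htD (mem_filter.2 ⟨ht, h⟩)
      have hd12 := cl d1 h1.1 d2 h2.1 hne
      have n1 : t ≠ d1 := fun h => htD (h ▸ h1.1)
      have n2 : t ≠ d2 := fun h => htD (h ▸ h2.1)
      apply h3b ![t, d1, d2] (inj_three n1 n2 hne) r
      refine ⟨cop_three n1 n2 hne h1.2 h2.2 hd12, ?_, hr, hsm, ?_⟩
      · intro i; fin_cases i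
        · exact ht
        · exact (hDm d1 h1.1).1
        · exact (hDm d2 h2.1).1
      · intro i; fin_cases i
        · exact iff_of_true hrt (by decide)
        · exact iff_of_false (hDm d1 h1.1).2 (by decide)
        · exact iff_of_false (hDm d2 h2.1).2 (by decide)
  have hsum : ∑ d ∈ D, cdeg G T d ≤ n := by
    rw [cdeg_swap]
    calc ∑ t ∈ T, cdeg G D t ≤ ∑ t ∈ T, 1 := sum_le_sum one
      _ = T.card := by simp
      _ ≤ n := by simpa using card_le_univ T
  set Lo := D.filter (fun t => cdeg G T t ≤ 4 * L ^ 2) with hLo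
  set Hi := D.filter (fun t => ¬ cdeg G T t ≤ 4 * L ^ 2) with hHi
  have hsplit : Lo.card + Hi.card = D.card := card_filter_add_card_filter_not _
  have hlo : Lo.card < L ^ 16 := lt_of_le_of_lt (card_le_card (filter_subset_filter _ (filter_subset _ _))) h10
  have hhi : Hi.card * (4 * L ^ 2) ≤ n := by
    calc Hi.card * (4 * L ^ 2) = ∑ d ∈ Hi, 4 * L ^ 2 := by rw [sum_const, smul_eq_mul]
      _ ≤ ∑ d ∈ Hi, cdeg G T d := sum_le_sum (fun d hd => by
          have := (mem_filter.1 hd).2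
          omega)
      _ ≤ ∑ d ∈ D, cdeg G T d := sum_le_sum_of_subset (filter_subset _ _)
      _ ≤ n := hsum
  have e1 : L ^ 16 * 100 ≤ L ^ 18 := by
    calc L ^ 16 * 100 ≤ L ^ 16 * (L * L) := Nat.mul_le_mul_left _ (by nlinarith)
      _ = L ^ 18 := by ring
  have e2 : (2 * Hi.card) * (2 * L ^ 2) ≤ L ^ 18 * (2 * L ^ 2) := by
    calc (2 * Hi.card) * (2 * L ^ 2) = Hi.card * (4 * L ^ 2) := by ring
      _ ≤ 2 * L ^ 20 := hhi.trans hn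
      _ = _ := by ring
  have e3 : 2 * Hi.card ≤ L ^ 18 := Nat.le_of_mul_le_mul_right e2 (by positivity)
  omega

theorem AGood : AA (fun _ G => Good G) := by
  obtain ⟨n0, h0⟩ := scale 1 (by norm_num) 0
  have A1 := CL1
  have A4a := CL4 ![0,2,4] ![1,3,5] (by norm_num) (by norm_num) (by norm_num) (by decide) (by decide)
  have A4b := CL4 ![1,2,4,5] ![0,3] (by norm_num) (by norm_num) (by norm_num) (by decide) (by decide)
  have A3a := CL3 ![2,4] ![1,3,5] 0 (by norm_num) (by norm_num) (by norm_num) (by decide) (by decide)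
  have A3b := CL3 ![1,3,4] ![2,5] 0 (by norm_num) (by norm_num) (by norm_num) (by decide) (by decide)
  refine ((AFS.and A1).and ((A4a.and A4b).and ((A3a.and A3b).and D10))).mono ⟨n0, fun n hn G hG => ?_⟩
  rintro ⟨⟨⟨S, T, hF⟩, c1⟩, ⟨c4a, c4b⟩, ⟨c3a, c3b⟩, c10⟩
  obtain ⟨-, s2, s3, s4, s5, s6⟩ := h0 n hn
  set L := sc n with hLdef
  replace c1 := c1 S T hF
  replace c4a := c4a S T hF
  replace c4b := c4b S T hF
  replace c3a := c3a S T hF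
  replace c3b := c3b S T hF
  replace c10 := c10 S T hF
  set S' := univ.filter (fun v => v ∉ T ∧ Sm G S (L ^ 18) v) with hS'
  have hSS : ∀ v ∈ S, v ∈ S' := by
    intro v hv
    refine mem_filter.2 ⟨mem_univ _, Finset.disjoint_left.1 hF.dST hv, Or.inl ?_⟩
    have : S.filter (fun y => G.Adj v y) = ∅ := by
      rw [Finset.filter_eq_empty_iff]
      intro y hy
      exact hF.sS v hv y hy
    rw [this]; simp
  have hdeg : ∀ v ∈ S'ᶜ, v ∉ S ∧ cdeg G T v ≤ L ^ 18 := by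
    intro v hv
    rw [mem_compl] at hv
    refine ⟨fun h => hv (hSS v h), ?_⟩
    by_cases hT : v ∈ T
    · exact (hF.dT v hT).trans (Nat.pow_le_pow_right (by omega) (by norm_num))
    · have hsm : ¬ Sm G S (L ^ 18) v := fun h => hv (mem_filter.2 ⟨mem_univ _, hT, h⟩)
      exact cl3_use s6 s3 hT hsm c10 c3a c3b
  refine ⟨S', S'ᶜ, fun v => by simpa using em (v ∈ S'), disjoint_compl_right, ?_, ?_⟩
  · refine stab_of_nocop (fun p hp => c1 p hp.1 (p 0) ⟨hp.mono (subset_univ _), fun i => ?_, fun i => ?_⟩)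
    · exact (mem_filter.1 (hp.2.1 i)).2.1
    · exact (mem_filter.1 (hp.2.1 i)).2.2
  · refine cog5_of_nocop (fun p hp => c4a p hp.1 (p 0) ⟨hp.mono (subset_univ _), fun i => ?_, fun i => ?_⟩)
      (fun p hp => c4b p hp.1 (p 0) ⟨hp.mono (subset_univ _), fun i => ?_, fun i => ?_⟩)
    · exact (hdeg _ (hp.2.1 i)).1
    · exact (hdeg _ (hp.2.1 i)).2
    · exact (hdeg _ (hp.2.1 i)).1
    · exact (hdeg _ (hp.2.1 i)).2

theorem main_lim : Tendsto (fun n : ℕ => (g n : ℝ) / f n) atTop (nhds 1) := AA_final AGood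

end fin
end C6P
end Part25

section Part26
open SimpleGraph Filter
open scoped Classical
namespace C6P
open Finset

section bridge

lemma indFree_iff {n : ℕ} (G : SimpleGraph (Fin n)) : IndFree (cycleGraph 6) G ↔ C6F G := by
  have hc : ∀ i j : Fin 6, (cycleGraph 6).Adj i j ↔ c6 i j = true := by decide
  constructor
  · intro h φ hφ
    exact h ⟨⟨⟨φ, emb_inj hφ⟩, fun {a b} => (hφ a b).trans (hc a b).symm⟩⟩
  · rintro h ⟨e⟩
    exact h e (fun i j => (e.map_rel_iff').trans (hc i j))

lemma girth_of {n : ℕ} {G : SimpleGraph (Fin n)} {S : Set (Fin n)} {T : Finset (Fin n)} (hT : CoG5 G T)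
    (hST : ∀ v, v ∉ S → v ∈ T) : GirthAtLeastFive (G.induce Sᶜ)ᶜ := by
  intro v w hw
  have adj : ∀ i, i < w.length → w.getVert i ≠ w.getVert (i+1) ∧ ¬ G.Adj (w.getVert i) (w.getVert (i+1)) := by
    intro i hi
    have := w.adj_getVert_succ hi
    simpa [SimpleGraph.compl_adj] using this
  have hinj := hw.getVert_injOn
  have hm : ∀ x : (Sᶜ : Set (Fin n)), (x : Fin n) ∈ T := fun x => hST x x.2
  have h0 : w.getVert 0 = v := w.getVert_zero
  have hl : w.getVert w.length = v := w.getVert_length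
  have ne : ∀ i j, 1 ≤ i → i < j → j ≤ w.length → (w.getVert i : Fin n) ≠ w.getVert j := by
    intro i j h1 h2 h3 h
    have := hinj ⟨h1, by omega⟩ ⟨by omega, h3⟩ (Subtype.ext h)
    omega
  constructor
  · intro h3
    have a0 := adj 0 (by omega)
    have a1 := adj 1 (by omega)
    have a2 := adj 2 (by omega)
    rw [h3] at hl
    have hl2 : w.getVert 0 = w.getVert 3 := h0.trans hl.symm
    rw [hl2] at a0
    rcases hT.1 _ (hm (w.getVert 1)) _ (hm (w.getVert 2)) _ (hm (w.getVert 3)) (ne 1 2 (by omega) (by omega) (by omega))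
      (ne 1 3 (by omega) (by omega) (by omega)) (ne 2 3 (by omega) (by omega) (by omega)) with h | h | h
    · exact a1.2 h
    · exact a0.2 h.symm
    · exact a2.2 h
  · intro h4
    have a0 := adj 0 (by omega)
    have a1 := adj 1 (by omega)
    have a2 := adj 2 (by omega)
    have a3 := adj 3 (by omega)
    rw [h4] at hl
    have hl2 : w.getVert 0 = w.getVert 4 := h0.trans hl.symm
    rw [hl2] at a0
    have n12 := ne 1 2 (by omega) (by omega) (by omega)
    have n13 := ne 1 3 (by omega) (by omega) (by omega)
    have n14 := ne 1 4 (by omega) (by omega) (by omega)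
    have n23 := ne 2 3 (by omega) (by omega) (by omega)
    have n24 := ne 2 4 (by omega) (by omega) (by omega)
    have n34 := ne 3 4 (by omega) (by omega) (by omega)
    have e13 : G.Adj (w.getVert 1) (w.getVert 3) := by
      rcases hT.1 _ (hm (w.getVert 1)) _ (hm (w.getVert 2)) _ (hm (w.getVert 3)) n12 n13 n23 with h | h | h
      · exact absurd h a1.2
      · exact h
      · exact absurd h a2.2
    have e24 : G.Adj (w.getVert 2) (w.getVert 4) := by
      rcases hT.1 _ (hm (w.getVert 2)) _ (hm (w.getVert 3)) _ (hm (w.getVert 4)) n23 n24 n34 with h | h | h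
      · exact absurd h a2.2
      · exact h
      · exact absurd h a3.2
    rcases hT.2 _ (hm (w.getVert 1)) _ (hm (w.getVert 3)) _ (hm (w.getVert 2)) _ (hm (w.getVert 4)) e13 e24 with h | h | h | h
    · exact a1.2 h
    · exact a0.2 h.symm
    · exact a2.2 h.symm
    · exact a3.2 h

theorem bridge :
    Tendsto
      (fun n : ℕ =>
        (({G : SimpleGraph (Fin n) |
              IndFree (cycleGraph 6) G ∧
              ∃ S : Set (Fin n),
                (∀ v ∈ S, ∀ w ∈ S, ¬ G.Adj v w) ∧
                GirthAtLeastFive (G.induce Sᶜ)ᶜ}.ncard : ℝ) /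
          ({G : SimpleGraph (Fin n) | IndFree (cycleGraph 6) G}.ncard : ℝ)))
      atTop (nhds 1) := by
  have hf : ∀ n, {G : SimpleGraph (Fin n) | IndFree (cycleGraph 6) G}.ncard = f n := by
    intro n
    unfold f
    rw [← Set.ncard_coe_finset]
    congr 1
    ext G
    simp only [Set.mem_ofPred_eq, mem_coe, mem_Fs, indFree_iff]
  refine tendsto_of_tendsto_of_tendsto_of_le_of_le main_lim tendsto_const_nhds ?_ ?_
  · intro n
    beta_reduce
    rw [hf n]
    refine div_le_div_of_nonneg_right ?_ (Nat.cast_nonneg _)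
    unfold g
    rw [← Set.ncard_coe_finset]
    refine Nat.cast_le.2 (Set.ncard_le_ncard ?_ (Set.toFinite _))
    intro G hG
    rw [mem_coe, mem_Gs] at hG
    refine ⟨(indFree_iff G).2 hG.c6f, ?_⟩
    obtain ⟨S, T, hc, -, hS, hT⟩ := hG
    exact ⟨(S : Set (Fin n)), fun v hv w hw => hS v hv w hw, girth_of hT (fun v hv => (hc v).resolve_left (by simpa using hv))⟩
  · intro n
    refine div_le_one_of_le₀ ?_ (Nat.cast_nonneg _)
    refine Nat.cast_le.2 (Set.ncard_le_ncard ?_ (Set.toFinite _))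
    intro G hG
    exact hG.1

end bridge
end C6P
end Part26

/-- Almost every `C₆`-free graph can be partitioned into a stable set `S` and a set `T`
whose induced subgraph has complement of girth at least 5. -/
theorem stmt_0 :
    Tendsto
      (fun n : ℕ =>
        (({G : SimpleGraph (Fin n) |
              IndFree (cycleGraph 6) G ∧
              ∃ S : Set (Fin n),
                (∀ v ∈ S, ∀ w ∈ S, ¬ G.Adj v w) ∧
                GirthAtLeastFive (G.induce Sᶜ)ᶜ}.ncard : ℝ) /
          ({G : SimpleGraph (Fin n) | IndFree (cycleGraph 6) G}.ncard : ℝ)))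
      atTop (nhds 1) := by
  exact C6P.bridge
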